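/- Let F be a binary form with integer coefficients, non-zero discriminant, and degree d ∈ {3,4}. Then there exists a real number β_d with 0 < β_d < 2/d depending only on d, and a positive rational number W_F depending only on F, such that for every ε > 0 one has R_F(Z) = W_F · A_F · Z^(2/d) + O_{F,ε}(Z^(β_d + ε)) as Z → ∞. -/

import Mathlib

open Filter Asymptotics

/-- The binary form of degree `d` with integer coefficients `a i` on `xⁱy^(d-i)`,
evaluated at integers. -/
def intForm (d : ℕ) (a : Fin (d + 1) → ℤ) (x y : ℤ) : ℤ :=
  ∑ i : Fin (d + 1), a i * x ^ (i : ℕ) * y ^ (d - (i : ℕ))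

/-- The same binary form evaluated over the reals. -/
noncomputable def realForm (d : ℕ) (a : Fin (d + 1) → ℤ) (x y : ℝ) : ℝ :=
  ∑ i : Fin (d + 1), (a i : ℝ) * x ^ (i : ℕ) * y ^ (d - (i : ℕ))

/-- A binary form of degree `d` has non-zero discriminant iff over `ℂ` it is a non-zero
constant times a product of `d` pairwise non-proportional linear forms. -/
def FormNonzeroDisc (d : ℕ) (a : Fin (d + 1) → ℤ) : Prop :=
  ∃ (c : ℂ) (L : Fin d → ℂ × ℂ), c ≠ 0 ∧
    (∀ i j : Fin d, i ≠ j → (L i).1 * (L j).2 - (L j).1 * (L i).2 ≠ 0) ∧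
    ∀ x y : ℂ, (∑ i : Fin (d + 1), (a i : ℂ) * x ^ (i : ℕ) * y ^ (d - (i : ℕ)))
      = c * ∏ j : Fin d, ((L j).1 * x + (L j).2 * y)

/-- `R_F(Z)`: the number of integers of absolute value at most `Z` represented by `F`. -/
noncomputable def RF (d : ℕ) (a : Fin (d + 1) → ℤ) (Z : ℝ) : ℕ :=
  Set.ncard {n : ℤ | |(n : ℝ)| ≤ Z ∧ ∃ x y : ℤ, intForm d a x y = n}

/-- `A_F`: the area of the region `{(x,y) ∈ ℝ² : |F(x,y)| ≤ 1}`. -/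
noncomputable def AF (d : ℕ) (a : Fin (d + 1) → ℤ) : ℝ :=
  (MeasureTheory.volume {p : ℝ × ℝ | |realForm d a p.1 p.2| ≤ 1}).toReal


/-- The binary form with integer coefficients `a`, evaluated in a commutative ring. -/
def BF {R : Type*} [CommRing R] (d : ℕ) (a : Fin (d + 1) → ℤ) (x y : R) : R :=
  ∑ i : Fin (d + 1), (a i : R) * x ^ (i : ℕ) * y ^ (d - (i : ℕ))

theorem intForm_eq_BF (d : ℕ) (a : Fin (d + 1) → ℤ) (x y : ℤ) : intForm d a x y = BF d a x y := by
  simp [intForm, BF]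

theorem map_BF {R S : Type*} [CommRing R] [CommRing S] (φ : R →+* S) (d : ℕ)
    (a : Fin (d + 1) → ℤ) (x y : R) : φ (BF d a x y) = BF d a (φ x) (φ y) := by
  simp [BF, map_sum]

theorem BF_mul {R : Type*} [CommRing R] (d : ℕ) (a : Fin (d + 1) → ℤ) (t x y : R) :
    BF d a (t * x) (t * y) = t ^ d * BF d a x y := by
  unfold BF
  rw [Finset.mul_sum]
  refine Finset.sum_congr rfl fun i _ => ?_
  have : t ^ d = t ^ (i : ℕ) * t ^ (d - (i : ℕ)) := by
    rw [← pow_add]; congr 1; omega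
  rw [this]; ring

theorem BF_intCast {R : Type*} [CommRing R] (d : ℕ) (a : Fin (d + 1) → ℤ) (x y : ℤ) :
    ((BF d a x y : ℤ) : R) = BF d a (x : R) (y : R) :=
  map_BF (Int.castRingHom R) d a x y

/-- A determinant of values of polynomials is a multiple of the Vandermonde determinant. -/
theorem vandermonde_dvd_det_eval {R : Type*} [CommRing R] {s : ℕ} (h : Fin s → Polynomial R)
    (x : Fin s → R) :
    (Matrix.vandermonde x).det ∣ (Matrix.of fun j i => (h i).eval (x j)).det := by
  rcases subsingleton_or_nontrivial R with hR | hR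
  · exact ⟨0, Subsingleton.elim _ _⟩
  set q : Polynomial R := ∏ l : Fin s, (Polynomial.X - Polynomial.C (x l)) with hq
  have hqm : q.Monic := Polynomial.monic_prod_of_monic _ _ fun l _ => Polynomial.monic_X_sub_C _
  have hqd : q.natDegree = s := by
    rw [hq, Polynomial.natDegree_prod_of_monic _ _ fun l _ => Polynomial.monic_X_sub_C _]
    simp
  have hq0 : ∀ j, q.eval (x j) = 0 := by
    intro j
    rw [hq, Polynomial.eval_prod]
    exact Finset.prod_eq_zero (Finset.mem_univ j) (by simp)
  have key : (Matrix.of fun j i => (h i).eval (x j)) =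
      Matrix.vandermonde x *
        (Matrix.of fun (k : Fin s) (i : Fin s) => ((h i) %ₘ q).coeff (k : ℕ)) := by
    ext j i
    have h1 : (h i).eval (x j) = ((h i) %ₘ q).eval (x j) := by
      conv_lhs => rw [← Polynomial.modByMonic_add_div (h i) q]
      simp [hq0]
    rcases Nat.eq_zero_or_pos s with hs | hs
    · subst hs; exact j.elim0
    have h2 : ((h i) %ₘ q).natDegree < s := by
      have := Polynomial.natDegree_modByMonic_lt (h i) hqm (by
        intro h; rw [h] at hqd; simp at hqd; omega)
      omega
    rw [Matrix.of_apply, h1, Polynomial.eval_eq_sum_range' h2, Matrix.mul_apply,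
      Finset.sum_range]
    refine Finset.sum_congr rfl fun k _ => ?_
    simp [Matrix.vandermonde_apply, mul_comm]
  rw [key, Matrix.det_mul]
  exact Dvd.intro _ rfl

theorem pow_dvd_det_vandermonde {R : Type*} [CommRing R] {s : ℕ} (x : Fin s → R) (π : R)
    (hx : ∀ j, π ∣ x j) : π ^ (s * (s - 1) / 2) ∣ (Matrix.vandermonde x).det := by
  rw [Matrix.det_vandermonde]
  have h1 : π ^ (s * (s - 1) / 2) = ∏ i : Fin s, ∏ j ∈ Finset.Ioi i, π := by
    simp only [Finset.prod_const, Fin.card_Ioi]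
    rw [Finset.prod_pow_eq_pow_sum, ← Finset.sum_range_id]
    congr 1
    rw [← Finset.sum_range_reflect, Finset.sum_range]
  rw [h1]
  exact Finset.prod_dvd_prod_of_dvd _ _ fun i _ => Finset.prod_dvd_prod_of_dvd _ _ fun j _ =>
    dvd_sub (hx j) (hx i)

theorem pow_dvd_det_of_congr {R : Type*} [CommRing R] {s : ℕ} (h : Fin s → Polynomial R)
    (x : Fin s → R) (π : R) (hx : ∀ j, π ∣ x j) :
    π ^ (s * (s - 1) / 2) ∣ (Matrix.of fun j i => (h i).eval (x j)).det :=
  (pow_dvd_det_vandermonde x π hx).trans (vandermonde_dvd_det_eval h x)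

theorem dvd_evalEval_sub {R : Type*} [CommRing R] (f : Polynomial (Polynomial R))
    {π u u₁ w w₁ : R} (hu : π ∣ u - u₁) (hw : π ∣ w - w₁) :
    π ∣ f.evalEval u w - f.evalEval u₁ w₁ := by
  have h1 : π ∣ f.evalEval u w - f.evalEval u w₁ := by
    rw [← Polynomial.map_evalRingHom_eval, ← Polynomial.map_evalRingHom_eval]
    exact hw.trans (Polynomial.sub_dvd_eval_sub _ _ _)
  have h2 : π ∣ f.evalEval u w₁ - f.evalEval u₁ w₁ :=
    hu.trans (Polynomial.sub_dvd_eval_sub _ _ _)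
  simpa using dvd_add h1 h2

/-- Approximate implicit function theorem: on the curve `f(u,w) = 0` near a point where
`∂f/∂w` is invertible modulo `π`, `w` is a polynomial in `u` modulo any power of `π`. -/
theorem exists_implicit_polynomial {R : Type*} [CommRing R] (f : Polynomial (Polynomial R))
    (π e u₁ w₁ : R)
    (he : π ∣ 1 - e * (f.derivative.evalEval u₁ w₁)) (N : ℕ) :
    ∃ W : Polynomial R, ∀ u w : R, π ∣ u - u₁ → π ∣ w - w₁ → f.evalEval u w = 0 →
      π ^ (N + 1) ∣ W.eval u - w := by
  induction N with
  | zero =>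
    refine ⟨Polynomial.C w₁, fun u w _ hw _ => ?_⟩
    simpa using (dvd_sub_comm).1 hw
  | succ N ih =>
    obtain ⟨W, hW⟩ := ih
    refine ⟨W - Polynomial.C e * f.eval W, fun u w hu hw hf => ?_⟩
    have h1 := hW u w hu hw hf
    obtain ⟨t, ht⟩ := h1
    have hfW : (f.eval W).eval u = (f.map (Polynomial.evalRingHom u)).eval (W.eval u) := by
      rw [Polynomial.eval_map, ← Polynomial.coe_evalRingHom, ← Polynomial.eval₂_id,
        Polynomial.hom_eval₂]
      simp
    obtain ⟨k, hk⟩ := (f.map (Polynomial.evalRingHom u)).binomExpansion w (W.eval u - w)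
    rw [add_sub_cancel, ← hfW, Polynomial.derivative_map, Polynomial.map_evalRingHom_eval,
      Polynomial.map_evalRingHom_eval, hf] at hk
    obtain ⟨r, hr⟩ := dvd_evalEval_sub f.derivative hu hw
    obtain ⟨q, hq⟩ := he
    have hD : f.derivative.evalEval u w = f.derivative.evalEval u₁ w₁ + π * r := by
      rw [← hr]; ring
    simp only [Polynomial.eval_sub, Polynomial.eval_mul, Polynomial.eval_C, hk]
    refine ⟨t * (q - e * r) - e * k * π ^ N * t ^ 2, ?_⟩
    rw [hD, ht]
    have hW' : W.eval u = w + π ^ (N + 1) * t := by rw [← ht]; ring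
    rw [hW']
    have hq' : e * f.derivative.evalEval u₁ w₁ = 1 - π * q := by rw [← hq]; ring
    linear_combination (-(π ^ (N + 1) * t)) * hq'

theorem MvPolynomial.IsHomogeneous.aeval_mul {σ R S : Type*} [CommRing R] [CommRing S] [Algebra R S]
    {f : MvPolynomial σ R} {n : ℕ} (hf : f.IsHomogeneous n) (c : S) (x : σ → S) :
    MvPolynomial.aeval (fun k => c * x k) f = c ^ n * MvPolynomial.aeval x f := by
  rw [MvPolynomial.aeval_def, MvPolynomial.eval₂_eq, MvPolynomial.aeval_def,
    MvPolynomial.eval₂_eq, Finset.mul_sum]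
  refine Finset.sum_congr rfl fun m hm => ?_
  have h1 := hf (MvPolynomial.mem_support_iff.1 hm)
  rw [Finsupp.weight_apply, Finsupp.sum] at h1
  simp only [Pi.one_apply, smul_eq_mul, mul_one] at h1
  simp only [mul_pow, Finset.prod_mul_distrib, Finset.prod_pow_eq_pow_sum, h1]
  ring

theorem derivative_aeval {R S : Type*} [CommRing R] [CommRing S] [Algebra R S]
    {σ : Type*} [DecidableEq σ] (i : σ) (g : σ → Polynomial S)
    (hg : ∀ k, (g k).derivative = if k = i then 1 else 0) (f : MvPolynomial σ R) :
    (MvPolynomial.aeval g f).derivative = MvPolynomial.aeval g (MvPolynomial.pderiv i f) := by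
  induction f using MvPolynomial.induction_on with
  | C a =>
    rw [MvPolynomial.pderiv_C, MvPolynomial.aeval_C, map_zero,
      IsScalarTower.algebraMap_apply R S (Polynomial S)]
    exact Polynomial.derivative_C
  | add p q hp hq => simp [hp, hq]
  | mul_X p k hp =>
    simp only [map_mul, Polynomial.derivative_mul, hp, MvPolynomial.aeval_X, hg,
      Derivation.leibniz, MvPolynomial.pderiv_X, smul_eq_mul, map_add, Pi.single_apply]
    by_cases h : k = i
    · simp [h]; ring
    · have h' : ¬ i = k := fun h' => h h'.symm
      simp [h]; ring

/-- Determinants of monomials of a fixed degree at points on a curve lying in one projective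
residue class, non-singular modulo `p`, are divisible by a large power of `p`. -/
theorem pow_prime_dvd_det_monomials (f : MvPolynomial (Fin 3) ℤ) {d : ℕ} (hf : f.IsHomogeneous d)
    {s D : ℕ} (P : Fin s → Fin 3 → ℤ) (e : Fin s → Fin 3 → ℕ) (he : ∀ i, ∑ k, e i k = D)
    (p : ℕ) (hp : p.Prime) (σ : Equiv.Perm (Fin 3)) (Q : Fin 3 → ℤ) (h0 : ∀ j, ¬ (p : ℤ) ∣ P j (σ 0))
    (hQ0 : ¬ (p : ℤ) ∣ Q (σ 0))
    (hc : ∀ j k, (p : ℤ) ∣ P j k * Q (σ 0) - Q k * P j (σ 0))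
    (hder : ¬ (p : ℤ) ∣ MvPolynomial.eval Q (MvPolynomial.pderiv (σ 2) f))
    (hz : ∀ j, MvPolynomial.eval (P j) f = 0) :
    (p : ℤ) ^ (s * (s - 1) / 2) ∣ (Matrix.of fun j i => ∏ k, P j k ^ e i k).det := by
  set N := s * (s - 1) / 2 with hN
  have hunit : ∀ a : ℤ, ¬ (p : ℤ) ∣ a → ∃ b : ZMod (p ^ N), b * (a : ZMod (p ^ N)) = 1 := by
    intro a ha
    have h1 : IsCoprime ((p ^ N : ℕ) : ℤ) a := by
      push_cast
      exact ((Nat.prime_iff_prime_int.1 hp).coprime_iff_not_dvd.2 ha).pow_left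
    obtain ⟨x, y, hxy⟩ := h1
    refine ⟨(y : ZMod (p ^ N)), ?_⟩
    have := congrArg (Int.cast : ℤ → ZMod (p ^ N)) hxy
    rw [Int.cast_add, Int.cast_mul, Int.cast_natCast, ZMod.natCast_self] at this
    simpa using this
  choose c hcj using fun j => hunit _ (h0 j)
  obtain ⟨cQ, hcQ⟩ := hunit _ hQ0
  obtain ⟨b, hb⟩ := hunit _ hder
  have h3 : ∀ k : Fin 3, k = σ 0 ∨ k = σ 1 ∨ k = σ 2 := by
    intro k
    obtain ⟨l, rfl⟩ := σ.surjective k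
    fin_cases l <;> simp
  have n01 : σ 1 ≠ σ 0 := by simp
  have n02 : σ 2 ≠ σ 0 := by simp
  have n12 : σ 2 ≠ σ 1 := by simp
  set g : Fin 3 → Polynomial (Polynomial (ZMod (p ^ N))) := fun k =>
    if k = σ 0 then 1 else if k = σ 1 then Polynomial.C Polynomial.X else Polynomial.X with hg
  have hgd : ∀ k, (g k).derivative = if k = σ 2 then 1 else 0 := by
    intro k
    rcases h3 k with rfl | rfl | rfl
    · simp [hg]
    · simp [hg]
    · simp [hg]
  have hev : ∀ (q : MvPolynomial (Fin 3) ℤ) (c : ZMod (p ^ N)) (x : Fin 3 → ℤ),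
      c * (x (σ 0) : ZMod (p ^ N)) = 1 →
      (MvPolynomial.aeval g q).evalEval (c * (x (σ 1) : ZMod (p ^ N)))
        (c * (x (σ 2) : ZMod (p ^ N))) =
      MvPolynomial.aeval (fun k => c * (x k : ZMod (p ^ N))) q := by
    intro q c x hx
    rw [← Polynomial.coe_evalEvalRingHom]
    have : ((Polynomial.evalEvalRingHom (c * (x (σ 1) : ZMod (p ^ N)))
        (c * (x (σ 2) : ZMod (p ^ N)))).toIntAlgHom.comp (MvPolynomial.aeval g)) =
        MvPolynomial.aeval (fun k => c * (x k : ZMod (p ^ N))) := by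
      refine MvPolynomial.algHom_ext fun k => ?_
      simp only [AlgHom.comp_apply, MvPolynomial.aeval_X]
      rcases h3 k with rfl | rfl | rfl
      · simp [hg, hx]
      · simp [hg]
      · simp [hg]
    exact DFunLike.congr_fun this q
  have hcast : ∀ (q : MvPolynomial (Fin 3) ℤ) (x : Fin 3 → ℤ),
      MvPolynomial.aeval (fun k => (x k : ZMod (p ^ N))) q =
        ((MvPolynomial.eval x q : ℤ) : ZMod (p ^ N)) := by
    intro q x
    have : (fun k => (x k : ZMod (p ^ N))) = algebraMap ℤ (ZMod (p ^ N)) ∘ x := rfl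
    rw [this, MvPolynomial.aeval_algebraMap_apply]
    simp
  have hdiff : ∀ j k, (p : ZMod (p ^ N)) ∣ c j * (P j k : ZMod (p ^ N)) - cQ * (Q k : ZMod (p ^ N)) := by
    intro j k
    obtain ⟨t, ht⟩ := hc j k
    refine ⟨c j * cQ * t, ?_⟩
    have h1 := congrArg (Int.cast : ℤ → ZMod (p ^ N)) ht
    push_cast at h1
    linear_combination (c j * cQ) * h1 - c j * (P j k) * hcQ + cQ * (Q k) * hcj j
  have hder' := hf.pderiv (i := σ 2)
  obtain ⟨W, hW⟩ := exists_implicit_polynomial (MvPolynomial.aeval g f) (p : ZMod (p ^ N))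
    (b * (Q (σ 0) : ZMod (p ^ N)) ^ (d - 1)) (cQ * (Q (σ 1) : ZMod (p ^ N)))
    (cQ * (Q (σ 2) : ZMod (p ^ N))) (by
      rw [derivative_aeval (σ 2) g hgd, hev _ _ _ hcQ, hder'.aeval_mul, hcast]
      have : (Q (σ 0) : ZMod (p ^ N)) ^ (d - 1) * cQ ^ (d - 1) = 1 := by
        rw [← mul_pow, mul_comm, hcQ, one_pow]
      refine ⟨0, ?_⟩
      linear_combination - hb - (b * (MvPolynomial.eval Q (MvPolynomial.pderiv (σ 2) f) : ℤ)) * this) N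
  have hpN : (p : ZMod (p ^ N)) ^ N = 0 := by
    have := ZMod.natCast_self (p ^ N)
    push_cast at this
    exact this
  have hWj : ∀ j, W.eval (c j * (P j (σ 1) : ZMod (p ^ N))) = c j * (P j (σ 2) : ZMod (p ^ N)) := by
    intro j
    have h1 := hW _ _ (hdiff j (σ 1)) (hdiff j (σ 2)) (by
      rw [hev _ _ _ (hcj j), hf.aeval_mul, hcast, hz]; simp)
    rw [pow_succ, hpN, zero_mul, zero_dvd_iff] at h1
    exact sub_eq_zero.1 h1
  set u₁ := cQ * (Q (σ 1) : ZMod (p ^ N)) with hu₁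
  have hdet := pow_dvd_det_of_congr (fun i => ((Polynomial.X : Polynomial (ZMod (p ^ N))) ^ e i (σ 1) *
    W ^ e i (σ 2)).comp (Polynomial.X + Polynomial.C u₁))
    (fun j => c j * (P j (σ 1) : ZMod (p ^ N)) - u₁) (p : ZMod (p ^ N)) (fun j => hdiff j (σ 1))
  rw [← hN, hpN, zero_dvd_iff] at hdet
  have hmat : ((Matrix.of fun j i => ∏ k, P j k ^ e i k).map (Int.castRingHom (ZMod (p ^ N)))) =
      Matrix.of fun j i => (P j (σ 0) : ZMod (p ^ N)) ^ D *
        (Matrix.of fun (j i : Fin s) => (((Polynomial.X : Polynomial (ZMod (p ^ N))) ^ e i (σ 1) *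
    W ^ e i (σ 2)).comp (Polynomial.X + Polynomial.C u₁)).eval
      (c j * (P j (σ 1) : ZMod (p ^ N)) - u₁)) j i := by
    ext j i
    simp only [Matrix.map_apply, Matrix.of_apply, Polynomial.eval_comp, Polynomial.eval_add,
      Polynomial.eval_X, Polynomial.eval_C, sub_add_cancel, Polynomial.eval_mul,
      Polynomial.eval_pow, hWj, map_prod, map_pow, eq_intCast]
    rw [← he i, ← Equiv.prod_comp σ, ← Equiv.sum_comp σ, Fin.prod_univ_three, Fin.sum_univ_three,
      pow_add, pow_add, mul_pow, mul_pow]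
    have h1 : ∀ n, (P j (σ 0) : ZMod (p ^ N)) ^ n * c j ^ n = 1 := by
      intro n
      rw [← mul_pow, mul_comm, hcj, one_pow]
    linear_combination (-(P j (σ 0) : ZMod (p ^ N)) ^ e i (σ 0) * (P j (σ 1) : ZMod (p ^ N)) ^ e i (σ 1)
      * (P j (σ 2) : ZMod (p ^ N)) ^ e i (σ 2)) * ((P j (σ 0) : ZMod (p ^ N)) ^ e i (σ 2) * c j ^ e i (σ 2)) * h1 (e i (σ 1)) -
      ((P j (σ 0) : ZMod (p ^ N)) ^ e i (σ 0) * (P j (σ 1) : ZMod (p ^ N)) ^ e i (σ 1)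
      * (P j (σ 2) : ZMod (p ^ N)) ^ e i (σ 2)) * h1 (e i (σ 2))
  have hfin : (((Matrix.of fun j i => ∏ k, P j k ^ e i k).det : ℤ) : ZMod (p ^ N)) = 0 := by
    rw [← eq_intCast (Int.castRingHom (ZMod (p ^ N))), RingHom.map_det]
    change (Matrix.map _ _).det = 0
    rw [hmat, Matrix.det_mul_column, hdet, mul_zero]
  have := (ZMod.intCast_zmod_eq_zero_iff_dvd _ _).1 hfin
  simpa using this

/-- A factor of a non-zero homogeneous polynomial is homogeneous. -/
theorem isHomogeneous_of_dvd {σ R : Type*} [CommRing R] [IsDomain R] {f a : MvPolynomial σ R}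
    {n : ℕ} (hf : f.IsHomogeneous n) (hf0 : f ≠ 0) (h : a ∣ f) :
    a.IsHomogeneous a.totalDegree := by
  obtain ⟨b, rfl⟩ := h
  have ha0 : a ≠ 0 := left_ne_zero_of_mul hf0
  have hb0 : b ≠ 0 := right_ne_zero_of_mul hf0
  set φ := MvPolynomial.aeval (R := R)
    (fun k : σ => (Polynomial.X * Polynomial.C (MvPolynomial.X k : MvPolynomial σ R))) with hφ
  have hhom : ∀ (q : MvPolynomial σ R) (m : ℕ), q.IsHomogeneous m →
      φ q = Polynomial.X ^ m * Polynomial.C q := by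
    intro q m hq
    rw [hφ, hq.aeval_mul]
    congr 1
    have : (fun k : σ => Polynomial.C (MvPolynomial.X k : MvPolynomial σ R)) =
      algebraMap (MvPolynomial σ R) (Polynomial (MvPolynomial σ R)) ∘ MvPolynomial.X := rfl
    rw [this, MvPolynomial.aeval_algebraMap_apply]
    simp
  have hcoeff : ∀ (q : MvPolynomial σ R) (j : ℕ),
      (φ q).coeff j = MvPolynomial.homogeneousComponent j q := by
    intro q j
    conv_lhs => rw [← MvPolynomial.sum_homogeneousComponent q, map_sum]
    rw [Polynomial.finsetSum_coeff]
    simp_rw [hhom _ _ (MvPolynomial.homogeneousComponent_isHomogeneous _ q),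
      Polynomial.coeff_X_pow_mul', Polynomial.coeff_C]
    by_cases hj : j < q.totalDegree + 1
    · rw [Finset.sum_eq_single_of_mem j (Finset.mem_range.2 hj)]
      · simp
      · intro i _ hij
        split_ifs with h1 h2
        · omega
        · rfl
        · rfl
    · rw [MvPolynomial.homogeneousComponent_eq_zero _ _ (by omega)]
      refine Finset.sum_eq_zero fun i hi => ?_
      rw [Finset.mem_range] at hi
      split_ifs with h1 h2
      · omega
      · rfl
      · rfl
  have hne : ∀ q : MvPolynomial σ R, q ≠ 0 → φ q ≠ 0 := by
    intro q hq h
    apply hq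
    rw [← MvPolynomial.sum_homogeneousComponent q]
    refine Finset.sum_eq_zero fun i _ => ?_
    rw [← hcoeff, h, Polynomial.coeff_zero]
  have hab : φ a * φ b = Polynomial.X ^ n * Polynomial.C (a * b) := by
    rw [← map_mul, hhom _ _ hf]
  have h1 : (φ a).natDegree + (φ b).natDegree = n := by
    rw [← Polynomial.natDegree_mul (hne a ha0) (hne b hb0), hab, mul_comm,
      Polynomial.natDegree_C_mul_X_pow _ _ hf0]
  have h2 : (φ a).natTrailingDegree + (φ b).natTrailingDegree = n := by
    rw [← Polynomial.natTrailingDegree_mul (hne a ha0) (hne b hb0), hab, mul_comm,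
      Polynomial.C_mul_X_pow_eq_monomial, Polynomial.natTrailingDegree_monomial hf0]
  have h3 := Polynomial.natTrailingDegree_le_natDegree (φ a)
  have h4 := Polynomial.natTrailingDegree_le_natDegree (φ b)
  have h5 : (φ a).natTrailingDegree = (φ a).natDegree := by omega
  have h6 : a.IsHomogeneous (φ a).natDegree := by
    have : a = MvPolynomial.homogeneousComponent (φ a).natDegree a := by
      conv_lhs => rw [← MvPolynomial.sum_homogeneousComponent a]
      rw [← hcoeff]
      simp_rw [← hcoeff]
      by_cases hj : (φ a).natDegree < a.totalDegree + 1
      · rw [Finset.sum_eq_single_of_mem _ (Finset.mem_range.2 hj)]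
        intro i _ hij
        rcases lt_or_gt_of_ne hij with h | h
        · exact Polynomial.coeff_eq_zero_of_lt_natTrailingDegree (by omega)
        · exact Polynomial.coeff_eq_zero_of_natDegree_lt h
      · exfalso
        have h7 := hcoeff a (φ a).natDegree
        rw [MvPolynomial.homogeneousComponent_eq_zero _ _ (by omega)] at h7
        exact hne a ha0 (Polynomial.leadingCoeff_eq_zero.1 h7)
    have h8 := MvPolynomial.homogeneousComponent_isHomogeneous (φ a).natDegree a
    rwa [← this] at h8
  rw [h6.totalDegree ha0]
  exact h6

section Ternary

variable {K : Type*} [Field K]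

theorem finrank_homogeneousSubmodule_three (n : ℕ) :
    Module.finrank K (MvPolynomial.homogeneousSubmodule (Fin 3) K n) = (n + 2).choose 2 := by
  rw [MvPolynomial.homogeneousSubmodule_eq_finsupp_supported,
    (AddMonoidAlgebra.supportedEquivFinsupp _).finrank_eq]
  have : {d : Fin 3 →₀ ℕ | d.degree = n} = ↑((Finset.univ : Finset (Fin 3)).finsuppAntidiag n) := by
    ext d
    simp [Finset.mem_finsuppAntidiag, Finsupp.degree_eq_sum]
  rw [this, Module.finrank_finsupp_self]
  change Fintype.card ((Finset.univ : Finset (Fin 3)).finsuppAntidiag n) = _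
  rw [Fintype.card_coe,
    Finset.card_finsuppAntidiag_nat_eq_choose, Finset.card_univ, Fintype.card_fin]
  rw [show 3 + n - 1 = n + 2 by omega, Nat.choose_symm_add]

instance finite_homogeneousSubmodule (n : ℕ) :
    Module.Finite K (MvPolynomial.homogeneousSubmodule (Fin 3) K n) :=
  Module.Finite.iff_fg.2 (MvPolynomial.homogeneousSubmodule_fg _ _ n)

/-- Multiples of `g` by forms of degree `n`. -/
noncomputable def mulForms (g : MvPolynomial (Fin 3) K) (n : ℕ) :
    Submodule K (MvPolynomial (Fin 3) K) :=
  (MvPolynomial.homogeneousSubmodule (Fin 3) K n).map (LinearMap.mulLeft K g)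

instance finite_mulForms (g : MvPolynomial (Fin 3) K) (n : ℕ) :
    Module.Finite K (mulForms g n) := by
  unfold mulForms; infer_instance

theorem finrank_mulForms {g : MvPolynomial (Fin 3) K} (hg : g ≠ 0) (n : ℕ) :
    Module.finrank K (mulForms g n) = (n + 2).choose 2 := by
  unfold mulForms
  rw [← finrank_homogeneousSubmodule_three (K := K) n]
  exact (LinearEquiv.finrank_eq (Submodule.equivMapOfInjective _
    (fun x y h => mul_left_cancel₀ hg h) _)).symm

theorem mem_mulForms {g q : MvPolynomial (Fin 3) K} {n : ℕ} :
    q ∈ mulForms g n ↔ ∃ h : MvPolynomial (Fin 3) K, h.IsHomogeneous n ∧ g * h = q := by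
  simp [mulForms, Submodule.mem_map]

theorem mem_mulForms_of_dvd {g q : MvPolynomial (Fin 3) K} {δ m n : ℕ} (hg : g.IsHomogeneous δ)
    (hg0 : g ≠ 0) (hn : n = δ + m) (hq : q.IsHomogeneous n) (h : g ∣ q) : q ∈ mulForms g m := by
  rw [mem_mulForms]
  obtain ⟨c, rfl⟩ := h
  refine ⟨c, ?_, rfl⟩
  rcases eq_or_ne c 0 with rfl | hc
  · exact MvPolynomial.isHomogeneous_zero _ _ _
  have h1 := isHomogeneous_of_dvd hq (mul_ne_zero hg0 hc) (Dvd.intro_left g rfl)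
  have h2 := (hg.mul h1).inj_right hq (mul_ne_zero hg0 hc)
  have : c.totalDegree = m := by omega
  rwa [this] at h1

theorem isHomogeneous_of_mem_mulForms {g q : MvPolynomial (Fin 3) K} {δ m : ℕ}
    (hg : g.IsHomogeneous δ) (h : q ∈ mulForms g m) : q.IsHomogeneous (δ + m) := by
  obtain ⟨c, hc, rfl⟩ := mem_mulForms.1 h
  exact hg.mul hc

/-- Two vectors are not proportional. -/
def NonProp {ι R : Type*} [Mul R] (P Q : ι → R) : Prop := ∃ a b, P a * Q b ≠ P b * Q a

theorem exists_form_vanishing {N m : ℕ} (P : Fin N → Fin 3 → K) (h0 : ∀ i, P i ≠ 0)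
    (hP : ∀ i j, i ≠ j → NonProp (P i) (P j)) (hm : N ≤ m + 1) (j : Fin N) :
    ∃ q : MvPolynomial (Fin 3) K, q.IsHomogeneous m ∧ MvPolynomial.eval (P j) q = 1 ∧
      ∀ i, i ≠ j → MvPolynomial.eval (P i) q = 0 := by
  have hl : ∀ i, ∃ l : MvPolynomial (Fin 3) K, l.IsHomogeneous 1 ∧ (i ≠ j →
      MvPolynomial.eval (P i) l = 0) ∧ MvPolynomial.eval (P j) l ≠ 0 := by
    intro i
    by_cases hij : i = j
    · obtain ⟨k, hk⟩ := Function.ne_iff.1 (h0 j)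
      exact ⟨MvPolynomial.X k, MvPolynomial.isHomogeneous_X _ _, fun h => absurd hij h, by
        simpa using hk⟩
    · obtain ⟨a, b, hab⟩ := hP i j hij
      refine ⟨MvPolynomial.C (P i a) * MvPolynomial.X b - MvPolynomial.C (P i b) * MvPolynomial.X a,
        (MvPolynomial.isHomogeneous_C_mul_X _ _).sub (MvPolynomial.isHomogeneous_C_mul_X _ _),
        fun _ => ?_, ?_⟩
      · simp; ring
      · simpa [sub_eq_zero] using hab
  choose l hl1 hl2 hl3 using hl
  obtain ⟨r, hr1, -, hr3⟩ := id (⟨l j, hl1 j, hl2 j, hl3 j⟩ : ∃ l : MvPolynomial (Fin 3) K,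
    l.IsHomogeneous 1 ∧ (j ≠ j → MvPolynomial.eval (P j) l = 0) ∧ MvPolynomial.eval (P j) l ≠ 0)
  set q := (∏ i ∈ Finset.univ.erase j, l i) * r ^ (m + 1 - N) with hq
  have hqj : MvPolynomial.eval (P j) q ≠ 0 := by
    rw [hq, map_mul, map_prod, map_pow]
    exact mul_ne_zero (Finset.prod_ne_zero_iff.2 fun i _ => hl3 i) (pow_ne_zero _ hr3)
  have hqh : q.IsHomogeneous m := by
    have h1 := (MvPolynomial.IsHomogeneous.prod (Finset.univ.erase j) l (fun _ => 1)
      fun i _ => hl1 i).mul (hr1.pow (m + 1 - N))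
    have hN : 0 < N := j.pos
    simp only [Finset.sum_const, Finset.card_erase_of_mem (Finset.mem_univ j), Finset.card_univ,
      Fintype.card_fin, smul_eq_mul, mul_one, one_mul] at h1
    rwa [show N - 1 + (m + 1 - N) = m by omega] at h1
  refine ⟨MvPolynomial.C (MvPolynomial.eval (P j) q)⁻¹ * q, hqh.C_mul _, ?_, fun i hi => ?_⟩
  · simp [hqj]
  · have h1 : MvPolynomial.eval (P i) q = 0 := by
      rw [hq, map_mul, map_prod,
        Finset.prod_eq_zero (Finset.mem_erase.2 ⟨hi, Finset.mem_univ i⟩) (hl2 i hi), zero_mul]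
    rw [map_mul, h1, mul_zero]

/-- Weak form of Bézout's theorem for plane curves. -/
theorem card_le_of_common_zeros {g G : MvPolynomial (Fin 3) K} {δ D N : ℕ} (hgp : Prime g)
    (hg : g.IsHomogeneous δ) (hG : G.IsHomogeneous D) (hgG : ¬ g ∣ G) (P : Fin N → Fin 3 → K)
    (h0 : ∀ i, P i ≠ 0) (hP : ∀ i j, i ≠ j → NonProp (P i) (P j))
    (hPg : ∀ i, MvPolynomial.eval (P i) g = 0) (hPG : ∀ i, MvPolynomial.eval (P i) G = 0) :
    N ≤ δ * D := by
  have hG0 : G ≠ 0 := fun h => hgG (h ▸ dvd_zero g)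
  set S := MvPolynomial.homogeneousSubmodule (Fin 3) K (δ + D + N)
  let ev : S →ₗ[K] (Fin N → K) :=
    { toFun := fun q i => MvPolynomial.eval (P i) q.1
      map_add' := fun x y => by ext i; simp
      map_smul' := fun c x => by ext i; simp }
  have hev : LinearMap.range ev = ⊤ := by
    rw [LinearMap.range_eq_top]
    intro v
    choose q hq1 hq2 hq3 using exists_form_vanishing P h0 hP (m := δ + D + N) (by omega)
    refine ⟨∑ j, v j • ⟨q j, hq1 j⟩, ?_⟩
    ext i
    rw [map_sum, Finset.sum_apply, Finset.sum_eq_single i]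
    · simp [ev, hq2]
    · intro j _ hj
      simp [ev, hq3 j i (Ne.symm hj)]
    · simp
  have h1 := LinearMap.finrank_range_add_finrank_ker ev
  rw [hev, finrank_top, Module.finrank_fin_fun, finrank_homogeneousSubmodule_three] at h1
  have hle : mulForms g (D + N) ⊔ mulForms G (δ + N) ≤ (LinearMap.ker ev).map S.subtype := by
    refine sup_le ?_ ?_
    · intro q hq
      have hh := isHomogeneous_of_mem_mulForms hg hq
      refine ⟨⟨q, by rw [← add_assoc] at hh; exact hh⟩, ?_, rfl⟩
      obtain ⟨c, _, rfl⟩ := mem_mulForms.1 hq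
      ext i
      simp [ev, hPg]
    · intro q hq
      have hh := isHomogeneous_of_mem_mulForms hG hq
      refine ⟨⟨q, by rw [show D + (δ + N) = δ + D + N by ring] at hh; exact hh⟩, ?_, rfl⟩
      obtain ⟨c, _, rfl⟩ := mem_mulForms.1 hq
      ext i
      simp [ev, hPG]
  have h2 := Submodule.finrank_mono hle
  rw [LinearEquiv.finrank_eq (Submodule.equivMapOfInjective S.subtype
    (Submodule.injective_subtype S) (LinearMap.ker ev)).symm] at h2
  have h3 := Submodule.finrank_sup_add_finrank_inf_eq (mulForms g (D + N)) (mulForms G (δ + N))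
  rw [finrank_mulForms hgp.ne_zero, finrank_mulForms hG0] at h3
  have hinf : mulForms g (D + N) ⊓ mulForms G (δ + N) ≤ mulForms (g * G) N := by
    rintro q ⟨hq1, hq2⟩
    refine mem_mulForms_of_dvd (hg.mul hG) (mul_ne_zero hgp.ne_zero hG0) rfl
      (n := δ + D + N) (by
        have hh := isHomogeneous_of_mem_mulForms hg hq1
        rwa [← add_assoc] at hh) ?_
    obtain ⟨a, -, rfl⟩ := mem_mulForms.1 hq1
    obtain ⟨b, -, hb⟩ := mem_mulForms.1 hq2
    have : g ∣ G * b := by rw [hb]; exact Dvd.intro _ rfl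
    obtain ⟨c, rfl⟩ := (hgp.dvd_or_dvd this).resolve_left hgG
    exact ⟨c, by rw [← hb]; ring⟩
  have h4 := Submodule.finrank_mono hinf
  rw [finrank_mulForms (mul_ne_zero hgp.ne_zero hG0)] at h4
  have hch : ∀ n : ℕ, 2 * (n + 2).choose 2 = (n + 2) * (n + 1) := by
    intro n
    rw [Nat.choose_two_right, Nat.mul_div_cancel' (Nat.even_mul_pred_self (n + 2)).two_dvd]
    rfl
  have e1 := hch (δ + D + N)
  have e2 := hch (D + N)
  have e3 := hch (δ + N)
  have e4 := hch N
  nlinarith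

/-- Monomials of degree `D` forming a basis of the forms of degree `D` modulo multiples of `g`. -/
theorem exists_independent_monomials {g : MvPolynomial (Fin 3) K} {δ : ℕ} (D : ℕ) (hg0 : g ≠ 0)
    (hg : g.IsHomogeneous δ) (hD : δ ≤ D) :
    ∃ (s : ℕ) (e : Fin s → Fin 3 →₀ ℕ), s + (D - δ + 2).choose 2 = (D + 2).choose 2 ∧
      (∀ i, (e i).degree = D) ∧ ∀ c : Fin s → K,
        g ∣ ∑ i, MvPolynomial.monomial (e i) (c i) → c = 0 := by
  classical
  set U := mulForms g (D - δ) with hU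
  set S := MvPolynomial.homogeneousSubmodule (Fin 3) K D with hS
  have hUS : U ≤ S := by
    intro q hq
    have := isHomogeneous_of_mem_mulForms hg hq
    rwa [show δ + (D - δ) = D by omega] at this
  let A : Set (Fin 3 →₀ ℕ) := {d | d.degree = D}
  let v : A → (MvPolynomial (Fin 3) K ⧸ U) := fun d => U.mkQ (MvPolynomial.monomial d.1 1)
  have hspan : Submodule.span K (Set.range v) = S.map U.mkQ := by
    have : S = Submodule.span K ((fun d => MvPolynomial.monomial d (1 : K)) '' A) := by
      apply le_antisymm
      · intro q hq
        rw [MvPolynomial.as_sum q]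
        refine Submodule.sum_mem _ fun d hd => ?_
        have h1 : MvPolynomial.monomial d (MvPolynomial.coeff d q) =
            (MvPolynomial.coeff d q) • MvPolynomial.monomial d (1 : K) := by
          simp [MvPolynomial.smul_monomial]
        rw [h1]
        refine Submodule.smul_mem _ _ (Submodule.subset_span ⟨d, ?_, rfl⟩)
        have h2 := hq (MvPolynomial.mem_support_iff.1 hd)
        change d.degree = D
        rw [Finsupp.degree_eq_weight_one]
        exact h2
      · rw [Submodule.span_le]
        rintro _ ⟨d, hd, rfl⟩
        exact MvPolynomial.isHomogeneous_monomial _ hd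
    rw [this, Submodule.map_span, ← Set.image_comp]
    congr 1
    ext x
    simp [v, A, Set.mem_image]
  obtain ⟨κ, a, ha, hsp, hli⟩ := exists_linearIndependent' K v
  have hAf : A.Finite := by
    have : A = ↑((Finset.univ : Finset (Fin 3)).finsuppAntidiag D) := by
      ext d
      simp [A, Finset.mem_finsuppAntidiag, Finsupp.degree_eq_sum]
    rw [this]
    exact Finset.finite_toSet _
  have : Finite A := hAf
  have : Finite κ := Finite.of_injective a ha
  have : Fintype κ := Fintype.ofFinite κ
  refine ⟨Fintype.card κ, fun i => (a ((Fintype.equivFin κ).symm i)).1, ?_, fun i =>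
    (a ((Fintype.equivFin κ).symm i)).2, fun c hc => ?_⟩
  · have h1 := finrank_span_eq_card hli
    rw [hsp, hspan] at h1
    have h2 := LinearMap.finrank_range_add_finrank_ker (U.mkQ.domRestrict S)
    rw [LinearMap.range_domRestrict, h1, LinearMap.ker_domRestrict, Submodule.ker_mkQ,
      (Submodule.comapSubtypeEquivOfLe hUS).finrank_eq, finrank_homogeneousSubmodule_three,
      finrank_mulForms hg0] at h2
    exact h2
  · have h1 : (∑ i, MvPolynomial.monomial (a ((Fintype.equivFin κ).symm i)).1 (c i)) ∈ U := by
      refine mem_mulForms_of_dvd hg hg0 (n := D) (by omega) ?_ hc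
      exact MvPolynomial.IsHomogeneous.sum _ _ _ fun i _ =>
        MvPolynomial.isHomogeneous_monomial _ (a ((Fintype.equivFin κ).symm i)).2
    have h2 : ∑ i, c i • (v ∘ a) ((Fintype.equivFin κ).symm i) = 0 := by
      rw [← (Submodule.Quotient.mk_eq_zero U)] at h1
      rw [← h1, ← Submodule.mkQ_apply, map_sum]
      refine Finset.sum_congr rfl fun i _ => ?_
      simp only [v, Function.comp, ← map_smul, smul_eq_mul, mul_one]
    have h3 := Fintype.linearIndependent_iff.1
      (hli.comp _ (Fintype.equivFin κ).symm.injective) c h2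
    exact funext h3

end Ternary

theorem exists_ne_zero_dot_eq_zero {K ι : Type} [Field K] {s : ℕ} (r : ι → Fin s → K)
    (h : ∀ f : Fin s → ι, (Matrix.of fun j => r (f j)).det = 0) :
    ∃ c : Fin s → K, c ≠ 0 ∧ ∀ i, ∑ k, c k * r i k = 0 := by
  have hlt : Submodule.span K (Set.range r) < ⊤ := by
    rw [lt_top_iff_ne_top]
    intro htop
    obtain ⟨κ, a, -, hsp, hli⟩ := exists_linearIndependent' K r
    rw [htop] at hsp
    have : Finite κ := hli.finite
    have : Fintype κ := Fintype.ofFinite κ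
    have hcard : Fintype.card κ = s := by
      rw [← finrank_span_eq_card hli, hsp, finrank_top, Module.finrank_fin_fun]
    let e : Fin s ≃ κ := (Fintype.equivFinOfCardEq hcard).symm
    have h1 := hli.comp e e.injective
    have h2 := (Matrix.linearIndependent_rows_iff_isUnit (A := Matrix.of fun j => r (a (e j)))).1 h1
    rw [Matrix.isUnit_iff_isUnit_det, show (Matrix.of fun j => r (a (e j))).det = 0 from h (a ∘ e)] at h2
    exact not_isUnit_zero h2
  obtain ⟨φ, hφ, hle⟩ := Submodule.exists_le_ker_of_lt_top _ hlt
  refine ⟨fun k => φ (Pi.single k 1), ?_, fun i => ?_⟩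
  · intro h0
    apply hφ
    refine (Pi.basisFun K (Fin s)).ext fun k => ?_
    simpa using congrFun h0 k
  · have h1 : φ (r i) = 0 := hle (Submodule.subset_span ⟨i, rfl⟩)
    rw [← h1]
    conv_rhs => rw [pi_eq_sum_univ' (r i), map_sum]
    refine Finset.sum_congr rfl fun k _ => ?_
    rw [map_smul, smul_eq_mul, mul_comm]

theorem aeval_monomial_int {s : ℕ} (c : Fin s → ℚ) (e : Fin s → Fin 3 →₀ ℕ) (x : Fin 3 → ℤ) :
    MvPolynomial.eval (fun k => (x k : ℚ)) (∑ i, MvPolynomial.monomial (e i) (c i)) =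
      ∑ i, c i * ((∏ k, x k ^ e i k : ℤ) : ℚ) := by
  rw [map_sum]
  refine Finset.sum_congr rfl fun i _ => ?_
  rw [MvPolynomial.eval_monomial, Finsupp.prod_fintype _ _ (by simp)]
  push_cast
  rfl

/-- Points of a curve in one smooth residue class modulo a large prime lie on an auxiliary curve. -/
theorem card_residue_class_le {f : MvPolynomial (Fin 3) ℤ} {d : ℕ} (hf : f.IsHomogeneous d)
    {g : MvPolynomial (Fin 3) ℚ} {δ : ℕ} (hgp : Prime g) (hg : g.IsHomogeneous δ) {s D : ℕ}
    {e : Fin s → Fin 3 →₀ ℕ} (he : ∀ i, (e i).degree = D)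
    (hind : ∀ c : Fin s → ℚ, g ∣ ∑ i, MvPolynomial.monomial (e i) (c i) → c = 0)
    {B : ℝ} {p : ℕ} (hp : p.Prime)
    (hlarge : s.factorial * (B ^ D) ^ s < (p : ℝ) ^ (s * (s - 1) / 2)) (σ : Equiv.Perm (Fin 3))
    (Q : Fin 3 → ℤ) (hQ0 : ¬ (p : ℤ) ∣ Q (σ 0))
    (hder : ¬ (p : ℤ) ∣ MvPolynomial.eval Q (MvPolynomial.pderiv (σ 2) f))
    (T : Finset (Fin 3 → ℤ)) (hTB : ∀ x ∈ T, ∀ k, |(x k : ℝ)| ≤ B)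
    (hT0 : ∀ x ∈ T, ¬ (p : ℤ) ∣ x (σ 0))
    (hTQ : ∀ x ∈ T, ∀ k, (p : ℤ) ∣ x k * Q (σ 0) - Q k * x (σ 0))
    (hTf : ∀ x ∈ T, MvPolynomial.eval x f = 0)
    (hTg : ∀ x ∈ T, MvPolynomial.eval (fun k => (x k : ℚ)) g = 0)
    (hTn : ∀ x ∈ T, ∀ y ∈ T, x ≠ y → NonProp x y) : T.card ≤ δ * D := by
  have hdet : ∀ φ : Fin s → T, (Matrix.of fun j => fun i : Fin s =>
      ((∏ k, (φ j).1 k ^ e i k : ℤ) : ℚ)).det = 0 := by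
    intro φ
    set A : Matrix (Fin s) (Fin s) ℤ := Matrix.of fun j i => ∏ k, (φ j).1 k ^ e i k with hA
    have h1 : (p : ℤ) ^ (s * (s - 1) / 2) ∣ A.det :=
      pow_prime_dvd_det_monomials f hf (fun j => (φ j).1) (fun i k => e i k) (D := D) (fun i => by
        rw [← he i, Finsupp.degree_eq_sum]) p hp σ Q (fun j => hT0 _ (φ j).2) hQ0
        (fun j k => hTQ _ (φ j).2 k) hder (fun j => hTf _ (φ j).2)
    have h2 : |(A.det : ℝ)| ≤ s.factorial * (B ^ D) ^ s := by
      have h3 := Matrix.det_le (A := A.map (Int.cast : ℤ → ℝ)) (abv := AbsoluteValue.abs)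
        (x := B ^ D) (by
          intro j i
          simp only [Matrix.map_apply, hA, Matrix.of_apply, AbsoluteValue.abs_apply]
          push_cast
          rw [Finset.abs_prod]
          calc ∏ k, |((φ j).1 k : ℝ) ^ e i k| ≤ ∏ k, B ^ e i k := by
                refine Finset.prod_le_prod (fun k _ => abs_nonneg _) fun k _ => ?_
                rw [abs_pow]
                exact pow_le_pow_left₀ (abs_nonneg _) (hTB _ (φ j).2 k) _
            _ = B ^ D := by rw [Finset.prod_pow_eq_pow_sum, ← he i, Finsupp.degree_eq_sum])
      have h4 : (A.map (Int.cast : ℤ → ℝ)).det = (A.det : ℝ) :=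
        ((Int.castRingHom ℝ).map_det A).symm
      rw [h4] at h3
      simpa [nsmul_eq_mul] using h3
    have h5 : A.det = 0 := by
      by_contra hne
      have h6 : (p : ℤ) ^ (s * (s - 1) / 2) ≤ |A.det| := Int.le_of_dvd (abs_pos.2 hne)
        ((dvd_abs _ _).2 h1)
      have h7 : ((p : ℝ)) ^ (s * (s - 1) / 2) ≤ |(A.det : ℝ)| := by exact_mod_cast h6
      linarith
    have h8 := (Int.castRingHom ℚ).map_det A
    rw [h5, map_zero] at h8
    exact h8.symm
  obtain ⟨c, hc0, hc⟩ := exists_ne_zero_dot_eq_zero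
    (fun (x : T) (i : Fin s) => ((∏ k, x.1 k ^ e i k : ℤ) : ℚ)) hdet
  have hgG : ¬ g ∣ ∑ i, MvPolynomial.monomial (e i) (c i) := fun h => hc0 (hind c h)
  have hG : (∑ i, MvPolynomial.monomial (e i) (c i)).IsHomogeneous D :=
    MvPolynomial.IsHomogeneous.sum _ _ _ fun i _ => MvPolynomial.isHomogeneous_monomial _ (he i)
  refine card_le_of_common_zeros hgp hg hG hgG
    (fun i : Fin T.card => fun k => (((T.equivFin.symm i).1 k : ℤ) : ℚ)) ?_ ?_ ?_ ?_
  · intro i h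
    apply hT0 _ (T.equivFin.symm i).2
    have := congrFun h (σ 0)
    simp only [Pi.zero_apply, Int.cast_eq_zero] at this
    rw [this]
    exact dvd_zero _
  · intro i j hij
    obtain ⟨a, b, hab⟩ := hTn _ (T.equivFin.symm i).2 _ (T.equivFin.symm j).2 (by
      intro h
      exact hij (T.equivFin.symm.injective (Subtype.ext h)))
    refine ⟨a, b, fun h => hab ?_⟩
    dsimp only at h
    exact_mod_cast h
  · exact fun i => hTg _ (T.equivFin.symm i).2
  · intro i
    rw [aeval_monomial_int]
    exact hc (T.equivFin.symm i)

theorem euler_identity {f : MvPolynomial (Fin 3) ℤ} {d : ℕ} (hf : f.IsHomogeneous d)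
    (x : Fin 3 → ℤ) : ∑ k, x k * MvPolynomial.eval x (MvPolynomial.pderiv k f) =
      d * MvPolynomial.eval x f := by
  have := congrArg (MvPolynomial.eval x) hf.sum_X_mul_pderiv
  simpa using this

/-- The number of points of a curve that are smooth modulo a given large prime. -/
theorem card_smooth_mod_prime_le {f : MvPolynomial (Fin 3) ℤ} {d : ℕ} (hf : f.IsHomogeneous d)
    {g : MvPolynomial (Fin 3) ℚ} {δ : ℕ} (hgp : Prime g) (hg : g.IsHomogeneous δ) {s D : ℕ}
    {e : Fin s → Fin 3 →₀ ℕ} (he : ∀ i, (e i).degree = D)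
    (hind : ∀ c : Fin s → ℚ, g ∣ ∑ i, MvPolynomial.monomial (e i) (c i) → c = 0)
    {B : ℝ} {p : ℕ} (hp : p.Prime)
    (hlarge : s.factorial * (B ^ D) ^ s < (p : ℝ) ^ (s * (s - 1) / 2))
    (T : Finset (Fin 3 → ℤ)) (hTB : ∀ x ∈ T, ∀ k, |(x k : ℝ)| ≤ B)
    (hTp : ∀ x ∈ T, ∃ k, ¬ (p : ℤ) ∣ x k)
    (hTs : ∀ x ∈ T, ∃ k, ¬ (p : ℤ) ∣ MvPolynomial.eval x (MvPolynomial.pderiv k f))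
    (hTf : ∀ x ∈ T, MvPolynomial.eval x f = 0)
    (hTg : ∀ x ∈ T, MvPolynomial.eval (fun k => (x k : ℚ)) g = 0)
    (hTn : ∀ x ∈ T, ∀ y ∈ T, x ≠ y → NonProp x y) : T.card ≤ 6 * (δ * D * (p * d)) := by
  classical
  have : Fact p.Prime := ⟨hp⟩
  let Tσ : Equiv.Perm (Fin 3) → Finset (Fin 3 → ℤ) := fun σ => T.filter fun x =>
    ¬ (p : ℤ) ∣ x (σ 0) ∧ ¬ (p : ℤ) ∣ MvPolynomial.eval x (MvPolynomial.pderiv (σ 2) f)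
  have hcover : T ⊆ Finset.univ.biUnion Tσ := by
    intro x hx
    obtain ⟨i, hi⟩ := hTp x hx
    have h1 : ∃ k, k ≠ i ∧ ¬ (p : ℤ) ∣ MvPolynomial.eval x (MvPolynomial.pderiv k f) := by
      by_contra! hcon
      obtain ⟨k, hk⟩ := hTs x hx
      have hki : k = i := by
        by_contra h
        exact hk (hcon k h)
      subst hki
      have h2 := euler_identity hf x
      rw [hTf x hx, mul_zero, ← Finset.add_sum_erase _ _ (Finset.mem_univ k)] at h2
      have h3 : (p : ℤ) ∣ ∑ j ∈ Finset.univ.erase k,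
          x j * MvPolynomial.eval x (MvPolynomial.pderiv j f) :=
        Finset.dvd_sum fun j hj => Dvd.dvd.mul_left (hcon j (Finset.ne_of_mem_erase hj)) _
      have h4 : (p : ℤ) ∣ x k * MvPolynomial.eval x (MvPolynomial.pderiv k f) := by
        have := dvd_neg.2 h3
        rwa [← eq_neg_of_add_eq_zero_left h2] at this
      rcases (Nat.prime_iff_prime_int.1 hp).dvd_or_dvd h4 with h | h
      · exact hi h
      · exact hk h
    obtain ⟨k, hki, hk⟩ := h1
    have h5 : ∃ σ : Equiv.Perm (Fin 3), σ 0 = i ∧ σ 2 = k := by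
      clear hi hk
      revert i k
      decide
    obtain ⟨σ, rfl, rfl⟩ := h5
    exact Finset.mem_biUnion.2 ⟨σ, Finset.mem_univ _, Finset.mem_filter.2 ⟨hx, hi, hk⟩⟩
  have hσ : ∀ σ ∈ (Finset.univ : Finset (Equiv.Perm (Fin 3))), (Tσ σ).card ≤ δ * D * (p * d) := by
    intro σ _
    let γ : ZMod p → Fin 3 → Polynomial (ZMod p) := fun u k =>
      if k = σ 0 then 1 else if k = σ 1 then Polynomial.C u else Polynomial.X
    let q : ZMod p → Polynomial (ZMod p) := fun u => MvPolynomial.aeval (γ u) f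
    have h3 : ∀ k : Fin 3, k = σ 0 ∨ k = σ 1 ∨ k = σ 2 := by
      intro k
      obtain ⟨l, rfl⟩ := σ.surjective k
      fin_cases l <;> simp
    have hγd : ∀ u k, (γ u k).derivative = if k = σ 2 then 1 else 0 := by
      intro u k
      rcases h3 k with rfl | rfl | rfl <;> simp [γ]
    have hev : ∀ (h : MvPolynomial (Fin 3) ℤ) (x : Fin 3 → ℤ), ¬ (p : ℤ) ∣ x (σ 0) →
        (MvPolynomial.aeval (γ ((x (σ 0) : ZMod p)⁻¹ * x (σ 1))) h).eval
          ((x (σ 0) : ZMod p)⁻¹ * x (σ 2)) =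
        MvPolynomial.aeval (fun k => (x (σ 0) : ZMod p)⁻¹ * (x k : ZMod p)) h := by
      intro h x hx
      have hx0 : (x (σ 0) : ZMod p) ≠ 0 := by
        rwa [Ne, ZMod.intCast_zmod_eq_zero_iff_dvd]
      have : ((Polynomial.evalRingHom ((x (σ 0) : ZMod p)⁻¹ * x (σ 2))).toIntAlgHom.comp
          (MvPolynomial.aeval (γ ((x (σ 0) : ZMod p)⁻¹ * x (σ 1))))) =
          MvPolynomial.aeval (fun k => (x (σ 0) : ZMod p)⁻¹ * (x k : ZMod p)) := by
        refine MvPolynomial.algHom_ext fun k => ?_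
        simp only [AlgHom.comp_apply, MvPolynomial.aeval_X]
        rcases h3 k with rfl | rfl | rfl
        · simp [γ, hx0]
        · simp [γ]
        · simp [γ]
      exact DFunLike.congr_fun this h
    have hcast : ∀ (h : MvPolynomial (Fin 3) ℤ) (x : Fin 3 → ℤ),
        MvPolynomial.aeval (fun k => (x k : ZMod p)) h =
          ((MvPolynomial.eval x h : ℤ) : ZMod p) := by
      intro h x
      have : (fun k => (x k : ZMod p)) = algebraMap ℤ (ZMod p) ∘ x := rfl
      rw [this, MvPolynomial.aeval_algebraMap_apply]
      simp
    have hdeg : ∀ u, (q u).natDegree ≤ d := by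
      intro u
      have h1 : q u = MvPolynomial.aeval (γ u) (MvPolynomial.map (algebraMap ℤ (ZMod p)) f) :=
        (MvPolynomial.aeval_map_algebraMap (ZMod p) (γ u) f).symm
      rw [h1]
      refine (MvPolynomial.aeval_natDegree_le (m := d) (n := 1) _ (hf.map _).totalDegree_le (γ u)
        ?_).trans (by omega)
      intro k
      rcases h3 k with rfl | rfl | rfl <;> simp [γ]
    let C : Finset (ZMod p × ZMod p) :=
      Finset.univ.biUnion fun u => (q u).roots.toFinset.image fun w => (u, w)
    have hC : C.card ≤ p * d := by
      refine Finset.card_biUnion_le.trans ?_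
      calc ∑ u : ZMod p, ((q u).roots.toFinset.image fun w => (u, w)).card
          ≤ ∑ u : ZMod p, d := by
            refine Finset.sum_le_sum fun u _ => ?_
            exact Finset.card_image_le.trans ((Multiset.toFinset_card_le _).trans
              ((Polynomial.card_roots' _).trans (hdeg u)))
        _ = p * d := by simp [ZMod.card]
    refine le_trans ?_ (Nat.mul_le_mul_left _ hC)
    refine Finset.card_le_mul_card_image_of_maps_to (f := fun x =>
      ((x (σ 0) : ZMod p)⁻¹ * x (σ 1), (x (σ 0) : ZMod p)⁻¹ * x (σ 2))) ?_ _ ?_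
    · intro x hx
      obtain ⟨hxT, hx0, hxd⟩ := Finset.mem_filter.1 hx
      have hx0' : (x (σ 0) : ZMod p) ≠ 0 := by
        rwa [Ne, ZMod.intCast_zmod_eq_zero_iff_dvd]
      refine Finset.mem_biUnion.2 ⟨_, Finset.mem_univ _, Finset.mem_image.2 ⟨_,
        Multiset.mem_toFinset.2 ?_, rfl⟩⟩
      have hq0 : q ((x (σ 0) : ZMod p)⁻¹ * x (σ 1)) ≠ 0 := by
        intro h
        have h1 := derivative_aeval (σ 2) _ (hγd ((x (σ 0) : ZMod p)⁻¹ * x (σ 1))) f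
        change (q _).derivative = _ at h1
        rw [h, Polynomial.derivative_zero] at h1
        have h2 := hev (MvPolynomial.pderiv (σ 2) f) x hx0
        rw [← h1, Polynomial.eval_zero, (hf.pderiv (i := σ 2)).aeval_mul, hcast] at h2
        have h4 := (mul_eq_zero.1 h2.symm).resolve_left (pow_ne_zero _ (inv_ne_zero hx0'))
        rw [ZMod.intCast_zmod_eq_zero_iff_dvd] at h4
        exact hxd h4
      rw [Polynomial.mem_roots hq0, Polynomial.IsRoot.def, hev f x hx0, hf.aeval_mul, hcast,
        hTf x hxT]
      simp
    · intro b _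
      rcases Finset.eq_empty_or_nonempty ((Tσ σ).filter fun x =>
        ((x (σ 0) : ZMod p)⁻¹ * x (σ 1), (x (σ 0) : ZMod p)⁻¹ * x (σ 2)) = b) with h | ⟨Q, hQ⟩
      · rw [h]; simp
      have hmem : ∀ x ∈ (Tσ σ).filter fun x =>
          ((x (σ 0) : ZMod p)⁻¹ * x (σ 1), (x (σ 0) : ZMod p)⁻¹ * x (σ 2)) = b,
          x ∈ T ∧ ¬ (p : ℤ) ∣ x (σ 0) ∧
          ¬ (p : ℤ) ∣ MvPolynomial.eval x (MvPolynomial.pderiv (σ 2) f) ∧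
          ((x (σ 0) : ZMod p)⁻¹ * x (σ 1), (x (σ 0) : ZMod p)⁻¹ * x (σ 2)) = b := by
        intro x hx
        obtain ⟨hx1, hx2⟩ := Finset.mem_filter.1 hx
        obtain ⟨hx3, hx4, hx5⟩ := Finset.mem_filter.1 hx1
        exact ⟨hx3, hx4, hx5, hx2⟩
      obtain ⟨hQT, hQ0, hQd, hQb⟩ := hmem Q hQ
      refine card_residue_class_le hf hgp hg he hind hp hlarge σ Q hQ0 hQd _
        (fun x hx => hTB x (hmem x hx).1) (fun x hx => (hmem x hx).2.1) ?_
        (fun x hx => hTf x (hmem x hx).1) (fun x hx => hTg x (hmem x hx).1)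
        (fun x hx y hy => hTn x (hmem x hx).1 y (hmem y hy).1)
      intro x hx k
      obtain ⟨-, hx0, -, hxb⟩ := hmem x hx
      rw [← hQb, Prod.mk.injEq] at hxb
      have hx0' : (x (σ 0) : ZMod p) ≠ 0 := by
        rwa [Ne, ZMod.intCast_zmod_eq_zero_iff_dvd]
      have hQ0' : (Q (σ 0) : ZMod p) ≠ 0 := by
        rwa [Ne, ZMod.intCast_zmod_eq_zero_iff_dvd]
      rw [← ZMod.intCast_zmod_eq_zero_iff_dvd]
      push_cast
      obtain ⟨e1, e2⟩ := hxb
      field_simp at e1 e2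
      rcases h3 k with rfl | rfl | rfl
      · ring
      · linear_combination e1
      · linear_combination e2
  calc T.card ≤ (Finset.univ.biUnion Tσ).card := Finset.card_le_card hcover
    _ ≤ ∑ σ, (Tσ σ).card := Finset.card_biUnion_le
    _ ≤ ∑ σ : Equiv.Perm (Fin 3), δ * D * (p * d) := Finset.sum_le_sum hσ
    _ = 6 * (δ * D * (p * d)) := by
      rw [Finset.sum_const, Finset.card_univ, Fintype.card_perm, Fintype.card_fin]; rfl

theorem exists_large_primes (n : ℕ) (hn : n ≠ 0) : ∃ p : ℕ → ℕ, (∀ i, (p i).Prime) ∧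
    StrictMono p ∧ ∀ i, n < p i ∧ p i ≤ 2 ^ (i + 1) * n := by
  have h := fun i : ℕ => Nat.exists_prime_lt_and_le_two_mul (2 ^ i * n) (by positivity)
  choose p hp h1 h2 using h
  refine ⟨p, hp, strictMono_nat_of_lt_succ fun i => ?_, fun i => ⟨?_, ?_⟩⟩
  · refine lt_of_le_of_lt (h2 i) ?_
    have := h1 (i + 1)
    rwa [pow_succ, mul_comm (2 ^ i) 2, mul_assoc] at this
  · exact lt_of_le_of_lt (Nat.le_mul_of_pos_left _ (by positivity)) (h1 i)
  · have := h2 i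
    rw [pow_succ]
    linarith

/-- Points of bounded height on an irreducible plane curve of degree `δ`. -/
theorem card_points_le (d δ κ : ℕ) (hδ : 0 < δ) (ε : ℝ) (hε : 0 < ε) :
    ∃ C : ℝ, 0 < C ∧ ∀ (B : ℝ), 1 ≤ B → ∀ (f : MvPolynomial (Fin 3) ℤ) (_ : f.IsHomogeneous d)
    (g : MvPolynomial (Fin 3) ℚ) (_ : Prime g) (_ : g.IsHomogeneous δ) (T : Finset (Fin 3 → ℤ))
    (_ : ∀ x ∈ T, ∀ k, |(x k : ℝ)| ≤ B)
    (_ : ∀ x ∈ T, ∀ p : ℕ, p.Prime → ∃ k, ¬ (p : ℤ) ∣ x k)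
    (_ : ∀ x ∈ T, ∃ k, MvPolynomial.eval x (MvPolynomial.pderiv k f) ≠ 0 ∧
      |(MvPolynomial.eval x (MvPolynomial.pderiv k f) : ℝ)| ≤ B ^ κ)
    (_ : ∀ x ∈ T, MvPolynomial.eval x f = 0)
    (_ : ∀ x ∈ T, MvPolynomial.eval (fun k => (x k : ℚ)) g = 0)
    (_ : ∀ x ∈ T, ∀ y ∈ T, x ≠ y → NonProp x y), (T.card : ℝ) ≤ C * B ^ (2 / (δ : ℝ) + ε) := by
  classical
  set D : ℕ := ⌈2 / ε⌉₊ + δ + 1 with hD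
  set s : ℕ := (D + 2).choose 2 - (D - δ + 2).choose 2 with hs
  clear_value s
  set J : ℕ := δ * κ + 1 with hJ
  have hch : ∀ n : ℕ, 2 * (n + 2).choose 2 = (n + 2) * (n + 1) := by
    intro n
    rw [Nat.choose_two_right, Nat.mul_div_cancel' (Nat.even_mul_pred_self (n + 2)).two_dvd]
    rfl
  have hsle : (D - δ + 2).choose 2 ≤ (D + 2).choose 2 := Nat.choose_le_choose 2 (by omega)
  have hs2 : 2 * s = 2 * δ * (D - δ) + δ * δ + 3 * δ := by
    have e1 := hch D
    have e2 := hch (D - δ)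
    obtain ⟨m, hm⟩ : ∃ m, D = m + δ := ⟨D - δ, by omega⟩
    have hm' : D - δ = m := by omega
    rw [hm'] at e2 hs hsle ⊢
    have ht : s + (m + 2).choose 2 = (D + 2).choose 2 := by omega
    rw [hm] at e1 ht
    nlinarith
  have hs3 : 3 ≤ s := by
    have h1 : 1 ≤ D - δ := by omega
    nlinarith
  have hsD : (D : ℝ) * s ≤ (2 / (δ : ℝ) + ε) * (s * (s - 1) / 2 : ℕ) := by
    have hev : ((s * (s - 1) / 2 : ℕ) : ℝ) = s * (s - 1) / 2 := by
      rw [Nat.cast_div (Nat.even_mul_pred_self s).two_dvd (by norm_num), Nat.cast_mul,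
        Nat.cast_sub (by omega)]
      norm_num
    rw [hev]
    have hδ' : (0 : ℝ) < δ := by exact_mod_cast hδ
    have h1 : 2 / ε ≤ D - δ - 1 := by
      have := Nat.le_ceil (2 / ε)
      rw [hD]; push_cast; linarith
    have h2 : 2 * (s : ℝ) = 2 * δ * (D - δ) + δ * δ + 3 * δ := by
      have h3 : ((D - δ : ℕ) : ℝ) = D - δ := by rw [Nat.cast_sub (by omega)]
      rw [← h3]
      exact_mod_cast hs2
    have h4 : (s : ℝ) - 1 ≥ δ * (D - δ) := by
      have : (1 : ℝ) ≤ δ := by exact_mod_cast hδ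
      nlinarith
    have h5 : (D : ℝ) ≤ (2 / (δ : ℝ) + ε) * (s - 1) / 2 := by
      have h6 : (2 / (δ : ℝ) + ε) * (δ * (D - δ)) / 2 = (D - δ) + δ * (ε * (D - δ)) / 2 := by
        field_simp
      have h7 : 2 ≤ ε * (D - δ) := by
        have h8 : 2 / ε ≤ D - δ := by linarith
        rw [div_le_iff₀ hε] at h8
        linarith
      have h9 : (2 / (δ : ℝ) + ε) * (δ * (D - δ)) / 2 ≤ (2 / (δ : ℝ) + ε) * (s - 1) / 2 := by
        gcongr
      nlinarith
    calc (D : ℝ) * s ≤ ((2 / (δ : ℝ) + ε) * (s - 1) / 2) * s := by gcongr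
      _ = _ := by ring
  set M : ℝ := s.factorial + 1 with hM
  refine ⟨J * (6 * (δ * D * (2 ^ J * (2 * M) * d))) + 1, by positivity, ?_⟩
  intro B hB f hf g hgp hg T hTB hTp hTs hTf hTg hTn
  obtain ⟨t, e, ht, he, hind⟩ := exists_independent_monomials D hgp.ne_zero hg (by omega)
  have hss : t = s := by omega
  subst hss
  set E := B ^ (2 / (δ : ℝ) + ε) with hE
  have hE1 : 1 ≤ E := Real.one_le_rpow hB (by positivity)
  have hM1 : 1 ≤ M := by rw [hM]; linarith [(Nat.cast_nonneg t.factorial : (0 : ℝ) ≤ t.factorial)]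
  set n0 : ℕ := ⌈M * E⌉₊ with hn0
  have hn0E : M * E ≤ n0 := Nat.le_ceil _
  have hME : 1 ≤ M * E := one_le_mul_of_one_le_of_one_le hM1 hE1
  have hn0E2 : (n0 : ℝ) ≤ 2 * M * E := by
    have := Nat.ceil_lt_add_one (a := M * E) (by linarith)
    rw [hn0]; linarith
  obtain ⟨p, hpp, hpmono, hpb⟩ := exists_large_primes n0 (by
    intro h; rw [h] at hn0E; norm_num at hn0E; linarith)
  have hlarge : ∀ i, t.factorial * (B ^ D) ^ t < (p i : ℝ) ^ (t * (t - 1) / 2) := by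
    intro i
    have hpi : M * E ≤ p i := hn0E.trans (by exact_mod_cast (hpb i).1.le)
    have hk : t * (t - 1) / 2 ≠ 0 := by
      have : 2 ≤ t * (t - 1) := by
        have : 2 ≤ t - 1 := by omega
        nlinarith
      omega
    calc t.factorial * (B ^ D) ^ t < M * (B ^ D) ^ t := by
          refine mul_lt_mul_of_pos_right ?_ (by positivity)
          rw [hM]; linarith
      _ ≤ M ^ (t * (t - 1) / 2) * E ^ (t * (t - 1) / 2) := by
          gcongr
          · exact le_self_pow₀ hM1 hk
          · rw [hE, ← pow_mul, ← Real.rpow_natCast, ← Real.rpow_natCast, ← Real.rpow_mul (by linarith)]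
            refine Real.rpow_le_rpow_of_exponent_le hB ?_
            push_cast at hsD ⊢
            exact hsD
      _ = (M * E) ^ (t * (t - 1) / 2) := (mul_pow _ _ _).symm
      _ ≤ _ := by gcongr
  let Ti : ℕ → Finset (Fin 3 → ℤ) := fun i => T.filter fun x =>
    ∃ k, ¬ (p i : ℤ) ∣ MvPolynomial.eval x (MvPolynomial.pderiv k f)
  have hcover : T ⊆ (Finset.range J).biUnion Ti := by
    intro x hx
    by_contra hcon
    obtain ⟨k, hk0, hkB⟩ := hTs x hx
    have hall : ∀ i ∈ Finset.range J, (p i : ℤ) ∣ MvPolynomial.eval x (MvPolynomial.pderiv k f) := by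
      intro i hi
      by_contra h
      exact hcon (Finset.mem_biUnion.2 ⟨i, hi, Finset.mem_filter.2 ⟨hx, k, h⟩⟩)
    have hprod : (∏ i ∈ Finset.range J, (p i : ℤ)) ∣
        MvPolynomial.eval x (MvPolynomial.pderiv k f) := by
      refine Finset.prod_dvd_of_coprime (fun i _ j _ hij => ?_) hall
      exact Nat.isCoprime_iff_coprime.2
        ((Nat.coprime_primes (hpp i) (hpp j)).2 fun h => hij (hpmono.injective h))
    have h1 := Int.le_of_dvd (abs_pos.2 hk0) ((dvd_abs _ _).2 hprod)
    have h2 : (∏ i ∈ Finset.range J, (p i : ℝ)) ≤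
        |(MvPolynomial.eval x (MvPolynomial.pderiv k f) : ℝ)| := by exact_mod_cast h1
    have h3 : ∏ i ∈ Finset.range J, (p i : ℝ) > ∏ i ∈ Finset.range J, E := by
      refine Finset.prod_lt_prod_of_nonempty (fun i _ => by linarith) (fun i _ => ?_) ⟨0, by simp [hJ]⟩
      have h4 : (n0 : ℝ) < p i := by exact_mod_cast (hpb i).1
      nlinarith
    rw [Finset.prod_const, Finset.card_range] at h3
    have h5 : B ^ κ ≤ E ^ J := by
      rw [hE, ← Real.rpow_natCast, ← Real.rpow_natCast, ← Real.rpow_mul (by linarith)]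
      refine Real.rpow_le_rpow_of_exponent_le hB ?_
      rw [hJ]; push_cast
      have hδ' : (0 : ℝ) < δ := by exact_mod_cast hδ
      have : 2 / (δ : ℝ) * (δ * κ) = 2 * κ := by field_simp
      have h6 : (0 : ℝ) ≤ κ := Nat.cast_nonneg _
      have h7 : 0 ≤ 2 / (δ : ℝ) := by positivity
      nlinarith [mul_nonneg hε.le (mul_nonneg hδ'.le h6)]
    linarith
  have hTi : ∀ i ∈ Finset.range J, ((Ti i).card : ℝ) ≤ 6 * (δ * D * (2 ^ J * (2 * M) * d)) * E := by
    intro i hi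
    have h1 := card_smooth_mod_prime_le hf hgp hg he hind (hpp i) (hlarge i) (Ti i)
      (fun x hx => hTB x (Finset.mem_of_mem_filter x hx))
      (fun x hx => hTp x (Finset.mem_of_mem_filter x hx) _ (hpp i))
      (fun x hx => (Finset.mem_filter.1 hx).2)
      (fun x hx => hTf x (Finset.mem_of_mem_filter x hx))
      (fun x hx => hTg x (Finset.mem_of_mem_filter x hx))
      (fun x hx y hy => hTn x (Finset.mem_of_mem_filter x hx) y (Finset.mem_of_mem_filter y hy))
    have h2 : ((Ti i).card : ℝ) ≤ 6 * (δ * D * (p i * d)) := by exact_mod_cast h1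
    have h3 : (p i : ℝ) ≤ 2 ^ J * (2 * M * E) := by
      have h4 : (p i : ℝ) ≤ 2 ^ (i + 1) * n0 := by exact_mod_cast (hpb i).2
      refine h4.trans (mul_le_mul ?_ hn0E2 (Nat.cast_nonneg _) (by positivity))
      exact pow_le_pow_right₀ (by norm_num) (Finset.mem_range.1 hi)
    calc ((Ti i).card : ℝ) ≤ 6 * (δ * D * (p i * d)) := h2
      _ ≤ 6 * (δ * D * ((2 ^ J * (2 * M * E)) * d)) := by gcongr
      _ = _ := by ring
  calc (T.card : ℝ) ≤ (((Finset.range J).biUnion Ti).card : ℝ) := by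
        exact_mod_cast Finset.card_le_card hcover
    _ ≤ ∑ i ∈ Finset.range J, ((Ti i).card : ℝ) := by exact_mod_cast Finset.card_biUnion_le
    _ ≤ ∑ i ∈ Finset.range J, 6 * (δ * D * (2 ^ J * (2 * M) * d)) * E := Finset.sum_le_sum hTi
    _ = J * (6 * (δ * D * (2 ^ J * (2 * M) * d))) * E := by
        rw [Finset.sum_const, Finset.card_range, nsmul_eq_mul]; ring
    _ ≤ _ := by nlinarith

section Lattice

variable {V : Type*} [NormedAddCommGroup V] [InnerProductSpace ℝ V] [FiniteDimensional ℝ V]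

/-- A locally finite subgroup of a Euclidean space has a reduced basis. -/
theorem exists_reduced_basis (n : ℕ) : ∃ K : ℝ, 1 ≤ K ∧ ∀ Λ : AddSubgroup V,
    (∀ R : ℝ, {v : V | v ∈ Λ ∧ ‖v‖ ≤ R}.Finite) →
    Module.finrank ℝ (Submodule.span ℝ (Λ : Set V)) = n →
    ∃ e : Fin n → V, (∀ i, e i ∈ Λ) ∧ LinearIndependent ℝ e ∧ ∀ P ∈ Λ, ∃ l : Fin n → ℤ,
      P = ∑ i, (l i) • e i ∧ ∀ i, |(l i : ℝ)| * ‖e i‖ ≤ K * ‖P‖ := by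
  induction n with
  | zero =>
    refine ⟨1, le_rfl, fun Λ _ h0 => ⟨Fin.elim0, fun i => i.elim0, linearIndependent_empty_type,
      fun P hP => ⟨Fin.elim0, ?_, fun i => i.elim0⟩⟩⟩
    rw [Submodule.finrank_eq_zero] at h0
    have := Submodule.subset_span (R := ℝ) hP
    rw [h0] at this
    simpa using this
  | succ n ih =>
    obtain ⟨K, hK, ih⟩ := ih
    refine ⟨1 + 2 * (n + 1) * K, by nlinarith [(Nat.cast_nonneg n : (0 : ℝ) ≤ n)], ?_⟩
    intro Λ hfin hrank
    have hne : ∃ v ∈ Λ, v ≠ 0 := by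
      by_contra! h
      have : Submodule.span ℝ (Λ : Set V) = ⊥ := Submodule.span_eq_bot.2 h
      rw [this, finrank_bot] at hrank
      omega
    obtain ⟨v₀, hv₀, hv₀0⟩ := hne
    obtain ⟨b, hb, hbmin⟩ := Set.exists_min_image {v : V | (v ∈ Λ ∧ ‖v‖ ≤ ‖v₀‖) ∧ v ≠ 0}
      (fun v => ‖v‖) ((hfin ‖v₀‖).subset fun v hv => hv.1) ⟨v₀, ⟨hv₀, le_rfl⟩, hv₀0⟩
    obtain ⟨⟨hbΛ, hbv⟩, hb0⟩ := hb
    have hmin : ∀ v ∈ Λ, v ≠ 0 → ‖b‖ ≤ ‖v‖ := by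
      intro v hv hv0
      by_cases h : ‖v‖ ≤ ‖v₀‖
      · exact hbmin v ⟨⟨hv, h⟩, hv0⟩
      · linarith
    have hbpos : 0 < ‖b‖ := norm_pos_iff.2 hb0
    let t : V →ₗ[ℝ] ℝ := (‖b‖ ^ 2)⁻¹ • (innerₛₗ ℝ b)
    have ht : ∀ x, t x = (‖b‖ ^ 2)⁻¹ * inner ℝ b x := fun x => rfl
    have htb : t b = 1 := by
      rw [ht, real_inner_self_eq_norm_sq, inv_mul_cancel₀ (by positivity)]
    let π : V →ₗ[ℝ] V := LinearMap.id - t.smulRight b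
    have hπ : ∀ x, π x = x - t x • b := fun x => rfl
    have hπb : π b = 0 := by rw [hπ, htb, one_smul, sub_self]
    have horth : ∀ x, inner ℝ (π x) b = 0 := by
      intro x
      rw [hπ, inner_sub_left, inner_smul_left, real_inner_self_eq_norm_sq, ht,
        real_inner_comm]
      simp only [conj_trivial]
      field_simp
      ring
    have hnorm : ∀ x (r : ℝ), ‖π x + r • b‖ ^ 2 = ‖π x‖ ^ 2 + r ^ 2 * ‖b‖ ^ 2 := by
      intro x r
      rw [norm_add_sq_real, inner_smul_right, horth, norm_smul, mul_pow, Real.norm_eq_abs, sq_abs]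
      ring
    have hπle : ∀ x, ‖π x‖ ≤ ‖x‖ := by
      intro x
      have h1 := hnorm x (t x)
      rw [show π x + t x • b = x by rw [hπ]; abel] at h1
      exact le_of_sq_le_sq (by nlinarith [sq_nonneg (t x * ‖b‖)]) (norm_nonneg _)
    have hlift : ∀ x ∈ Λ, ∃ y ∈ Λ, π y = π x ∧ ‖y - π x‖ ≤ ‖b‖ / 2 := by
      intro x hx
      refine ⟨x - (round (t x)) • b, Λ.sub_mem hx (Λ.zsmul_mem hbΛ _), ?_, ?_⟩
      · rw [map_sub, map_zsmul, hπb, smul_zero, sub_zero]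
      · rw [hπ, show x - round (t x) • b - (x - t x • b) = (t x - round (t x)) • b by
          rw [sub_smul, Int.cast_smul_eq_zsmul]; abel, norm_smul, Real.norm_eq_abs]
        nlinarith [abs_sub_round (t x)]
    have hshort : ∀ x ∈ Λ, π x ≠ 0 → ‖b‖ ≤ 2 * ‖π x‖ := by
      intro x hx hx0
      obtain ⟨y, hy, hyx, hyn⟩ := hlift x hx
      have hy0 : y ≠ 0 := by
        rintro rfl
        exact hx0 (by rw [← hyx, map_zero])
      have h1 := hmin y hy hy0
      have h2 : ‖y‖ ≤ ‖y - π x‖ + ‖π x‖ := by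
        simpa using norm_add_le (y - π x) (π x)
      linarith
    obtain ⟨e', he'Λ, he'li, he'⟩ := ih (Λ.map π.toAddMonoidHom) (by
      intro R
      refine ((hfin (R + ‖b‖ / 2)).image π).subset ?_
      rintro _ ⟨⟨x, hx, rfl⟩, hR⟩
      obtain ⟨y, hy, hyx, hyn⟩ := hlift x hx
      refine ⟨y, ⟨hy, ?_⟩, hyx⟩
      have h2 : ‖y‖ ≤ ‖y - π x‖ + ‖π x‖ := by
        simpa using norm_add_le (y - π x) (π x)
      have h3 : ‖π x‖ ≤ R := hR
      linarith) (by
      have h1 : Submodule.span ℝ ((Λ.map π.toAddMonoidHom : AddSubgroup V) : Set V) =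
          (Submodule.span ℝ (Λ : Set V)).map π := by
        rw [Submodule.map_span]; rfl
      have hker : LinearMap.ker π = Submodule.span ℝ {b} := by
        ext x
        rw [LinearMap.mem_ker, hπ, sub_eq_zero, Submodule.mem_span_singleton]
        constructor
        · intro h; exact ⟨t x, h.symm⟩
        · rintro ⟨a, rfl⟩
          rw [map_smul, htb, smul_eq_mul, mul_one]
      have hle : LinearMap.ker π ≤ Submodule.span ℝ (Λ : Set V) := by
        rw [hker, Submodule.span_singleton_le_iff_mem]
        exact Submodule.subset_span hbΛ
      have h2 := LinearMap.finrank_range_add_finrank_ker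
        (π.domRestrict (Submodule.span ℝ (Λ : Set V)))
      rw [LinearMap.range_domRestrict, LinearMap.ker_domRestrict,
        (Submodule.comapSubtypeEquivOfLe hle).finrank_eq, hker, finrank_span_singleton hb0,
        hrank] at h2
      rw [h1]
      omega)
    choose x hxΛ hx using he'Λ
    choose e heΛ heπ hen using fun i => hlift (x i) (hxΛ i)
    have hx' : ∀ i, π (x i) = e' i := hx
    simp only [hx'] at heπ hen
    have he2 : ∀ i, ‖e i‖ ≤ 2 * ‖e' i‖ := by
      intro i
      have h1 := hshort (x i) (hxΛ i) (by rw [hx']; exact he'li.ne_zero i)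
      rw [hx'] at h1
      have h2 : ‖e i‖ ≤ ‖e i - e' i‖ + ‖e' i‖ := by simpa using norm_add_le (e i - e' i) (e' i)
      linarith [hen i]
    have hπe : π ∘ e = e' := funext heπ
    refine ⟨Fin.cons b e, ?_, ?_, ?_⟩
    · intro i
      refine Fin.cases ?_ (fun j => ?_) i
      · exact hbΛ
      · exact heΛ j
    · rw [linearIndependent_finCons]
      have hli : LinearIndependent ℝ (π ∘ e) := by rw [hπe]; exact he'li
      refine ⟨LinearIndependent.of_comp π hli, fun hmem => hb0 ?_⟩
      obtain ⟨c, hc⟩ := (Submodule.mem_span_range_iff_exists_fun ℝ).1 hmem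
      have h1 : ∑ i, c i • e' i = 0 := by
        rw [← hπb, ← hc, map_sum]
        exact Finset.sum_congr rfl fun i _ => by rw [map_smul, heπ]
      have h2 := Fintype.linearIndependent_iff.1 he'li c h1
      rw [← hc]
      exact Finset.sum_eq_zero fun i _ => by rw [h2, zero_smul]
    · intro P hP
      obtain ⟨l, hl, hlb⟩ := he' (π P) ⟨P, hP, rfl⟩
      set y := P - ∑ i, l i • e i with hy
      have hyΛ : y ∈ Λ := Λ.sub_mem hP (sum_mem fun i _ => Λ.zsmul_mem (heΛ i) _)
      have hyπ : π y = 0 := by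
        rw [hy, map_sub, map_sum, sub_eq_zero, hl]
        exact Finset.sum_congr rfl fun i _ => by rw [map_zsmul, heπ]
      have hyt : y = t y • b := by
        have := hπ y
        rw [hyπ] at this
        exact (sub_eq_zero.1 this.symm)
      have hym : y = round (t y) • b := by
        by_contra hne
        have h1 := hmin (y - round (t y) • b) (Λ.sub_mem hyΛ (Λ.zsmul_mem hbΛ _))
          (sub_ne_zero.2 hne)
        have h2 : y - round (t y) • b = (t y - round (t y)) • b := by
          rw [sub_smul, Int.cast_smul_eq_zsmul, ← hyt]
        rw [h2, norm_smul, Real.norm_eq_abs] at h1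
        nlinarith [abs_sub_round (t y)]
      refine ⟨Fin.cons (round (t y)) l, ?_, ?_⟩
      · rw [Fin.sum_univ_succ]
        simp only [Fin.cons_zero, Fin.cons_succ]
        rw [← hym, hy]; abel
      · have hbd : ∀ i, |(l i : ℝ)| * ‖e i‖ ≤ 2 * K * ‖P‖ := by
          intro i
          calc |(l i : ℝ)| * ‖e i‖ ≤ |(l i : ℝ)| * (2 * ‖e' i‖) := by gcongr; exact he2 i
            _ = 2 * (|(l i : ℝ)| * ‖e' i‖) := by ring
            _ ≤ 2 * (K * ‖π P‖) := mul_le_mul_of_nonneg_left (hlb i) (by norm_num)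
            _ ≤ 2 * (K * ‖P‖) := by gcongr; exact hπle P
            _ = _ := by ring
        intro i
        refine Fin.cases ?_ (fun j => ?_) i
        · simp only [Fin.cons_zero]
          have h1 : |((round (t y) : ℤ) : ℝ)| * ‖b‖ = ‖y‖ := by
            conv_rhs => rw [hym]
            rw [← Int.cast_smul_eq_zsmul ℝ, norm_smul, Real.norm_eq_abs]
          rw [h1]
          calc ‖y‖ ≤ ‖P‖ + ‖∑ i, l i • e i‖ := norm_sub_le _ _
            _ ≤ ‖P‖ + ∑ i, ‖l i • e i‖ := by gcongr; exact norm_sum_le _ _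
            _ ≤ ‖P‖ + ∑ i : Fin n, 2 * K * ‖P‖ := by
                gcongr with i
                rw [← Int.cast_smul_eq_zsmul ℝ, norm_smul, Real.norm_eq_abs]
                exact hbd i
            _ = (1 + 2 * n * K) * ‖P‖ := by
                rw [Finset.sum_const, Finset.card_univ, Fintype.card_fin, nsmul_eq_mul]; ring
            _ ≤ _ := by
                gcongr
                linarith
        · simp only [Fin.cons_succ]
          refine (hbd j).trans ?_
          gcongr
          have : (0 : ℝ) ≤ n := Nat.cast_nonneg n
          nlinarith
  
end Lattice

section Hyperplane

/-- The embedding of the integer lattice in Euclidean space. -/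
noncomputable def intEmb (n : ℕ) : (Fin n → ℤ) →+ EuclideanSpace ℝ (Fin n) where
  toFun P := WithLp.toLp 2 fun j => (P j : ℝ)
  map_zero' := by ext; simp
  map_add' x y := by ext; simp

@[simp] theorem intEmb_apply (n : ℕ) (P : Fin n → ℤ) (j : Fin n) : intEmb n P j = (P j : ℝ) := rfl

theorem abs_le_norm_intEmb (n : ℕ) (P : Fin n → ℤ) (j : Fin n) : |(P j : ℝ)| ≤ ‖intEmb n P‖ := by
  have := EuclideanSpace.norm_eq (intEmb n P)
  rw [this]
  apply Real.le_sqrt_of_sq_le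
  rw [← Real.norm_eq_abs]
  exact Finset.single_le_sum (f := fun j => ‖intEmb n P j‖ ^ 2) (fun i _ => by positivity)
    (Finset.mem_univ j)

theorem norm_intEmb_le (P : Fin 4 → ℤ) {B : ℝ} (hB : ∀ j, |(P j : ℝ)| ≤ B) :
    ‖intEmb 4 P‖ ≤ 2 * B := by
  have hB0 : 0 ≤ B := (abs_nonneg _).trans (hB 0)
  rw [EuclideanSpace.norm_eq]
  refine Real.sqrt_le_iff.2 ⟨by positivity, ?_⟩
  calc ∑ i, ‖intEmb 4 P i‖ ^ 2 ≤ ∑ i : Fin 4, B ^ 2 := by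
        gcongr with i
        exact hB i
    _ = (2 * B) ^ 2 := by simp; ring

theorem finite_abs_le (n : ℕ) (R : ℝ) : {P : Fin n → ℤ | ∀ j, |(P j : ℝ)| ≤ R}.Finite := by
  refine (Set.Finite.pi' (t := fun _ : Fin n => Set.Icc (-⌈R⌉) ⌈R⌉)
    fun _ => Set.finite_Icc _ _).subset ?_
  intro P hP j
  have h1 := abs_le.1 (hP j)
  have h2 := Int.le_ceil R
  constructor
  · have : -(⌈R⌉ : ℝ) ≤ P j := by linarith
    exact_mod_cast this
  · have : (P j : ℝ) ≤ ⌈R⌉ := by linarith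
    exact_mod_cast this

/-- The integer points of the hyperplane orthogonal to `c`, in Euclidean space. -/
noncomputable def hyperLattice (c : Fin 4 → ℤ) : AddSubgroup (EuclideanSpace ℝ (Fin 4)) :=
  ((∑ j, c j • (Pi.evalAddMonoidHom (fun _ : Fin 4 => ℤ) j)).ker).map (intEmb 4)

theorem mem_hyperLattice {c : Fin 4 → ℤ} {v : EuclideanSpace ℝ (Fin 4)} :
    v ∈ hyperLattice c ↔ ∃ P : Fin 4 → ℤ, ∑ j, c j * P j = 0 ∧ intEmb 4 P = v := by
  simp [hyperLattice, AddMonoidHom.mem_ker]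

/-- The integer vector `c k • e_j - c j • e_k`. -/
def hyperGen (c : Fin 4 → ℤ) (k j : Fin 4) : Fin 4 → ℤ :=
  c k • Pi.single j 1 - c j • Pi.single k 1

theorem sum_hyperGen (c : Fin 4 → ℤ) (k j : Fin 4) : ∑ i, c i * hyperGen c k j i = 0 := by
  simp [hyperGen, mul_sub, Finset.sum_sub_distrib, Pi.single_apply, mul_comm]

theorem abs_hyperGen_le (c : Fin 4 → ℤ) (k j i : Fin 4) {C : ℝ} (hC : ∀ j, |(c j : ℝ)| ≤ C) :
    |(hyperGen c k j i : ℝ)| ≤ 2 * C := by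
  have h0 : 0 ≤ C := (abs_nonneg _).trans (hC 0)
  have h1 := abs_le.1 (hC k)
  have h2 := abs_le.1 (hC j)
  simp only [hyperGen, Pi.sub_apply, Pi.smul_apply, Pi.single_apply, smul_eq_mul]
  rw [abs_le]
  split_ifs <;> push_cast <;> constructor <;> linarith

theorem eq_sum_hyperGen (c : Fin 4 → ℤ) {k : Fin 4} (hk : c k ≠ 0)
    (v : EuclideanSpace ℝ (Fin 4)) (hv : ∑ j, (c j : ℝ) * v j = 0) :
    v = ∑ j, ((c k : ℝ)⁻¹ * v j) • intEmb 4 (hyperGen c k j) := by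
  have hk' : (c k : ℝ) ≠ 0 := by exact_mod_cast hk
  ext i
  have h1 : ∀ j, ((c k : ℝ)⁻¹ * v j) * (hyperGen c k j i : ℝ) =
      (if i = j then v j else 0) - (if i = k then (c k : ℝ)⁻¹ * (c j * v j) else 0) := by
    intro j
    simp only [hyperGen, Pi.sub_apply, Pi.smul_apply, Pi.single_apply, smul_eq_mul]
    split_ifs <;> push_cast <;> field_simp <;> ring
  have h2 : (∑ j, ((c k : ℝ)⁻¹ * v j) • intEmb 4 (hyperGen c k j)) i
      = ∑ j, ((c k : ℝ)⁻¹ * v j) * (hyperGen c k j i : ℝ) := by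
    simp
  rw [h2, Finset.sum_congr rfl fun j _ => h1 j, Finset.sum_sub_distrib]
  by_cases hik : i = k
  · simp only [hik, if_true, ← Finset.mul_sum, hv]; simp
  · simp [hik]

theorem span_hyperLattice (c : Fin 4 → ℤ) (hc : c ≠ 0) :
    Module.finrank ℝ (Submodule.span ℝ (hyperLattice c : Set (EuclideanSpace ℝ (Fin 4)))) = 3 := by
  obtain ⟨k, hk⟩ := Function.ne_iff.1 hc
  simp only [Pi.zero_apply] at hk
  let φ : EuclideanSpace ℝ (Fin 4) →ₗ[ℝ] ℝ :=
    { toFun := fun v => ∑ j, (c j : ℝ) * v j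
      map_add' := by intro x y; simp [mul_add, Finset.sum_add_distrib]
      map_smul' := by intro x y; simp [Finset.mul_sum, mul_left_comm] }
  have hφ : φ ≠ 0 := by
    intro h
    have := congrArg (fun f => f (intEmb 4 (Pi.single k 1))) h
    simp [φ, Pi.single_apply] at this
    exact hk this
  have hspan : Submodule.span ℝ (hyperLattice c : Set (EuclideanSpace ℝ (Fin 4)))
      = LinearMap.ker φ := by
    apply le_antisymm
    · rw [Submodule.span_le]
      rintro v hv
      obtain ⟨P, hP, rfl⟩ := mem_hyperLattice.1 hv
      simp only [SetLike.mem_coe, LinearMap.mem_ker]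
      change ∑ j, (c j : ℝ) * (P j : ℝ) = 0
      exact_mod_cast hP
    · intro v hv
      rw [eq_sum_hyperGen c hk v hv]
      refine Submodule.sum_mem _ fun j _ => Submodule.smul_mem _ _ (Submodule.subset_span ?_)
      exact mem_hyperLattice.2 ⟨_, sum_hyperGen c k j, rfl⟩
  rw [hspan]
  have h1 := LinearMap.finrank_range_add_finrank_ker φ
  have h2 : LinearMap.range φ = ⊤ := LinearMap.range_eq_top.2 (LinearMap.surjective hφ)
  rw [h2, finrank_top, Module.finrank_self, finrank_euclideanSpace, Fintype.card_fin] at h1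
  omega

/-- A uniform reduced basis of the integer points of a hyperplane in four-space. -/
theorem exists_reduced_basis_hyperplane : ∃ K : ℝ, 1 ≤ K ∧ ∀ c : Fin 4 → ℤ, c ≠ 0 →
    ∃ e : Fin 3 → Fin 4 → ℤ, (∀ i, ∑ j, c j * e i j = 0) ∧
      (∀ l : Fin 3 → ℝ, (∀ j, ∑ i, l i * (e i j : ℝ) = 0) → l = 0) ∧
      (∀ C : ℝ, (∀ j, |(c j : ℝ)| ≤ C) → ∀ i j, |(e i j : ℝ)| ≤ K * C) ∧
      ∀ P : Fin 4 → ℤ, ∑ j, c j * P j = 0 → ∃ l : Fin 3 → ℤ, (∀ j, P j = ∑ i, l i * e i j) ∧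
        ∀ B : ℝ, (∀ j, |(P j : ℝ)| ≤ B) → ∀ i j, |(l i : ℝ)| * |(e i j : ℝ)| ≤ K * B := by
  obtain ⟨K, hK, H⟩ := exists_reduced_basis (V := EuclideanSpace ℝ (Fin 4)) 3
  refine ⟨4 * K, by linarith, fun c hc => ?_⟩
  obtain ⟨e', he', hli, hP⟩ := H (hyperLattice c) (by
    intro R
    refine ((finite_abs_le 4 R).image (intEmb 4)).subset ?_
    rintro v ⟨hv, hvR⟩
    obtain ⟨P, -, rfl⟩ := mem_hyperLattice.1 hv
    exact ⟨P, fun j => (abs_le_norm_intEmb 4 P j).trans hvR, rfl⟩) (span_hyperLattice c hc)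
  choose e hce hee using fun i => mem_hyperLattice.1 (he' i)
  have hli' : ∀ l : Fin 3 → ℝ, (∀ j, ∑ i, l i * (e i j : ℝ) = 0) → l = 0 := by
    intro l hl
    have := Fintype.linearIndependent_iff.1 hli l (by
      ext j
      have := hl j
      simpa [← hee] using this)
    exact funext this
  have hlP : ∀ P : Fin 4 → ℤ, ∑ j, c j * P j = 0 → ∃ l : Fin 3 → ℤ, (∀ j, P j = ∑ i, l i * e i j) ∧
        ∀ B : ℝ, (∀ j, |(P j : ℝ)| ≤ B) → ∀ i j, |(l i : ℝ)| * |(e i j : ℝ)| ≤ 2 * K * B := by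
    intro P hPc
    obtain ⟨l, hl1, hl2⟩ := hP (intEmb 4 P) (mem_hyperLattice.2 ⟨P, hPc, rfl⟩)
    refine ⟨l, fun j => ?_, fun B hB i j => ?_⟩
    · have := congrArg (fun v : EuclideanSpace ℝ (Fin 4) => v j) hl1
      simp only [intEmb_apply, ← hee, ← map_zsmul, ← map_sum] at this
      have h2 : P j = (∑ i, l i • e i) j := by exact_mod_cast this
      simpa using h2
    · calc |(l i : ℝ)| * |(e i j : ℝ)| ≤ |(l i : ℝ)| * ‖e' i‖ := by
            gcongr
            rw [← hee]; exact abs_le_norm_intEmb 4 _ j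
        _ ≤ K * ‖intEmb 4 P‖ := hl2 i
        _ ≤ K * (2 * B) := by gcongr; exact norm_intEmb_le P hB
        _ = _ := by ring
  refine ⟨e, hce, hli', fun C hC i j => ?_, fun P hPc => ?_⟩
  · obtain ⟨k, hk⟩ := Function.ne_iff.1 hc
    simp only [Pi.zero_apply] at hk
    choose l hl1 hl2 using fun m => hlP (hyperGen c k m) (sum_hyperGen c k m)
    have hex : ∃ m, l m i ≠ 0 := by
      by_contra! h
      have h1 := eq_sum_hyperGen c hk (intEmb 4 (e i)) (by
        simp only [intEmb_apply]; exact_mod_cast hce i)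
      have h2 : (fun i' => (Pi.single i 1 : Fin 3 → ℝ) i' -
          ∑ m, (c k : ℝ)⁻¹ * (e i m : ℝ) * (l m i' : ℝ)) = 0 := by
        apply hli'
        intro j
        have h3 := congrArg (fun v : EuclideanSpace ℝ (Fin 4) => v j) h1
        simp only [intEmb_apply, WithLp.ofLp_sum, WithLp.ofLp_smul, Finset.sum_apply, Pi.smul_apply,
          smul_eq_mul] at h3
        simp only [sub_mul, Finset.sum_sub_distrib, Pi.single_apply, ite_mul, one_mul, zero_mul,
          Finset.sum_ite_eq', Finset.mem_univ, if_true, Finset.sum_mul]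
        rw [Finset.sum_comm, h3, sub_eq_zero]
        refine Finset.sum_congr rfl fun m _ => ?_
        rw [hl1 m j]
        push_cast
        rw [Finset.mul_sum]
        exact Finset.sum_congr rfl fun _ _ => by ring
      have h4 := congrFun h2 i
      simp [h] at h4
    obtain ⟨m, hm⟩ := hex
    have h1 : (1 : ℝ) ≤ |(l m i : ℝ)| := by exact_mod_cast Int.one_le_abs hm
    calc |(e i j : ℝ)| ≤ |(l m i : ℝ)| * |(e i j : ℝ)| := le_mul_of_one_le_left (abs_nonneg _) h1
      _ ≤ 2 * K * (2 * C) := hl2 m _ (fun i => abs_hyperGen_le c k m i hC) i j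
      _ = _ := by ring
  · obtain ⟨l, h1, h2⟩ := hlP P hPc
    refine ⟨l, h1, fun B hB i j => (h2 B hB i j).trans ?_⟩
    have hB0 : 0 ≤ B := (abs_nonneg _).trans (hB 0)
    nlinarith

/-- Siegel's lemma for integer matrices with entries bounded by `H`. -/
theorem siegel_lemma {α β : Type*} [Fintype α] [Fintype β] (A : α → β → ℤ)
    (hn : Fintype.card α < Fintype.card β) (hm : 0 < Fintype.card α) {H : ℝ} (hH : 1 ≤ H)
    (hA : ∀ i j, |(A i j : ℝ)| ≤ H) :
    ∃ t : β → ℤ, t ≠ 0 ∧ (∀ i, ∑ j, A i j * t j = 0) ∧ ∀ j, |(t j : ℝ)| ≤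
      (Fintype.card β * H) ^ ((Fintype.card α : ℝ) / (Fintype.card β - Fintype.card α)) := by
  let _ := Matrix.seminormedAddCommGroup (m := α) (n := β) (α := ℤ)
  obtain ⟨t, ht0, ht, htn⟩ := Int.Matrix.exists_ne_zero_int_vec_norm_le (Matrix.of A) hn hm
  refine ⟨t, ht0, fun i => ?_, fun j => ?_⟩
  · have := congrFun ht i
    simpa [Matrix.mulVec, dotProduct] using this
  · have h1 : |(t j : ℝ)| ≤ ‖t‖ := by
      have := norm_le_pi_norm t j
      rwa [Int.norm_eq_abs] at this
    refine h1.trans (htn.trans ?_)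
    have h2 : max 1 ‖Matrix.of A‖ ≤ H := by
      refine max_le hH ?_
      rw [Matrix.norm_le_iff (by linarith)]
      intro i j
      rw [Int.norm_eq_abs]
      exact hA i j
    have h3 : (Fintype.card α : ℝ) < Fintype.card β := by exact_mod_cast hn
    refine Real.rpow_le_rpow (by positivity) (by gcongr) (div_nonneg (by positivity) (by linarith))

/-- Every point of the box `[-B, B]⁴` lies on a rational hyperplane of small height. -/
theorem exists_small_hyperplane {B : ℝ} (hB : 1 ≤ B) (P : Fin 4 → ℤ) (hP : ∀ j, |(P j : ℝ)| ≤ B) :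
    ∃ c : Fin 4 → ℤ, c ≠ 0 ∧ ∑ j, c j * P j = 0 ∧ ∀ j, |(c j : ℝ)| ≤ 4 * B ^ (1 / 3 : ℝ) := by
  obtain ⟨c, h0, h1, h2⟩ := siegel_lemma (fun _ : Unit => P) (by simp) (by simp) hB
    (fun _ j => hP j)
  refine ⟨c, h0, ?_, fun j => (h2 j).trans ?_⟩
  · rw [← h1 ()]
    exact Finset.sum_congr rfl fun _ _ => mul_comm _ _
  · simp only [Fintype.card_fin, Fintype.card_unit]
    norm_num
    rw [Real.mul_rpow (by norm_num) (by linarith)]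
    gcongr
    calc (4 : ℝ) ^ (1 / 3 : ℝ) ≤ 4 ^ (1 : ℝ) := by
          apply Real.rpow_le_rpow_of_exponent_le <;> norm_num
      _ = 4 := by norm_num

end Hyperplane

section FormBasics

variable {d : ℕ} {a : Fin (d + 1) → ℤ}

theorem BF_zero (hd : d ≠ 0) {R : Type*} [CommRing R] : BF d a (0 : R) 0 = 0 := by
  have := BF_mul d a (0 : R) 0 0
  simpa [hd] using this

theorem BF_ratCast_complex (x y : ℚ) : ((BF d a x y : ℚ) : ℂ) = BF d a (x : ℂ) (y : ℂ) :=
  map_BF (Rat.castHom ℂ) d a x y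

open Polynomial in
/-- The restriction of the form to the line `t ↦ w + t • u`. -/
noncomputable def lineBF (d : ℕ) (a : Fin (d + 1) → ℤ) {R : Type*} [CommRing R] (w0 w1 u0 u1 : R) :
    R[X] := BF d a (C w0 + C u0 * X) (C w1 + C u1 * X)

open Polynomial in
theorem eval_lineBF {R : Type*} [CommRing R] (w0 w1 u0 u1 t : R) :
    (lineBF d a w0 w1 u0 u1).eval t = BF d a (w0 + u0 * t) (w1 + u1 * t) := by
  have := map_BF (evalRingHom t) d a (C w0 + C u0 * X) (C w1 + C u1 * X)
  simpa [lineBF] using this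

open Polynomial in
theorem map_lineBF {R S : Type*} [CommRing R] [CommRing S] (φ : R →+* S) (w0 w1 u0 u1 : R) :
    (lineBF d a w0 w1 u0 u1).map φ = lineBF d a (φ w0) (φ w1) (φ u0) (φ u1) := by
  have := map_BF (mapRingHom φ) d a (C w0 + C u0 * X) (C w1 + C u1 * X)
  simpa [lineBF] using this

open Polynomial in
theorem natDegree_lineBF_le {R : Type*} [CommRing R] (w0 w1 u0 u1 : R) :
    (lineBF d a w0 w1 u0 u1).natDegree ≤ d := by
  unfold lineBF BF
  refine natDegree_sum_le_of_forall_le _ _ fun i _ => ?_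
  have h1 : ∀ w u : R, (C w + C u * X).natDegree ≤ 1 := fun w u => by
    rw [add_comm]; exact natDegree_linear_le
  refine (natDegree_mul_le).trans ?_
  have h2 : ((C w1 + C u1 * X) ^ (d - (i : ℕ))).natDegree ≤ (d - i) * 1 :=
    natDegree_pow_le_of_le _ (h1 _ _)
  have h3 : (((a i : ℤ) : R[X]) * (C w0 + C u0 * X) ^ (i : ℕ)).natDegree ≤ (i : ℕ) := by
    refine (natDegree_mul_le).trans ?_
    have h4 : ((C w0 + C u0 * X) ^ (i : ℕ)).natDegree ≤ (i : ℕ) * 1 :=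
      natDegree_pow_le_of_le _ (h1 _ _)
    have h5 : ((a i : ℤ) : R[X]).natDegree = 0 := natDegree_intCast _
    omega
  have : (i : ℕ) ≤ d := by omega
  omega

theorem le_natDegree_lineBF (hd : 2 ≤ d) (h : FormNonzeroDisc d a) {w0 w1 u0 u1 : ℚ}
    (hdet : w0 * u1 - w1 * u0 ≠ 0) : d ≤ (lineBF d a w0 w1 u0 u1).natDegree + 1 := by
  obtain ⟨c, L, hc, hL, hF⟩ := h
  have h1 := Polynomial.natDegree_map_eq_of_injective (Rat.castHom ℂ).injective
    (lineBF d a w0 w1 u0 u1)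
  rw [map_lineBF] at h1
  have h2 : lineBF d a (w0 : ℂ) w1 u0 u1 = Polynomial.C c * ∏ j : Fin d,
      (Polynomial.C ((L j).1 * w0 + (L j).2 * w1) +
        Polynomial.C ((L j).1 * u0 + (L j).2 * u1) * Polynomial.X) := by
    apply Polynomial.funext
    intro t
    rw [eval_lineBF]
    simp only [Polynomial.eval_mul, Polynomial.eval_C, Polynomial.eval_prod, Polynomial.eval_add,
      Polynomial.eval_X]
    rw [BF, hF]
    congr 1
    refine Finset.prod_congr rfl fun j _ => ?_
    ring
  have hdet' : (w0 : ℂ) * u1 - w1 * u0 ≠ 0 := by exact_mod_cast hdet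
  have hne : ∀ j : Fin d, (Polynomial.C ((L j).1 * w0 + (L j).2 * w1) +
        Polynomial.C ((L j).1 * u0 + (L j).2 * u1) * Polynomial.X : Polynomial ℂ) ≠ 0 := by
    intro j hj
    have e0 : (L j).1 * w0 + (L j).2 * w1 = 0 := by
      have := congrArg (Polynomial.eval 0) hj
      simpa using this
    have e1 : (L j).1 * u0 + (L j).2 * u1 = 0 := by
      have := congrArg (Polynomial.eval 1) hj
      simpa [e0] using this
    have e2 : (L j).1 = 0 := by
      apply (mul_eq_zero.1 (_ : (L j).1 * (w0 * u1 - w1 * u0) = 0)).resolve_right hdet'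
      linear_combination (u1 : ℂ) * e0 - (w1 : ℂ) * e1
    have e3 : (L j).2 = 0 := by
      apply (mul_eq_zero.1 (_ : (L j).2 * (w0 * u1 - w1 * u0) = 0)).resolve_right hdet'
      linear_combination (w0 : ℂ) * e1 - (u0 : ℂ) * e0
    obtain ⟨i, hi⟩ : ∃ i : Fin d, i ≠ j := by
      by_cases hj : (j : ℕ) = 0
      · exact ⟨⟨1, by omega⟩, fun h => by simp [← h] at hj⟩
      · exact ⟨⟨0, by omega⟩, fun h => by simp [← h] at hj⟩
    apply hL i j hi
    rw [e2, e3]; ring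
  have hcard : (Finset.univ.filter fun j : Fin d => (L j).1 * u0 + (L j).2 * u1 = 0).card ≤ 1 := by
    rw [Finset.card_le_one]
    intro i hi j hj
    simp only [Finset.mem_filter, Finset.mem_univ, true_and] at hi hj
    by_contra hij
    have hD := hL i j hij
    apply hdet'
    have e2 : (u0 : ℂ) = 0 := by
      refine (mul_eq_zero.1 (?_ : (u0 : ℂ) * _ = 0)).resolve_right hD
      linear_combination (L j).2 * hi - (L i).2 * hj
    have e3 : (u1 : ℂ) = 0 := by
      refine (mul_eq_zero.1 (?_ : (u1 : ℂ) * _ = 0)).resolve_right hD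
      linear_combination (L i).1 * hj - (L j).1 * hi
    rw [e2, e3]; ring
  have hsum := Finset.card_filter_add_card_filter_not (s := (Finset.univ : Finset (Fin d)))
    (fun j : Fin d => (L j).1 * u0 + (L j).2 * u1 = 0)
  rw [Finset.card_univ, Fintype.card_fin] at hsum
  rw [← h1]
  change d ≤ (lineBF d a (w0 : ℂ) w1 u0 u1).natDegree + 1
  rw [h2, Polynomial.natDegree_C_mul hc, Polynomial.natDegree_prod _ _ fun j _ => hne j]
  have hge : (Finset.univ.filter fun j : Fin d => ¬ (L j).1 * u0 + (L j).2 * u1 = 0).card ≤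
      ∑ j : Fin d, (Polynomial.C ((L j).1 * w0 + (L j).2 * w1) +
        Polynomial.C ((L j).1 * u0 + (L j).2 * u1) * Polynomial.X : Polynomial ℂ).natDegree := by
    rw [Finset.card_filter]
    refine Finset.sum_le_sum fun j _ => ?_
    split_ifs with hx
    · exact Nat.zero_le _
    · rw [add_comm, Polynomial.natDegree_linear hx]
  omega

/-- A form with non-zero discriminant is not constant along a line off the origin. -/
theorem lineBF_ne_C (hd : 2 ≤ d) (h : FormNonzeroDisc d a) {w0 w1 u0 u1 : ℚ}
    (hdet : w0 * u1 - w1 * u0 ≠ 0) (s : ℚ) : lineBF d a w0 w1 u0 u1 ≠ Polynomial.C s := by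
  intro hs
  have := le_natDegree_lineBF hd h hdet
  rw [hs, Polynomial.natDegree_C] at this
  omega

theorem not_constant_on_line (hd : 2 ≤ d) (h : FormNonzeroDisc d a) {w0 w1 u0 u1 : ℚ}
    (hdet : w0 * u1 - w1 * u0 ≠ 0) {s : ℚ} (hs : ∀ t : ℚ, BF d a (w0 + u0 * t) (w1 + u1 * t) = s) :
    False := by
  refine lineBF_ne_C hd h hdet s (Polynomial.funext fun t => ?_)
  rw [eval_lineBF, hs, Polynomial.eval_C]

theorem derivative_lineBF_ne_zero (hd : 2 ≤ d) (h : FormNonzeroDisc d a) {w0 w1 u0 u1 : ℚ}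
    (hdet : w0 * u1 - w1 * u0 ≠ 0) : Polynomial.derivative (lineBF d a w0 w1 u0 u1) ≠ 0 := by
  intro h0
  exact lineBF_ne_C hd h hdet _ (Polynomial.eq_C_of_derivative_eq_zero h0)

/-- The rational automorphisms of the form. -/
def autForm (d : ℕ) (a : Fin (d + 1) → ℤ) : Set (Matrix (Fin 2) (Fin 2) ℚ) :=
  {M | ∀ x y : ℚ, BF d a (M 0 0 * x + M 0 1 * y) (M 1 0 * x + M 1 1 * y) = BF d a x y}

theorem det_ne_zero_of_mem_autForm (hd : 2 ≤ d) (h : FormNonzeroDisc d a)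
    {M : Matrix (Fin 2) (Fin 2) ℚ} (hM : M ∈ autForm d a) : M 0 0 * M 1 1 - M 0 1 * M 1 0 ≠ 0 := by
  intro hdet
  obtain ⟨u0, u1, hu, h0, h1⟩ : ∃ u0 u1 : ℚ, (u0 ≠ 0 ∨ u1 ≠ 0) ∧ M 0 0 * u0 + M 0 1 * u1 = 0 ∧
      M 1 0 * u0 + M 1 1 * u1 = 0 := by
    by_cases h1 : M 0 0 = 0 ∧ M 0 1 = 0
    · by_cases h2 : M 1 0 = 0 ∧ M 1 1 = 0
      · exact ⟨1, 0, by simp, by simp [h1], by simp [h2]⟩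
      · refine ⟨M 1 1, - M 1 0, ?_, by simp [h1], by ring⟩
        by_contra! h3
        exact h2 ⟨neg_eq_zero.1 h3.2, h3.1⟩
    · refine ⟨M 0 1, - M 0 0, ?_, by ring, by linear_combination -hdet⟩
      by_contra! h3
      exact h1 ⟨neg_eq_zero.1 h3.2, h3.1⟩
  have hdet' : (-u1) * u1 - u0 * u0 ≠ 0 := by
    intro h3
    have h4 : u0 = 0 := pow_eq_zero_iff two_ne_zero |>.1 (by nlinarith [sq_nonneg u0, sq_nonneg u1])
    have h5 : u1 = 0 := pow_eq_zero_iff two_ne_zero |>.1 (by nlinarith [sq_nonneg u0, sq_nonneg u1])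
    simp [h4, h5] at hu
  refine not_constant_on_line hd h (w0 := -u1) (w1 := u0) (u0 := u0) (u1 := u1) hdet'
    (s := BF d a (M 0 0 * (-u1) + M 0 1 * u0) (M 1 0 * (-u1) + M 1 1 * u0)) fun t => ?_
  rw [← hM (-u1 + u0 * t)]
  congr 1
  · linear_combination t * h0
  · linear_combination t * h1

theorem autForm_complex {M : Matrix (Fin 2) (Fin 2) ℚ} (hM : M ∈ autForm d a) (x y : ℂ) :
    BF d a ((M 0 0 : ℂ) * x + M 0 1 * y) (M 1 0 * x + M 1 1 * y) = BF d a x y := by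
  have h1 : BF d a (MvPolynomial.C (M 0 0) * MvPolynomial.X (0 : Fin 2) + MvPolynomial.C (M 0 1) *
      MvPolynomial.X 1) (MvPolynomial.C (M 1 0) * MvPolynomial.X 0 + MvPolynomial.C (M 1 1) *
      MvPolynomial.X 1) = BF d a (MvPolynomial.X 0) (MvPolynomial.X 1) := by
    apply MvPolynomial.funext
    intro v
    rw [map_BF, map_BF]
    simpa using hM (v 0) (v 1)
  have h2 := congrArg (MvPolynomial.eval₂Hom (Rat.castHom ℂ) ![x, y]) h1
  rw [map_BF, map_BF] at h2
  simpa using h2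

theorem binary_quadratic_eq_zero {A B C : ℂ} {x y : Fin 3 → ℂ}
    (hxy : ∀ i j, i ≠ j → x i * y j - x j * y i ≠ 0)
    (h : ∀ i, A * x i ^ 2 + B * (x i * y i) + C * y i ^ 2 = 0) : A = 0 ∧ B = 0 ∧ C = 0 := by
  have h01 := hxy 0 1 (by decide)
  have h02 := hxy 0 2 (by decide)
  have h12 := hxy 1 2 (by decide)
  have e0 := h 0
  have e1 := h 1
  have e2 := h 2
  have hD : (x 0 * y 1 - x 1 * y 0) * (x 0 * y 2 - x 2 * y 0) * (x 1 * y 2 - x 2 * y 1) ≠ 0 :=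
    mul_ne_zero (mul_ne_zero h01 h02) h12
  refine ⟨?_, ?_, ?_⟩
  · refine (mul_eq_zero.1 (?_ : A * _ = 0)).resolve_right hD
    linear_combination (y 1 * y 2 * (x 1 * y 2 - x 2 * y 1)) * e0
      - (y 0 * y 2 * (x 0 * y 2 - x 2 * y 0)) * e1 + (y 0 * y 1 * (x 0 * y 1 - x 1 * y 0)) * e2
  · refine (mul_eq_zero.1 (?_ : B * _ = 0)).resolve_right hD
    linear_combination -(x 1 ^ 2 * y 2 ^ 2 - x 2 ^ 2 * y 1 ^ 2) * e0
      + (x 0 ^ 2 * y 2 ^ 2 - x 2 ^ 2 * y 0 ^ 2) * e1 - (x 0 ^ 2 * y 1 ^ 2 - x 1 ^ 2 * y 0 ^ 2) * e2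
  · refine (mul_eq_zero.1 (?_ : C * _ = 0)).resolve_right hD
    linear_combination (x 1 * x 2 * (x 1 * y 2 - x 2 * y 1)) * e0
      - (x 0 * x 2 * (x 0 * y 2 - x 2 * y 0)) * e1 + (x 0 * x 1 * (x 0 * y 1 - x 1 * y 0)) * e2

theorem BF_ne_zero_somewhere (hd : 2 ≤ d) (h : FormNonzeroDisc d a) :
    ∃ x y : ℚ, BF d a x y ≠ 0 := by
  by_contra! h0
  exact not_constant_on_line hd h (w0 := 1) (w1 := 0) (u0 := 0) (u1 := 1) (by simp) (s := 0)
    fun t => h0 _ _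

theorem eq_or_eq_neg_of_same_roots (hd : 3 ≤ d) (h : FormNonzeroDisc d a)
    {M N : Matrix (Fin 2) (Fin 2) ℚ} (hM : M ∈ autForm d a) (hN : N ∈ autForm d a)
    {x y : Fin 3 → ℂ} (hxy : ∀ i j, i ≠ j → x i * y j - x j * y i ≠ 0)
    (hx : ∀ i, ∃ l : ℂ × ℂ, (l.1 ≠ 0 ∨ l.2 ≠ 0) ∧
      l.1 * (M 0 0 * x i + M 0 1 * y i) + l.2 * (M 1 0 * x i + M 1 1 * y i) = 0 ∧
      l.1 * (N 0 0 * x i + N 0 1 * y i) + l.2 * (N 1 0 * x i + N 1 1 * y i) = 0) :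
    M = N ∨ M = -N := by
  obtain ⟨hA, hB, hC⟩ := binary_quadratic_eq_zero (A := M 0 0 * N 1 0 - M 1 0 * N 0 0)
    (B := M 0 0 * N 1 1 + M 0 1 * N 1 0 - M 1 0 * N 0 1 - M 1 1 * N 0 0)
    (C := M 0 1 * N 1 1 - M 1 1 * N 0 1) hxy (by
      intro i
      obtain ⟨l, hl, h1, h2⟩ := hx i
      rcases hl with hl | hl
      · refine (mul_eq_zero.1 (?_ : l.1 * _ = 0)).resolve_left hl
        linear_combination h1 * (N 1 0 * x i + N 1 1 * y i) - h2 * (M 1 0 * x i + M 1 1 * y i)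
      · refine (mul_eq_zero.1 (?_ : l.2 * _ = 0)).resolve_left hl
        linear_combination h2 * (M 0 0 * x i + M 0 1 * y i) - h1 * (N 0 0 * x i + N 0 1 * y i))
  have hA' : M 0 0 * N 1 0 - M 1 0 * N 0 0 = 0 := by exact_mod_cast hA
  have hB' : M 0 0 * N 1 1 + M 0 1 * N 1 0 - M 1 0 * N 0 1 - M 1 1 * N 0 0 = 0 := by
    exact_mod_cast hB
  have hC' : M 0 1 * N 1 1 - M 1 1 * N 0 1 = 0 := by exact_mod_cast hC
  have hdN := det_ne_zero_of_mem_autForm (by omega) h hN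
  obtain ⟨s, hs⟩ : ∃ s : ℚ, s = (M 0 0 * N 1 1 - M 1 0 * N 0 1) / (N 0 0 * N 1 1 - N 0 1 * N 1 0) :=
    ⟨_, rfl⟩
  rw [eq_div_iff hdN] at hs
  have e00 : M 0 0 = s * N 0 0 := by
    refine mul_right_cancel₀ hdN ?_
    linear_combination (-N 0 0) * hs - N 0 1 * hA'
  have e10 : M 1 0 = s * N 1 0 := by
    refine mul_right_cancel₀ hdN ?_
    linear_combination (-N 1 0) * hs - N 1 1 * hA'
  have e01 : M 0 1 = s * N 0 1 := by
    refine mul_right_cancel₀ hdN ?_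
    linear_combination (-N 0 1) * hs + N 0 0 * hC' - N 0 1 * hB'
  have e11 : M 1 1 = s * N 1 1 := by
    refine mul_right_cancel₀ hdN ?_
    linear_combination (-N 1 1) * hs + N 1 0 * hC' - N 1 1 * hB'
  obtain ⟨x0, y0, h0⟩ := BF_ne_zero_somewhere (by omega) h
  have h1 := hM x0 y0
  rw [e00, e01, e10, e11, mul_assoc, mul_assoc, ← mul_add, mul_assoc, mul_assoc, ← mul_add,
    BF_mul, hN x0 y0] at h1
  have h2 : s ^ d = 1 := mul_right_cancel₀ h0 (by rw [h1, one_mul])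
  have h3 : |s| = 1 := by
    have := congrArg abs h2
    rw [abs_pow, abs_one] at this
    exact (pow_eq_one_iff_of_nonneg (abs_nonneg s) (by omega)).1 this
  rcases abs_eq (zero_le_one) |>.1 h3 with h4 | h4
  · left
    ext i j
    fin_cases i <;> fin_cases j <;> simp [e00, e01, e10, e11, h4]
  · right
    ext i j
    fin_cases i <;> fin_cases j <;> simp [e00, e01, e10, e11, h4]

theorem autForm_finite (hd : 3 ≤ d) (h : FormNonzeroDisc d a) : (autForm d a).Finite := by
  classical
  obtain ⟨c, L, hc, hL, hF⟩ := id h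
  have hroot : ∀ M : autForm d a, ∀ i : Fin d, ∃ j : Fin d,
      (L j).1 * ((M.1 0 0 : ℂ) * (L i).2 + M.1 0 1 * (-(L i).1)) +
        (L j).2 * (M.1 1 0 * (L i).2 + M.1 1 1 * (-(L i).1)) = 0 := by
    intro M i
    have h1 := autForm_complex M.2 (L i).2 (-(L i).1)
    rw [BF, hF, BF, hF] at h1
    have h2 : ∏ j, ((L j).1 * (L i).2 + (L j).2 * (-(L i).1)) = 0 :=
      Finset.prod_eq_zero (Finset.mem_univ i) (by ring)
    rw [h2, mul_zero, mul_eq_zero, Finset.prod_eq_zero_iff] at h1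
    obtain ⟨j, -, hj⟩ := h1.resolve_left hc
    exact ⟨j, hj⟩
  choose σ hσ using hroot
  have hfin : Finite (autForm d a) := by
    have : (Set.univ : Set (autForm d a)).Finite := by
      refine Set.Finite.of_finite_fibers σ (Set.toFinite _) fun τ _ => ?_
      by_cases hne : ∃ M0, σ M0 = τ
      · obtain ⟨M0, hM0⟩ := hne
        refine Set.Finite.of_finite_image (f := Subtype.val)
          ((Set.toFinite {M0.1, -M0.1}).subset ?_) Subtype.val_injective.injOn
        rintro _ ⟨M, ⟨-, hM⟩, rfl⟩
        have hM' : σ M = τ := hM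
        refine eq_or_eq_neg_of_same_roots hd h M.2 M0.2
          (x := fun i => (L ⟨i, by omega⟩).2) (y := fun i => -(L ⟨i, by omega⟩).1) ?_ ?_
        · intro i j hij
          have := hL ⟨i, by omega⟩ ⟨j, by omega⟩ (by simpa [Fin.ext_iff] using hij)
          intro h0
          apply this
          linear_combination h0
        · intro i
          refine ⟨L (τ ⟨i, by omega⟩), ?_, ?_, ?_⟩
          · by_contra! h0
            obtain ⟨j, hj⟩ : ∃ j : Fin d, j ≠ τ ⟨i, by omega⟩ := by
              by_cases hj : ((τ ⟨i, by omega⟩ : Fin d) : ℕ) = 0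
              · exact ⟨⟨1, by omega⟩, fun h => by simp [← h] at hj⟩
              · exact ⟨⟨0, by omega⟩, fun h => by simp [← h] at hj⟩
            apply hL j _ hj
            rw [h0.1, h0.2]; ring
          · have := hσ M ⟨i, by omega⟩
            rwa [hM'] at this
          · have := hσ M0 ⟨i, by omega⟩
            rwa [hM0] at this
      · convert Set.finite_empty
        ext M
        simp only [Set.mem_inter_iff, Set.mem_preimage, Set.mem_singleton_iff,
          Set.mem_empty_iff_false, iff_false, not_and]
        exact fun _ h => hne ⟨M, h⟩
    exact Set.finite_univ_iff.1 this
  exact Set.toFinite _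

end FormBasics

section Special

variable {d : ℕ} {a : Fin (d + 1) → ℤ}

/-- A rational plane through the origin on which `F(x₀,x₁) = F(x₂,x₃)` is either the graph of an
automorphism or a product of two root lines. -/
theorem two_dim_subspace (hd : 2 ≤ d) (h : FormNonzeroDisc d a) (p q : Fin 4 → ℚ)
    (hind : ∀ s t : ℚ, (∀ j, s * p j + t * q j = 0) → s = 0 ∧ t = 0)
    (hF : ∀ s t : ℚ, BF d a (s * p 0 + t * q 0) (s * p 1 + t * q 1) =
      BF d a (s * p 2 + t * q 2) (s * p 3 + t * q 3)) :
    (∃ M ∈ autForm d a, ∀ s t : ℚ,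
      s * p 2 + t * q 2 = M 0 0 * (s * p 0 + t * q 0) + M 0 1 * (s * p 1 + t * q 1) ∧
      s * p 3 + t * q 3 = M 1 0 * (s * p 0 + t * q 0) + M 1 1 * (s * p 1 + t * q 1)) ∨
    ((∀ s t : ℚ, BF d a (s * p 0 + t * q 0) (s * p 1 + t * q 1) = 0) ∧
      (∃ s t : ℚ, (s * p 0 + t * q 0 ≠ 0 ∨ s * p 1 + t * q 1 ≠ 0) ∧
        s * p 2 + t * q 2 = 0 ∧ s * p 3 + t * q 3 = 0) ∧
      (∃ s t : ℚ, (s * p 2 + t * q 2 ≠ 0 ∨ s * p 3 + t * q 3 ≠ 0) ∧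
        s * p 0 + t * q 0 = 0 ∧ s * p 1 + t * q 1 = 0)) := by
  by_cases hD : p 0 * q 1 - p 1 * q 0 = 0
  · right
    obtain ⟨s0, t0, hst, e0, e1⟩ : ∃ s0 t0 : ℚ, (s0 ≠ 0 ∨ t0 ≠ 0) ∧ s0 * p 0 + t0 * q 0 = 0 ∧
        s0 * p 1 + t0 * q 1 = 0 := by
      by_cases h1 : p 0 = 0 ∧ q 0 = 0
      · by_cases h2 : p 1 = 0 ∧ q 1 = 0
        · exact ⟨1, 0, by simp, by simp [h1], by simp [h2]⟩
        · refine ⟨q 1, - p 1, ?_, by simp [h1], by ring⟩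
          by_contra! h3
          exact h2 ⟨neg_eq_zero.1 h3.2, h3.1⟩
      · refine ⟨q 0, - p 0, ?_, by ring, by linear_combination -hD⟩
        by_contra! h3
        exact h1 ⟨neg_eq_zero.1 h3.2, h3.1⟩
    have hN : s0 ^ 2 + t0 ^ 2 ≠ 0 := by
      rcases hst with h1 | h1 <;> positivity
    obtain ⟨b0, hb0⟩ : ∃ b0, b0 = s0 * p 2 + t0 * q 2 := ⟨_, rfl⟩
    obtain ⟨b1, hb1⟩ : ∃ b1, b1 = s0 * p 3 + t0 * q 3 := ⟨_, rfl⟩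
    obtain ⟨r, hr⟩ : ∃ r : Fin 4 → ℚ, ∀ j, r j = -t0 * p j + s0 * q j := ⟨_, fun j => rfl⟩
    have hb : b0 ≠ 0 ∨ b1 ≠ 0 := by
      by_contra! hb
      have := hind s0 t0 (by
        intro j
        fin_cases j
        · exact e0
        · exact e1
        · exact hb0.symm.trans hb.1
        · exact hb1.symm.trans hb.2)
      simp [this.1, this.2] at hst
    have hFr : ∀ τ : ℚ, BF d a (r 2 + b0 * τ) (r 3 + b1 * τ) = BF d a (r 0) (r 1) := by
      intro τ
      have := hF (-t0 + τ * s0) (s0 + τ * t0)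
      rw [hr, hr, hr, hr, hb0, hb1]
      convert this.symm using 2 <;> first | ring1 | linear_combination -τ * e0 |
        linear_combination -τ * e1
    have hdet : r 2 * b1 - r 3 * b0 = 0 := by
      by_contra hdet
      exact not_constant_on_line hd h hdet hFr
    obtain ⟨ρ, hρ0, hρ1⟩ : ∃ ρ : ℚ, r 2 = ρ * b0 ∧ r 3 = ρ * b1 := by
      by_cases h0 : b0 = 0
      · have h1 : b1 ≠ 0 := by tauto
        refine ⟨r 3 / b1, ?_, by field_simp⟩
        rw [h0, mul_zero]
        rw [h0, mul_zero, sub_zero] at hdet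
        exact (mul_eq_zero.1 hdet).resolve_right h1
      · refine ⟨r 2 / b0, by field_simp, ?_⟩
        field_simp
        linear_combination -hdet
    have hr0 : BF d a (r 0) (r 1) = 0 := by
      rw [← hFr (-ρ), hρ0, hρ1]
      rw [show ρ * b0 + b0 * -ρ = 0 by ring, show ρ * b1 + b1 * -ρ = 0 by ring]
      exact BF_zero (by omega)
    refine ⟨fun s t => ?_, ⟨-t0 - ρ * s0, s0 - ρ * t0, ?_, ?_, ?_⟩, ⟨s0, t0, ?_, e0, e1⟩⟩
    · have h1 : s * p 0 + t * q 0 = (-t0 * s + s0 * t) / (s0 ^ 2 + t0 ^ 2) * r 0 := by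
        rw [hr]; field_simp
        linear_combination (s * s0 + t * t0) * e0
      have h2 : s * p 1 + t * q 1 = (-t0 * s + s0 * t) / (s0 ^ 2 + t0 ^ 2) * r 1 := by
        rw [hr]; field_simp
        linear_combination (s * s0 + t * t0) * e1
      rw [h1, h2, BF_mul, hr0, mul_zero]
    · by_contra! hc
      have := hind (-t0 - ρ * s0) (s0 - ρ * t0) (by
        intro j
        fin_cases j
        · exact hc.1
        · exact hc.2
        · change (-t0 - ρ * s0) * p 2 + (s0 - ρ * t0) * q 2 = 0
          linear_combination hρ0 - hr 2 + ρ * hb0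
        · change (-t0 - ρ * s0) * p 3 + (s0 - ρ * t0) * q 3 = 0
          linear_combination hρ1 - hr 3 + ρ * hb1)
      have hs0 : (s0 ^ 2 + t0 ^ 2) = 0 := by linear_combination s0 * this.2 - t0 * this.1
      exact hN hs0
    · linear_combination hρ0 - hr 2 + ρ * hb0
    · linear_combination hρ1 - hr 3 + ρ * hb1
    · rwa [← hb0, ← hb1]
  · left
    have key : ∀ x y : ℚ, ∃ s t : ℚ, s * p 0 + t * q 0 = x ∧ s * p 1 + t * q 1 = y := fun x y =>
      ⟨(x * q 1 - y * q 0) / (p 0 * q 1 - p 1 * q 0), (-x * p 1 + y * p 0) /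
        (p 0 * q 1 - p 1 * q 0), by rw [div_mul_eq_mul_div, div_mul_eq_mul_div, ← add_div, div_eq_iff hD]; ring,
        by rw [div_mul_eq_mul_div, div_mul_eq_mul_div, ← add_div, div_eq_iff hD]; ring⟩
    obtain ⟨M, hM⟩ : ∃ M : Matrix (Fin 2) (Fin 2) ℚ, ∀ s t : ℚ,
      s * p 2 + t * q 2 = M 0 0 * (s * p 0 + t * q 0) + M 0 1 * (s * p 1 + t * q 1) ∧
      s * p 3 + t * q 3 = M 1 0 * (s * p 0 + t * q 0) + M 1 1 * (s * p 1 + t * q 1) := by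
      refine ⟨!![(p 2 * q 1 - q 2 * p 1) / (p 0 * q 1 - p 1 * q 0),
        (-p 2 * q 0 + q 2 * p 0) / (p 0 * q 1 - p 1 * q 0);
        (p 3 * q 1 - q 3 * p 1) / (p 0 * q 1 - p 1 * q 0),
        (-p 3 * q 0 + q 3 * p 0) / (p 0 * q 1 - p 1 * q 0)], fun s t => ⟨?_, ?_⟩⟩
      · simp only [Matrix.of_apply, Matrix.cons_val', Matrix.cons_val_zero, Matrix.cons_val_one,
          Matrix.cons_val_fin_one]
        rw [div_mul_eq_mul_div, div_mul_eq_mul_div, ← add_div, eq_div_iff hD]; ring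
      · simp only [Matrix.of_apply, Matrix.cons_val', Matrix.cons_val_zero, Matrix.cons_val_one,
          Matrix.cons_val_fin_one]
        rw [div_mul_eq_mul_div, div_mul_eq_mul_div, ← add_div, eq_div_iff hD]; ring
    refine ⟨M, fun x y => ?_, hM⟩
    obtain ⟨s, t, rfl, rfl⟩ := key x y
    rw [← (hM s t).1, ← (hM s t).2, hF]

/-- The point with coordinates `x` in the system `e`. -/
def planePt (e : Fin 3 → Fin 4 → ℤ) (x : Fin 3 → ℚ) (j : Fin 4) : ℚ := ∑ i, x i * (e i j : ℚ)

theorem planePt_comb (e : Fin 3 → Fin 4 → ℤ) (x y : Fin 3 → ℚ) (s t : ℚ) (j : Fin 4) :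
    s * planePt e x j + t * planePt e y j = planePt e (fun i => s * x i + t * y i) j := by
  simp only [planePt, Finset.mul_sum, ← Finset.sum_add_distrib]
  exact Finset.sum_congr rfl fun i _ => by ring

theorem sum_mul_planePt {c : Fin 4 → ℤ} {e : Fin 3 → Fin 4 → ℤ} (hc : ∀ i, ∑ j, c j * e i j = 0)
    (x : Fin 3 → ℚ) : ∑ j, (c j : ℚ) * planePt e x j = 0 := by
  simp only [planePt, Finset.mul_sum]
  rw [Finset.sum_comm]
  refine Finset.sum_eq_zero fun i _ => ?_
  have h1 : (∑ j, (c j : ℚ) * (e i j : ℚ)) = 0 := by exact_mod_cast hc i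
  calc ∑ j, (c j : ℚ) * (x i * (e i j : ℚ)) = x i * ∑ j, (c j : ℚ) * (e i j : ℚ) := by
        rw [Finset.mul_sum]; exact Finset.sum_congr rfl fun j _ => by ring
    _ = 0 := by rw [h1, mul_zero]

/-- The line orthogonal to `(k₀, k₁)` is a root line or an eigenline of an automorphism. -/
def IsSpecDir (d : ℕ) (a : Fin (d + 1) → ℤ) (k0 k1 : ℤ) : Prop :=
  ∃ u0 u1 : ℚ, (u0 ≠ 0 ∨ u1 ≠ 0) ∧ (k0 : ℚ) * u0 + k1 * u1 = 0 ∧ (BF d a u0 u1 = 0 ∨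
    ∃ M ∈ autForm d a, M ≠ -1 ∧ M 0 0 * u0 + M 0 1 * u1 = -u0 ∧ M 1 0 * u0 + M 1 1 * u1 = -u1)

/-- The hyperplanes whose intersection with `F(x₀,x₁) = F(x₂,x₃)` may be reducible. -/
def SpecialHyper (d : ℕ) (a : Fin (d + 1) → ℤ) (c : Fin 4 → ℤ) : Prop :=
  (c 0 = 0 ∧ c 1 = 0) ∨ (c 2 = 0 ∧ c 3 = 0) ∨ (IsSpecDir d a (c 0) (c 1) ∧ IsSpecDir d a (c 2) (c 3))
  ∨ ∃ M ∈ autForm d a, (c 0 : ℚ) = -(M 0 0 * c 2 + M 1 0 * c 3) ∧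
    (c 1 : ℚ) = -(M 0 1 * c 2 + M 1 1 * c 3)

theorem linear_factor_point (hd : 2 ≤ d) (h : FormNonzeroDisc d a) {c : Fin 4 → ℤ}
    {e : Fin 3 → Fin 4 → ℤ} (hc : ∀ i, ∑ j, c j * e i j = 0)
    (he : ∀ l : Fin 3 → ℚ, (∀ j, planePt e l j = 0) → l = 0) {l : Fin 3 → ℚ} (hl : l ≠ 0)
    (hf : ∀ x : Fin 3 → ℚ, ∑ i, l i * x i = 0 →
      BF d a (planePt e x 0) (planePt e x 1) = BF d a (planePt e x 2) (planePt e x 3))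
    (x : Fin 3 → ℚ) (hx0 : x ≠ 0) (hx : ∑ i, l i * x i = 0) :
    SpecialHyper d a c ∧ (BF d a (planePt e x 0) (planePt e x 1) = 0 ∨ ∃ M ∈ autForm d a,
      planePt e x 2 = M 0 0 * planePt e x 0 + M 0 1 * planePt e x 1 ∧
      planePt e x 3 = M 1 0 * planePt e x 0 + M 1 1 * planePt e x 1) := by
  have sq_sum_ne : ∀ v : Fin 3 → ℚ, v ≠ 0 → v 0 ^ 2 + v 1 ^ 2 + v 2 ^ 2 ≠ 0 := by
    intro v hv h0
    apply hv
    have h1 : v 0 ^ 2 = 0 := by nlinarith [sq_nonneg (v 0), sq_nonneg (v 1), sq_nonneg (v 2)]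
    have h2 : v 1 ^ 2 = 0 := by nlinarith [sq_nonneg (v 0), sq_nonneg (v 1), sq_nonneg (v 2)]
    have h3 : v 2 ^ 2 = 0 := by nlinarith [sq_nonneg (v 0), sq_nonneg (v 1), sq_nonneg (v 2)]
    ext i
    fin_cases i
    · simpa using h1
    · simpa using h2
    · simpa using h3
  obtain ⟨y, hy⟩ : ∃ y : Fin 3 → ℚ, y = ![l 1 * x 2 - l 2 * x 1, l 2 * x 0 - l 0 * x 2,
    l 0 * x 1 - l 1 * x 0] := ⟨_, rfl⟩
  have y0 : y 0 = l 1 * x 2 - l 2 * x 1 := by rw [hy]; rfl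
  have y1 : y 1 = l 2 * x 0 - l 0 * x 2 := by rw [hy]; rfl
  have y2 : y 2 = l 0 * x 1 - l 1 * x 0 := by rw [hy]; rfl
  rw [Fin.sum_univ_three] at hx
  have hind : ∀ s t : ℚ, (∀ i, s * x i + t * y i = 0) → s = 0 ∧ t = 0 := by
    intro s t hst
    have h0 := hst 0
    have h1 := hst 1
    have h2 := hst 2
    rw [y0] at h0
    rw [y1] at h1
    rw [y2] at h2
    have hs : s = 0 := by
      refine (mul_eq_zero.1 (?_ : s * _ = 0)).resolve_right (sq_sum_ne x hx0)
      linear_combination x 0 * h0 + x 1 * h1 + x 2 * h2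
    refine ⟨hs, ?_⟩
    subst hs
    refine (mul_eq_zero.1 (?_ : t * _ = 0)).resolve_right
      (mul_ne_zero (sq_sum_ne x hx0) (sq_sum_ne l hl))
    linear_combination (l 1 * x 2 - l 2 * x 1) * h0 + (l 2 * x 0 - l 0 * x 2) * h1 +
      (l 0 * x 1 - l 1 * x 0) * h2 + t * (l 0 * x 0 + l 1 * x 1 + l 2 * x 2) * hx
  have hmain := two_dim_subspace hd h (planePt e x) (planePt e y) (by
    intro s t hst
    simp only [planePt_comb] at hst
    have := he _ hst
    exact hind s t fun i => congrFun this i) (by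
    intro s t
    simp only [planePt_comb]
    apply hf
    rw [Fin.sum_univ_three, y0, y1, y2]
    linear_combination s * hx)
  have hcx := sum_mul_planePt hc x
  have hcy := sum_mul_planePt hc y
  rw [Fin.sum_univ_four] at hcx hcy
  rcases hmain with ⟨M, hM, hG⟩ | ⟨hz, ⟨s, t, hst, h2, h3⟩, ⟨s', t', hst', h0, h1⟩⟩
  · have g1 := hG 1 0
    simp only [one_mul, zero_mul, add_zero] at g1
    have g2 := hG 0 1
    simp only [one_mul, zero_mul, zero_add] at g2
    refine ⟨?_, Or.inr ⟨M, hM, g1⟩⟩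
    refine Or.inr (Or.inr (Or.inr ⟨M, hM, ?_⟩))
    have e1 : ((c 0 : ℚ) + (M 0 0 * c 2 + M 1 0 * c 3)) * planePt e x 0 +
        ((c 1 : ℚ) + (M 0 1 * c 2 + M 1 1 * c 3)) * planePt e x 1 = 0 := by
      linear_combination hcx - c 2 * g1.1 - c 3 * g1.2
    have e2 : ((c 0 : ℚ) + (M 0 0 * c 2 + M 1 0 * c 3)) * planePt e y 0 +
        ((c 1 : ℚ) + (M 0 1 * c 2 + M 1 1 * c 3)) * planePt e y 1 = 0 := by
      linear_combination hcy - c 2 * g2.1 - c 3 * g2.2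
    have hD : planePt e x 0 * planePt e y 1 - planePt e x 1 * planePt e y 0 ≠ 0 := by
      intro hD
      have hdep : ∀ s t : ℚ, s * planePt e x 0 + t * planePt e y 0 = 0 →
          s * planePt e x 1 + t * planePt e y 1 = 0 → s = 0 ∧ t = 0 := by
        intro s t h0 h1
        have h23 := hG s t
        rw [h0, h1, mul_zero, mul_zero, mul_zero, mul_zero, add_zero] at h23
        refine hind s t fun i => ?_
        have := he (fun i => s * x i + t * y i) (by
          intro j
          rw [← planePt_comb]
          fin_cases j
          · exact h0
          · exact h1
          · exact h23.1
          · exact h23.2)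
        exact congrFun this i
      have A := hdep (planePt e y 0) (-planePt e x 0) (by ring) (by linear_combination -hD)
      have B := hdep (planePt e y 1) (-planePt e x 1) (by linear_combination hD) (by ring)
      have := hdep 1 0 (by rw [neg_eq_zero.1 A.2, mul_zero, zero_mul, add_zero])
        (by rw [neg_eq_zero.1 B.2, mul_zero, zero_mul, add_zero])
      exact one_ne_zero this.1
    constructor
    · have : ((c 0 : ℚ) + (M 0 0 * c 2 + M 1 0 * c 3)) = 0 := by
        refine mul_right_cancel₀ hD ?_
        linear_combination planePt e y 1 * e1 - planePt e x 1 * e2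
      linear_combination this
    · have : ((c 1 : ℚ) + (M 0 1 * c 2 + M 1 1 * c 3)) = 0 := by
        refine mul_right_cancel₀ hD ?_
        linear_combination planePt e x 0 * e2 - planePt e y 0 * e1
      linear_combination this
  · refine ⟨Or.inr (Or.inr (Or.inl ⟨⟨_, _, hst, ?_, Or.inl (hz s t)⟩,
      ⟨_, _, hst', ?_, Or.inl ?_⟩⟩)), Or.inl ?_⟩
    · linear_combination s * hcx + t * hcy - c 2 * h2 - c 3 * h3
    · linear_combination s' * hcx + t' * hcy - c 0 * h0 - c 1 * h1
    · have := hf (fun i => s' * x i + t' * y i) (by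
        rw [Fin.sum_univ_three, y0, y1, y2]
        linear_combination s' * hx)
      simp only [← planePt_comb] at this
      rw [← this, hz]
    · have := hz 1 0
      simpa using this

theorem special_of_linear_factor (hd : 2 ≤ d) (h : FormNonzeroDisc d a) {c : Fin 4 → ℤ}
    {e : Fin 3 → Fin 4 → ℤ} (hc : ∀ i, ∑ j, c j * e i j = 0)
    (he : ∀ l : Fin 3 → ℚ, (∀ j, planePt e l j = 0) → l = 0) {l : Fin 3 → ℚ} (hl : l ≠ 0)
    (hf : ∀ x : Fin 3 → ℚ, ∑ i, l i * x i = 0 →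
      BF d a (planePt e x 0) (planePt e x 1) = BF d a (planePt e x 2) (planePt e x 3)) :
    SpecialHyper d a c := by
  by_cases h0 : l 0 = 0
  · refine (linear_factor_point hd h hc he hl hf ![1, 0, 0] (fun h => ?_) ?_).1
    · simpa using congrFun h 0
    · simp [Fin.sum_univ_three, h0]
  · refine (linear_factor_point hd h hc he hl hf ![l 1, - l 0, 0] (fun h => ?_) ?_).1
    · exact h0 (by simpa using congrFun h 1)
    · simp [Fin.sum_univ_three]; ring

theorem quartic_coeff_eq_zero {c0 c1 c2 c3 c4 : ℚ}
    (h : ∀ t : ℚ, c0 + c1 * t + c2 * t ^ 2 + c3 * t ^ 3 + c4 * t ^ 4 = 0) :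
    c0 = 0 ∧ c1 = 0 ∧ c2 = 0 ∧ c3 = 0 ∧ c4 = 0 := by
  have h0 := h 0
  have h1 := h 1
  have h2 := h (-1)
  have h3 := h 2
  have h4 := h (-2)
  norm_num at h0 h1 h2 h3 h4
  refine ⟨?_, ?_, ?_, ?_, ?_⟩ <;> linarith

/-- The constraints on a difference of two binary quartics `Φ(T,ℓ) - Ψ(S,ℓ)` that splits into
two quadratic factors. -/
theorem quartic_split {f0 f1 f2 f3 f4 g0 g1 g2 g3 g4 u v w m n r u' v' w' m' n' r' : ℚ}
    (h : ∀ T S l : ℚ, (f4 * T ^ 4 + f3 * T ^ 3 * l + f2 * T ^ 2 * l ^ 2 + f1 * T * l ^ 3 + f0 * l ^ 4)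
      - (g4 * S ^ 4 + g3 * S ^ 3 * l + g2 * S ^ 2 * l ^ 2 + g1 * S * l ^ 3 + g0 * l ^ 4) =
      (u * T ^ 2 + v * T * S + w * S ^ 2 + m * T * l + n * S * l + r * l ^ 2) *
      (u' * T ^ 2 + v' * T * S + w' * S ^ 2 + m' * T * l + n' * S * l + r' * l ^ 2))
    (hf : f4 ≠ 0 → f3 = 0) (hg : g4 ≠ 0 → g3 = 0) :
    (f4 = 0 ∧ g4 = 0) ∨ (f4 = 0 ∧ f3 = 0) ∨ (g4 = 0 ∧ g3 = 0) ∨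
    (f4 ≠ 0 ∧ g4 ≠ 0 ∧ f1 = 0 ∧ g1 = 0) := by
  have H : ∀ T S : ℚ, _ := fun T S => quartic_coeff_eq_zero
    (c0 := f4 * T ^ 4 - g4 * S ^ 4 - (u * T ^ 2 + v * T * S + w * S ^ 2) *
      (u' * T ^ 2 + v' * T * S + w' * S ^ 2))
    (c1 := f3 * T ^ 3 - g3 * S ^ 3 - (u * T ^ 2 + v * T * S + w * S ^ 2) * (m' * T + n' * S)
      - (u' * T ^ 2 + v' * T * S + w' * S ^ 2) * (m * T + n * S))
    (c2 := f2 * T ^ 2 - g2 * S ^ 2 - (u * T ^ 2 + v * T * S + w * S ^ 2) * r'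
      - (u' * T ^ 2 + v' * T * S + w' * S ^ 2) * r - (m * T + n * S) * (m' * T + n' * S))
    (c3 := f1 * T - g1 * S - (m * T + n * S) * r' - (m' * T + n' * S) * r)
    (c4 := f0 - g0 - r * r') fun t => by linear_combination h T S t
  obtain ⟨a0, a1, a2, a3, a4⟩ := quartic_coeff_eq_zero
    (c0 := f4 - u * u') (c1 := -(u * v' + v * u')) (c2 := -(u * w' + v * v' + w * u'))
    (c3 := -(v * w' + w * v')) (c4 := -g4 - w * w') fun t => by
      linear_combination (H 1 t).1
  obtain ⟨b0, b1, b2, b3, -⟩ := quartic_coeff_eq_zero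
    (c0 := f3 - u * m' - m * u') (c1 := -(u * n' + v * m' + m * v' + n * u'))
    (c2 := -(v * n' + w * m' + m * w' + n * v')) (c3 := -g3 - w * n' - n * w') (c4 := 0) fun t => by
      linear_combination (H 1 t).2.1
  have d0 := (H 1 0).2.2.2.1
  have d1 := (H 0 1).2.2.2.1
  by_cases hf4 : f4 = 0
  · by_cases hg4 : g4 = 0
    · exact Or.inl ⟨hf4, hg4⟩
    · refine Or.inr (Or.inl ⟨hf4, ?_⟩)
      have hw : w ≠ 0 := by rintro rfl; apply hg4; linear_combination -a4
      have hw' : w' ≠ 0 := by rintro rfl; apply hg4; linear_combination -a4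
      rw [hf4, zero_sub, neg_eq_zero, mul_eq_zero] at a0
      rcases a0 with rfl | rfl
      · have hv : v * u' = 0 := by linear_combination -a1
        rcases mul_eq_zero.1 hv with rfl | rfl
        · have : w * u' = 0 := by linear_combination -a2
          rw [(mul_eq_zero.1 this).resolve_left hw] at b0
          linear_combination b0
        · linear_combination b0
      · have hv : u * v' = 0 := by linear_combination -a1
        rcases mul_eq_zero.1 hv with rfl | rfl
        · linear_combination b0
        · have : u * w' = 0 := by linear_combination -a2
          rw [(mul_eq_zero.1 this).resolve_right hw'] at b0
          linear_combination b0
  · by_cases hg4 : g4 = 0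
    · refine Or.inr (Or.inr (Or.inl ⟨hg4, ?_⟩))
      have hw : u ≠ 0 := by rintro rfl; apply hf4; linear_combination a0
      have hw' : u' ≠ 0 := by rintro rfl; apply hf4; linear_combination a0
      have a4' : w * w' = 0 := by linear_combination -a4 - hg4
      rcases mul_eq_zero.1 a4' with rfl | rfl
      · have hv : v * w' = 0 := by linear_combination -a3
        rcases mul_eq_zero.1 hv with rfl | rfl
        · have : u * w' = 0 := by linear_combination -a2
          rw [(mul_eq_zero.1 this).resolve_left hw] at b3
          linear_combination -b3
        · linear_combination -b3
      · have hv : w * v' = 0 := by linear_combination -a3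
        rcases mul_eq_zero.1 hv with rfl | rfl
        · linear_combination -b3
        · have : w * u' = 0 := by linear_combination -a2
          rw [(mul_eq_zero.1 this).resolve_right hw'] at b3
          linear_combination -b3
    · refine Or.inr (Or.inr (Or.inr ⟨hf4, hg4, ?_⟩))
      have hu : u ≠ 0 := by rintro rfl; apply hf4; linear_combination a0
      have hu' : u' ≠ 0 := by rintro rfl; apply hf4; linear_combination a0
      have hw : w ≠ 0 := by rintro rfl; apply hg4; linear_combination -a4
      have hw' : w' ≠ 0 := by rintro rfl; apply hg4; linear_combination -a4
      have hf3 := hf hf4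
      have hg3 := hg hg4
      have key : m = 0 ∧ n = 0 := by
        have hvw : v * (u * w' - w * u') = 0 := by linear_combination -u * a3 + w * a1
        rcases mul_eq_zero.1 hvw with rfl | hx
        · have hv' : v' = 0 := by
            refine (mul_eq_zero.1 (?_ : u * _ = 0)).resolve_left hu
            linear_combination -a1
          subst hv'
          constructor
          · refine (mul_eq_zero.1 (?_ : 2 * w' * u * _ = 0)).resolve_left
              (mul_ne_zero (mul_ne_zero two_ne_zero hw') hu)
            linear_combination -u * b2 - m * a2 + w * b0 - w * hf3
          · refine (mul_eq_zero.1 (?_ : 2 * u' * w * _ = 0)).resolve_left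
              (mul_ne_zero (mul_ne_zero two_ne_zero hu') hw)
            linear_combination -w * b1 - n * a2 + u * b3 + u * hg3
        · by_cases hv : v = 0
          · exfalso
            have hv' : v' = 0 := by
              refine (mul_eq_zero.1 (?_ : u * _ = 0)).resolve_left hu
              linear_combination -a1 - u' * hv
            have : 2 * w * u' = 0 := by linear_combination -a2 - hx - v' * hv
            exact (mul_ne_zero (mul_ne_zero two_ne_zero hw) hu') this
          · have hN : u * n' + n * u' = 0 := by
              refine (mul_eq_zero.1 (?_ : w * _ = 0)).resolve_left hw
              linear_combination -u * b3 - u * hg3 - n * hx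
            constructor
            · refine (mul_eq_zero.1 (?_ : 2 * v * u' * _ = 0)).resolve_left
                (mul_ne_zero (mul_ne_zero two_ne_zero hv) hu')
              linear_combination u * hN + v * (hf3 - b0) - m * a1 + u * b1
            · refine (mul_eq_zero.1 (?_ : 2 * v * u' * _ = 0)).resolve_left
                (mul_ne_zero (mul_ne_zero two_ne_zero hv) hu')
              linear_combination w * (hf3 - b0) + m * hx + v * hN - n * a1 + u * b2
      have hm' : m' = 0 := by
        refine (mul_eq_zero.1 (?_ : u * _ = 0)).resolve_left hu
        linear_combination -b0 - u' * key.1 + hf3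
      have hn' : n' = 0 := by
        refine (mul_eq_zero.1 (?_ : w * _ = 0)).resolve_left hw
        linear_combination -b3 - w' * key.2 - hg3
      rw [key.1, key.2, hm', hn'] at d0 d1
      constructor
      · linear_combination d0
      · linear_combination -d1

theorem quartic_expand (a : Fin (4 + 1) → ℤ) (p0 p1 b0 b1 : ℚ) : ∃ f0 f1 f2 f3 f4 : ℚ, ∀ T l : ℚ,
    BF 4 a (T * p0 + l * b0) (T * p1 + l * b1) =
      f4 * T ^ 4 + f3 * T ^ 3 * l + f2 * T ^ 2 * l ^ 2 + f1 * T * l ^ 3 + f0 * l ^ 4 := by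
  have hmon : ∀ i : ℕ, i ≤ 4 → ∃ f0 f1 f2 f3 f4 : ℚ, ∀ T l : ℚ,
      (T * p0 + l * b0) ^ i * (T * p1 + l * b1) ^ (4 - i) =
      f4 * T ^ 4 + f3 * T ^ 3 * l + f2 * T ^ 2 * l ^ 2 + f1 * T * l ^ 3 + f0 * l ^ 4 := by
    intro i hi
    interval_cases i
    · exact ⟨b1 ^ 4, 4 * p1 * b1 ^ 3, 6 * p1 ^ 2 * b1 ^ 2, 4 * p1 ^ 3 * b1, p1 ^ 4,
        fun T l => by ring⟩
    · exact ⟨b0 * b1 ^ 3, p0 * b1 ^ 3 + 3 * b0 * p1 * b1 ^ 2,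
        3 * p0 * p1 * b1 ^ 2 + 3 * b0 * p1 ^ 2 * b1, 3 * p0 * p1 ^ 2 * b1 + b0 * p1 ^ 3,
        p0 * p1 ^ 3, fun T l => by ring⟩
    · exact ⟨b0 ^ 2 * b1 ^ 2, 2 * p0 * b0 * b1 ^ 2 + 2 * b0 ^ 2 * p1 * b1,
        p0 ^ 2 * b1 ^ 2 + 4 * p0 * b0 * p1 * b1 + b0 ^ 2 * p1 ^ 2,
        2 * p0 ^ 2 * p1 * b1 + 2 * p0 * b0 * p1 ^ 2, p0 ^ 2 * p1 ^ 2, fun T l => by ring⟩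
    · exact ⟨b1 * b0 ^ 3, p1 * b0 ^ 3 + 3 * b1 * p0 * b0 ^ 2,
        3 * p1 * p0 * b0 ^ 2 + 3 * b1 * p0 ^ 2 * b0, 3 * p1 * p0 ^ 2 * b0 + b1 * p0 ^ 3,
        p1 * p0 ^ 3, fun T l => by ring⟩
    · exact ⟨b0 ^ 4, 4 * p0 * b0 ^ 3, 6 * p0 ^ 2 * b0 ^ 2, 4 * p0 ^ 3 * b0, p0 ^ 4,
        fun T l => by ring⟩
  choose f0 f1 f2 f3 f4 hf using fun i : Fin (4 + 1) => hmon i (by omega)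
  refine ⟨∑ i, a i * f0 i, ∑ i, a i * f1 i, ∑ i, a i * f2 i, ∑ i, a i * f3 i, ∑ i, a i * f4 i,
    fun T l => ?_⟩
  unfold BF
  simp only [Finset.sum_mul, ← Finset.sum_add_distrib]
  refine Finset.sum_congr rfl fun i _ => ?_
  rw [mul_assoc, hf]
  ring

theorem quartic_expand_depressed (a : Fin (4 + 1) → ℤ) (h : FormNonzeroDisc 4 a) {k0 k1 : ℤ}
    (hk : ¬ (k0 = 0 ∧ k1 = 0)) : ∃ b0 b1 f0 f1 f2 f3 f4 : ℚ, (k0 : ℚ) * b0 + k1 * b1 = 1 ∧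
      (f4 ≠ 0 → f3 = 0) ∧ (f4 = 0 → f3 ≠ 0) ∧
      (f4 = 0 → IsSpecDir 4 a k0 k1) ∧ (f4 ≠ 0 → f1 = 0 → IsSpecDir 4 a k0 k1) ∧ ∀ T l : ℚ,
      BF 4 a (T * k1 + l * b0) (T * (-k0) + l * b1) =
      f4 * T ^ 4 + f3 * T ^ 3 * l + f2 * T ^ 2 * l ^ 2 + f1 * T * l ^ 3 + f0 * l ^ 4 := by
  have hk' : (k0 : ℚ) ^ 2 + (k1 : ℚ) ^ 2 ≠ 0 := by
    rcases not_and_or.1 hk with h1 | h1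
    · have : (k0 : ℚ) ≠ 0 := by exact_mod_cast h1
      positivity
    · have : (k1 : ℚ) ≠ 0 := by exact_mod_cast h1
      positivity
  have hku : (k1 : ℚ) ≠ 0 ∨ -(k0 : ℚ) ≠ 0 := by
    by_contra! h0
    apply hk'
    rw [h0.1, neg_eq_zero.1 h0.2]; simp
  obtain ⟨b0, b1, f0, f1, f2, f3, f4, hb, h34, hf⟩ : ∃ b0 b1 f0 f1 f2 f3 f4 : ℚ,
      (k0 : ℚ) * b0 + k1 * b1 = 1 ∧ (f4 ≠ 0 → f3 = 0) ∧ ∀ T l : ℚ,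
      BF 4 a (T * k1 + l * b0) (T * (-k0) + l * b1) =
      f4 * T ^ 4 + f3 * T ^ 3 * l + f2 * T ^ 2 * l ^ 2 + f1 * T * l ^ 3 + f0 * l ^ 4 := by
    obtain ⟨f0, f1, f2, f3, f4, hf⟩ := quartic_expand a k1 (-k0)
      (k0 / ((k0 : ℚ) ^ 2 + (k1 : ℚ) ^ 2)) (k1 / ((k0 : ℚ) ^ 2 + (k1 : ℚ) ^ 2))
    have hb : (k0 : ℚ) * (k0 / ((k0 : ℚ) ^ 2 + (k1 : ℚ) ^ 2)) +
        k1 * (k1 / ((k0 : ℚ) ^ 2 + (k1 : ℚ) ^ 2)) = 1 := by field_simp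
    by_cases hf4 : f4 = 0
    · exact ⟨_, _, f0, f1, f2, f3, f4, hb, fun h => absurd hf4 h, hf⟩
    · obtain ⟨s, hs⟩ : ∃ s, f3 = 4 * s * f4 := ⟨f3 / (4 * f4), by field_simp⟩
      refine ⟨k0 / ((k0 : ℚ) ^ 2 + (k1 : ℚ) ^ 2) - s * k1,
        k1 / ((k0 : ℚ) ^ 2 + (k1 : ℚ) ^ 2) + s * k0,
        f4 * s ^ 4 - f3 * s ^ 3 + f2 * s ^ 2 - f1 * s + f0,
        -4 * f4 * s ^ 3 + 3 * f3 * s ^ 2 - 2 * f2 * s + f1, 6 * f4 * s ^ 2 - 3 * f3 * s + f2,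
        -4 * f4 * s + f3, f4, by linear_combination hb, fun _ => by linear_combination hs,
        fun T l => ?_⟩
      rw [show T * (k1 : ℚ) + l * (k0 / ((k0 : ℚ) ^ 2 + (k1 : ℚ) ^ 2) - s * k1) =
          (T - s * l) * k1 + l * (k0 / ((k0 : ℚ) ^ 2 + (k1 : ℚ) ^ 2)) by ring,
        show T * (-k0 : ℚ) + l * (k1 / ((k0 : ℚ) ^ 2 + (k1 : ℚ) ^ 2) + s * k0) =
          (T - s * l) * (-k0) + l * (k1 / ((k0 : ℚ) ^ 2 + (k1 : ℚ) ^ 2)) by ring, hf]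
      ring
  have hf4 : BF 4 a (k1 : ℚ) (-k0) = f4 := by
    have := hf 1 0
    simpa using this
  refine ⟨b0, b1, f0, f1, f2, f3, f4, hb, h34, fun h4 h3 => ?_, fun h4 => ?_, fun h4 h1 => ?_, hf⟩
  · have h1 := le_natDegree_lineBF (by norm_num) h (w0 := b0) (w1 := b1) (u0 := k1) (u1 := -k0)
      (by intro h0; have : (1 : ℚ) = 0 := by linear_combination -hb - h0
          exact one_ne_zero this)
    have h2 : lineBF 4 a b0 b1 (k1 : ℚ) (-k0) = Polynomial.C f2 * Polynomial.X ^ 2 +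
        Polynomial.C f1 * Polynomial.X + Polynomial.C f0 := by
      apply Polynomial.funext
      intro t
      rw [eval_lineBF]
      have := hf t 1
      rw [h4, h3] at this
      simp only [one_mul, one_pow, mul_one, zero_mul, zero_add] at this
      simp only [Polynomial.eval_add, Polynomial.eval_mul, Polynomial.eval_C, Polynomial.eval_pow,
        Polynomial.eval_X]
      rw [← this]
      congr 1 <;> ring
    rw [h2] at h1
    have h3 := Polynomial.natDegree_quadratic_le (a := f2) (b := f1) (c := f0)
    omega
  · exact ⟨k1, -k0, hku, by ring, Or.inl (hf4.trans h4)⟩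
  · refine ⟨k1, -k0, hku, by ring, Or.inr ⟨!![1 - 2 * b1 * k1, 2 * b0 * k1; 2 * b1 * k0,
      1 - 2 * b0 * k0], fun x y => ?_, fun hM => ?_, ?_, ?_⟩⟩
    · have e1 := hf (x * b1 - y * b0) (k0 * x + k1 * y)
      have e2 := hf (-(x * b1 - y * b0)) (k0 * x + k1 * y)
      rw [show (x * b1 - y * b0) * (k1 : ℚ) + (k0 * x + k1 * y) * b0 = x by
        linear_combination x * hb, show (x * b1 - y * b0) * (-k0 : ℚ) + (k0 * x + k1 * y) * b1 = y by
        linear_combination y * hb] at e1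
      rw [show -(x * b1 - y * b0) * (k1 : ℚ) + (k0 * x + k1 * y) * b0 =
          (1 - 2 * b1 * k1) * x + (2 * b0 * k1) * y by linear_combination x * hb,
        show -(x * b1 - y * b0) * (-k0 : ℚ) + (k0 * x + k1 * y) * b1 =
          (2 * b1 * k0) * x + (1 - 2 * b0 * k0) * y by linear_combination y * hb] at e2
      simp only [Matrix.of_apply, Matrix.cons_val', Matrix.cons_val_zero, Matrix.cons_val_one,
          Matrix.cons_val_fin_one]
      rw [e1, e2, h1, h34 h4]
      ring
    · have m0 := congrFun (congrFun hM 0) 0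
      have m1 := congrFun (congrFun hM 1) 1
      simp at m0 m1
      linarith
    · simp only [Matrix.of_apply, Matrix.cons_val', Matrix.cons_val_zero, Matrix.cons_val_one,
          Matrix.cons_val_fin_one]
      linear_combination (-2 * k1 : ℚ) * hb
    · simp only [Matrix.of_apply, Matrix.cons_val', Matrix.cons_val_zero, Matrix.cons_val_one,
          Matrix.cons_val_fin_one]
      linear_combination (2 * k0 : ℚ) * hb

/-- Every rational point of the hyperplane is a combination of a basis. -/
theorem exists_planePt {c : Fin 4 → ℤ} {e : Fin 3 → Fin 4 → ℤ}
    (hspan : ∀ P : Fin 4 → ℤ, ∑ j, c j * P j = 0 → ∃ l : Fin 3 → ℤ, ∀ j, P j = ∑ i, l i * e i j)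
    (P : Fin 4 → ℚ) (hP : ∑ j, (c j : ℚ) * P j = 0) : ∃ x : Fin 3 → ℚ, ∀ j, planePt e x j = P j := by
  obtain ⟨N, hN⟩ := IsLocalization.exist_integer_multiples_of_finset (nonZeroDivisors ℤ)
    (Finset.univ.image P)
  have hN' : ((N : ℤ) : ℚ) ≠ 0 := by exact_mod_cast nonZeroDivisors.coe_ne_zero N
  have hintegral : ∀ j, ∃ q : ℤ, (q : ℚ) = (N : ℤ) * P j := by
    intro j
    obtain ⟨q, hq⟩ := hN (P j) (Finset.mem_image_of_mem _ (Finset.mem_univ j))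
    exact ⟨q, by simpa [zsmul_eq_mul] using hq⟩
  choose Q hQ using hintegral
  obtain ⟨l, hl⟩ := hspan Q (by
    have : ∑ j, (c j : ℚ) * Q j = 0 := by
      calc ∑ j, (c j : ℚ) * Q j = (N : ℤ) * ∑ j, (c j : ℚ) * P j := by
            rw [Finset.mul_sum]
            exact Finset.sum_congr rfl fun j _ => by rw [hQ]; ring
        _ = 0 := by rw [hP, mul_zero]
    exact_mod_cast this)
  refine ⟨fun i => (l i : ℚ) / (N : ℤ), fun j => ?_⟩
  have h1 : (Q j : ℚ) = ∑ i, (l i : ℚ) * e i j := by rw [hl j]; push_cast; rfl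
  rw [planePt]
  calc ∑ i, (l i : ℚ) / (N : ℤ) * e i j = (∑ i, (l i : ℚ) * e i j) / (N : ℤ) := by
        rw [Finset.sum_div]
        exact Finset.sum_congr rfl fun i _ => by ring
    _ = P j := by rw [← h1, hQ]; field_simp

theorem special_of_quadratic_factors (a : Fin (4 + 1) → ℤ) (h : FormNonzeroDisc 4 a)
    {c : Fin 4 → ℤ} {e : Fin 3 → Fin 4 → ℤ}
    (hspan : ∀ P : Fin 4 → ℤ, ∑ j, c j * P j = 0 → ∃ l : Fin 3 → ℤ, ∀ j, P j = ∑ i, l i * e i j)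
    {m n : Fin 3 → Fin 3 → ℚ} (hf : ∀ x : Fin 3 → ℚ,
      BF 4 a (planePt e x 0) (planePt e x 1) - BF 4 a (planePt e x 2) (planePt e x 3) =
      (∑ i, ∑ j, m i j * (x i * x j)) * (∑ i, ∑ j, n i j * (x i * x j))) :
    SpecialHyper 4 a c := by
  by_cases hc1 : c 0 = 0 ∧ c 1 = 0
  · exact Or.inl hc1
  by_cases hc2 : c 2 = 0 ∧ c 3 = 0
  · exact Or.inr (Or.inl hc2)
  obtain ⟨b0, b1, f0, f1, f2, f3, f4, hb, hf34, hf34', hfs, hfs', hfe⟩ :=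
    quartic_expand_depressed a h hc1
  obtain ⟨b2, b3, g0, g1, g2, g3, g4, hb', hg34, hg34', hgs, hgs', hge⟩ :=
    quartic_expand_depressed a h hc2
  obtain ⟨A, hA⟩ := exists_planePt hspan ![c 1, -c 0, 0, 0] (by simp [Fin.sum_univ_four]; ring)
  obtain ⟨B, hB⟩ := exists_planePt hspan ![0, 0, c 3, -c 2] (by simp [Fin.sum_univ_four]; ring)
  obtain ⟨C, hC⟩ := exists_planePt hspan ![b0, b1, -b2, -b3] (by
    simp [Fin.sum_univ_four]; linear_combination hb - hb')
  have hpt : ∀ T S l : ℚ, ∀ j, planePt e (fun i => T * A i + S * B i + l * C i) j =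
      T * planePt e A j + S * planePt e B j + l * planePt e C j := by
    intro T S l j
    simp only [planePt, Finset.mul_sum, ← Finset.sum_add_distrib]
    exact Finset.sum_congr rfl fun i _ => by ring
  have hquad : ∀ m : Fin 3 → Fin 3 → ℚ, ∃ u v w p q r : ℚ, ∀ T S l : ℚ,
      ∑ i, ∑ j, m i j * ((T * A i + S * B i + l * C i) * (T * A j + S * B j + l * C j)) =
      u * T ^ 2 + v * T * S + w * S ^ 2 + p * T * l + q * S * l + r * l ^ 2 := by
    intro m
    refine ⟨∑ i, ∑ j, m i j * (A i * A j), ∑ i, ∑ j, m i j * (A i * B j + B i * A j),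
      ∑ i, ∑ j, m i j * (B i * B j), ∑ i, ∑ j, m i j * (A i * C j + C i * A j),
      ∑ i, ∑ j, m i j * (B i * C j + C i * B j), ∑ i, ∑ j, m i j * (C i * C j), fun T S l => ?_⟩
    simp only [Finset.sum_mul, ← Finset.sum_add_distrib]
    exact Finset.sum_congr rfl fun i _ => Finset.sum_congr rfl fun j _ => by ring
  obtain ⟨u, v, w, p, q, r, hm⟩ := hquad m
  obtain ⟨u', v', w', p', q', r', hn⟩ := hquad n
  have hsplit := quartic_split (f0 := f0) (f1 := f1) (f2 := f2) (f3 := f3) (f4 := f4) (g0 := g0)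
    (g1 := -g1) (g2 := g2) (g3 := -g3) (g4 := g4) (u := u) (v := v) (w := w) (m := p) (n := q)
    (r := r) (u' := u') (v' := v') (w' := w') (m' := p') (n' := q') (r' := r') (by
      intro T S l
      have h1 := hf (fun i => T * A i + S * B i + l * C i)
      rw [hm, hn] at h1
      rw [← h1, hpt, hpt, hpt, hpt]
      simp only [hA, hB, hC]
      have e1 := hfe T l
      have e2 := hge S (-l)
      simp only [Matrix.cons_val_zero, Matrix.cons_val_one, Matrix.cons_val]
      rw [show T * (c 1 : ℚ) + S * 0 + l * b0 = T * c 1 + l * b0 by ring,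
        show T * (-c 0 : ℚ) + S * 0 + l * b1 = T * -c 0 + l * b1 by ring, e1,
        show T * (0 : ℚ) + S * c 3 + l * -b2 = S * c 3 + -l * b2 by ring,
        show T * (0 : ℚ) + S * -c 2 + l * -b3 = S * -c 2 + -l * b3 by ring, e2]
      ring) hf34 (fun h => neg_eq_zero.2 (hg34 h))
  rcases hsplit with ⟨h1, h2⟩ | ⟨h1, h2⟩ | ⟨h1, h2⟩ | ⟨h1, h2, h3, h4⟩
  · exact Or.inr (Or.inr (Or.inl ⟨hfs h1, hgs h2⟩))
  · exact absurd h2 (hf34' h1)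
  · exact absurd (neg_eq_zero.1 h2) (hg34' h1)
  · exact Or.inr (Or.inr (Or.inl ⟨hfs' h1 h3, hgs' h2 (neg_eq_zero.1 h4)⟩))

end Special

section PlaneCount

variable {d : ℕ} {a : Fin (d + 1) → ℤ}

/-- The partial derivative of the form with respect to the first variable. -/
def BFx {R : Type*} [CommRing R] (d : ℕ) (a : Fin (d + 1) → ℤ) (x y : R) : R :=
  ∑ i : Fin (d + 1), (a i : R) * ((i : ℕ) * x ^ ((i : ℕ) - 1)) * y ^ (d - (i : ℕ))

/-- The partial derivative of the form with respect to the second variable. -/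
def BFy {R : Type*} [CommRing R] (d : ℕ) (a : Fin (d + 1) → ℤ) (x y : R) : R :=
  ∑ i : Fin (d + 1), (a i : R) * x ^ (i : ℕ) * ((d - (i : ℕ) : ℕ) * y ^ (d - (i : ℕ) - 1))

theorem map_BFx {R S : Type*} [CommRing R] [CommRing S] (φ : R →+* S) (x y : R) :
    φ (BFx d a x y) = BFx d a (φ x) (φ y) := by
  simp [BFx, map_sum]

theorem map_BFy {R S : Type*} [CommRing R] [CommRing S] (φ : R →+* S) (x y : R) :
    φ (BFy d a x y) = BFy d a (φ x) (φ y) := by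
  simp [BFy, map_sum]

theorem BFx_intCast {R : Type*} [CommRing R] (x y : ℤ) :
    ((BFx d a x y : ℤ) : R) = BFx d a (x : R) (y : R) :=
  map_BFx (Int.castRingHom R) x y

theorem BFy_intCast {R : Type*} [CommRing R] (x y : ℤ) :
    ((BFy d a x y : ℤ) : R) = BFy d a (x : R) (y : R) :=
  map_BFy (Int.castRingHom R) x y

theorem derivation_BF {R A : Type*} [CommRing R] [CommRing A] [Algebra R A] (D : Derivation R A A)
    (x y : A) : D (BF d a x y) = BFx d a x y * D x + BFy d a x y * D y := by
  simp only [BF, BFx, BFy, map_sum, Finset.sum_mul, ← Finset.sum_add_distrib]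
  refine Finset.sum_congr rfl fun i _ => ?_
  simp only [Derivation.leibniz, Derivation.leibniz_pow, smul_eq_mul, nsmul_eq_mul,
    Derivation.map_intCast]
  ring

theorem BFx_euler {R : Type*} [CommRing R] (x y : R) :
    x * BFx d a x y + y * BFy d a x y = d * BF d a x y := by
  simp only [BF, BFx, BFy, Finset.mul_sum, ← Finset.sum_add_distrib]
  refine Finset.sum_congr rfl fun i _ => ?_
  have hx : x * ((i : ℕ) * x ^ ((i : ℕ) - 1)) = (i : ℕ) * x ^ (i : ℕ) := by
    rcases Nat.eq_zero_or_pos (i : ℕ) with h | h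
    · simp [h]
    · obtain ⟨k, hk⟩ := Nat.exists_eq_succ_of_ne_zero h.ne'
      rw [hk]; simp; ring
  have hy : y * ((d - (i : ℕ) : ℕ) * y ^ (d - (i : ℕ) - 1)) =
      (d - (i : ℕ) : ℕ) * y ^ (d - (i : ℕ)) := by
    rcases Nat.eq_zero_or_pos (d - (i : ℕ)) with h | h
    · simp [h]
    · obtain ⟨k, hk⟩ := Nat.exists_eq_succ_of_ne_zero h.ne'
      rw [hk]; simp; ring
  have hd : (d : R) = (i : ℕ) + (d - (i : ℕ) : ℕ) := by
    rw [← Nat.cast_add]; congr 1; omega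
  calc _ = (a i : R) * (x * ((i : ℕ) * x ^ ((i : ℕ) - 1))) * y ^ (d - (i : ℕ)) +
        (a i : R) * x ^ (i : ℕ) * (y * ((d - (i : ℕ) : ℕ) * y ^ (d - (i : ℕ) - 1))) := by ring
    _ = _ := by rw [hx, hy, hd]; ring

theorem derivative_lineBF_eval {R : Type*} [CommRing R] (w0 w1 u0 u1 t : R) :
    (Polynomial.derivative (lineBF d a w0 w1 u0 u1)).eval t =
      BFx d a (w0 + u0 * t) (w1 + u1 * t) * u0 + BFy d a (w0 + u0 * t) (w1 + u1 * t) * u1 := by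
  have h := derivation_BF (d := d) (a := a) (Polynomial.derivative' (R := R))
    (Polynomial.C w0 + Polynomial.C u0 * Polynomial.X)
    (Polynomial.C w1 + Polynomial.C u1 * Polynomial.X)
  have h2 := congrArg (Polynomial.evalRingHom t) h
  rw [map_add, map_mul, map_mul, map_BFx, map_BFy] at h2
  simpa [lineBF] using h2

theorem BFx_mul {R : Type*} [CommRing R] (t x y : R) :
    BFx d a (t * x) (t * y) = t ^ (d - 1) * BFx d a x y := by
  unfold BFx
  rw [Finset.mul_sum]
  refine Finset.sum_congr rfl fun i _ => ?_
  rcases Nat.eq_zero_or_pos (i : ℕ) with h | h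
  · simp [h]
  · have : t ^ (d - 1) = t ^ ((i : ℕ) - 1) * t ^ (d - (i : ℕ)) := by
      rw [← pow_add]; congr 1; omega
    rw [this]; ring

theorem BFy_mul {R : Type*} [CommRing R] (t x y : R) :
    BFy d a (t * x) (t * y) = t ^ (d - 1) * BFy d a x y := by
  unfold BFy
  rw [Finset.mul_sum]
  refine Finset.sum_congr rfl fun i _ => ?_
  rcases Nat.eq_zero_or_pos (d - (i : ℕ)) with h | h
  · simp [h]
  · have : t ^ (d - 1) = t ^ (i : ℕ) * t ^ (d - (i : ℕ) - 1) := by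
      rw [← pow_add]; congr 1; omega
    rw [this]; ring

theorem exists_BFx_bound (d : ℕ) (a : Fin (d + 1) → ℤ) : ∃ K : ℝ, 1 ≤ K ∧ ∀ (B : ℝ), 1 ≤ B →
    ∀ x y : ℝ, |x| ≤ B → |y| ≤ B →
      |BF d a x y| ≤ K * B ^ d ∧ |BFx d a x y| ≤ K * B ^ (d - 1) ∧
        |BFy d a x y| ≤ K * B ^ (d - 1) := by
  set S : ℝ := ∑ i : Fin (d + 1), |(a i : ℝ)| with hS
  have hS0 : 0 ≤ S := Finset.sum_nonneg fun i _ => abs_nonneg _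
  have key : ∀ (m : ℕ) (c : Fin (d + 1) → ℝ) (p q : Fin (d + 1) → ℕ)
      (_ : ∀ i, c i = 0 ∨ p i + q i ≤ m) (_ : ∀ i, 0 ≤ c i ∧ c i ≤ d + 1) (B : ℝ), 1 ≤ B →
      ∀ x y : ℝ, |x| ≤ B → |y| ≤ B →
      |∑ i, (a i : ℝ) * (c i * (x ^ p i * y ^ q i))| ≤ (S * (d + 1) + 1) * B ^ m := by
    intro m c p q hpq hc B hB x y hx hy
    have hB0 : (0 : ℝ) ≤ B := by linarith
    have h1 : ∀ i, |(a i : ℝ) * (c i * (x ^ p i * y ^ q i))| ≤ |(a i : ℝ)| * ((d + 1) * B ^ m) := by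
      intro i
      rw [abs_mul]
      refine mul_le_mul_of_nonneg_left ?_ (abs_nonneg _)
      rcases hpq i with h | h
      · rw [h]; simp; positivity
      · rw [abs_mul, abs_of_nonneg (hc i).1, abs_mul, abs_pow, abs_pow]
        refine mul_le_mul (hc i).2 ?_ (by positivity) (by positivity)
        calc |x| ^ p i * |y| ^ q i ≤ B ^ p i * B ^ q i := by gcongr
          _ = B ^ (p i + q i) := (pow_add _ _ _).symm
          _ ≤ B ^ m := pow_le_pow_right₀ hB h
    calc _ ≤ ∑ i, |(a i : ℝ) * (c i * (x ^ p i * y ^ q i))| := Finset.abs_sum_le_sum_abs _ _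
      _ ≤ ∑ i, |(a i : ℝ)| * ((d + 1) * B ^ m) := Finset.sum_le_sum fun i _ => h1 i
      _ = S * (d + 1) * B ^ m := by rw [← Finset.sum_mul, ← hS]; ring
      _ ≤ _ := by
        have : 0 ≤ B ^ m := by positivity
        nlinarith
  refine ⟨S * (d + 1) + 1, by nlinarith [mul_nonneg hS0 (by positivity : (0 : ℝ) ≤ d + 1)],
    fun B hB x y hx hy => ⟨?_, ?_, ?_⟩⟩
  · have := key d (fun _ => 1) (fun i => i) (fun i => d - i) (fun i => Or.inr (by omega))
      (fun i => ⟨by simp, by simp⟩) B hB x y hx hy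
    convert this using 2
    unfold BF
    exact Finset.sum_congr rfl fun i _ => by ring
  · have := key (d - 1) (fun i => (i : ℕ)) (fun i => i - 1) (fun i => d - i)
      (fun i => by
        rcases Nat.eq_zero_or_pos (i : ℕ) with h | h
        · left; simp [h]
        · right; omega)
      (fun i => ⟨by positivity, by exact_mod_cast (by omega : (i : ℕ) ≤ d + 1)⟩) B hB x y hx hy
    convert this using 2
    unfold BFx
    exact Finset.sum_congr rfl fun i _ => by ring
  · have := key (d - 1) (fun i => (d - (i : ℕ) : ℕ)) (fun i => i) (fun i => d - i - 1)
      (fun i => by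
        rcases Nat.eq_zero_or_pos (d - (i : ℕ)) with h | h
        · left; simp [h]
        · right; omega)
      (fun i => ⟨by positivity, by exact_mod_cast (by omega : d - (i : ℕ) ≤ d + 1)⟩)
      B hB x y hx hy
    convert this using 2
    unfold BFy
    exact Finset.sum_congr rfl fun i _ => by ring

open MvPolynomial in
/-- The `j`-th coordinate on the plane spanned by `e`. -/
noncomputable def linCoord (R : Type*) [CommRing R] (e : Fin 3 → Fin 4 → ℤ) (j : Fin 4) :
    MvPolynomial (Fin 3) R := ∑ i, C (e i j : R) * X i

/-- The equation `F(x₀,x₁) = F(x₂,x₃)` restricted to the plane spanned by `e`. -/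
noncomputable def planeForm (R : Type*) [CommRing R] (d : ℕ) (a : Fin (d + 1) → ℤ)
    (e : Fin 3 → Fin 4 → ℤ) : MvPolynomial (Fin 3) R :=
  BF d a (linCoord R e 0) (linCoord R e 1) - BF d a (linCoord R e 2) (linCoord R e 3)

theorem eval_linCoord {R : Type*} [CommRing R] (e : Fin 3 → Fin 4 → ℤ) (j : Fin 4) (x : Fin 3 → R) :
    MvPolynomial.eval x (linCoord R e j) = ∑ i, x i * (e i j : R) := by
  simp [linCoord, mul_comm]

theorem eval_planeForm {R : Type*} [CommRing R] (e : Fin 3 → Fin 4 → ℤ) (x : Fin 3 → R) :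
    MvPolynomial.eval x (planeForm R d a e) =
      BF d a (∑ i, x i * (e i 0 : R)) (∑ i, x i * (e i 1 : R)) -
      BF d a (∑ i, x i * (e i 2 : R)) (∑ i, x i * (e i 3 : R)) := by
  rw [planeForm, map_sub, map_BF, map_BF]
  simp only [eval_linCoord]

theorem isHomogeneous_BF {R : Type*} [CommRing R] {p q : MvPolynomial (Fin 3) R}
    (hp : p.IsHomogeneous 1) (hq : q.IsHomogeneous 1) : (BF d a p q).IsHomogeneous d := by
  unfold BF
  refine MvPolynomial.IsHomogeneous.sum _ _ _ fun i _ => ?_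
  have h1 : (((a i : ℤ) : MvPolynomial (Fin 3) R)).IsHomogeneous 0 := by
    have := MvPolynomial.isHomogeneous_C (R := R) (Fin 3) ((a i : ℤ) : R)
    simpa using this
  have h2 := (h1.mul (hp.pow i)).mul (hq.pow (d - i))
  have h3 : 0 + 1 * (i : ℕ) + 1 * (d - (i : ℕ)) = d := by omega
  rwa [h3] at h2

theorem isHomogeneous_linCoord (R : Type*) [CommRing R] (e : Fin 3 → Fin 4 → ℤ) (j : Fin 4) :
    (linCoord R e j).IsHomogeneous 1 := by
  unfold linCoord
  refine MvPolynomial.IsHomogeneous.sum _ _ _ fun i _ => ?_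
  have := (MvPolynomial.isHomogeneous_C (Fin 3) (e i j : R)).mul
    (MvPolynomial.isHomogeneous_X R i)
  rwa [zero_add] at this

theorem isHomogeneous_planeForm (R : Type*) [CommRing R] (e : Fin 3 → Fin 4 → ℤ) :
    (planeForm R d a e).IsHomogeneous d :=
  (isHomogeneous_BF (isHomogeneous_linCoord _ _ _) (isHomogeneous_linCoord _ _ _)).sub
    (isHomogeneous_BF (isHomogeneous_linCoord _ _ _) (isHomogeneous_linCoord _ _ _))

theorem eval_pderiv_planeForm {R : Type*} [CommRing R] (e : Fin 3 → Fin 4 → ℤ) (x : Fin 3 → R)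
    (P : Fin 4 → R) (hP : ∀ j, P j = ∑ i, x i * (e i j : R)) (k : Fin 3) :
    MvPolynomial.eval x (MvPolynomial.pderiv k (planeForm R d a e)) =
      BFx d a (P 0) (P 1) * e k 0 + BFy d a (P 0) (P 1) * e k 1 -
      (BFx d a (P 2) (P 3) * e k 2 + BFy d a (P 2) (P 3) * e k 3) := by
  have hD : ∀ j, MvPolynomial.pderiv k (linCoord R e j) = MvPolynomial.C (e k j : R) := by
    intro j
    simp [linCoord, MvPolynomial.pderiv_X, Pi.single_apply]
  rw [planeForm, map_sub, derivation_BF, derivation_BF]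
  simp only [map_sub, map_add, map_mul, map_BFx, map_BFy, hD, eval_linCoord, MvPolynomial.eval_C, hP]

theorem eval_of_isHomogeneous_one {f : MvPolynomial (Fin 3) ℚ} (hf : f.IsHomogeneous 1) :
    ∃ l : Fin 3 → ℚ, ∀ x, MvPolynomial.eval x f = ∑ i, l i * x i := by
  have h0 : ∀ i, ∃ c, MvPolynomial.pderiv i f = MvPolynomial.C c := fun i =>
    ⟨_, MvPolynomial.totalDegree_eq_zero_iff_eq_C.1
      ((MvPolynomial.totalDegree_zero_iff_isHomogeneous _).2 (hf.pderiv (i := i)))⟩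
  choose l hl using h0
  refine ⟨l, fun x => ?_⟩
  have := congrArg (MvPolynomial.eval x) hf.sum_X_mul_pderiv
  simp only [hl, map_sum, map_mul, MvPolynomial.eval_X, MvPolynomial.eval_C, one_smul] at this
  rw [← this]
  exact Finset.sum_congr rfl fun i _ => mul_comm _ _

theorem eval_of_isHomogeneous_two {f : MvPolynomial (Fin 3) ℚ} (hf : f.IsHomogeneous 2) :
    ∃ m : Fin 3 → Fin 3 → ℚ, ∀ x, MvPolynomial.eval x f = ∑ i, ∑ j, m i j * (x i * x j) := by
  have h0 : ∀ i, ∃ l : Fin 3 → ℚ, ∀ x, MvPolynomial.eval x (MvPolynomial.pderiv i f) =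
      ∑ j, l j * x j := fun i => eval_of_isHomogeneous_one (hf.pderiv (i := i))
  choose l hl using h0
  refine ⟨fun i j => l i j / 2, fun x => ?_⟩
  have := congrArg (MvPolynomial.eval x) hf.sum_X_mul_pderiv
  simp only [hl, map_sum, map_mul, MvPolynomial.eval_X, map_nsmul] at this
  have h2 : MvPolynomial.eval x f = (∑ i, x i * ∑ j, l i j * x j) / 2 := by
    rw [this]; simp
  rw [h2, Finset.sum_div]
  refine Finset.sum_congr rfl fun i _ => ?_
  rw [Finset.mul_sum, Finset.sum_div]
  exact Finset.sum_congr rfl fun j _ => by ring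

/-- A non-trivial point of `F(x₀,x₁) = F(x₂,x₃)`: it lies on none of the rational planes
contained in this hypersurface. -/
def GoodPt (d : ℕ) (a : Fin (d + 1) → ℤ) (P : Fin 4 → ℤ) : Prop :=
  BF d a (P 0) (P 1) = BF d a (P 2) (P 3) ∧ BF d a (P 0) (P 1) ≠ 0 ∧
  ¬ ∃ M ∈ autForm d a, (P 2 : ℚ) = M 0 0 * P 0 + M 0 1 * P 1 ∧
    (P 3 : ℚ) = M 1 0 * P 0 + M 1 1 * P 1

theorem GoodPt.ne_zero (hd : d ≠ 0) {P : Fin 4 → ℤ} (h : GoodPt d a P) : P ≠ 0 := by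
  rintro rfl
  exact h.2.1 (by simpa using BF_zero hd)

theorem no_linear_factor_at_goodPt (hd : 2 ≤ d) (h : FormNonzeroDisc d a) {c : Fin 4 → ℤ}
    {e : Fin 3 → Fin 4 → ℤ} (hc : ∀ i, ∑ j, c j * e i j = 0)
    (he : ∀ l : Fin 3 → ℚ, (∀ j, planePt e l j = 0) → l = 0) {l : Fin 3 → ℚ} (hl : l ≠ 0)
    (hf : ∀ x : Fin 3 → ℚ, ∑ i, l i * x i = 0 →
      BF d a (planePt e x 0) (planePt e x 1) = BF d a (planePt e x 2) (planePt e x 3))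
    {P : Fin 4 → ℤ} (hP : GoodPt d a P) {x : Fin 3 → ℚ} (hPx : ∀ j, (P j : ℚ) = planePt e x j)
    (hx : ∑ i, l i * x i = 0) : False := by
  have hx0 : x ≠ 0 := by
    rintro rfl
    refine hP.ne_zero (by omega) (funext fun j => ?_)
    have := hPx j
    simpa [planePt] using this
  rcases (linear_factor_point hd h hc he hl hf x hx0 hx).2 with h1 | h1
  · rw [← hPx, ← hPx] at h1
    exact hP.2.1 (by exact_mod_cast (BF_intCast (R := ℚ) d a (P 0) (P 1)).trans h1)
  · simp only [← hPx] at h1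
    exact hP.2.2 h1

theorem planeForm_ne_zero (hd : 2 ≤ d) (h : FormNonzeroDisc d a) {c : Fin 4 → ℤ}
    {e : Fin 3 → Fin 4 → ℤ} (hc : ∀ i, ∑ j, c j * e i j = 0)
    (he : ∀ l : Fin 3 → ℚ, (∀ j, planePt e l j = 0) → l = 0)
    {P : Fin 4 → ℤ} (hP : GoodPt d a P) {x : Fin 3 → ℚ} (hPx : ∀ j, (P j : ℚ) = planePt e x j) :
    planeForm ℚ d a e ≠ 0 := by
  intro h0
  have hz : ∀ x : Fin 3 → ℚ, BF d a (planePt e x 0) (planePt e x 1) =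
      BF d a (planePt e x 2) (planePt e x 3) := by
    intro y
    have := eval_planeForm (d := d) (a := a) e y
    rw [h0, map_zero] at this
    exact (sub_eq_zero.1 this.symm)
  obtain ⟨l, hl, hlx⟩ : ∃ l : Fin 3 → ℚ, l ≠ 0 ∧ ∑ i, l i * x i = 0 := by
    by_cases hx : x 0 = 0
    · exact ⟨![1, 0, 0], fun h => by simpa using congrFun h 0, by simp [Fin.sum_univ_three, hx]⟩
    · exact ⟨![x 1, -x 0, 0], fun h => hx (by simpa using congrFun h 1), by
        simp [Fin.sum_univ_three]; ring⟩
  exact no_linear_factor_at_goodPt hd h hc he hl (fun y _ => hz y) hP hPx hlx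

theorem exists_linear_of_prime {e : Fin 3 → Fin 4 → ℤ} {g : MvPolynomial (Fin 3) ℚ} (hg0 : g ≠ 0)
    (hg : g.IsHomogeneous 1) (hdvd : g ∣ planeForm ℚ d a e) :
    ∃ l : Fin 3 → ℚ, l ≠ 0 ∧ (∀ x, MvPolynomial.eval x g = ∑ i, l i * x i) ∧
      ∀ x : Fin 3 → ℚ, ∑ i, l i * x i = 0 →
      BF d a (planePt e x 0) (planePt e x 1) = BF d a (planePt e x 2) (planePt e x 3) := by
  obtain ⟨l, hl⟩ := eval_of_isHomogeneous_one hg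
  refine ⟨l, ?_, hl, fun x hx => ?_⟩
  · rintro rfl
    exact hg0 (MvPolynomial.funext fun x => by simp [hl])
  · obtain ⟨q, hq⟩ := hdvd
    have h1 := eval_planeForm (d := d) (a := a) e x
    rw [hq, map_mul, hl, hx, zero_mul] at h1
    exact (sub_eq_zero.1 h1.symm)

theorem two_le_totalDegree_of_prime (hd : 2 ≤ d) (h : FormNonzeroDisc d a) {c : Fin 4 → ℤ}
    {e : Fin 3 → Fin 4 → ℤ} (hc : ∀ i, ∑ j, c j * e i j = 0)
    (he : ∀ l : Fin 3 → ℚ, (∀ j, planePt e l j = 0) → l = 0)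
    (hf0 : planeForm ℚ d a e ≠ 0) {g : MvPolynomial (Fin 3) ℚ} (hgp : Prime g)
    (hdvd : g ∣ planeForm ℚ d a e)
    {P : Fin 4 → ℤ} (hP : GoodPt d a P) {x : Fin 3 → ℚ} (hPx : ∀ j, (P j : ℚ) = planePt e x j)
    (hx : MvPolynomial.eval x g = 0) : 2 ≤ g.totalDegree := by
  have hgh := isHomogeneous_of_dvd (isHomogeneous_planeForm ℚ e) hf0 hdvd
  by_contra! hlt
  have h0 : g.totalDegree ≠ 0 := fun h0 => hgp.not_isUnit (by
    rw [MvPolynomial.totalDegree_eq_zero_iff_eq_C.1 h0]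
    refine IsUnit.map MvPolynomial.C (isUnit_iff_ne_zero.2 fun h1 => hgp.ne_zero ?_)
    rw [MvPolynomial.totalDegree_eq_zero_iff_eq_C.1 h0, h1, MvPolynomial.C_0])
  have h1 : g.totalDegree = 1 := by omega
  rw [h1] at hgh
  obtain ⟨l, hl, hlx, hf⟩ := exists_linear_of_prime hgp.ne_zero hgh hdvd
  exact no_linear_factor_at_goodPt hd h hc he hl hf hP hPx (by rw [← hlx, hx])

theorem three_le_totalDegree_of_prime (hd : d = 3 ∨ d = 4) (h : FormNonzeroDisc d a)
    {c : Fin 4 → ℤ} {e : Fin 3 → Fin 4 → ℤ} (hc : ∀ i, ∑ j, c j * e i j = 0)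
    (he : ∀ l : Fin 3 → ℚ, (∀ j, planePt e l j = 0) → l = 0)
    (hspan : ∀ P : Fin 4 → ℤ, ∑ j, c j * P j = 0 → ∃ l : Fin 3 → ℤ, ∀ j, P j = ∑ i, l i * e i j)
    (hns : ¬ SpecialHyper d a c)
    (hf0 : planeForm ℚ d a e ≠ 0) {g : MvPolynomial (Fin 3) ℚ} (hgp : Prime g)
    (hdvd : g ∣ planeForm ℚ d a e) : 3 ≤ g.totalDegree := by
  have hfh := isHomogeneous_planeForm (d := d) (a := a) ℚ e
  have hgh := isHomogeneous_of_dvd hfh hf0 hdvd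
  have no_one : ∀ q : MvPolynomial (Fin 3) ℚ, q ≠ 0 → q ∣ planeForm ℚ d a e →
      q.totalDegree ≠ 1 := by
    intro q hq0 hq h1
    have hqh := isHomogeneous_of_dvd hfh hf0 hq
    rw [h1] at hqh
    obtain ⟨l, hl, hlx, hf⟩ := exists_linear_of_prime hq0 hqh hq
    exact hns (special_of_linear_factor (by omega) h hc he hl hf)
  have h0 : g.totalDegree ≠ 0 := fun h0 => hgp.not_isUnit (by
    rw [MvPolynomial.totalDegree_eq_zero_iff_eq_C.1 h0]
    refine IsUnit.map MvPolynomial.C (isUnit_iff_ne_zero.2 fun h1 => hgp.ne_zero ?_)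
    rw [MvPolynomial.totalDegree_eq_zero_iff_eq_C.1 h0, h1, MvPolynomial.C_0])
  have h1 := no_one g hgp.ne_zero hdvd
  by_contra! hlt
  have h2 : g.totalDegree = 2 := by omega
  obtain ⟨q, hq⟩ := hdvd
  have hq0 : q ≠ 0 := fun h => hf0 (by rw [hq, h, mul_zero])
  have hqd : q ∣ planeForm ℚ d a e := ⟨g, by rw [hq, mul_comm]⟩
  have hqh := isHomogeneous_of_dvd hfh hf0 hqd
  have hdeg : d = 2 + q.totalDegree := by
    rw [← h2, ← MvPolynomial.totalDegree_mul_of_isDomain hgp.ne_zero hq0, ← hq,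
      hfh.totalDegree hf0]
  rcases hd with rfl | rfl
  · exact no_one q hq0 hqd (by omega)
  · have h3 : q.totalDegree = 2 := by omega
    rw [h3] at hqh
    rw [h2] at hgh
    obtain ⟨m, hm⟩ := eval_of_isHomogeneous_two hgh
    obtain ⟨n, hn⟩ := eval_of_isHomogeneous_two hqh
    refine hns (special_of_quadratic_factors a h hspan (m := m) (n := n) fun x => ?_)
    have h1 := eval_planeForm (d := 4) (a := a) e x
    rw [hq, map_mul, hm, hn] at h1
    exact h1.symm

theorem card_roots_derivative_lineBF (w0 w1 u0 u1 : ℚ) :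
    (Polynomial.derivative (lineBF d a w0 w1 u0 u1)).roots.toFinset.card ≤ d := by
  classical
  calc _ ≤ (Polynomial.derivative (lineBF d a w0 w1 u0 u1)).roots.card :=
        Multiset.toFinset_card_le _
    _ ≤ (Polynomial.derivative (lineBF d a w0 w1 u0 u1)).natDegree := Polynomial.card_roots' _
    _ ≤ (lineBF d a w0 w1 u0 u1).natDegree - 1 := Polynomial.natDegree_derivative_le _
    _ ≤ d := (Nat.sub_le _ _).trans (natDegree_lineBF_le _ _ _ _)

theorem mem_roots_derivative_lineBF (hd : 2 ≤ d) (h : FormNonzeroDisc d a) {k0 k1 x y : ℚ}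
    (hm : k0 * x + k1 * y ≠ 0) (hG : BFx d a x y * k1 - BFy d a x y * k0 = 0) :
    (k1 * x - k0 * y) / ((k0 * x + k1 * y) * (k0 ^ 2 + k1 ^ 2)) ∈
      (Polynomial.derivative (lineBF d a (k0 / (k0 ^ 2 + k1 ^ 2)) (k1 / (k0 ^ 2 + k1 ^ 2)) k1
        (-k0))).roots.toFinset := by
  have hk : k0 ^ 2 + k1 ^ 2 ≠ 0 := by
    intro h0
    have h1 : k0 = 0 := by nlinarith [sq_nonneg k0, sq_nonneg k1]
    have h2 : k1 = 0 := by nlinarith [sq_nonneg k0, sq_nonneg k1]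
    exact hm (by rw [h1, h2]; ring)
  have hdet : k0 / (k0 ^ 2 + k1 ^ 2) * (-k0) - k1 / (k0 ^ 2 + k1 ^ 2) * k1 ≠ 0 := by
    have : k0 / (k0 ^ 2 + k1 ^ 2) * (-k0) - k1 / (k0 ^ 2 + k1 ^ 2) * k1 = -1 := by
      field_simp; ring
    rw [this]; norm_num
  rw [Multiset.mem_toFinset, Polynomial.mem_roots (derivative_lineBF_ne_zero hd h hdet),
    Polynomial.IsRoot.def, derivative_lineBF_eval]
  set m := k0 * x + k1 * y with hmd
  have e1 : k0 / (k0 ^ 2 + k1 ^ 2) + k1 * ((k1 * x - k0 * y) / (m * (k0 ^ 2 + k1 ^ 2))) =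
      m⁻¹ * x := by
    field_simp
    rw [hmd]; ring
  have e2 : k1 / (k0 ^ 2 + k1 ^ 2) + -k0 * ((k1 * x - k0 * y) / (m * (k0 ^ 2 + k1 ^ 2))) =
      m⁻¹ * y := by
    field_simp
    rw [hmd]; ring
  rw [e1, e2, BFx_mul, BFy_mul]
  linear_combination (m⁻¹ ^ (d - 1)) * hG

theorem eq_of_line_parameter {k0 k1 x y x' y' : ℚ} (hm : k0 * x + k1 * y ≠ 0)
    (hm' : k0 * x' + k1 * y' ≠ 0)
    (he : (k1 * x - k0 * y) / ((k0 * x + k1 * y) * (k0 ^ 2 + k1 ^ 2)) =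
      (k1 * x' - k0 * y') / ((k0 * x' + k1 * y') * (k0 ^ 2 + k1 ^ 2))) :
    x * (k0 * x' + k1 * y') = x' * (k0 * x + k1 * y) ∧
      y * (k0 * x' + k1 * y') = y' * (k0 * x + k1 * y) := by
  have hk : k0 ^ 2 + k1 ^ 2 ≠ 0 := by
    intro h0
    have h1 : k0 = 0 := by nlinarith [sq_nonneg k0, sq_nonneg k1]
    have h2 : k1 = 0 := by nlinarith [sq_nonneg k0, sq_nonneg k1]
    exact hm (by rw [h1, h2]; ring)
  rw [div_eq_div_iff (mul_ne_zero hm hk) (mul_ne_zero hm' hk)] at he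
  have he2 : (k0 ^ 2 + k1 ^ 2) * ((k1 * x - k0 * y) * (k0 * x' + k1 * y') -
      (k1 * x' - k0 * y') * (k0 * x + k1 * y)) = 0 := by linear_combination he
  have he3 := (mul_eq_zero.1 he2).resolve_left hk
  have he4 : (k0 ^ 2 + k1 ^ 2) * (x * y' - x' * y) = 0 := by linear_combination he3
  have he5 := (mul_eq_zero.1 he4).resolve_left hk
  constructor
  · linear_combination k1 * he5
  · linear_combination -k0 * he5

theorem card_singular_le (hd : 2 ≤ d) (h : FormNonzeroDisc d a) {c : Fin 4 → ℤ}
    {e : Fin 3 → Fin 4 → ℤ}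
    (hspan : ∀ P : Fin 4 → ℤ, ∑ j, c j * P j = 0 → ∃ l : Fin 3 → ℤ, ∀ j, P j = ∑ i, l i * e i j)
    (T : Finset (Fin 4 → ℤ)) (hgood : ∀ P ∈ T, GoodPt d a P) (hcP : ∀ P ∈ T, ∑ j, c j * P j = 0)
    (hnp : ∀ P ∈ T, ∀ Q ∈ T, P ≠ Q → NonProp P Q)
    (hsing : ∀ P ∈ T, ∀ k, BFx d a (P 0) (P 1) * e k 0 + BFy d a (P 0) (P 1) * e k 1 -
      (BFx d a (P 2) (P 3) * e k 2 + BFy d a (P 2) (P 3) * e k 3) = 0) :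
    T.card ≤ d * d := by
  classical
  have hdir : ∀ P ∈ T, ∀ Q : Fin 4 → ℤ, ∑ j, c j * Q j = 0 →
      BFx d a (P 0) (P 1) * Q 0 + BFy d a (P 0) (P 1) * Q 1 -
      (BFx d a (P 2) (P 3) * Q 2 + BFy d a (P 2) (P 3) * Q 3) = 0 := by
    intro P hP Q hQ
    obtain ⟨l, hl⟩ := hspan Q hQ
    have := hsing P hP
    have h0 := this 0
    have h1 := this 1
    have h2 := this 2
    simp only [hl, Fin.sum_univ_three]
    linear_combination l 0 * h0 + l 1 * h1 + l 2 * h2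
  have hd0 : (d : ℤ) ≠ 0 := by exact_mod_cast (by omega : d ≠ 0)
  have hm1 : ∀ P ∈ T, (c 0 : ℚ) * P 0 + c 1 * P 1 ≠ 0 := by
    intro P hP h0
    have h0' : c 0 * P 0 + c 1 * P 1 = 0 := by exact_mod_cast h0
    have h1 := hdir P hP ![P 0, P 1, 0, 0] (by simpa [Fin.sum_univ_four] using h0')
    have h2 := BFx_euler (d := d) (a := a) (P 0) (P 1)
    have h3 : (d : ℤ) * BF d a (P 0) (P 1) = 0 := by
      simp at h1
      linarith
    exact (mul_ne_zero hd0 (hgood P hP).2.1) h3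
  have hsum : ∀ P ∈ T, (c 2 : ℚ) * P 2 + c 3 * P 3 = -(c 0 * P 0 + c 1 * P 1) := by
    intro P hP
    have h0 := hcP P hP
    rw [Fin.sum_univ_four] at h0
    have h1 : (c 0 : ℚ) * P 0 + c 1 * P 1 + c 2 * P 2 + c 3 * P 3 = 0 := by exact_mod_cast h0
    linarith
  have hm2 : ∀ P ∈ T, (c 2 : ℚ) * P 2 + c 3 * P 3 ≠ 0 := fun P hP => by
    rw [hsum P hP]; exact neg_ne_zero.2 (hm1 P hP)
  have hG1 : ∀ P ∈ T, BFx d a (P 0 : ℚ) (P 1) * c 1 - BFy d a (P 0 : ℚ) (P 1) * c 0 = 0 := by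
    intro P hP
    have h1 := hdir P hP ![c 1, -c 0, 0, 0] (by simp [Fin.sum_univ_four]; ring)
    have h2 : BFx d a (P 0) (P 1) * c 1 - BFy d a (P 0) (P 1) * c 0 = 0 := by
      simp at h1
      linarith
    have h3 := congrArg (Int.castRingHom ℚ) h2
    rw [map_sub, map_mul, map_mul, map_BFx, map_BFy] at h3
    simpa using h3
  have hG2 : ∀ P ∈ T, BFx d a (P 2 : ℚ) (P 3) * c 3 - BFy d a (P 2 : ℚ) (P 3) * c 2 = 0 := by
    intro P hP
    have h1 := hdir P hP ![0, 0, c 3, -c 2] (by simp [Fin.sum_univ_four]; ring)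
    have h2 : BFx d a (P 2) (P 3) * c 3 - BFy d a (P 2) (P 3) * c 2 = 0 := by
      simp at h1
      linarith
    have h3 := congrArg (Int.castRingHom ℚ) h2
    rw [map_sub, map_mul, map_mul, map_BFx, map_BFy] at h3
    simpa using h3
  let par : ℚ → ℚ → ℚ → ℚ → ℚ := fun k0 k1 x y =>
    (k1 * x - k0 * y) / ((k0 * x + k1 * y) * (k0 ^ 2 + k1 ^ 2))
  let R : ℚ → ℚ → Finset ℚ := fun k0 k1 =>
    (Polynomial.derivative (lineBF d a (k0 / (k0 ^ 2 + k1 ^ 2)) (k1 / (k0 ^ 2 + k1 ^ 2)) k1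
        (-k0))).roots.toFinset
  have hR : ∀ k0 k1 : ℚ, (R k0 k1).card ≤ d := fun k0 k1 => card_roots_derivative_lineBF _ _ _ _
  calc T.card ≤ (R (c 0) (c 1) ×ˢ R (c 2) (c 3)).card := by
        refine Finset.card_le_card_of_injOn
          (fun P => (par (c 0) (c 1) (P 0) (P 1), par (c 2) (c 3) (P 2) (P 3))) ?_ ?_
        · intro P hP
          exact Finset.mem_coe.2 (Finset.mem_product.2
            ⟨mem_roots_derivative_lineBF hd h (hm1 P hP) (hG1 P hP),
              mem_roots_derivative_lineBF hd h (hm2 P hP) (hG2 P hP)⟩)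
        · intro P hP Q hQ hPQ
          by_contra hne
          have hPQ' := Prod.mk.inj hPQ
          obtain ⟨h0, h1⟩ := eq_of_line_parameter (hm1 P hP) (hm1 Q hQ) hPQ'.1
          obtain ⟨h2, h3⟩ := eq_of_line_parameter (hm2 P hP) (hm2 Q hQ) hPQ'.2
          rw [hsum P hP, hsum Q hQ] at h2 h3
          obtain ⟨i, j, hij⟩ := hnp P hP Q hQ hne
          have hall : ∀ i, (P i : ℚ) * ((c 0 : ℚ) * Q 0 + c 1 * Q 1) =
              Q i * ((c 0 : ℚ) * P 0 + c 1 * P 1) := by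
            intro i
            fin_cases i
            · exact h0
            · exact h1
            · simp only [Fin.reduceFinMk]; linear_combination -h2
            · simp only [Fin.reduceFinMk]; linear_combination -h3
          have hi := hall i
          have hj := hall j
          apply hij
          have : ((P i : ℚ) * Q j - P j * Q i) * ((c 0 : ℚ) * Q 0 + c 1 * Q 1) = 0 := by
            linear_combination (Q j : ℚ) * hi - (Q i : ℚ) * hj
          have h5 := (mul_eq_zero.1 this).resolve_right (hm1 Q hQ)
          have h6 : (P i : ℚ) * Q j = P j * Q i := by linarith
          exact_mod_cast h6
    _ = (R (c 0) (c 1)).card * (R (c 2) (c 3)).card := Finset.card_product _ _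
    _ ≤ d * d := Nat.mul_le_mul (hR _ _) (hR _ _)

theorem card_le_totalDegree_prod (s : Multiset (MvPolynomial (Fin 3) ℚ)) (hs : ∀ g ∈ s, Prime g) :
    s.card ≤ s.prod.totalDegree := by
  induction s using Multiset.induction with
  | empty => simp
  | cons g s ih =>
    have hg := hs g (Multiset.mem_cons_self g s)
    have hs' : ∀ q ∈ s, Prime q := fun q hq => hs q (Multiset.mem_cons_of_mem hq)
    have h0 : s.prod ≠ 0 := Multiset.prod_ne_zero fun h0 => (hs' 0 h0).ne_zero rfl
    rw [Multiset.prod_cons, MvPolynomial.totalDegree_mul_of_isDomain hg.ne_zero h0,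
      Multiset.card_cons]
    have h1 : g.totalDegree ≠ 0 := fun h0 => hg.not_isUnit (by
      rw [MvPolynomial.totalDegree_eq_zero_iff_eq_C.1 h0]
      refine IsUnit.map MvPolynomial.C (isUnit_iff_ne_zero.2 fun h1 => hg.ne_zero ?_)
      rw [MvPolynomial.totalDegree_eq_zero_iff_eq_C.1 h0, h1, MvPolynomial.C_0])
    have := ih hs'
    omega

set_option maxHeartbeats 1000000 in
theorem card_plane_points_of_totalDegree (hd : 2 ≤ d) (h : FormNonzeroDisc d a) {K0 : ℝ}
    (hK0 : 1 ≤ K0) {δ0 : ℕ} (hδ0 : 2 ≤ δ0) {ε : ℝ} (hε : 0 < ε) :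
    ∃ K : ℝ, 0 < K ∧ ∀ B B1 : ℝ, 1 ≤ B → 1 ≤ B1 → B ≤ B1 ^ 2 → ∀ (c : Fin 4 → ℤ)
    (e : Fin 3 → Fin 4 → ℤ) (_ : ∀ i, ∑ j, c j * e i j = 0)
    (_ : ∀ l : Fin 3 → ℚ, (∀ j, planePt e l j = 0) → l = 0)
    (_ : ∀ P : Fin 4 → ℤ, ∑ j, c j * P j = 0 → ∃ l : Fin 3 → ℤ, ∀ j, P j = ∑ i, l i * e i j)
    (_ : ∀ i j, |(e i j : ℝ)| ≤ K0 * B) (T : Finset (Fin 4 → ℤ))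
    (_ : ∀ P ∈ T, GoodPt d a P) (_ : ∀ P ∈ T, ∑ j, c j * P j = 0)
    (_ : ∀ P ∈ T, ∀ j, |(P j : ℝ)| ≤ B)
    (_ : ∀ P ∈ T, ∀ l : Fin 3 → ℤ, (∀ j, P j = ∑ i, l i * e i j) → ∀ i, |(l i : ℝ)| ≤ B1)
    (_ : ∀ P ∈ T, ∀ p : ℕ, p.Prime → ∃ k, ¬ (p : ℤ) ∣ P k)
    (_ : ∀ P ∈ T, ∀ Q ∈ T, P ≠ Q → NonProp P Q)
    (_ : planeForm ℚ d a e ≠ 0 → ∀ g, Prime g → g ∣ planeForm ℚ d a e →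
      (∃ P ∈ T, ∃ l : Fin 3 → ℚ, (∀ j, (P j : ℚ) = planePt e l j) ∧ MvPolynomial.eval l g = 0) →
      δ0 ≤ g.totalDegree),
    (T.card : ℝ) ≤ K * B1 ^ (2 / (δ0 : ℝ) + ε) := by
  classical
  obtain ⟨K1, hK1, hb⟩ := exists_BFx_bound d a
  have hC : ∀ δ : ℕ, ∃ C : ℝ, 0 < C ∧ (0 < δ → ∀ (B : ℝ), 1 ≤ B → ∀ (f : MvPolynomial (Fin 3) ℤ)
      (_ : f.IsHomogeneous d)
    (g : MvPolynomial (Fin 3) ℚ) (_ : Prime g) (_ : g.IsHomogeneous δ) (T : Finset (Fin 3 → ℤ))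
    (_ : ∀ x ∈ T, ∀ k, |(x k : ℝ)| ≤ B)
    (_ : ∀ x ∈ T, ∀ p : ℕ, p.Prime → ∃ k, ¬ (p : ℤ) ∣ x k)
    (_ : ∀ x ∈ T, ∃ k, MvPolynomial.eval x (MvPolynomial.pderiv k f) ≠ 0 ∧
      |(MvPolynomial.eval x (MvPolynomial.pderiv k f) : ℝ)| ≤ B ^ (2 * d))
    (_ : ∀ x ∈ T, MvPolynomial.eval x f = 0)
    (_ : ∀ x ∈ T, MvPolynomial.eval (fun k => (x k : ℚ)) g = 0)
    (_ : ∀ x ∈ T, ∀ y ∈ T, x ≠ y → NonProp x y), (T.card : ℝ) ≤ C * B ^ (2 / (δ : ℝ) + ε)) := by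
    intro δ
    by_cases hδ : 0 < δ
    · obtain ⟨C, hC0, hC⟩ := card_points_le d δ (2 * d) hδ ε hε
      exact ⟨C, hC0, fun _ => hC⟩
    · exact ⟨1, one_pos, fun h => absurd h hδ⟩
  choose C hC0 hC using hC
  set K3 : ℝ := 4 * K1 * K0 with hK3
  have hK3' : 1 ≤ K3 := by nlinarith [mul_nonneg (sub_nonneg.2 hK1) (sub_nonneg.2 hK0)]
  set CS : ℝ := ∑ δ ∈ Finset.range (d + 1), C δ with hCS
  have hCle : ∀ δ ≤ d, C δ ≤ CS := fun δ hδ =>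
    Finset.single_le_sum (f := C) (fun i _ => (hC0 i).le) (Finset.mem_range.2 (by omega))
  have hCS0 : 0 < CS := (hC0 0).trans_le (hCle 0 (Nat.zero_le _))
  refine ⟨d * d + d * (CS * K3 ^ (1 + ε)), by positivity, ?_⟩
  intro B B1 hB hB1 hBB c e hc he hspan heK T hgood hcT hTB hTl hprim hnp hdeg
  have hB10 : (0 : ℝ) < B1 := by linarith
  have hex : ∀ P : Fin 4 → ℤ, ∃ l : Fin 3 → ℤ, P ∈ T → ∀ j, P j = ∑ i, l i * e i j := by
    intro P
    by_cases hP : P ∈ T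
    · obtain ⟨l, hl⟩ := hspan P (hcT P hP)
      exact ⟨l, fun _ => hl⟩
    · exact ⟨0, fun h => absurd h hP⟩
  choose L hL using hex
  have hLQ : ∀ P ∈ T, ∀ j, (P j : ℚ) = planePt e (fun i => (L P i : ℚ)) j := by
    intro P hP j
    rw [hL P hP j]; simp [planePt]
  rcases T.eq_empty_or_nonempty with rfl | ⟨P0, hP0⟩
  · simp; positivity
  have hf0 : planeForm ℚ d a e ≠ 0 := planeForm_ne_zero hd h hc he (hgood P0 hP0) (hLQ P0 hP0)
  have hfh := isHomogeneous_planeForm (d := d) (a := a) ℚ e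
  obtain ⟨s, hs, hsf⟩ := UniqueFactorizationMonoid.exists_prime_factors _ hf0
  have hsdvd : ∀ g ∈ s, g ∣ planeForm ℚ d a e := fun g hg =>
    (Multiset.dvd_prod hg).trans hsf.dvd
  have hscard : s.card ≤ d := by
    have h1 := card_le_totalDegree_prod s hs
    obtain ⟨q, hq⟩ := hsf.dvd
    have hp0 : s.prod ≠ 0 := fun h0 => hf0 (by rw [hq, h0, zero_mul])
    have hq0 : q ≠ 0 := fun h0 => hf0 (by rw [hq, h0, mul_zero])
    have h2 := MvPolynomial.totalDegree_mul_of_isDomain hp0 hq0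
    rw [← hq, hfh.totalDegree hf0] at h2
    omega
  let sing : (Fin 4 → ℤ) → Prop := fun P =>
    ∀ k, BFx d a (P 0) (P 1) * e k 0 + BFy d a (P 0) (P 1) * e k 1 -
      (BFx d a (P 2) (P 3) * e k 2 + BFy d a (P 2) (P 3) * e k 3) = 0
  have hsing : (T.filter sing).card ≤ d * d := by
    refine card_singular_le hd h hspan _ (fun P hP => hgood P (Finset.mem_filter.1 hP).1)
      (fun P hP => hcT P (Finset.mem_filter.1 hP).1) (fun P hP Q hQ =>
        hnp P (Finset.mem_filter.1 hP).1 Q (Finset.mem_filter.1 hQ).1) fun P hP =>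
        (Finset.mem_filter.1 hP).2
  let Tg : MvPolynomial (Fin 3) ℚ → Finset (Fin 4 → ℤ) := fun g =>
    T.filter fun P => ¬ sing P ∧ MvPolynomial.eval (fun i => (L P i : ℚ)) g = 0
  have hcover : T ⊆ T.filter sing ∪ s.toFinset.biUnion Tg := by
    intro P hP
    by_cases hPs : sing P
    · exact Finset.mem_union_left _ (Finset.mem_filter.2 ⟨hP, hPs⟩)
    · refine Finset.mem_union_right _ ?_
      have h1 := eval_planeForm (d := d) (a := a) e (fun i => (L P i : ℚ))
      have h2 : MvPolynomial.eval (fun i => (L P i : ℚ)) (planeForm ℚ d a e) = 0 := by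
        rw [h1]
        have h3 := hLQ P hP
        simp only [planePt] at h3
        rw [← h3, ← h3, ← h3, ← h3, ← BF_intCast, ← BF_intCast, (hgood P hP).1, sub_self]
      obtain ⟨q, hq⟩ := hsf.symm.dvd
      have h4 : MvPolynomial.eval (fun i => (L P i : ℚ)) s.prod = 0 := by
        rw [hq, map_mul, h2, zero_mul]
      rw [map_multiset_prod, Multiset.prod_eq_zero_iff, Multiset.mem_map] at h4
      obtain ⟨g, hg, hg0⟩ := h4
      exact Finset.mem_biUnion.2 ⟨g, Multiset.mem_toFinset.2 hg, Finset.mem_filter.2 ⟨hP, hPs, hg0⟩⟩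
  have hTg : ∀ g ∈ s.toFinset, ((Tg g).card : ℝ) ≤ CS * K3 ^ (1 + ε) * B1 ^ (2 / (δ0 : ℝ) + ε) := by
    intro g hg
    rw [Multiset.mem_toFinset] at hg
    rcases (Tg g).eq_empty_or_nonempty with h0 | ⟨P1, hP1⟩
    · rw [h0]; simp; positivity
    have hTm : ∀ P ∈ Tg g, P ∈ T := fun P hP => (Finset.mem_filter.1 hP).1
    have hδ : δ0 ≤ g.totalDegree := hdeg hf0 g (hs g hg) (hsdvd g hg)
      ⟨P1, hTm P1 hP1, _, hLQ P1 (hTm P1 hP1), (Finset.mem_filter.1 hP1).2.2⟩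
    have hδd : g.totalDegree ≤ d := by
      have := MvPolynomial.totalDegree_le_of_dvd_of_isDomain (hsdvd g hg) hf0
      rwa [hfh.totalDegree hf0] at this
    have hinj : Set.InjOn L (Tg g : Set (Fin 4 → ℤ)) := by
      intro P hP Q hQ hPQ
      funext j
      rw [hL P (hTm P hP) j, hL Q (hTm Q hQ) j, hPQ]
    rw [← Finset.card_image_of_injOn hinj]
    have hK3B : 1 ≤ K3 * B1 := by nlinarith
    have key := hC g.totalDegree (by omega) (K3 * B1) hK3B (planeForm ℤ d a e)
      (isHomogeneous_planeForm ℤ e) g (hs g hg) (isHomogeneous_of_dvd hfh hf0 (hsdvd g hg))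
      ((Tg g).image L) ?_ ?_ ?_ ?_ ?_ ?_
    · refine key.trans ?_
      rw [Real.mul_rpow (by linarith) hB10.le]
      have hδ2 : (2 : ℝ) ≤ δ0 := by exact_mod_cast hδ0
      have hδ3 : (δ0 : ℝ) ≤ g.totalDegree := by exact_mod_cast hδ
      have e1 : 2 / (g.totalDegree : ℝ) ≤ 2 / (δ0 : ℝ) := by gcongr
      have e2 : 2 / (δ0 : ℝ) ≤ 1 := by rw [div_le_one (by linarith)]; exact hδ2
      rw [← mul_assoc]
      refine mul_le_mul (mul_le_mul (hCle _ hδd) ?_ (by positivity) hCS0.le) ?_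
        (by positivity) (by positivity)
      · exact Real.rpow_le_rpow_of_exponent_le hK3' (by linarith)
      · exact Real.rpow_le_rpow_of_exponent_le hB1 (by linarith)
    · intro x hx k
      obtain ⟨P, hP, rfl⟩ := Finset.mem_image.1 hx
      exact (hTl P (hTm P hP) _ (hL P (hTm P hP)) k).trans (le_mul_of_one_le_left hB10.le hK3')
    · intro x hx p hp
      obtain ⟨P, hP, rfl⟩ := Finset.mem_image.1 hx
      by_contra! hall
      obtain ⟨k, hk⟩ := hprim P (hTm P hP) p hp
      apply hk
      rw [hL P (hTm P hP) k]
      exact Finset.dvd_sum fun i _ => (hall i).mul_right _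
    · intro x hx
      obtain ⟨P, hP, rfl⟩ := Finset.mem_image.1 hx
      have hns := (Finset.mem_filter.1 hP).2.1
      obtain ⟨k, hk⟩ := not_forall.1 hns
      have e1 := eval_pderiv_planeForm (d := d) (a := a) e (L P) P (hL P (hTm P hP)) k
      simp only [Int.cast_id] at e1
      rw [← e1] at hk
      refine ⟨k, hk, ?_⟩
      rw [e1]
      have hPB := hTB P (hTm P hP)
      obtain ⟨-, b1, b2⟩ := hb B hB (P 0) (P 1) (hPB 0) (hPB 1)
      obtain ⟨-, b3, b4⟩ := hb B hB (P 2) (P 3) (hPB 2) (hPB 3)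
      have e2 : ((BFx d a (P 0) (P 1) * e k 0 + BFy d a (P 0) (P 1) * e k 1 -
          (BFx d a (P 2) (P 3) * e k 2 + BFy d a (P 2) (P 3) * e k 3) : ℤ) : ℝ) =
          BFx d a (P 0 : ℝ) (P 1) * e k 0 + BFy d a (P 0 : ℝ) (P 1) * e k 1 -
          (BFx d a (P 2 : ℝ) (P 3) * e k 2 + BFy d a (P 2 : ℝ) (P 3) * e k 3) := by
        rw [Int.cast_sub, Int.cast_add, Int.cast_add, Int.cast_mul, Int.cast_mul, Int.cast_mul,
          Int.cast_mul, BFx_intCast, BFy_intCast, BFx_intCast, BFy_intCast]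
      rw [e2]
      have hd1 : B ^ (d - 1) * B = B ^ d := by
        rw [← pow_succ]; congr 1; omega
      have hm : ∀ u v : ℝ, |u| ≤ K1 * B ^ (d - 1) → |v| ≤ K0 * B → |u * v| ≤ K1 * K0 * B ^ d := by
        intro u v hu hv
        rw [abs_mul, ← hd1]
        calc |u| * |v| ≤ (K1 * B ^ (d - 1)) * (K0 * B) :=
              mul_le_mul hu hv (abs_nonneg _) (by positivity)
          _ = _ := by ring
      have m1 := hm _ _ b1 (heK k 0)
      have m2 := hm _ _ b2 (heK k 1)
      have m3 := hm _ _ b3 (heK k 2)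
      have m4 := hm _ _ b4 (heK k 3)
      have hBd : B ^ d ≤ B1 ^ (2 * d) := by
        rw [pow_mul]; exact pow_le_pow_left₀ (by linarith) hBB d
      have hK3d : K3 ≤ K3 ^ (2 * d) := le_self_pow₀ hK3' (by omega)
      calc _ ≤ K3 * B ^ d := by
            rw [hK3]
            rw [abs_le] at *
            constructor <;> linarith [m1.1, m1.2, m2.1, m2.2, m3.1, m3.2, m4.1, m4.2]
        _ ≤ K3 ^ (2 * d) * B1 ^ (2 * d) := by gcongr
        _ = _ := (mul_pow _ _ _).symm
    · intro x hx
      obtain ⟨P, hP, rfl⟩ := Finset.mem_image.1 hx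
      rw [eval_planeForm]
      have h3 := hL P (hTm P hP)
      simp only [Int.cast_id]
      rw [← h3, ← h3, ← h3, ← h3, (hgood P (hTm P hP)).1, sub_self]
    · intro x hx
      obtain ⟨P, hP, rfl⟩ := Finset.mem_image.1 hx
      exact (Finset.mem_filter.1 hP).2.2
    · intro x hx y hy hxy
      obtain ⟨P, hP, rfl⟩ := Finset.mem_image.1 hx
      obtain ⟨Q, hQ, rfl⟩ := Finset.mem_image.1 hy
      have hPQ : P ≠ Q := fun h0 => hxy (by rw [h0])
      obtain ⟨i, j, hij⟩ := hnp P (hTm P hP) Q (hTm Q hQ) hPQ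
      by_contra hcon
      have hcon' : ∀ r t, L P r * L Q t = L P t * L Q r := by
        intro r t
        by_contra h0
        exact hcon ⟨r, t, h0⟩
      apply hij
      rw [hL P (hTm P hP) i, hL P (hTm P hP) j, hL Q (hTm Q hQ) i, hL Q (hTm Q hQ) j]
      simp only [Fin.sum_univ_three]
      have h01 := hcon' 0 1
      have h02 := hcon' 0 2
      have h12 := hcon' 1 2
      linear_combination (e 0 i * e 1 j - e 1 i * e 0 j) * h01 +
        (e 0 i * e 2 j - e 2 i * e 0 j) * h02 + (e 1 i * e 2 j - e 2 i * e 1 j) * h12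
  have hp1 : 1 ≤ B1 ^ (2 / (δ0 : ℝ) + ε) := Real.one_le_rpow hB1 (by positivity)
  have hsum : ((s.toFinset.biUnion Tg).card : ℝ) ≤
      d * (CS * K3 ^ (1 + ε) * B1 ^ (2 / (δ0 : ℝ) + ε)) := by
    calc ((s.toFinset.biUnion Tg).card : ℝ) ≤ ∑ g ∈ s.toFinset, ((Tg g).card : ℝ) := by
          exact_mod_cast Finset.card_biUnion_le
      _ ≤ ∑ g ∈ s.toFinset, CS * K3 ^ (1 + ε) * B1 ^ (2 / (δ0 : ℝ) + ε) := Finset.sum_le_sum hTg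
      _ = s.toFinset.card * (CS * K3 ^ (1 + ε) * B1 ^ (2 / (δ0 : ℝ) + ε)) := by simp
      _ ≤ _ := by
        have : (s.toFinset.card : ℝ) ≤ d := by
          exact_mod_cast (Multiset.toFinset_card_le s).trans hscard
        gcongr
  calc (T.card : ℝ) ≤ ((T.filter sing ∪ s.toFinset.biUnion Tg).card : ℝ) := by
        exact_mod_cast Finset.card_le_card hcover
    _ ≤ ((T.filter sing).card : ℝ) + ((s.toFinset.biUnion Tg).card : ℝ) := by
        exact_mod_cast Finset.card_union_le _ _
    _ ≤ d * d + d * (CS * K3 ^ (1 + ε) * B1 ^ (2 / (δ0 : ℝ) + ε)) := by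
        refine add_le_add ?_ hsum
        exact_mod_cast hsing
    _ ≤ d * d * B1 ^ (2 / (δ0 : ℝ) + ε) + d * (CS * K3 ^ (1 + ε) * B1 ^ (2 / (δ0 : ℝ) + ε)) := by
        have := le_mul_of_one_le_right (by positivity : (0 : ℝ) ≤ d * d) hp1
        linarith
    _ = _ := by ring

theorem card_hyperplane_points (hd : d = 3 ∨ d = 4) (h : FormNonzeroDisc d a) {ε : ℝ}
    (hε : 0 < ε) : ∃ K : ℝ, 0 < K ∧ ∀ B : ℝ, 1 ≤ B → ∀ (c : Fin 4 → ℤ) (_ : c ≠ 0)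
    (_ : ∀ j, |(c j : ℝ)| ≤ 4 * B ^ (1 / 3 : ℝ)) (T : Finset (Fin 4 → ℤ))
    (_ : ∀ P ∈ T, GoodPt d a P) (_ : ∀ P ∈ T, ∑ j, c j * P j = 0)
    (_ : ∀ P ∈ T, ∀ j, |(P j : ℝ)| ≤ B)
    (_ : ∀ P ∈ T, ∀ p : ℕ, p.Prime → ∃ k, ¬ (p : ℤ) ∣ P k)
    (_ : ∀ P ∈ T, ∀ Q ∈ T, P ≠ Q → NonProp P Q),
    (T.card : ℝ) ≤ K * B ^ (1 + ε) ∧ (¬ SpecialHyper d a c → ∀ E : ℝ, 1 ≤ E → E ^ 2 ≤ B →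
      (∀ e : Fin 4 → ℤ, e ≠ 0 → ∑ j, c j * e j = 0 → ∃ j, E ≤ |(e j : ℝ)|) →
      (T.card : ℝ) ≤ K * (B / E) ^ (2 / 3 + ε)) := by
  obtain ⟨Kh, hKh, hbasis⟩ := exists_reduced_basis_hyperplane
  obtain ⟨K2, hK2, h2⟩ := card_plane_points_of_totalDegree (d := d) (a := a) (by omega) h
    (K0 := 4 * Kh) (by linarith) (δ0 := 2) le_rfl hε
  obtain ⟨K3, hK3, h3⟩ := card_plane_points_of_totalDegree (d := d) (a := a) (by omega) h
    (K0 := 4 * Kh) (by linarith) (δ0 := 3) (by norm_num) hε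
  refine ⟨K2 * Kh ^ (1 + ε) + K3 * Kh ^ (2 / 3 + ε), by positivity, ?_⟩
  intro B hB c hc0 hcC T hgood hcT hTB hprim hnp
  obtain ⟨e, hce, hlinR, heC, hspan'⟩ := hbasis c hc0
  have hspan : ∀ P : Fin 4 → ℤ, ∑ j, c j * P j = 0 →
      ∃ l : Fin 3 → ℤ, ∀ j, P j = ∑ i, l i * e i j := fun P hP => by
    obtain ⟨l, hl, -⟩ := hspan' P hP
    exact ⟨l, hl⟩
  have he : ∀ l : Fin 3 → ℚ, (∀ j, planePt e l j = 0) → l = 0 := by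
    intro l hl
    have := hlinR (fun i => (l i : ℝ)) fun j => by
      have := hl j
      rw [planePt] at this
      exact_mod_cast this
    funext i
    have := congrFun this i
    simpa using this
  have heK : ∀ i j, |(e i j : ℝ)| ≤ 4 * Kh * B := by
    intro i j
    refine (heC _ hcC i j).trans ?_
    have : B ^ (1 / 3 : ℝ) ≤ B := by
      conv_rhs => rw [← Real.rpow_one B]
      exact Real.rpow_le_rpow_of_exponent_le hB (by norm_num)
    nlinarith
  have he0 : ∀ i, e i ≠ 0 := by
    intro i h0
    have := congrFun (he (Pi.single i 1) fun j => by simp [planePt, Pi.single_apply, h0]) i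
    simp at this
  have hTl : ∀ E : ℝ, 1 ≤ E →
      (∀ e : Fin 4 → ℤ, e ≠ 0 → ∑ j, c j * e j = 0 → ∃ j, E ≤ |(e j : ℝ)|) →
      ∀ P ∈ T, ∀ l : Fin 3 → ℤ, (∀ j, P j = ∑ i, l i * e i j) → ∀ i, |(l i : ℝ)| ≤ Kh * (B / E) := by
    intro E hE hlong P hP l hl i
    obtain ⟨l', hl', hlb⟩ := hspan' P (hcT P hP)
    have hll : l' = l := by
      have := hlinR (fun i => (l' i : ℝ) - l i) fun j => by
        have e1 := (hl j).symm.trans (hl' j)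
        have e2 : (∑ i, (l i : ℝ) * e i j) = ∑ i, (l' i : ℝ) * e i j := by exact_mod_cast e1
        simp only [sub_mul, Finset.sum_sub_distrib, e2, sub_self]
      funext i
      have := congrFun this i
      simp only [Pi.zero_apply, sub_eq_zero] at this
      exact_mod_cast this
    obtain ⟨j, hj⟩ := hlong (e i) (he0 i) (hce i)
    have := hlb B (hTB P hP) i j
    rw [hll] at this
    rw [← mul_div_assoc, le_div_iff₀ (by linarith)]
    calc |(l i : ℝ)| * E ≤ |(l i : ℝ)| * |(e i j : ℝ)| := by gcongr
      _ ≤ _ := this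
  have hlong1 : ∀ e : Fin 4 → ℤ, e ≠ 0 → ∑ j, c j * e j = 0 → ∃ j, (1 : ℝ) ≤ |(e j : ℝ)| := by
    intro e he _
    obtain ⟨j, hj⟩ := Function.ne_iff.1 he
    exact ⟨j, by exact_mod_cast Int.one_le_abs hj⟩
  constructor
  · have hB1 : B ≤ Kh * B := le_mul_of_one_le_left (by linarith) hKh
    have key := h2 B (Kh * B) hB (by linarith) (by nlinarith) c e hce he hspan heK T hgood hcT hTB
      (fun P hP l hl i => by simpa using hTl 1 le_rfl hlong1 P hP l hl i) hprim hnp ?_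
    · refine key.trans ?_
      norm_num
      rw [Real.mul_rpow (by linarith) (by linarith)]
      have : 0 ≤ K3 * Kh ^ (2 / 3 + ε) * B ^ (1 + ε) := by positivity
      linarith
    · rintro hf0 g hg hdvd ⟨P, hP, l, hl, hlg⟩
      exact two_le_totalDegree_of_prime (by omega) h hce he hf0 hg hdvd (hgood P hP) hl hlg
  · intro hns E hE hEB hlong
    have hE0 : 0 < E := by linarith
    have hBE : E ≤ B / E := by rw [le_div_iff₀ hE0]; nlinarith
    have hBE2 : B ≤ (B / E) ^ 2 := by
      have : B = (B / E) * E := by field_simp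
      nlinarith
    have hB1 : B / E ≤ Kh * (B / E) := le_mul_of_one_le_left (by linarith) hKh
    have key := h3 B (Kh * (B / E)) hB (by linarith)
      (hBE2.trans (pow_le_pow_left₀ (by linarith) hB1 2)) c e hce he hspan heK T hgood hcT hTB
      (hTl E hE hlong) hprim hnp ?_
    · refine key.trans ?_
      push_cast
      rw [Real.mul_rpow (by linarith) (by linarith)]
      have hBE0 : 0 ≤ B / E := by linarith
      have : 0 ≤ K2 * Kh ^ (1 + ε) * (B / E) ^ (2 / 3 + ε) := by positivity
      linarith
    · rintro hf0 g hg hdvd -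
      exact three_le_totalDegree_of_prime hd h hce he hspan hns hf0 hg hdvd

end PlaneCount

section PropB

variable {d : ℕ} {a : Fin (d + 1) → ℤ}

/-- Integer vectors with entries of absolute value at most `N`. -/
noncomputable def intBox (n N : ℕ) : Finset (Fin n → ℤ) := Fintype.piFinset fun _ => Finset.Icc (-(N : ℤ)) N

theorem card_intBox (n N : ℕ) : (intBox n N).card = (2 * N + 1) ^ n := by
  rw [intBox, Fintype.card_piFinset]
  simp only [Int.card_Icc, Finset.prod_const, Finset.card_univ, Fintype.card_fin]
  congr 1; omega

theorem mem_intBox {n N : ℕ} {c : Fin n → ℤ} : c ∈ intBox n N ↔ ∀ j, |c j| ≤ N := by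
  simp [intBox, abs_le]

theorem mem_intBox_floor {n : ℕ} {C : ℝ} {c : Fin n → ℤ} (hC : 0 ≤ C) :
    c ∈ intBox n ⌊C⌋₊ ↔ ∀ j, |(c j : ℝ)| ≤ C := by
  rw [mem_intBox]
  refine forall_congr' fun j => ?_
  have : |(c j : ℝ)| = ((c j).natAbs : ℝ) := by rw [Nat.cast_natAbs, Int.cast_abs]
  rw [this, ← Nat.le_floor_iff hC, Int.abs_eq_natAbs]
  norm_cast

theorem card_intBox_floor_le (n : ℕ) {C : ℝ} (hC : 1 ≤ C) :
    ((intBox n ⌊C⌋₊).card : ℝ) ≤ (3 * C) ^ n := by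
  rw [card_intBox]
  push_cast
  have := Nat.floor_le (by linarith : 0 ≤ C)
  gcongr
  linarith

theorem card_hyperplane_box (n N : ℕ) {e : Fin (n + 1) → ℤ} (he : e ≠ 0) :
    ((intBox (n + 1) N).filter fun c => ∑ j, c j * e j = 0).card ≤ (2 * N + 1) ^ n := by
  obtain ⟨j, hj⟩ := Function.ne_iff.1 he
  rw [← card_intBox]
  refine Finset.card_le_card_of_injOn (fun c i => c (j.succAbove i)) ?_ ?_
  · intro c hc
    have := mem_intBox.1 (Finset.mem_filter.1 hc).1
    exact Finset.mem_coe.2 (mem_intBox.2 fun i => this _)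
  · intro c hc c' hc' h
    have h1 := (Finset.mem_filter.1 hc).2
    have h2 := (Finset.mem_filter.1 hc').2
    rw [Fin.sum_univ_succAbove _ j] at h1 h2
    have h3 : ∀ i, c (j.succAbove i) = c' (j.succAbove i) := fun i => congrFun h i
    simp only [h3] at h1
    have h4 : c j = c' j := mul_right_cancel₀ hj (by linarith)
    funext i
    rcases Fin.eq_self_or_eq_succAbove j i with rfl | ⟨k, rfl⟩
    · exact h4
    · exact h3 k

theorem exists_special_directions (hd : 3 ≤ d) (h : FormNonzeroDisc d a) :
    ∃ D : Finset (ℚ × ℚ), (∀ p ∈ D, p ≠ 0) ∧ ∀ k0 k1 : ℤ, IsSpecDir d a k0 k1 →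
      ∃ p ∈ D, (k0 : ℚ) * p.1 + k1 * p.2 = 0 := by
  classical
  have hfin := autForm_finite hd h
  obtain ⟨γ, L, hγ, hL, hF⟩ := h
  have hone : ∀ S : Set (ℚ × ℚ), (∀ u ∈ S, ∀ v ∈ S, u.1 * v.2 = u.2 * v.1) →
      ∃ p : ℚ × ℚ, p ≠ 0 ∧ ∀ u ∈ S, u.1 * p.2 = u.2 * p.1 := by
    intro S hS
    by_cases hne : ∃ p ∈ S, p ≠ 0
    · obtain ⟨p, hp, hp0⟩ := hne
      exact ⟨p, hp0, fun u hu => hS u hu p hp⟩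
    · push Not at hne
      exact ⟨(1, 0), by simp, fun u hu => by simp [hne u hu]⟩
  have hL' : ∀ j, ∃ p : ℚ × ℚ, p ≠ 0 ∧
      ∀ u ∈ {u : ℚ × ℚ | (L j).1 * (u.1 : ℂ) + (L j).2 * (u.2 : ℂ) = 0},
      u.1 * p.2 = u.2 * p.1 := by
    intro j
    refine hone _ fun u hu v hv => ?_
    simp only [Set.mem_ofPred_eq] at hu hv
    have hLj : (L j).1 ≠ 0 ∨ (L j).2 ≠ 0 := by
      by_contra! h0
      obtain ⟨i, hi⟩ : ∃ i : Fin d, i ≠ j := by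
        have : Nontrivial (Fin d) := Fin.nontrivial_iff_two_le.2 (by omega)
        exact exists_ne j
      exact hL i j hi (by rw [h0.1, h0.2]; ring)
    have : ((u.1 : ℂ) * v.2 - u.2 * v.1) = 0 := by
      rcases hLj with h1 | h1
      · apply (mul_eq_zero.1 (?_ : (L j).1 * ((u.1 : ℂ) * v.2 - u.2 * v.1) = 0)).resolve_left h1
        linear_combination (v.2 : ℂ) * hu - (u.2 : ℂ) * hv
      · apply (mul_eq_zero.1 (?_ : (L j).2 * ((u.1 : ℂ) * v.2 - u.2 * v.1) = 0)).resolve_left h1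
        linear_combination (u.1 : ℂ) * hv - (v.1 : ℂ) * hu
    have h2 := sub_eq_zero.1 this
    exact_mod_cast h2
  have hM' : ∀ M : Matrix (Fin 2) (Fin 2) ℚ, ∃ p : ℚ × ℚ, p ≠ 0 ∧
      ∀ u ∈ {u : ℚ × ℚ | M ≠ -1 ∧ M 0 0 * u.1 + M 0 1 * u.2 = -u.1 ∧
        M 1 0 * u.1 + M 1 1 * u.2 = -u.2}, u.1 * p.2 = u.2 * p.1 := by
    intro M
    refine hone _ ?_
    rintro u ⟨hM, hu0, hu1⟩ v ⟨-, hv0, hv1⟩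
    by_contra hne
    apply hM
    have hD : u.1 * v.2 - u.2 * v.1 ≠ 0 := sub_ne_zero.2 hne
    have e00 : (M 0 0 + 1) * (u.1 * v.2 - u.2 * v.1) = 0 := by
      linear_combination v.2 * hu0 - u.2 * hv0
    have e01 : M 0 1 * (u.1 * v.2 - u.2 * v.1) = 0 := by
      linear_combination u.1 * hv0 - v.1 * hu0
    have e10 : M 1 0 * (u.1 * v.2 - u.2 * v.1) = 0 := by
      linear_combination v.2 * hu1 - u.2 * hv1
    have e11 : (M 1 1 + 1) * (u.1 * v.2 - u.2 * v.1) = 0 := by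
      linear_combination u.1 * hv1 - v.1 * hu1
    have f00 := (mul_eq_zero.1 e00).resolve_right hD
    have f01 := (mul_eq_zero.1 e01).resolve_right hD
    have f10 := (mul_eq_zero.1 e10).resolve_right hD
    have f11 := (mul_eq_zero.1 e11).resolve_right hD
    ext i j
    fin_cases i <;> fin_cases j <;> simp <;> linarith
  choose p hp0 hp using hL'
  choose q hq0 hq using hM'
  refine ⟨Finset.univ.image p ∪ hfin.toFinset.image q, ?_, ?_⟩
  · intro r hr
    rcases Finset.mem_union.1 hr with hr | hr
    · obtain ⟨j, -, rfl⟩ := Finset.mem_image.1 hr; exact hp0 j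
    · obtain ⟨j, -, rfl⟩ := Finset.mem_image.1 hr; exact hq0 j
  · rintro k0 k1 ⟨u0, u1, hu, hku, hor⟩
    have fin : ∀ r : ℚ × ℚ, u0 * r.2 = u1 * r.1 → (k0 : ℚ) * r.1 + k1 * r.2 = 0 := by
      intro r hr
      rcases hu with hu | hu
      · apply (mul_eq_zero.1 (?_ : u0 * ((k0 : ℚ) * r.1 + k1 * r.2) = 0)).resolve_left hu
        linear_combination r.1 * hku + (k1 : ℚ) * hr
      · apply (mul_eq_zero.1 (?_ : u1 * ((k0 : ℚ) * r.1 + k1 * r.2) = 0)).resolve_left hu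
        linear_combination r.2 * hku - (k0 : ℚ) * hr
    rcases hor with h0 | ⟨M, hM, hM1, hMu0, hMu1⟩
    · have h1 : BF d a (u0 : ℂ) (u1 : ℂ) = 0 := by
        rw [← BF_ratCast_complex, h0, Rat.cast_zero]
      have h2 := hF u0 u1
      rw [show (∑ i : Fin (d + 1), (a i : ℂ) * (u0 : ℂ) ^ (i : ℕ) * (u1 : ℂ) ^ (d - (i : ℕ))) = 0
        from h1] at h2
      obtain ⟨j, -, hj⟩ := Finset.prod_eq_zero_iff.1 ((mul_eq_zero.1 h2.symm).resolve_left hγ)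
      exact ⟨p j, Finset.mem_union_left _ (Finset.mem_image_of_mem _ (Finset.mem_univ _)),
        fin _ (hp j (u0, u1) hj)⟩
    · exact ⟨q M, Finset.mem_union_right _ (Finset.mem_image_of_mem _ (hfin.mem_toFinset.2 hM)),
        fin _ (hq M (u0, u1) ⟨hM1, hMu0, hMu1⟩)⟩

open Classical in
theorem card_special_le (hd : 3 ≤ d) (h : FormNonzeroDisc d a) : ∃ K : ℝ, 0 < K ∧
    ∀ N : ℕ, (((intBox 4 N).filter fun c => SpecialHyper d a c).card : ℝ) ≤ K * (2 * N + 1) ^ 2 := by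
  have hfin := autForm_finite hd h
  obtain ⟨D, hD0, hD⟩ := exists_special_directions hd h
  refine ⟨2 + D.card * D.card + hfin.toFinset.card, by positivity, fun N => ?_⟩
  let I : Finset ℤ := Finset.Icc (-(N : ℤ)) N
  have hI : I.card = 2 * N + 1 := by simp only [I, Int.card_Icc]; omega
  have hmem : ∀ c ∈ intBox 4 N, ∀ j, c j ∈ I := fun c hc j => by
    have := mem_intBox.1 hc j
    exact Finset.mem_Icc.2 (abs_le.1 this)
  let A1 := (intBox 4 N).filter fun c => c 0 = 0 ∧ c 1 = 0
  let A2 := (intBox 4 N).filter fun c => c 2 = 0 ∧ c 3 = 0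
  let A3 : (ℚ × ℚ) × (ℚ × ℚ) → Finset (Fin 4 → ℤ) := fun r => (intBox 4 N).filter fun c =>
    (c 0 : ℚ) * r.1.1 + c 1 * r.1.2 = 0 ∧ (c 2 : ℚ) * r.2.1 + c 3 * r.2.2 = 0
  let A4 : Matrix (Fin 2) (Fin 2) ℚ → Finset (Fin 4 → ℤ) := fun M => (intBox 4 N).filter fun c =>
    (c 0 : ℚ) = -(M 0 0 * c 2 + M 1 0 * c 3) ∧ (c 1 : ℚ) = -(M 0 1 * c 2 + M 1 1 * c 3)
  have card2 : ∀ (A : Finset (Fin 4 → ℤ)) (i j : Fin 4), A ⊆ intBox 4 N →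
      (∀ c ∈ A, ∀ c' ∈ A, c i = c' i → c j = c' j → c = c') → A.card ≤ (2 * N + 1) ^ 2 := by
    intro A i j hA hinj
    calc A.card ≤ (I ×ˢ I).card := by
          refine Finset.card_le_card_of_injOn (fun c => (c i, c j)) ?_ ?_
          · intro c hc
            exact Finset.mem_coe.2 (Finset.mem_product.2 ⟨hmem c (hA hc) i, hmem c (hA hc) j⟩)
          · intro c hc c' hc' hcc
            exact hinj c hc c' hc' (Prod.mk.inj hcc).1 (Prod.mk.inj hcc).2
      _ = (2 * N + 1) ^ 2 := by rw [Finset.card_product, hI]; ring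
  have hA1 : A1.card ≤ (2 * N + 1) ^ 2 := by
    refine card2 A1 2 3 (Finset.filter_subset _ _) fun c hc c' hc' h2 h3 => ?_
    have e := (Finset.mem_filter.1 hc).2
    have e' := (Finset.mem_filter.1 hc').2
    funext i
    fin_cases i
    · exact e.1.trans e'.1.symm
    · exact e.2.trans e'.2.symm
    · exact h2
    · exact h3
  have hA2 : A2.card ≤ (2 * N + 1) ^ 2 := by
    refine card2 A2 0 1 (Finset.filter_subset _ _) fun c hc c' hc' h2 h3 => ?_
    have e := (Finset.mem_filter.1 hc).2
    have e' := (Finset.mem_filter.1 hc').2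
    funext i
    fin_cases i
    · exact h2
    · exact h3
    · exact e.1.trans e'.1.symm
    · exact e.2.trans e'.2.symm
  have hA4 : ∀ M, (A4 M).card ≤ (2 * N + 1) ^ 2 := by
    intro M
    refine card2 (A4 M) 2 3 (Finset.filter_subset _ _) fun c hc c' hc' h2 h3 => ?_
    have e := (Finset.mem_filter.1 hc).2
    have e' := (Finset.mem_filter.1 hc').2
    rw [← h2, ← h3] at e'
    funext i
    fin_cases i
    · exact_mod_cast e.1.trans e'.1.symm
    · exact_mod_cast e.2.trans e'.2.symm
    · exact h2
    · exact h3
  have hline : ∀ r : ℚ × ℚ, r ≠ 0 → (∀ x y x' y' : ℤ, (x : ℚ) * r.1 + y * r.2 = 0 →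
      (x' : ℚ) * r.1 + y' * r.2 = 0 → (if r.1 = 0 then x else y) = (if r.1 = 0 then x' else y') →
      x = x' ∧ y = y') := by
    intro r hr x y x' y' h1 h2 h3
    by_cases hr1 : r.1 = 0
    · have hr2 : r.2 ≠ 0 := fun h0 => hr (Prod.ext hr1 h0)
      simp only [hr1, if_true, mul_zero, zero_add, mul_eq_zero, hr2, or_false] at h1 h2 h3
      have e1 : y = 0 := by exact_mod_cast h1
      have e2 : y' = 0 := by exact_mod_cast h2
      exact ⟨h3, by rw [e1, e2]⟩
    · simp only [hr1, if_false] at h3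
      subst h3
      have : (x : ℚ) = x' := mul_right_cancel₀ hr1 (by linarith)
      exact ⟨by exact_mod_cast this, rfl⟩
  have hA3 : ∀ r ∈ D ×ˢ D, (A3 r).card ≤ (2 * N + 1) ^ 2 := by
    rintro r hr
    obtain ⟨hr1, hr2⟩ := Finset.mem_product.1 hr
    refine card2 (A3 r) (if r.1.1 = 0 then 0 else 1) (if r.2.1 = 0 then 2 else 3)
      (Finset.filter_subset _ _) fun c hc c' hc' h2 h3 => ?_
    have e := (Finset.mem_filter.1 hc).2
    have e' := (Finset.mem_filter.1 hc').2
    obtain ⟨f0, f1⟩ := hline r.1 (hD0 _ hr1) _ _ _ _ e.1 e'.1 (by split_ifs at h2 ⊢ <;> exact h2)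
    obtain ⟨f2, f3⟩ := hline r.2 (hD0 _ hr2) _ _ _ _ e.2 e'.2 (by split_ifs at h3 ⊢ <;> exact h3)
    funext i
    fin_cases i <;> assumption
  have hcover : ((intBox 4 N).filter fun c => SpecialHyper d a c) ⊆
      A1 ∪ A2 ∪ (D ×ˢ D).biUnion A3 ∪ hfin.toFinset.biUnion A4 := by
    intro c hc
    obtain ⟨hcB, hs⟩ := Finset.mem_filter.1 hc
    simp only [Finset.mem_union, Finset.mem_biUnion]
    rcases hs with h1 | h1 | ⟨h1, h2⟩ | ⟨M, hM, h1⟩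
    · exact Or.inl (Or.inl (Or.inl (Finset.mem_filter.2 ⟨hcB, h1⟩)))
    · exact Or.inl (Or.inl (Or.inr (Finset.mem_filter.2 ⟨hcB, h1⟩)))
    · obtain ⟨p, hp, hp'⟩ := hD _ _ h1
      obtain ⟨q, hq, hq'⟩ := hD _ _ h2
      exact Or.inl (Or.inr ⟨(p, q), Finset.mem_product.2 ⟨hp, hq⟩,
        Finset.mem_filter.2 ⟨hcB, hp', hq'⟩⟩)
    · exact Or.inr ⟨M, hfin.mem_toFinset.2 hM, Finset.mem_filter.2 ⟨hcB, h1⟩⟩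
  have hnat : ((intBox 4 N).filter fun c => SpecialHyper d a c).card ≤
      (2 + D.card * D.card + hfin.toFinset.card) * (2 * N + 1) ^ 2 := by
    calc _ ≤ _ := Finset.card_le_card hcover
      _ ≤ (A1.card + A2.card + ((D ×ˢ D).biUnion A3).card) + (hfin.toFinset.biUnion A4).card := by
        refine (Finset.card_union_le _ _).trans (Nat.add_le_add_right ?_ _)
        refine (Finset.card_union_le _ _).trans (Nat.add_le_add_right ?_ _)
        exact Finset.card_union_le _ _
      _ ≤ ((2 * N + 1) ^ 2 + (2 * N + 1) ^ 2 + (D ×ˢ D).card * (2 * N + 1) ^ 2) +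
          hfin.toFinset.card * (2 * N + 1) ^ 2 := by
        gcongr
        · exact Finset.card_biUnion_le_card_mul _ _ _ hA3
        · exact Finset.card_biUnion_le_card_mul _ _ _ fun M _ => hA4 M
      _ = _ := by rw [Finset.card_product]; ring
  exact_mod_cast hnat

/-- No prime divides all the coordinates. -/
def Primitive4 (P : Fin 4 → ℤ) : Prop := ∀ p : ℕ, p.Prime → ∃ k, ¬ (p : ℤ) ∣ P k

theorem exists_bezout_of_primitive {P : Fin 4 → ℤ} (hP : Primitive4 P) :
    ∃ u : Fin 4 → ℤ, ∑ i, u i * P i = 1 := by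
  set J : Ideal ℤ := Ideal.span (Set.range P) with hJ
  obtain ⟨g, hg⟩ := (IsPrincipalIdealRing.principal J).principal
  have hdvd : ∀ k, g ∣ P k := fun k => by
    have : P k ∈ J := Ideal.subset_span (Set.mem_range_self k)
    rw [hg] at this
    exact Ideal.mem_span_singleton.1 this
  have hunit : g.natAbs = 1 := by
    by_contra hne
    obtain ⟨p, hp, hpg⟩ := Nat.exists_prime_and_dvd hne
    obtain ⟨k, hk⟩ := hP p hp
    exact hk ((Int.natCast_dvd.2 hpg).trans (hdvd k))
  have h1 : (1 : ℤ) ∈ J := by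
    rw [hg]
    exact Ideal.mem_span_singleton.2 (Int.isUnit_iff_natAbs_eq.2 hunit).dvd
  rw [hJ, Ideal.mem_span_range_iff_exists_fun] at h1
  exact h1

theorem eq_or_eq_neg_of_not_nonProp {P Q : Fin 4 → ℤ} (hP : Primitive4 P) (hQ : Primitive4 Q)
    (h : ¬ NonProp P Q) : Q = P ∨ Q = -P := by
  have h' : ∀ i j, P i * Q j = P j * Q i := by
    intro i j
    by_contra h0
    exact h ⟨i, j, h0⟩
  obtain ⟨u, hu⟩ := exists_bezout_of_primitive hP
  have hQm : ∀ j, Q j = (∑ i, u i * Q i) * P j := by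
    intro j
    calc Q j = (∑ i, u i * P i) * Q j := by rw [hu, one_mul]
      _ = ∑ i, u i * (P i * Q j) := by
        rw [Finset.sum_mul]; exact Finset.sum_congr rfl fun i _ => by ring
      _ = ∑ i, u i * (P j * Q i) := by simp only [h' _ j]
      _ = _ := by rw [Finset.sum_mul]; exact Finset.sum_congr rfl fun i _ => by ring
  have hm : (∑ i, u i * Q i).natAbs = 1 := by
    by_contra hne
    obtain ⟨p, hp, hpg⟩ := Nat.exists_prime_and_dvd hne
    obtain ⟨k, hk⟩ := hQ p hp
    apply hk
    rw [hQm k]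
    exact (Int.natCast_dvd.2 hpg).mul_right _
  rcases Int.natAbs_eq_iff.1 hm with h1 | h1
  · left
    funext j
    rw [hQm j, h1]; simp
  · right
    funext j
    rw [hQm j, h1]; simp

set_option maxHeartbeats 1000000 in
theorem card_nonProp_points_le (hd : d = 3 ∨ d = 4) (h : FormNonzeroDisc d a) :
    ∃ K : ℝ, 0 < K ∧ ∀ B : ℝ, 1 ≤ B → ∀ (T : Finset (Fin 4 → ℤ))
    (_ : ∀ P ∈ T, GoodPt d a P) (_ : ∀ P ∈ T, ∀ j, |(P j : ℝ)| ≤ B)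
    (_ : ∀ P ∈ T, Primitive4 P) (_ : ∀ P ∈ T, ∀ Q ∈ T, P ≠ Q → NonProp P Q),
    (T.card : ℝ) ≤ K * B ^ (79 / 40 : ℝ) := by
  classical
  obtain ⟨K, hK, hmain⟩ := card_hyperplane_points hd h (ε := 1 / 100) (by norm_num)
  obtain ⟨Ks, hKs, hspec⟩ := card_special_le (d := d) (a := a) (by omega) h
  refine ⟨Ks * 12 ^ 2 * K + (3 ^ 4 * 12 ^ 3) * K + 12 ^ 4 * K, by positivity, ?_⟩
  intro B hB T hgood hTB hprim hnp
  have hB0 : 0 < B := by linarith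
  set C : ℝ := 4 * B ^ (1 / 3 : ℝ) with hC
  set E : ℝ := B ^ (1 / 15 : ℝ) with hE
  have hb3 : 1 ≤ B ^ (1 / 3 : ℝ) := Real.one_le_rpow hB (by norm_num)
  have hC1 : 1 ≤ C := by linarith
  have hE1 : 1 ≤ E := Real.one_le_rpow hB (by norm_num)
  have hEB : E ^ 2 ≤ B := by
    rw [hE, ← Real.rpow_natCast, ← Real.rpow_mul hB0.le]
    conv_rhs => rw [← Real.rpow_one B]
    exact Real.rpow_le_rpow_of_exponent_le hB (by norm_num)
  have hcex : ∀ P : Fin 4 → ℤ, ∃ c : Fin 4 → ℤ, P ∈ T → c ≠ 0 ∧ ∑ j, c j * P j = 0 ∧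
      ∀ j, |(c j : ℝ)| ≤ C := by
    intro P
    by_cases hP : P ∈ T
    · obtain ⟨c, hc⟩ := exists_small_hyperplane hB P (hTB P hP)
      exact ⟨c, fun _ => hc⟩
    · exact ⟨0, fun h => absurd h hP⟩
  choose c hc using hcex
  let Tc : (Fin 4 → ℤ) → Finset (Fin 4 → ℤ) := fun k => T.filter fun P => c P = k
  let N := ⌊C⌋₊
  have hC0 : 0 ≤ C := by linarith
  have hTc : ∀ k ∈ intBox 4 N, ((Tc k).card : ℝ) ≤ K * B ^ (1 + 1 / 100 : ℝ) ∧
      (¬ SpecialHyper d a k → ∀ E : ℝ, 1 ≤ E → E ^ 2 ≤ B →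
      (∀ e : Fin 4 → ℤ, e ≠ 0 → ∑ j, k j * e j = 0 → ∃ j, E ≤ |(e j : ℝ)|) →
      ((Tc k).card : ℝ) ≤ K * (B / E) ^ (2 / 3 + 1 / 100 : ℝ)) := by
    intro k hk
    rcases (Tc k).eq_empty_or_nonempty with h0 | ⟨P0, hP0⟩
    · rw [h0]
      simp only [Finset.card_empty, Nat.cast_zero]
      refine ⟨by positivity, fun _ E hE _ _ => ?_⟩
      have : 0 ≤ B / E := div_nonneg hB0.le (by linarith)
      positivity
    have hmem : ∀ P ∈ Tc k, P ∈ T ∧ c P = k := fun P hP => Finset.mem_filter.1 hP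
    have hk0 : k ≠ 0 := by
      have := (hc P0 (hmem P0 hP0).1).1
      rwa [(hmem P0 hP0).2] at this
    refine hmain B hB k hk0 ((mem_intBox_floor hC0).1 hk) (Tc k) (fun P hP => hgood P (hmem P hP).1)
      ?_ (fun P hP => hTB P (hmem P hP).1) (fun P hP => hprim P (hmem P hP).1)
      (fun P hP Q hQ => hnp P (hmem P hP).1 Q (hmem Q hQ).1)
    intro P hP
    have := (hc P (hmem P hP).1).2.1
    rwa [(hmem P hP).2] at this
  let S1 := (intBox 4 N).filter fun k => SpecialHyper d a k
  let e0 : Finset (Fin 4 → ℤ) := (intBox 4 ⌊E⌋₊).filter fun e => e ≠ 0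
  let S2 := e0.biUnion fun e =>
    ((intBox 4 N).filter fun k => ∑ j, k j * e j = 0).filter fun k => ¬ SpecialHyper d a k
  let S3 := (intBox 4 N).filter fun k => ¬ SpecialHyper d a k ∧
    ∀ e : Fin 4 → ℤ, e ≠ 0 → ∑ j, k j * e j = 0 → ∃ j, E ≤ |(e j : ℝ)|
  have hcover : T ⊆ S1.biUnion Tc ∪ S2.biUnion Tc ∪ S3.biUnion Tc := by
    intro P hP
    have hPc : P ∈ Tc (c P) := Finset.mem_filter.2 ⟨hP, rfl⟩
    have hcB : c P ∈ intBox 4 N := (mem_intBox_floor hC0).2 (hc P hP).2.2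
    simp only [Finset.mem_union, Finset.mem_biUnion]
    by_cases hs : SpecialHyper d a (c P)
    · exact Or.inl (Or.inl ⟨c P, Finset.mem_filter.2 ⟨hcB, hs⟩, hPc⟩)
    by_cases hl : ∀ e : Fin 4 → ℤ, e ≠ 0 → ∑ j, c P j * e j = 0 → ∃ j, E ≤ |(e j : ℝ)|
    · exact Or.inr ⟨c P, Finset.mem_filter.2 ⟨hcB, hs, hl⟩, hPc⟩
    · push Not at hl
      obtain ⟨e, he0, hce, hes⟩ := hl
      refine Or.inl (Or.inr ⟨c P, Finset.mem_biUnion.2 ⟨e, Finset.mem_filter.2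
        ⟨(mem_intBox_floor (by linarith)).2 fun j => (hes j).le, he0⟩, Finset.mem_filter.2
        ⟨Finset.mem_filter.2 ⟨hcB, hce⟩, hs⟩⟩, hPc⟩)
  have hNC : (2 * N + 1 : ℝ) ≤ 12 * B ^ (1 / 3 : ℝ) := by
    have := Nat.floor_le hC0
    have : (N : ℝ) ≤ C := this
    linarith
  have hbi : ∀ (S : Finset (Fin 4 → ℤ)) (A b : ℝ), (S.card : ℝ) ≤ A → 0 ≤ b →
      (∀ k ∈ S, ((Tc k).card : ℝ) ≤ b) → ((S.biUnion Tc).card : ℝ) ≤ A * b := by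
    intro S A b hSA hb hk
    calc ((S.biUnion Tc).card : ℝ) ≤ ∑ k ∈ S, ((Tc k).card : ℝ) := by
          exact_mod_cast Finset.card_biUnion_le
      _ ≤ ∑ k ∈ S, b := Finset.sum_le_sum hk
      _ = S.card * b := by simp
      _ ≤ A * b := by gcongr
  have hlong1 : ∀ k : Fin 4 → ℤ, ∀ e : Fin 4 → ℤ, e ≠ 0 → ∑ j, k j * e j = 0 →
      ∃ j, (1 : ℝ) ≤ |(e j : ℝ)| := by
    intro k e he _
    obtain ⟨j, hj⟩ := Function.ne_iff.1 he
    exact ⟨j, by exact_mod_cast Int.one_le_abs hj⟩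
  have hS1 : (S1.card : ℝ) ≤ Ks * (12 * B ^ (1 / 3 : ℝ)) ^ 2 := by
    refine (hspec N).trans ?_
    gcongr
  have hS2 : (S2.card : ℝ) ≤ (3 * E) ^ 4 * (12 * B ^ (1 / 3 : ℝ)) ^ 3 := by
    calc (S2.card : ℝ) ≤ ∑ e ∈ e0, ((((intBox 4 N).filter fun k => ∑ j, k j * e j = 0).filter
          fun k => ¬ SpecialHyper d a k).card : ℝ) := by
          exact_mod_cast Finset.card_biUnion_le
      _ ≤ ∑ e ∈ e0, (12 * B ^ (1 / 3 : ℝ)) ^ 3 := by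
        refine Finset.sum_le_sum fun e he => ?_
        calc _ ≤ ((((intBox 4 N).filter fun k => ∑ j, k j * e j = 0)).card : ℝ) := by
              exact_mod_cast Finset.card_filter_le _ _
          _ ≤ (2 * N + 1 : ℝ) ^ 3 := by
              exact_mod_cast card_hyperplane_box 3 N (Finset.mem_filter.1 he).2
          _ ≤ _ := by gcongr
      _ = e0.card * (12 * B ^ (1 / 3 : ℝ)) ^ 3 := by simp
      _ ≤ _ := by
        gcongr
        refine le_trans ?_ (card_intBox_floor_le 4 hE1)
        exact_mod_cast Finset.card_filter_le _ _
  have hS3 : (S3.card : ℝ) ≤ (12 * B ^ (1 / 3 : ℝ)) ^ 4 := by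
    calc (S3.card : ℝ) ≤ (intBox 4 N).card := by exact_mod_cast Finset.card_filter_le _ _
      _ ≤ (3 * C) ^ 4 := card_intBox_floor_le 4 hC1
      _ = _ := by rw [hC]; ring
  have b1 := hbi S1 _ (K * B ^ (1 + 1 / 100 : ℝ)) hS1 (by positivity) fun k hk =>
    (hTc k (Finset.mem_filter.1 hk).1).1
  have b2 := hbi S2 _ (K * B ^ (2 / 3 + 1 / 100 : ℝ)) hS2 (by positivity) fun k hk => by
    obtain ⟨e, he, hk⟩ := Finset.mem_biUnion.1 hk
    obtain ⟨hk1, hk2⟩ := Finset.mem_filter.1 hk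
    have := (hTc k (Finset.mem_filter.1 hk1).1).2 hk2 1 le_rfl (by linarith) (hlong1 k)
    rwa [div_one] at this
  have b3 := hbi S3 _ (K * (B / E) ^ (2 / 3 + 1 / 100 : ℝ)) hS3 (by positivity) fun k hk => by
    obtain ⟨hk1, hk2, hk3⟩ := Finset.mem_filter.1 hk
    exact (hTc k hk1).2 hk2 E hE1 hEB hk3
  have hpow : ∀ n : ℕ, (B ^ (1 / 3 : ℝ)) ^ n = B ^ ((n : ℝ) / 3) := by
    intro n
    rw [← Real.rpow_natCast, ← Real.rpow_mul hB0.le]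
    congr 1; ring
  have hE4 : E ^ 4 = B ^ (4 / 15 : ℝ) := by
    rw [hE, ← Real.rpow_natCast, ← Real.rpow_mul hB0.le]
    norm_num
  have hBE : B / E = B ^ (14 / 15 : ℝ) := by
    rw [hE]
    nth_rewrite 1 [← Real.rpow_one B]
    rw [← Real.rpow_sub hB0]; norm_num
  have hle : ∀ t : ℝ, t ≤ 79 / 40 → B ^ t ≤ B ^ (79 / 40 : ℝ) := fun t ht =>
    Real.rpow_le_rpow_of_exponent_le hB ht
  have c1 : Ks * (12 * B ^ (1 / 3 : ℝ)) ^ 2 * (K * B ^ (1 + 1 / 100 : ℝ)) ≤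
      Ks * 12 ^ 2 * K * B ^ (79 / 40 : ℝ) := by
    rw [mul_pow, hpow]
    calc _ = Ks * 12 ^ 2 * K * (B ^ (((2 : ℕ) : ℝ) / 3) * B ^ (1 + 1 / 100 : ℝ)) := by ring
      _ ≤ _ := by
        rw [← Real.rpow_add hB0]
        gcongr
        norm_num
  have c2 : (3 * E) ^ 4 * (12 * B ^ (1 / 3 : ℝ)) ^ 3 * (K * B ^ (2 / 3 + 1 / 100 : ℝ)) ≤
      (3 ^ 4 * 12 ^ 3) * K * B ^ (79 / 40 : ℝ) := by
    rw [mul_pow, mul_pow, hpow, hE4]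
    calc _ = (3 ^ 4 * 12 ^ 3) * K * (B ^ (4 / 15 : ℝ) * B ^ (((3 : ℕ) : ℝ) / 3) *
          B ^ (2 / 3 + 1 / 100 : ℝ)) := by ring
      _ ≤ _ := by
        rw [← Real.rpow_add hB0, ← Real.rpow_add hB0]
        gcongr
        norm_num
  have c3 : (12 * B ^ (1 / 3 : ℝ)) ^ 4 * (K * (B / E) ^ (2 / 3 + 1 / 100 : ℝ)) ≤
      12 ^ 4 * K * B ^ (79 / 40 : ℝ) := by
    rw [mul_pow, hpow, hBE, ← Real.rpow_mul hB0.le]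
    calc _ = 12 ^ 4 * K * (B ^ (((4 : ℕ) : ℝ) / 3) * B ^ (14 / 15 * (2 / 3 + 1 / 100) : ℝ)) := by ring
      _ ≤ _ := by
        rw [← Real.rpow_add hB0]
        gcongr
        norm_num
  have hT : (T.card : ℝ) ≤ ((S1.biUnion Tc).card : ℝ) + ((S2.biUnion Tc).card : ℝ) +
      ((S3.biUnion Tc).card : ℝ) := by
    have h1 := Finset.card_le_card hcover
    have h2 := Finset.card_union_le (S1.biUnion Tc ∪ S2.biUnion Tc) (S3.biUnion Tc)
    have h3 := Finset.card_union_le (S1.biUnion Tc) (S2.biUnion Tc)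
    exact_mod_cast (by omega : T.card ≤ (S1.biUnion Tc).card + (S2.biUnion Tc).card +
      (S3.biUnion Tc).card)
  linarith

theorem GoodPt.coord_ne_zero (hd : d ≠ 0) {P : Fin 4 → ℤ} (h : GoodPt d a P) :
    P 0 ≠ 0 ∨ P 1 ≠ 0 := by
  by_contra! h0
  exact h.2.1 (by rw [h0.1, h0.2]; exact BF_zero hd)

theorem card_primitive_points_le (hd : d = 3 ∨ d = 4) (h : FormNonzeroDisc d a) :
    ∃ K : ℝ, 0 < K ∧ ∀ B : ℝ, 1 ≤ B → ∀ (T : Finset (Fin 4 → ℤ))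
    (_ : ∀ P ∈ T, GoodPt d a P) (_ : ∀ P ∈ T, ∀ j, |(P j : ℝ)| ≤ B)
    (_ : ∀ P ∈ T, Primitive4 P), (T.card : ℝ) ≤ K * B ^ (79 / 40 : ℝ) := by
  classical
  obtain ⟨K, hK, hmain⟩ := card_nonProp_points_le hd h
  refine ⟨2 * K, by positivity, fun B hB T hg hTB hp => ?_⟩
  let q : (Fin 4 → ℤ) → Prop := fun P => 0 < P 0 ∨ P 0 = 0 ∧ 0 < P 1
  have hq : ∀ P Q : Fin 4 → ℤ, P ∈ T → Q ∈ T → (q P ↔ q Q) → P ≠ Q → NonProp P Q := by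
    intro P Q hP hQ hPQ hne
    by_contra hn
    rcases eq_or_eq_neg_of_not_nonProp (hp P hP) (hp Q hQ) hn with h1 | h1
    · exact hne h1.symm
    · have := (hg P hP).coord_ne_zero (by omega)
      subst h1
      simp only [q, Pi.neg_apply] at hPQ
      omega
  have e1 := hmain B hB (T.filter q) (fun P hP => hg P (Finset.mem_filter.1 hP).1)
    (fun P hP => hTB P (Finset.mem_filter.1 hP).1) (fun P hP => hp P (Finset.mem_filter.1 hP).1)
    fun P hP Q hQ => by
      obtain ⟨hP1, hP2⟩ := Finset.mem_filter.1 hP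
      obtain ⟨hQ1, hQ2⟩ := Finset.mem_filter.1 hQ
      exact hq P Q hP1 hQ1 (by tauto)
  have e2 := hmain B hB (T.filter fun P => ¬ q P) (fun P hP => hg P (Finset.mem_filter.1 hP).1)
    (fun P hP => hTB P (Finset.mem_filter.1 hP).1) (fun P hP => hp P (Finset.mem_filter.1 hP).1)
    fun P hP Q hQ => by
      obtain ⟨hP1, hP2⟩ := Finset.mem_filter.1 hP
      obtain ⟨hQ1, hQ2⟩ := Finset.mem_filter.1 hQ
      exact hq P Q hP1 hQ1 (by tauto)
  have e3 := Finset.card_filter_add_card_filter_not (s := T) q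
  have e4 : (T.card : ℝ) = (T.filter q).card + (T.filter fun P => ¬ q P).card := by
    exact_mod_cast e3.symm
  rw [e4]; linarith

theorem GoodPt.of_mul (hd : d ≠ 0) {P Q : Fin 4 → ℤ} {g : ℤ} (hPQ : ∀ j, P j = g * Q j)
    (h : GoodPt d a P) : GoodPt d a Q := by
  obtain ⟨h1, h2, h3⟩ := h
  simp only [hPQ, BF_mul] at h1 h2
  have hg : g ≠ 0 := fun h0 => h2 (by rw [h0, zero_pow hd, zero_mul])
  have hgd : g ^ d ≠ 0 := pow_ne_zero _ hg
  refine ⟨mul_left_cancel₀ hgd h1, right_ne_zero_of_mul h2, ?_⟩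
  rintro ⟨M, hM, e1, e2⟩
  refine h3 ⟨M, hM, ?_, ?_⟩
  · simp only [hPQ]; push_cast; rw [e1]; ring
  · simp only [hPQ]; push_cast; rw [e2]; ring

theorem exists_primitive_part {P : Fin 4 → ℤ} (hP : P ≠ 0) :
    ∃ (g : ℕ) (Q : Fin 4 → ℤ), 0 < g ∧ (∀ j, P j = g * Q j) ∧ Primitive4 Q := by
  obtain ⟨Q, hQ, hg⟩ := Finset.extract_gcd P (s := Finset.univ) Finset.univ_nonempty
  set G := Finset.univ.gcd P with hG
  have hG0 : G ≠ 0 := by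
    intro h0
    apply hP
    funext j
    rw [hQ j (Finset.mem_univ j), h0, zero_mul]; rfl
  have hGn : G = (G.natAbs : ℤ) := by
    rw [Int.natCast_natAbs, Int.abs_eq_normalize, hG, Finset.normalize_gcd]
  refine ⟨G.natAbs, Q, Int.natAbs_pos.2 hG0, fun j => ?_, ?_⟩
  · rw [← hGn]; exact hQ j (Finset.mem_univ j)
  · intro p hp
    by_contra! h0
    have : (p : ℤ) ∣ 1 := by rw [← hg]; exact Finset.dvd_gcd fun j _ => h0 j
    have h1 := Int.isUnit_iff.1 (isUnit_of_dvd_one this)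
    have := hp.two_le
    omega

/-- The number of coincidences `F(v₁) = F(v₂) ≠ 0` not explained by an automorphism of `F`. -/
theorem card_goodPt_le (hd : d = 3 ∨ d = 4) (h : FormNonzeroDisc d a) :
    ∃ K : ℝ, 0 < K ∧ ∀ B : ℝ, 1 ≤ B → ∀ (T : Finset (Fin 4 → ℤ))
    (_ : ∀ P ∈ T, GoodPt d a P) (_ : ∀ P ∈ T, ∀ j, |(P j : ℝ)| ≤ B),
    (T.card : ℝ) ≤ K * B ^ (79 / 40 : ℝ) := by
  classical
  obtain ⟨K, hK, hmain⟩ := card_primitive_points_le hd h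
  have hsum : Summable fun n : ℕ => ((n : ℝ) ^ (79 / 40 : ℝ))⁻¹ :=
    Real.summable_nat_rpow_inv.2 (by norm_num)
  refine ⟨K * (∑' n : ℕ, ((n : ℝ) ^ (79 / 40 : ℝ))⁻¹) + 1, ?_, fun B hB T hg hTB => ?_⟩
  · have : 0 ≤ ∑' n : ℕ, ((n : ℝ) ^ (79 / 40 : ℝ))⁻¹ := tsum_nonneg fun n => by positivity
    positivity
  have hB0 : 0 < B := by linarith
  have hex : ∀ P : Fin 4 → ℤ, ∃ (g : ℕ) (Q : Fin 4 → ℤ), P ∈ T →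
      0 < g ∧ (∀ j, P j = g * Q j) ∧ Primitive4 Q := by
    intro P
    by_cases hP : P ∈ T
    · obtain ⟨g, Q, h1⟩ := exists_primitive_part ((hg P hP).ne_zero (by omega))
      exact ⟨g, Q, fun _ => h1⟩
    · exact ⟨0, 0, fun h => absurd h hP⟩
  choose g Q hgQ using hex
  have hcover : T ⊆ (Finset.Icc 1 ⌊B⌋₊).biUnion fun n => T.filter fun P => g P = n := by
    intro P hP
    obtain ⟨h1, h2, h3⟩ := hgQ P hP
    refine Finset.mem_biUnion.2 ⟨g P, Finset.mem_Icc.2 ⟨h1, Nat.le_floor ?_⟩,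
      Finset.mem_filter.2 ⟨hP, rfl⟩⟩
    obtain ⟨j, hj⟩ := Function.ne_iff.1 ((hg P hP).ne_zero (by omega))
    have h4 := hTB P hP j
    rw [h2 j] at h4 hj
    push_cast at h4
    rw [abs_mul, Nat.abs_cast] at h4
    have h5 : (1 : ℝ) ≤ |(Q P j : ℝ)| := by
      exact_mod_cast Int.one_le_abs (right_ne_zero_of_mul hj)
    nlinarith [Nat.cast_nonneg (α := ℝ) (g P)]
  have hfib : ∀ n ∈ Finset.Icc 1 ⌊B⌋₊, ((T.filter fun P => g P = n).card : ℝ) ≤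
      K * B ^ (79 / 40 : ℝ) * ((n : ℝ) ^ (79 / 40 : ℝ))⁻¹ := by
    intro n hn
    obtain ⟨hn1, hn2⟩ := Finset.mem_Icc.1 hn
    have hn0 : (0 : ℝ) < n := by exact_mod_cast hn1
    have hnB : (n : ℝ) ≤ B := (Nat.le_floor_iff hB0.le).1 hn2
    have hinj : Set.InjOn Q ((T.filter fun P => g P = n : Finset _) : Set (Fin 4 → ℤ)) := by
      intro P hP P' hP' he
      obtain ⟨hP1, hP2⟩ := Finset.mem_filter.1 (Finset.mem_coe.1 hP)
      obtain ⟨hP1', hP2'⟩ := Finset.mem_filter.1 (Finset.mem_coe.1 hP')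
      funext j
      rw [(hgQ P hP1).2.1 j, (hgQ P' hP1').2.1 j, hP2, hP2', he]
    rw [← Finset.card_image_of_injOn hinj, mul_assoc, ← div_eq_mul_inv,
      ← Real.div_rpow hB0.le hn0.le]
    refine hmain (B / n) ((one_le_div hn0).2 hnB) _ ?_ ?_ ?_ <;> intro R hR <;>
      obtain ⟨P, hP, rfl⟩ := Finset.mem_image.1 hR <;>
      obtain ⟨hP1, hP2⟩ := Finset.mem_filter.1 hP <;> obtain ⟨h1, h2, h3⟩ := hgQ P hP1
    · exact GoodPt.of_mul (by omega) h2 (hg P hP1)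
    · intro j
      have h4 := hTB P hP1 j
      rw [h2 j, hP2] at h4
      push_cast at h4
      rw [abs_mul, Nat.abs_cast] at h4
      rw [le_div_iff₀ hn0]; linarith
    · exact h3
  calc (T.card : ℝ) ≤ ∑ n ∈ Finset.Icc 1 ⌊B⌋₊, ((T.filter fun P => g P = n).card : ℝ) := by
        exact_mod_cast (Finset.card_le_card hcover).trans Finset.card_biUnion_le
    _ ≤ ∑ n ∈ Finset.Icc 1 ⌊B⌋₊, K * B ^ (79 / 40 : ℝ) * ((n : ℝ) ^ (79 / 40 : ℝ))⁻¹ :=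
        Finset.sum_le_sum hfib
    _ = K * B ^ (79 / 40 : ℝ) * ∑ n ∈ Finset.Icc 1 ⌊B⌋₊, ((n : ℝ) ^ (79 / 40 : ℝ))⁻¹ := by
        rw [Finset.mul_sum]
    _ ≤ K * B ^ (79 / 40 : ℝ) * ∑' n : ℕ, ((n : ℝ) ^ (79 / 40 : ℝ))⁻¹ := by
        gcongr
        exact hsum.sum_le_tsum _ fun n _ => by positivity
    _ ≤ _ := by
        have : 0 ≤ B ^ (79 / 40 : ℝ) := by positivity
        linarith

end PropB

section Thue

open Polynomial

theorem norm_eval_hasseDeriv_le {P : ℂ[X]} {N : ℕ} {H R : ℝ} (hN : P.natDegree ≤ N)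
    (hR : 1 ≤ R) (hP : ∀ i, ‖P.coeff i‖ ≤ H) (j : ℕ) {z : ℂ} (hz : ‖z‖ ≤ R) :
    ‖(hasseDeriv j P).eval z‖ ≤ (N + 1) * (2 ^ N * H * R ^ N) := by
  have hH : 0 ≤ H := (norm_nonneg _).trans (hP 0)
  rw [hasseDeriv_apply, Polynomial.sum_over_range' _ (by simp) (N + 1) (by omega), eval_finsetSum]
  refine (norm_sum_le _ _).trans ?_
  calc _ ≤ ∑ i ∈ Finset.range (N + 1), (2 ^ N * H * R ^ N) := by
        refine Finset.sum_le_sum fun i hi => ?_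
        have hi' : i ≤ N := by simpa [Nat.lt_succ_iff] using hi
        rw [eval_monomial, norm_mul, norm_mul, norm_pow, Complex.norm_natCast]
        have h1 : ((i.choose j : ℕ) : ℝ) ≤ 2 ^ N := by
          have := (Nat.choose_le_two_pow i j).trans (Nat.pow_le_pow_right (by norm_num) hi')
          exact_mod_cast this
        have h2 : ‖z‖ ^ (i - j) ≤ R ^ N :=
          (pow_le_pow_left₀ (norm_nonneg _) hz _).trans (pow_le_pow_right₀ hR (by omega))
        gcongr
        exact hP i
    _ = _ := by simp

/-- Taylor estimate for Hasse derivatives at a point near a zero of high order. -/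
theorem norm_eval_hasseDeriv_le_of_vanish {P : ℂ[X]} {N m j : ℕ} {H R : ℝ} (hN : P.natDegree ≤ N)
    (hR : 1 ≤ R) (hP : ∀ i, ‖P.coeff i‖ ≤ H) {θ z : ℂ} (hθ : ‖θ‖ ≤ R)
    (hv : ∀ k < m, (hasseDeriv k P).eval θ = 0) (hz : ‖z - θ‖ ≤ 1) :
    ‖(hasseDeriv j P).eval z‖ ≤
      (N + 1) * (2 ^ N * ((N + 1) * (2 ^ N * H * R ^ N)) * ‖z - θ‖ ^ (m - j)) := by
  have hH : 0 ≤ H := (norm_nonneg _).trans (hP 0)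
  have e : (hasseDeriv j P).eval z = (hasseDeriv j (taylor θ P)).eval (z - θ) := by
    rw [← taylor_coeff, ← taylor_coeff, taylor_taylor]
    congr 2
    ring_nf
  rw [e, hasseDeriv_apply, Polynomial.sum_over_range' _ (by simp) (N + 1)
    (by rw [natDegree_taylor]; omega), eval_finsetSum]
  refine (norm_sum_le _ _).trans ?_
  calc _ ≤ ∑ i ∈ Finset.range (N + 1),
        (2 ^ N * ((N + 1) * (2 ^ N * H * R ^ N)) * ‖z - θ‖ ^ (m - j)) := by
        refine Finset.sum_le_sum fun i hi => ?_
        have hi' : i ≤ N := by simpa [Nat.lt_succ_iff] using hi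
        rw [eval_monomial, norm_mul, norm_mul, norm_pow, Complex.norm_natCast, taylor_coeff]
        by_cases him : i < m
        · rw [hv i him]; simp; positivity
        have h1 : ((i.choose j : ℕ) : ℝ) ≤ 2 ^ N := by
          have := (Nat.choose_le_two_pow i j).trans (Nat.pow_le_pow_right (by norm_num) hi')
          exact_mod_cast this
        have h2 : ‖z - θ‖ ^ (i - j) ≤ ‖z - θ‖ ^ (m - j) :=
          pow_le_pow_of_le_one (norm_nonneg _) hz (by omega)
        have h3 := norm_eval_hasseDeriv_le hN hR hP i hθ
        gcongr
    _ = _ := by simp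

theorem X_sub_C_pow_dvd_of_hasseDeriv {K : Type*} [Field K] {P : K[X]} {m : ℕ} {x : K}
    (hv : ∀ k < m, (hasseDeriv k P).eval x = 0) : (X - C x) ^ m ∣ P := by
  rw [X_sub_C_pow_dvd_iff, X_pow_dvd_iff]
  intro k hk
  have := hv k hk
  rwa [← taylor_coeff, taylor_apply] at this

/-- Powers of an algebraic integer in terms of the first few powers. -/
theorem exists_pow_coeff {f : ℤ[X]} (hf : f.Monic) {θ : ℂ} (hθ : aeval θ f = 0)
    (hn : f ≠ 1) :
    ∃ K : ℝ, 1 ≤ K ∧ ∃ c : ℕ → Fin f.natDegree → ℤ,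
      (∀ i, θ ^ i = ∑ l, (c i l : ℂ) * θ ^ (l : ℕ)) ∧ ∀ i l, |(c i l : ℝ)| ≤ K ^ i := by
  set n := f.natDegree with hndef
  have hM : ∀ j : ℕ, ∃ r : Fin n → ℤ, θ ^ j = ∑ l, (r l : ℂ) * θ ^ (l : ℕ) := by
    intro j
    refine ⟨fun l => (X ^ j %ₘ f).coeff l, ?_⟩
    have h1 : aeval θ (X ^ j %ₘ f) = aeval θ (X ^ j : ℤ[X]) := by
      conv_rhs => rw [← modByMonic_add_div (X ^ j : ℤ[X]) f]
      rw [map_add, map_mul, hθ, zero_mul, add_zero]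
    have h2 := natDegree_modByMonic_lt (X ^ j : ℤ[X]) hf hn
    rw [aeval_eq_sum_range' h2, map_pow, aeval_X, Finset.sum_range] at h1
    rw [← h1]
    simp [zsmul_eq_mul]
    rfl
  choose M hM using hM
  set S : ℝ := ∑ l : Fin n, ∑ k : Fin n, |(M (l + 1) k : ℝ)| with hS
  set S0 : ℝ := ∑ k : Fin n, |(M 0 k : ℝ)| with hS0
  have hS_nn : 0 ≤ S := by positivity
  have key : ∀ i : ℕ, ∃ c : Fin n → ℤ, θ ^ i = ∑ l, (c l : ℂ) * θ ^ (l : ℕ) ∧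
      ∀ l, |(c l : ℝ)| ≤ (1 + S) ^ i := by
    intro i
    induction i with
    | zero =>
      have hn0 : 0 < n := by
        rw [hndef]
        refine Nat.pos_of_ne_zero fun h0 => hn ?_
        exact (Polynomial.Monic.natDegree_eq_zero hf).1 h0
      refine ⟨fun l => if l = ⟨0, hn0⟩ then 1 else 0, ?_, ?_⟩
      · simp
      · intro l
        by_cases h : l = ⟨0, hn0⟩ <;> simp [h]
    | succ i ih =>
      obtain ⟨c, hc, hcb⟩ := ih
      refine ⟨fun k => ∑ l, c l * M (l + 1) k, ?_, ?_⟩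
      · rw [pow_succ, hc, Finset.sum_mul]
        push_cast
        simp only [Finset.sum_mul]
        rw [Finset.sum_comm]
        refine Finset.sum_congr rfl fun l _ => ?_
        rw [mul_assoc, ← pow_succ, hM, Finset.mul_sum]
        refine Finset.sum_congr rfl fun k _ => by ring
      · intro k
        push_cast
        refine (Finset.abs_sum_le_sum_abs _ _).trans ?_
        calc ∑ l, |(c l : ℝ) * M (l + 1) k| ≤ ∑ l : Fin n, (1 + S) ^ i *
              ∑ k : Fin n, |(M (l + 1) k : ℝ)| := by
              refine Finset.sum_le_sum fun l _ => ?_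
              rw [abs_mul]
              gcongr
              · exact hcb l
              · exact Finset.single_le_sum (f := fun k => |(M (l + 1) k : ℝ)|)
                  (fun k _ => abs_nonneg _) (Finset.mem_univ k)
          _ = (1 + S) ^ i * S := by rw [← Finset.mul_sum]
          _ ≤ _ := by
            rw [pow_succ]; gcongr; linarith
  choose c hc hcb using key
  exact ⟨1 + S, by linarith, c, hc, hcb⟩

/-- Siegel's auxiliary pair of polynomials for Thue's method. -/
theorem exists_auxiliary_pair {θ : ℂ} {n : ℕ} {c : ℕ → Fin n → ℤ} {K : ℝ} (hK : 1 ≤ K)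
    (hc : ∀ i, θ ^ i = ∑ l, (c i l : ℂ) * θ ^ (l : ℕ)) (hcb : ∀ i l, |(c i l : ℝ)| ≤ K ^ i)
    {m N : ℕ} (hm : 0 < n * m) (hN : n * m < 2 * (N + 1)) :
    ∃ t : Bool × Fin (N + 1) → ℤ, t ≠ 0 ∧
      (∀ i, |(t i : ℝ)| ≤ ((2 * (N + 1) : ℝ) * (2 * K) ^ (N + 1)) ^
        ((n * m : ℝ) / (2 * (N + 1) - n * m))) ∧
      ∀ k < m, ∑ i : Fin (N + 1), ((i : ℕ).choose k : ℂ) * t (true, i) * θ ^ ((i : ℕ) - k) =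
        θ * ∑ i : Fin (N + 1), ((i : ℕ).choose k : ℂ) * t (false, i) * θ ^ ((i : ℕ) - k) := by
  let A : Fin n × Fin m → Bool × Fin (N + 1) → ℤ := fun p q =>
    bif q.1 then (q.2 : ℕ).choose p.2 * c (q.2 - p.2) p.1
      else -((q.2 : ℕ).choose p.2 * c (q.2 - p.2 + 1) p.1)
  have hch : ∀ i k : ℕ, i ≤ N → ((i.choose k : ℕ) : ℝ) ≤ 2 ^ (N + 1) := fun i k hi => by
    have := (Nat.choose_le_two_pow i k).trans (Nat.pow_le_pow_right (show 0 < 2 by norm_num)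
      (show i ≤ N + 1 by omega))
    exact_mod_cast this
  have hcb' : ∀ i l, i ≤ N + 1 → |(c i l : ℝ)| ≤ K ^ (N + 1) := fun i l hi =>
    (hcb i l).trans (pow_le_pow_right₀ hK hi)
  have hA : ∀ p q, |(A p q : ℝ)| ≤ (2 * K) ^ (N + 1) := by
    rintro ⟨l, k⟩ ⟨s, i⟩
    have hi := i.2
    rw [mul_pow]
    cases s <;> simp only [A, cond_true, cond_false] <;> push_cast
    · rw [abs_neg, abs_mul, Nat.abs_cast]
      exact mul_le_mul (hch _ _ (by omega)) (hcb' _ _ (by omega)) (abs_nonneg _) (by positivity)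
    · rw [abs_mul, Nat.abs_cast]
      exact mul_le_mul (hch _ _ (by omega)) (hcb' _ _ (by omega)) (abs_nonneg _) (by positivity)
  obtain ⟨t, ht0, ht, htb⟩ := siegel_lemma A (by simpa using hN) (by simpa using hm)
    (H := (2 * K) ^ (N + 1)) (one_le_pow₀ (by linarith)) hA
  refine ⟨t, ht0, ?_, ?_⟩
  · intro i
    have := htb i
    simpa using this
  · intro k hk
    have h1 : ∑ l : Fin n, ((∑ q, A (l, ⟨k, hk⟩) q * t q : ℤ) : ℂ) * θ ^ (l : ℕ) = 0 := by
      refine Finset.sum_eq_zero fun l _ => by rw [ht]; simp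
    simp only [Fintype.sum_prod_type, Fintype.sum_bool, A, cond_true, cond_false] at h1
    rw [← sub_eq_zero, ← h1, Finset.mul_sum]
    push_cast
    simp only [add_mul, Finset.sum_add_distrib, Finset.sum_mul]
    rw [Finset.sum_comm, Finset.sum_comm (s := Finset.univ (α := Fin n)), sub_eq_add_neg,
      ← Finset.sum_neg_distrib]
    congr 1
    · refine Finset.sum_congr rfl fun i _ => ?_
      rw [hc, Finset.mul_sum]
      refine Finset.sum_congr rfl fun l _ => by ring
    · refine Finset.sum_congr rfl fun i _ => ?_
      rw [show θ * (((i : ℕ).choose k : ℂ) * t (false, i) * θ ^ ((i : ℕ) - k)) =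
        ((i : ℕ).choose k : ℂ) * t (false, i) * θ ^ ((i : ℕ) - k + 1) by ring, hc, Finset.mul_sum,
        ← Finset.sum_neg_distrib]
      refine Finset.sum_congr rfl fun l _ => by ring

theorem pow_dvd_of_X_sub_C_pow_dvd {f : ℚ[X]} (hf : Irreducible f) {θ : ℂ} (hθ : aeval θ f = 0)
    (k : ℕ) : ∀ {W : ℚ[X]}, (X - C θ) ^ k ∣ W.map (algebraMap ℚ ℂ) → f ^ k ∣ W := by
  have hroot : (f.map (algebraMap ℚ ℂ)).IsRoot θ := by
    rwa [IsRoot.def, eval_map_algebraMap]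
  obtain ⟨g, hg⟩ := dvd_iff_isRoot.2 hroot
  have hgθ : ¬ g.IsRoot θ := by
    intro h0
    have hsep := (hf.separable).map (f := algebraMap ℚ ℂ)
    obtain ⟨u, hu⟩ := dvd_iff_isRoot.2 h0
    rw [hg, hu] at hsep
    have := hsep.squarefree (X - C θ) ⟨u, by ring⟩
    exact not_isUnit_X_sub_C θ this
  have hcop : IsCoprime (X - C θ) g := by
    rcases (irreducible_X_sub_C θ).isCoprime_or_dvd g with h | h
    · exact h
    · exact absurd (dvd_iff_isRoot.1 h) hgθ
  induction k with
  | zero => intro W _; simp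
  | succ k ih =>
    intro W hW
    have hWθ : aeval θ W = 0 := by
      have := dvd_iff_isRoot.1 ((dvd_pow_self (X - C θ) (Nat.succ_ne_zero k)).trans hW)
      rwa [IsRoot.def, eval_map_algebraMap] at this
    have hfW : f ∣ W := by
      have h1 := minpoly.dvd ℚ θ hWθ
      have h2 := minpoly.dvd ℚ θ hθ
      have h3 : Associated (minpoly ℚ θ) f := by
        refine (minpoly.irreducible ?_).associated_of_dvd hf h2
        exact (isAlgebraic_iff_isIntegral).1 ⟨f, hf.ne_zero, hθ⟩
      exact h3.symm.dvd.trans h1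
    obtain ⟨V, rfl⟩ := hfW
    rw [Polynomial.map_mul, hg, pow_succ', mul_assoc] at hW
    have h4 := (mul_dvd_mul_iff_left (X_sub_C_ne_zero θ)).1 hW
    rw [pow_succ']
    exact mul_dvd_mul_left f (ih ((hcop.pow_left).dvd_of_dvd_mul_left h4))

theorem X_sub_C_pow_dvd_wronskian {K : Type*} [Field K] {P B : K[X]} {m : ℕ} {x : K}
    (h : (X - C x) ^ m ∣ P) : (X - C x) ^ (m - 1) ∣ wronskian P B := by
  have h1 : (X - C x) ^ (m - 1) ∣ P := (pow_dvd_pow _ (Nat.sub_le _ _)).trans h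
  have h2 := pow_sub_one_dvd_derivative_of_pow_dvd h
  exact dvd_sub (h1.mul_right _) (h2.mul_right _)

theorem wronskian_sub_C_mul {K : Type*} [Field K] (A B : K[X]) (y : K) :
    wronskian (A - C y * B) B = wronskian A B := by
  simp only [wronskian, derivative_sub, derivative_C_mul]; ring

theorem exists_coprime_factors {R : Type*} [EuclideanDomain R] {A B : R} (h : A ≠ 0 ∨ B ≠ 0) :
    ∃ g A' B' : R, IsCoprime A' B' ∧ A = g * A' ∧ B = g * B' := by
  classical
  have hg0 : EuclideanDomain.gcd A B ≠ 0 := by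
    rw [Ne, EuclideanDomain.gcd_eq_zero_iff]
    exact fun h0 => h.elim (fun h' => h' h0.1) (fun h' => h' h0.2)
  have h1 := EuclideanDomain.gcd_eq_gcd_ab A B
  obtain ⟨A', hA⟩ := EuclideanDomain.gcd_dvd_left A B
  obtain ⟨B', hB⟩ := EuclideanDomain.gcd_dvd_right A B
  refine ⟨_, A', B', ⟨EuclideanDomain.gcdA A B, EuclideanDomain.gcdB A B, ?_⟩, hA, hB⟩
  apply mul_left_cancel₀ hg0
  calc _ = (EuclideanDomain.gcd A B * A') * EuclideanDomain.gcdA A B +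
        (EuclideanDomain.gcd A B * B') * EuclideanDomain.gcdB A B := by ring
    _ = _ := by rw [← hA, ← hB, ← h1, mul_one]

theorem wronskian_ne_zero_of_vanish {f : ℚ[X]} (hf : Irreducible f) (hn : 2 ≤ f.natDegree) {θ : ℂ}
    (hθ : aeval θ f = 0) {A B : ℚ[X]} {m N : ℕ} (hA : A.natDegree ≤ N) (hB : B.natDegree ≤ N)
    (hN : N < f.natDegree * m) (hAB : A ≠ 0 ∨ B ≠ 0)
    (hdvd : (X - C θ) ^ m ∣ A.map (algebraMap ℚ ℂ) - C θ * B.map (algebraMap ℚ ℂ)) :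
    wronskian A B ≠ 0 := by
  classical
  intro hW
  obtain ⟨g, A', B', hcop, hA', hB'⟩ := exists_coprime_factors hAB
  have hg0 : g ≠ 0 := by
    rintro rfl
    simp_all
  have hW' : wronskian A' B' = 0 := by
    have : g ^ 2 * wronskian A' B' = 0 := by
      rw [← hW, hA', hB']
      simp only [wronskian, derivative_mul]; ring
    exact (mul_eq_zero.1 this).resolve_left (pow_ne_zero 2 hg0)
  obtain ⟨d1, d2⟩ := hcop.wronskian_eq_zero_iff.1 hW'
  have hAc := eq_C_of_derivative_eq_zero d1
  have hBc := eq_C_of_derivative_eq_zero d2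
  set u := A'.coeff 0
  set v := B'.coeff 0
  have hne : (u : ℂ) - θ * v ≠ 0 := by
    intro h0
    have h1 : aeval θ (C u - C v * X) = 0 := by
      rw [map_sub, map_mul, aeval_C, aeval_C, aeval_X, mul_comm]
      exact h0
    have h2 : f ∣ C u - C v * X := by
      have := pow_dvd_of_X_sub_C_pow_dvd hf hθ 1 (W := C u - C v * X) (by
        rw [pow_one, dvd_iff_isRoot, IsRoot.def, eval_map_algebraMap, h1])
      simpa using this
    have h3 : C u - C v * X ≠ 0 := by
      intro h4
      have h5 : u = 0 := by simpa using congrArg (fun p => coeff p 0) h4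
      have h6 : v = 0 := by simpa using congrArg (fun p => coeff p 1) h4
      rw [hAc, hBc, h5, h6, map_zero] at hcop
      exact not_isCoprime_zero_zero hcop
    have h4 := natDegree_le_of_dvd h2 h3
    have h5 : (C u - C v * X).natDegree ≤ 1 := by compute_degree
    omega
  have hgm : (X - C θ) ^ m ∣ g.map (algebraMap ℚ ℂ) := by
    rw [hA', hB', hAc, hBc] at hdvd
    have e : (g * C u).map (algebraMap ℚ ℂ) - C θ * (g * C v).map (algebraMap ℚ ℂ) =
        C ((u : ℂ) - θ * v) * g.map (algebraMap ℚ ℂ) := by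
      simp only [Polynomial.map_mul, Polynomial.map_C, C_sub, C_mul, eq_ratCast]; ring
    rw [e] at hdvd
    exact ((isUnit_C.2 (isUnit_iff_ne_zero.2 hne)).dvd_mul_left).1 hdvd
  have h1 := natDegree_le_of_dvd (pow_dvd_of_X_sub_C_pow_dvd hf hθ m hgm) hg0
  rw [natDegree_pow, mul_comm] at h1
  have h2 : g.natDegree ≤ N := by
    rcases hAB with h0 | h0
    · exact (natDegree_le_of_dvd ⟨A', hA'⟩ h0).trans hA
    · exact (natDegree_le_of_dvd ⟨B', hB'⟩ h0).trans hB
  omega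

theorem exists_hasseDeriv_ne_zero {f : ℚ[X]} (hf : Irreducible f) (hn : 2 ≤ f.natDegree) {θ : ℂ}
    (hθ : aeval θ f = 0) {A B : ℚ[X]} {m N J : ℕ} (hA : A.natDegree ≤ N) (hB : B.natDegree ≤ N)
    (hN : N < f.natDegree * m) (hAB : A ≠ 0 ∨ B ≠ 0)
    (hdvd : (X - C θ) ^ m ∣ A.map (algebraMap ℚ ℂ) - C θ * B.map (algebraMap ℚ ℂ))
    (hJ : 2 * N ≤ J + f.natDegree * (m - 1)) (x y : ℚ) :
    ∃ j ≤ J, (hasseDeriv j (A - C y * B)).eval x ≠ 0 := by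
  by_contra! hv
  have hW := wronskian_ne_zero_of_vanish hf hn hθ hA hB hN hAB hdvd
  have h1 : (X - C x) ^ J ∣ wronskian A B := by
    have := X_sub_C_pow_dvd_wronskian (B := B)
      (X_sub_C_pow_dvd_of_hasseDeriv (m := J + 1) fun k hk => hv k (by omega))
    rwa [wronskian_sub_C_mul] at this
  have h2 : f ^ (m - 1) ∣ wronskian A B := by
    refine pow_dvd_of_X_sub_C_pow_dvd hf hθ _ ?_
    have := X_sub_C_pow_dvd_wronskian (B := B.map (algebraMap ℚ ℂ)) hdvd
    rw [wronskian_sub_C_mul] at this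
    simpa [wronskian, derivative_map] using this
  have hcop : IsCoprime (X - C x) f := by
    rcases (irreducible_X_sub_C x).isCoprime_or_dvd f with h | h
    · exact h
    · have := ((irreducible_X_sub_C x).associated_of_dvd hf h).symm.dvd
      have := natDegree_le_of_dvd this (X_sub_C_ne_zero x)
      rw [natDegree_X_sub_C] at this
      omega
  have h3 := natDegree_le_of_dvd ((hcop.pow (m := J) (n := m - 1)).mul_dvd h1 h2) hW
  rw [natDegree_mul (pow_ne_zero _ (X_sub_C_ne_zero x)) (pow_ne_zero _ hf.ne_zero), natDegree_pow,
    natDegree_pow, natDegree_X_sub_C, mul_one, mul_comm (m - 1)] at h3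
  have := natDegree_wronskian_lt_add hW
  omega

/-- The polynomial with integer coefficients `t 0, …, t N` over a field. -/
noncomputable def polyOf (K : Type*) [Field K] {N : ℕ} (t : Fin (N + 1) → ℤ) : K[X] :=
  ∑ i : Fin (N + 1), monomial (i : ℕ) (t i : K)

section polyOf

variable {K : Type*} [Field K] {N : ℕ} (t : Fin (N + 1) → ℤ)

theorem coeff_polyOf (k : ℕ) : (polyOf K t).coeff k =
    if h : k < N + 1 then (t ⟨k, h⟩ : K) else 0 := by
  rw [polyOf, finsetSum_coeff]
  split_ifs with h
  · rw [Finset.sum_eq_single ⟨k, h⟩]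
    · simp
    · intro i _ hi
      rw [coeff_monomial, if_neg fun h' => hi (Fin.ext h')]
    · simp
  · refine Finset.sum_eq_zero fun i _ => ?_
    rw [coeff_monomial, if_neg]
    have := i.2
    omega

theorem natDegree_polyOf_le : (polyOf K t).natDegree ≤ N := by
  rw [natDegree_le_iff_coeff_eq_zero]
  intro k hk
  rw [coeff_polyOf, dif_neg (by omega)]

theorem polyOf_ne_zero [CharZero K] {t : Fin (N + 1) → ℤ} (ht : t ≠ 0) : polyOf K t ≠ 0 := by
  intro h
  apply ht
  funext i
  have := congrArg (fun p => coeff p i) h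
  simp only [coeff_polyOf, coeff_zero, i.2, dite_true] at this
  exact_mod_cast this

theorem eval_hasseDeriv_polyOf (k : ℕ) (z : K) : (hasseDeriv k (polyOf K t)).eval z =
    ∑ i : Fin (N + 1), ((i : ℕ).choose k : K) * t i * z ^ ((i : ℕ) - k) := by
  rw [polyOf, map_sum, eval_finsetSum]
  simp only [hasseDeriv_monomial, eval_monomial]

theorem map_polyOf (t : Fin (N + 1) → ℤ) :
    (polyOf ℚ t).map (algebraMap ℚ ℂ) = polyOf ℂ t := by
  simp [polyOf, Polynomial.map_sum]

end polyOf

theorem thue_constant_bound {K R l : ℝ} (hK : 1 ≤ K) (hR : 1 ≤ R) (hl : 0 < l) (n : ℕ) :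
    ∃ K1 : ℝ, 1 ≤ K1 ∧ ∀ m N : ℕ, N + 1 ≤ 2 * n * m → ∀ e : ℝ, e ≤ 1 / l →
      (N + 1) * (2 ^ N * ((N + 1) * (2 ^ N * (((2 * (N + 1) : ℝ) * (2 * K) ^ (N + 1)) ^ e *
        (1 + R)) * R ^ N))) ≤ K1 ^ m := by
  set b : ℝ := (8 * K) ^ (1 / l) with hb
  have hb1 : 1 ≤ b := Real.one_le_rpow (by linarith) (by positivity)
  have hb16 : (1 : ℝ) ≤ 16 * b * (1 + R) * R := by
    have h1 : 1 ≤ 16 * b := by linarith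
    have h2 : 1 ≤ 16 * b * (1 + R) := one_le_mul_of_one_le_of_one_le h1 (by linarith)
    exact one_le_mul_of_one_le_of_one_le h2 hR
  refine ⟨(16 * b * (1 + R) * R) ^ (2 * n), one_le_pow₀ hb16, fun m N hN e he => ?_⟩
  have hN2 : (N + 1 : ℝ) ≤ 2 ^ (N + 1) := by
    have : N + 1 ≤ 2 ^ (N + 1) := Nat.lt_two_pow_self.le
    exact_mod_cast this
  have hbase : (2 * (N + 1) : ℝ) * (2 * K) ^ (N + 1) ≤ (8 * K) ^ (N + 1) := by
    have : (2 * (N + 1) : ℝ) ≤ 4 ^ (N + 1) := by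
      have h4 : ((4 : ℝ)) ^ (N + 1) = 2 ^ (N + 1) * 2 ^ (N + 1) := by rw [← mul_pow]; norm_num
      have h2 : (2 : ℝ) ≤ 2 ^ (N + 1) := by
        rw [pow_succ]; linarith [one_le_pow₀ (M₀ := ℝ) (a := 2) (n := N) (by norm_num)]
      rw [h4]
      exact mul_le_mul h2 hN2 (by positivity) (by positivity)
    calc _ ≤ (4 : ℝ) ^ (N + 1) * (2 * K) ^ (N + 1) := by gcongr
      _ = _ := by rw [← mul_pow]; ring
  have hbase1 : (1 : ℝ) ≤ (2 * (N + 1) : ℝ) * (2 * K) ^ (N + 1) :=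
    one_le_mul_of_one_le_of_one_le (by linarith [Nat.cast_nonneg (α := ℝ) N])
      (one_le_pow₀ (by linarith))
  have hH : ((2 * (N + 1) : ℝ) * (2 * K) ^ (N + 1)) ^ e ≤ b ^ (N + 1) := by
    calc _ ≤ ((2 * (N + 1) : ℝ) * (2 * K) ^ (N + 1)) ^ (1 / l) :=
          Real.rpow_le_rpow_of_exponent_le hbase1 he
      _ ≤ ((8 * K) ^ (N + 1)) ^ (1 / l) :=
          Real.rpow_le_rpow (by linarith) hbase (by positivity)
      _ = _ := by
        rw [hb, ← Real.rpow_natCast, ← Real.rpow_natCast, ← Real.rpow_mul (by linarith),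
          ← Real.rpow_mul (by linarith), mul_comm (1 / l)]
  have h2N : (2 : ℝ) ^ N ≤ 2 ^ (N + 1) := pow_le_pow_right₀ (by norm_num) (by omega)
  have hRN : R ^ N ≤ R ^ (N + 1) := pow_le_pow_right₀ hR (by omega)
  have hR1 : 1 + R ≤ (1 + R) ^ (N + 1) := le_self_pow₀ (by linarith) (by omega)
  calc _ ≤ (2 : ℝ) ^ (N + 1) * (2 ^ (N + 1) * (2 ^ (N + 1) * (2 ^ (N + 1) * (b ^ (N + 1) *
        (1 + R) ^ (N + 1)) * R ^ (N + 1)))) := by gcongr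
    _ = (16 * b * (1 + R) * R) ^ (N + 1) := by
      simp only [mul_pow]
      rw [show (16 : ℝ) = 2 * 2 * 2 * 2 by norm_num]
      simp only [mul_pow]; ring
    _ ≤ (16 * b * (1 + R) * R) ^ (2 * n * m) := pow_le_pow_right₀ hb16 hN
    _ = _ := by rw [pow_mul]

theorem one_le_of_int_multiple {N : ℕ} {q1 q2 p1 p2 : ℤ} (hq1 : 0 < q1) (hq2 : 0 < q2) (j : ℕ)
    (s t : Fin (N + 1) → ℤ)
    (h : ∑ i : Fin (N + 1), ((i : ℕ).choose j : ℚ) * s i * (p1 / q1 : ℚ) ^ ((i : ℕ) - j) -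
      (p2 / q2 : ℚ) * ∑ i : Fin (N + 1), ((i : ℕ).choose j : ℚ) * t i * (p1 / q1 : ℚ) ^ ((i : ℕ) - j) ≠ 0) :
    1 ≤ (q1 : ℝ) ^ N * q2 *
      |((∑ i : Fin (N + 1), ((i : ℕ).choose j : ℚ) * s i * (p1 / q1 : ℚ) ^ ((i : ℕ) - j) -
      (p2 / q2 : ℚ) * ∑ i : Fin (N + 1), ((i : ℕ).choose j : ℚ) * t i *
        (p1 / q1 : ℚ) ^ ((i : ℕ) - j) : ℚ) : ℝ)| := by
  have hq1' : (q1 : ℚ) ≠ 0 := by exact_mod_cast hq1.ne'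
  have hq2' : (q2 : ℚ) ≠ 0 := by exact_mod_cast hq2.ne'
  have key : ∀ s : Fin (N + 1) → ℤ, (q1 : ℚ) ^ N *
      ∑ i : Fin (N + 1), ((i : ℕ).choose j : ℚ) * s i * (p1 / q1 : ℚ) ^ ((i : ℕ) - j) =
      ((∑ i : Fin (N + 1), ((i : ℕ).choose j : ℤ) * s i * (p1 ^ ((i : ℕ) - j) *
        q1 ^ (N - ((i : ℕ) - j))) : ℤ) : ℚ) := by
    intro s
    rw [Finset.mul_sum]
    push_cast
    refine Finset.sum_congr rfl fun i _ => ?_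
    have hi : (i : ℕ) - j ≤ N := by have := i.2; omega
    have e : (q1 : ℚ) ^ N = q1 ^ ((i : ℕ) - j) * q1 ^ (N - ((i : ℕ) - j)) := by
      rw [← pow_add]; congr 1; omega
    rw [e, div_pow]
    field_simp
  set D : ℚ := ∑ i : Fin (N + 1), ((i : ℕ).choose j : ℚ) * s i * (p1 / q1 : ℚ) ^ ((i : ℕ) - j) -
      (p2 / q2 : ℚ) * ∑ i : Fin (N + 1), ((i : ℕ).choose j : ℚ) * t i *
        (p1 / q1 : ℚ) ^ ((i : ℕ) - j) with hD
  obtain ⟨z, hz⟩ : ∃ z : ℤ, (q1 : ℚ) ^ N * q2 * D = z := by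
    refine ⟨q2 * (∑ i : Fin (N + 1), ((i : ℕ).choose j : ℤ) * s i * (p1 ^ ((i : ℕ) - j) *
        q1 ^ (N - ((i : ℕ) - j)))) - p2 * (∑ i : Fin (N + 1), ((i : ℕ).choose j : ℤ) * t i *
        (p1 ^ ((i : ℕ) - j) * q1 ^ (N - ((i : ℕ) - j)))), ?_⟩
    rw [Int.cast_sub, Int.cast_mul, Int.cast_mul, ← key, ← key, hD]
    field_simp
  have hz0 : z ≠ 0 := by
    rintro rfl
    rw [Int.cast_zero, mul_eq_zero, mul_eq_zero] at hz
    rcases hz with (h1 | h1) | h1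
    · exact pow_ne_zero _ hq1' h1
    · exact hq2' h1
    · exact h h1
  have hz1 : (1 : ℝ) ≤ |(z : ℝ)| := by exact_mod_cast Int.one_le_abs hz0
  have hzr : (q1 : ℝ) ^ N * q2 * (D : ℝ) = z := by exact_mod_cast congrArg (Rat.cast (K := ℝ)) hz
  rw [← hzr, abs_mul, abs_of_pos (by positivity)] at hz1
  exact hz1

/-- The fundamental inequality of Thue's method for two rational approximations. -/
theorem thue_inequality {f : ℤ[X]} (hf : f.Monic) (hirr : Irreducible (f.map (algebraMap ℤ ℚ)))
    (hn : 2 ≤ f.natDegree) {θ : ℂ} (hθ : aeval θ f = 0) {l : ℝ} (hl : 0 < l) (hl1 : l < 1) :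
    ∃ K : ℝ, 1 ≤ K ∧ ∀ m : ℕ, 1 ≤ m → ∀ p1 q1 p2 q2 : ℤ, 0 < q1 → 0 < q2 →
      ‖(p1 / q1 : ℂ) - θ‖ ≤ 1 → ∃ j N : ℕ, (j : ℝ) ≤ l * f.natDegree * m + f.natDegree ∧
        (N : ℝ) ≤ (1 + l) * f.natDegree * m / 2 ∧
        1 ≤ (q1 : ℝ) ^ N * q2 * (K ^ m * (‖(p1 / q1 : ℂ) - θ‖ ^ (m - j) +
          ‖(p2 / q2 : ℂ) - θ‖)) := by
  set n := f.natDegree with hndef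
  have hf1 : f ≠ 1 := by rintro rfl; simp at hndef; omega
  obtain ⟨K0, hK0, c, hc, hcb⟩ := exists_pow_coeff hf hθ hf1
  set R : ℝ := ‖θ‖ + 1 with hR
  have hR1 : 1 ≤ R := by rw [hR]; linarith [norm_nonneg θ]
  obtain ⟨K, hK, hKb⟩ := thue_constant_bound hK0 hR1 hl n
  refine ⟨K, hK, fun m hm p1 q1 p2 q2 hq1 hq2 hx => ?_⟩
  set N := ⌊(1 + l) * n * m / 2⌋₊ with hNdef
  have hn' : (2 : ℝ) ≤ n := by exact_mod_cast hn
  have hm' : (1 : ℝ) ≤ m := by exact_mod_cast hm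
  have hnm : (2 : ℝ) ≤ n * m := by nlinarith
  have hN1 : (N : ℝ) ≤ (1 + l) * n * m / 2 := Nat.floor_le (by positivity)
  have hN2 : (1 + l) * n * m / 2 < N + 1 := Nat.lt_floor_add_one _
  have hlnm : 0 < l * (n * m) := by positivity
  have hNlt : N < n * m := by
    have : (N : ℝ) < (n * m : ℕ) := by push_cast; nlinarith
    exact_mod_cast this
  have hNgt : n * m < 2 * (N + 1) := by
    have : ((n * m : ℕ) : ℝ) < (2 * (N + 1) : ℕ) := by push_cast; nlinarith
    exact_mod_cast this
  obtain ⟨t, ht0, htb, ht⟩ := exists_auxiliary_pair hK0 hc hcb (m := m) (N := N) (by positivity) hNgt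
  set s1 : Fin (N + 1) → ℤ := fun i => t (true, i) with hs1
  set s2 : Fin (N + 1) → ℤ := fun i => t (false, i) with hs2
  have hor : polyOf ℚ s1 ≠ 0 ∨ polyOf ℚ s2 ≠ 0 := by
    by_contra! h0
    apply ht0
    funext ⟨b, i⟩
    have h1 : s1 = 0 := by by_contra h; exact polyOf_ne_zero h h0.1
    have h2 : s2 = 0 := by by_contra h; exact polyOf_ne_zero h h0.2
    cases b
    · exact congrFun h2 i
    · exact congrFun h1 i
  set P : ℂ[X] := polyOf ℂ s1 - C θ * polyOf ℂ s2 with hP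
  have hPv : ∀ k < m, (hasseDeriv k P).eval θ = 0 := by
    intro k hk
    have h1 : hasseDeriv k (C θ * polyOf ℂ s2) = C θ * hasseDeriv k (polyOf ℂ s2) := by
      rw [← smul_eq_C_mul, ← smul_eq_C_mul, map_smul]
    rw [hP, map_sub, h1, eval_sub, eval_mul, eval_C, eval_hasseDeriv_polyOf,
      eval_hasseDeriv_polyOf, ht k hk, sub_self]
  have hfd : (f.map (algebraMap ℤ ℚ)).natDegree = n := hf.natDegree_map _
  have hθ' : aeval θ (f.map (algebraMap ℤ ℚ)) = 0 := by rw [aeval_map_algebraMap, hθ]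
  obtain ⟨j, hj, hjne⟩ := exists_hasseDeriv_ne_zero (J := 2 * N - n * (m - 1)) hirr (by omega) hθ'
    (natDegree_polyOf_le s1) (natDegree_polyOf_le s2) (m := m) (by rw [hfd]; exact hNlt) hor
    (by rw [map_polyOf, map_polyOf]; exact X_sub_C_pow_dvd_of_hasseDeriv hPv)
    (by rw [hfd]; omega) (p1 / q1 : ℚ) (p2 / q2 : ℚ)
  have h1 : hasseDeriv j (C (p2 / q2 : ℚ) * polyOf ℚ s2) =
      C (p2 / q2 : ℚ) * hasseDeriv j (polyOf ℚ s2) := by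
    rw [← smul_eq_C_mul, ← smul_eq_C_mul, map_smul]
  rw [map_sub, h1, eval_sub, eval_mul, eval_C, eval_hasseDeriv_polyOf,
      eval_hasseDeriv_polyOf] at hjne
  have hintegral := one_le_of_int_multiple hq1 hq2 j s1 s2 hjne
  refine ⟨j, N, ?_, hN1, hintegral.trans ?_⟩
  · have h2 : n * (m - 1) ≤ 2 * N := by
      have : n * (m - 1) + n = n * m := by
        rw [← Nat.mul_succ]; congr 1; omega
      omega
    have h3 : (j : ℝ) ≤ 2 * N - n * (m - 1) := by
      have : j + n * (m - 1) ≤ 2 * N := by omega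
      have : ((j + n * (m - 1) : ℕ) : ℝ) ≤ (2 * N : ℕ) := by exact_mod_cast this
      push_cast [Nat.cast_sub hm] at this
      linarith
    nlinarith
  have hq1r : (0 : ℝ) < q1 := by exact_mod_cast hq1
  have hq2r : (0 : ℝ) < q2 := by exact_mod_cast hq2
  refine mul_le_mul_of_nonneg_left ?_ (by positivity)
  set H : ℝ := ((2 * (N + 1) : ℝ) * (2 * K0) ^ (N + 1)) ^
        ((n * m : ℝ) / (2 * (N + 1) - n * m)) with hH
  have hH0 : 0 ≤ H := by positivity
  have hcoef : ∀ s : Fin (N + 1) → ℤ, (∀ i, |(s i : ℝ)| ≤ H) →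
      ∀ i, ‖(polyOf ℂ s).coeff i‖ ≤ H := by
    intro s hs i
    rw [coeff_polyOf]
    split_ifs with h
    · rw [Complex.norm_intCast]; exact hs _
    · simpa using hH0
  have hc1 := hcoef s1 fun i => htb _
  have hc2 := hcoef s2 fun i => htb _
  have hcP : ∀ i, ‖P.coeff i‖ ≤ H * (1 + R) := by
    intro i
    rw [hP, coeff_sub, coeff_C_mul]
    refine (norm_sub_le _ _).trans ?_
    rw [norm_mul]
    have : ‖θ‖ * ‖(polyOf ℂ s2).coeff i‖ ≤ R * H :=
      mul_le_mul (by linarith) (hc2 i) (norm_nonneg _) (by linarith)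
    linarith [hc1 i]
  have hPN : P.natDegree ≤ N := (natDegree_sub_le_of_le (natDegree_polyOf_le s1)
    ((natDegree_C_mul_le _ _).trans (natDegree_polyOf_le s2))).trans (max_self N).le
  have hx' : ‖(p1 / q1 : ℂ)‖ ≤ R := by
    have := norm_add_le ((p1 / q1 : ℂ) - θ) θ
    rw [sub_add_cancel] at this
    linarith
  have e1 := norm_eval_hasseDeriv_le_of_vanish (j := j) hPN hR1 hcP (by linarith : ‖θ‖ ≤ R) hPv hx
  have e2 := norm_eval_hasseDeriv_le (natDegree_polyOf_le s2) hR1 hc2 j hx'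
  have hE : (n * m : ℝ) / (2 * (N + 1) - n * m) ≤ 1 / l := by
    rw [div_le_div_iff₀ (by nlinarith) hl]; nlinarith
  have hKm := hKb m N (by
    have : n * m + n * m = 2 * n * m := by ring
    have : 1 ≤ n * m := Nat.mul_pos (by omega) hm
    omega) _ hE
  rw [← hH] at hKm
  set E : ℝ := (N + 1) * (2 ^ N * ((N + 1) * (2 ^ N * (H * (1 + R)) * R ^ N))) with hEdef
  have hE2 : (N + 1 : ℝ) * (2 ^ N * H * R ^ N) ≤ E := by
    have h2 : (1 : ℝ) ≤ (N + 1) * 2 ^ N := one_le_mul_of_one_le_of_one_le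
      (by linarith [Nat.cast_nonneg (α := ℝ) N]) (one_le_pow₀ (by norm_num))
    have h3 : (1 : ℝ) ≤ (N + 1) * 2 ^ N * (1 + R) :=
      one_le_mul_of_one_le_of_one_le h2 (by linarith)
    calc _ ≤ ((N + 1 : ℝ) * (2 ^ N * H * R ^ N)) * ((N + 1) * 2 ^ N * (1 + R)) :=
          le_mul_of_one_le_right (by positivity) h3
      _ = E := by rw [hEdef]; ring
  have hval : (((∑ i : Fin (N + 1), ((i : ℕ).choose j : ℚ) * s1 i * (p1 / q1 : ℚ) ^ ((i : ℕ) - j) -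
      (p2 / q2 : ℚ) * ∑ i : Fin (N + 1), ((i : ℕ).choose j : ℚ) * s2 i *
        (p1 / q1 : ℚ) ^ ((i : ℕ) - j) : ℚ) : ℝ) : ℂ) = (hasseDeriv j P).eval (p1 / q1 : ℂ) -
        ((p2 / q2 : ℂ) - θ) * (hasseDeriv j (polyOf ℂ s2)).eval (p1 / q1 : ℂ) := by
    have h1 : hasseDeriv j (C θ * polyOf ℂ s2) = C θ * hasseDeriv j (polyOf ℂ s2) := by
      rw [← smul_eq_C_mul, ← smul_eq_C_mul, map_smul]
    rw [hP, map_sub, h1, eval_sub, eval_mul, eval_C, eval_hasseDeriv_polyOf,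
      eval_hasseDeriv_polyOf]
    push_cast
    ring
  rw [← Real.norm_eq_abs, ← Complex.norm_real, hval]
  refine (norm_sub_le _ _).trans ?_
  rw [norm_mul, mul_add]
  refine add_le_add (e1.trans ?_) ?_
  · calc _ = E * ‖(p1 / q1 : ℂ) - θ‖ ^ (m - j) := by rw [hEdef]; ring
      _ ≤ _ := by gcongr
  · rw [mul_comm]
    refine mul_le_mul_of_nonneg_right ?_ (norm_nonneg _)
    exact e2.trans (hE2.trans hKm)

set_option maxHeartbeats 1000000 in
/-- Thue's theorem for algebraic integers. -/
theorem thue_eventually {f : ℤ[X]} (hf : f.Monic) (hirr : Irreducible (f.map (algebraMap ℤ ℚ)))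
    (hn : 2 ≤ f.natDegree) {θ : ℂ} (hθ : aeval θ f = 0) {κ : ℝ}
    (hκ : (f.natDegree : ℝ) / 2 + 1 < κ) :
    ∃ Q : ℝ, ∀ p q : ℤ, 0 < q → Q ≤ q → (q : ℝ) ^ (-κ) < ‖(p / q : ℂ) - θ‖ := by
  set n := f.natDegree with hndef
  have hn' : (2 : ℝ) ≤ n := by exact_mod_cast hn
  set σ : ℝ := κ - (n / 2 + 1) with hσ
  have hσ0 : 0 < σ := by rw [hσ]; linarith
  have hκ1 : 1 < κ := by linarith
  have hκ0 : 0 < κ := by linarith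
  set l : ℝ := min (1 / (2 * n)) (σ / (n * (1 + 2 * κ))) with hl
  have hl0 : 0 < l := lt_min (by positivity) (by positivity)
  have hla : l * n ≤ 1 / 2 := by
    have : l ≤ 1 / (2 * n) := min_le_left _ _
    calc l * n ≤ 1 / (2 * n) * n := by gcongr
      _ = 1 / 2 := by field_simp
  have hl1 : l < 1 := by nlinarith
  have hlb : l * n * (1 + 2 * κ) ≤ σ := by
    have : l ≤ σ / (n * (1 + 2 * κ)) := min_le_right _ _
    rw [le_div_iff₀ (by positivity)] at this
    linarith
  obtain ⟨K, hK, hmain⟩ := thue_inequality hf hirr hn hθ hl0 hl1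
  by_contra! hcon
  obtain ⟨m0, hm0⟩ := exists_nat_gt (4 * (1 + κ * n) / σ + 2 * n + 1)
  obtain ⟨p1, q1, hq1, hQ1, hap1⟩ := hcon (max 2 ((2 * K) ^ (4 / σ)))
  have hq12 : (2 : ℝ) ≤ q1 := (le_max_left _ _).trans hQ1
  have hq1K : 2 * K ≤ (q1 : ℝ) ^ (σ / 4) := by
    have h1 : (2 * K) ^ (4 / σ) ≤ q1 := (le_max_right _ _).trans hQ1
    have h2 := Real.rpow_le_rpow (by positivity) h1 (by positivity : 0 ≤ σ / 4)
    rwa [← Real.rpow_mul (by positivity), show 4 / σ * (σ / 4) = 1 by field_simp,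
      Real.rpow_one] at h2
  obtain ⟨p2, q2, hq2, hQ2, hap2⟩ := hcon ((q1 : ℝ) ^ m0)
  have hq1r : (0 : ℝ) < q1 := by linarith
  have hq2r : (0 : ℝ) < q2 := by exact_mod_cast hq2
  have hq11 : (1 : ℝ) ≤ q1 := by linarith
  obtain ⟨m, hmm, hm1, hm2⟩ : ∃ m : ℕ, m0 ≤ m ∧ (q1 : ℝ) ^ m ≤ q2 ∧ (q2 : ℝ) < q1 ^ (m + 1) := by
    have hlt1 : (1 : ℝ) < q1 := by linarith
    obtain ⟨m, h1, h2⟩ := exists_nat_pow_near (le_trans (one_le_pow₀ hq11) hQ2) hlt1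
    refine ⟨m, ?_, h1, h2⟩
    have h3 : (q1 : ℝ) ^ m0 < q1 ^ (m + 1) := hQ2.trans_lt h2
    have := (pow_lt_pow_iff_right₀ hlt1).1 h3
    omega
  have hmR : 4 * (1 + κ * n) / σ + 2 * n + 1 < m := hm0.trans_le (by exact_mod_cast hmm)
  have hpos4 : 0 < 4 * (1 + κ * n) / σ := by positivity
  have hm1' : 1 ≤ m := by
    have : (1 : ℝ) ≤ m := by linarith
    exact_mod_cast this
  have hmσ : 4 * (1 + κ * n) < σ * m := by
    have : 4 * (1 + κ * n) / σ < m := by linarith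
    rw [div_lt_iff₀ hσ0] at this
    linarith
  have hx1 : ‖(p1 / q1 : ℂ) - θ‖ ≤ 1 := hap1.trans (by
    rw [← Real.rpow_zero (q1 : ℝ)]
    exact Real.rpow_le_rpow_of_exponent_le hq11 (by linarith))
  obtain ⟨j, N, hj, hN, hineq⟩ := hmain m hm1' p1 q1 p2 q2 hq1 hq2 hx1
  have hjm : j ≤ m := by
    have : (j : ℝ) ≤ m := by nlinarith
    exact_mod_cast this
  have t1 : ‖(p1 / q1 : ℂ) - θ‖ ^ (m - j) ≤ (q1 : ℝ) ^ (-κ * (m - j)) := by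
    calc _ ≤ ((q1 : ℝ) ^ (-κ)) ^ (m - j) := pow_le_pow_left₀ (norm_nonneg _) hap1 _
      _ = _ := by
        rw [← Real.rpow_natCast, ← Real.rpow_mul hq1r.le, Nat.cast_sub hjm]
  have b1 : (q1 : ℝ) ^ N * q2 * (q1 : ℝ) ^ (-κ * (m - j)) ≤ (q1 : ℝ) ^ (1 + κ * n - σ * m / 2) := by
    calc _ ≤ (q1 : ℝ) ^ N * (q1 : ℝ) ^ (m + 1) * (q1 : ℝ) ^ (-κ * (m - j)) := by gcongr
      _ = (q1 : ℝ) ^ ((N : ℝ) + (m + 1) + -κ * (m - j)) := by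
        rw [Real.rpow_add hq1r, Real.rpow_add hq1r, Real.rpow_natCast]
        norm_cast
      _ ≤ _ := by
        refine Real.rpow_le_rpow_of_exponent_le hq11 ?_
        have h1 : κ * j ≤ κ * (l * n * m + n) := mul_le_mul_of_nonneg_left hj (by linarith)
        have h2 : l * n * (1 + 2 * κ) * m ≤ σ * m := by gcongr
        have h3 : σ * m = κ * m - n * m / 2 - m := by rw [hσ]; ring
        linarith
  have b2 : (q1 : ℝ) ^ N * q2 * ‖(p2 / q2 : ℂ) - θ‖ ≤ (q1 : ℝ) ^ (1 + κ * n - σ * m / 2) := by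
    calc _ ≤ (q1 : ℝ) ^ N * q2 * (q2 : ℝ) ^ (-κ) := by gcongr
      _ = (q1 : ℝ) ^ N * (q2 : ℝ) ^ (1 - κ) := by
        rw [sub_eq_add_neg, Real.rpow_add hq2r, Real.rpow_one, mul_assoc]
      _ ≤ (q1 : ℝ) ^ N * ((q1 : ℝ) ^ m) ^ (1 - κ) := by
        refine mul_le_mul_of_nonneg_left ?_ (by positivity)
        exact Real.rpow_le_rpow_of_nonpos (by positivity) hm1 (by linarith)
      _ = (q1 : ℝ) ^ ((N : ℝ) + m * (1 - κ)) := by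
        rw [Real.rpow_add hq1r, Real.rpow_natCast, Real.rpow_mul hq1r.le, Real.rpow_natCast]
      _ ≤ _ := by
        refine Real.rpow_le_rpow_of_exponent_le hq11 ?_
        have h2 : l * n * (1 + 2 * κ) * m ≤ σ * m := by gcongr
        have h3 : 0 ≤ l * n * κ * m := by positivity
        have h4 : 0 ≤ κ * n := by positivity
        have h5 : σ * m = κ * m - n * m / 2 - m := by rw [hσ]; ring
        linarith
  have hKm : 2 * K ^ m ≤ (q1 : ℝ) ^ (σ * m / 4) := by
    calc 2 * K ^ m ≤ (2 * K) ^ m := by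
          rw [mul_pow]
          gcongr
          exact le_self_pow₀ (by norm_num) (by omega)
      _ ≤ ((q1 : ℝ) ^ (σ / 4)) ^ m := by gcongr
      _ = _ := by
        rw [← Real.rpow_natCast, ← Real.rpow_mul hq1r.le]; congr 1; ring
  have hfin : (1 : ℝ) ≤ (q1 : ℝ) ^ (1 + κ * n - σ * m / 4) := by
    calc (1 : ℝ) ≤ _ := hineq
      _ = K ^ m * ((q1 : ℝ) ^ N * q2 * ‖(p1 / q1 : ℂ) - θ‖ ^ (m - j) +
          (q1 : ℝ) ^ N * q2 * ‖(p2 / q2 : ℂ) - θ‖) := by ring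
      _ ≤ K ^ m * ((q1 : ℝ) ^ (1 + κ * n - σ * m / 2) + (q1 : ℝ) ^ (1 + κ * n - σ * m / 2)) := by
        refine mul_le_mul_of_nonneg_left (add_le_add (le_trans ?_ b1) b2) (by positivity)
        exact mul_le_mul_of_nonneg_left t1 (by positivity)
      _ = 2 * K ^ m * (q1 : ℝ) ^ (1 + κ * n - σ * m / 2) := by ring
      _ ≤ (q1 : ℝ) ^ (σ * m / 4) * (q1 : ℝ) ^ (1 + κ * n - σ * m / 2) :=
        mul_le_mul_of_nonneg_right hKm (by positivity)
      _ = _ := by rw [← Real.rpow_add hq1r]; congr 1; ring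
  have hlt : (q1 : ℝ) ^ (1 + κ * n - σ * m / 4) < 1 :=
    Real.rpow_lt_one_of_one_lt_of_neg (by linarith) (by linarith)
  linarith

end Thue

section Roots

open Polynomial

variable {d : ℕ} {a : Fin (d + 1) → ℤ}

/-- The value of the complex linear form with coefficients `l` at a real point. -/
def linAt (l : ℂ × ℂ) (p : ℝ × ℝ) : ℂ := l.1 * p.1 + l.2 * p.2

/-- The real point underlying an integral one. -/
def realPt (v : ℤ × ℤ) : ℝ × ℝ := (v.1, v.2)

theorem norm_realPt (v : ℤ × ℤ) : ‖realPt v‖ = max |(v.1 : ℝ)| |(v.2 : ℝ)| := rfl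

theorem det_mul_norm_le (l m : ℂ × ℂ) (p : ℝ × ℝ) :
    ‖l.1 * m.2 - m.1 * l.2‖ * ‖p‖ ≤ (‖l‖ + ‖m‖) * max ‖linAt l p‖ ‖linAt m p‖ := by
  have key : ∀ (s t : ℂ) (x : ℝ), ‖s‖ ≤ ‖m‖ → ‖t‖ ≤ ‖l‖ →
      (l.1 * m.2 - m.1 * l.2) * x = s * linAt l p - t * linAt m p →
      ‖l.1 * m.2 - m.1 * l.2‖ * |x| ≤ (‖l‖ + ‖m‖) * max ‖linAt l p‖ ‖linAt m p‖ := by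
    intro s t x hs ht e
    have e2 : ‖l.1 * m.2 - m.1 * l.2‖ * |x| = ‖s * linAt l p - t * linAt m p‖ := by
      rw [← e, norm_mul, Complex.norm_real, Real.norm_eq_abs]
    rw [e2]
    calc ‖s * linAt l p - t * linAt m p‖ ≤ ‖s‖ * ‖linAt l p‖ + ‖t‖ * ‖linAt m p‖ := by
          refine (norm_sub_le _ _).trans ?_
          rw [norm_mul, norm_mul]
      _ ≤ ‖m‖ * max ‖linAt l p‖ ‖linAt m p‖ + ‖l‖ * max ‖linAt l p‖ ‖linAt m p‖ := by
          gcongr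
          · exact le_max_left _ _
          · exact le_max_right _ _
      _ = _ := by ring
  have e : ‖p‖ = max |p.1| |p.2| := rfl
  rw [e]
  rcases max_choice |p.1| |p.2| with h | h
  · rw [h]
    refine key m.2 l.2 _ (norm_snd_le m) (norm_snd_le l) ?_
    unfold linAt; ring
  · rw [h]
    refine key (-m.1) (-l.1) _ (by rw [norm_neg]; exact norm_fst_le m)
      (by rw [norm_neg]; exact norm_fst_le l) ?_
    unfold linAt; ring

theorem exists_linear_minorant (hd : 2 ≤ d) (h : FormNonzeroDisc d a) :
    ∃ (L : Fin d → ℂ × ℂ) (C : ℝ), 0 < C ∧ (∀ j, L j ≠ 0) ∧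
      (∀ j, ∀ x y : ℂ, (L j).1 * x + (L j).2 * y = 0 → BF d a x y = 0) ∧
      ∀ p : ℝ × ℝ, ∃ j, C * ‖p‖ ^ (d - 1) * ‖linAt (L j) p‖ ≤ |BF d a p.1 p.2| := by
  obtain ⟨c, L, hc, hL, hF⟩ := h
  have hL0 : ∀ j, L j ≠ 0 := by
    intro j hj
    have : Nontrivial (Fin d) := Fin.nontrivial_iff_two_le.mpr hd
    obtain ⟨i, hi⟩ := exists_ne j
    exact hL i j hi (by rw [hj]; simp)
  obtain ⟨κ, hκ, hsep⟩ : ∃ κ : ℝ, 0 < κ ∧ ∀ i j, i ≠ j → ∀ p : ℝ × ℝ,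
      κ * ‖p‖ ≤ max ‖linAt (L i) p‖ ‖linAt (L j) p‖ := by
    set κ0 : Fin d × Fin d → ℝ := fun q => if q.1 = q.2 then 1 else
      ‖(L q.1).1 * (L q.2).2 - (L q.2).1 * (L q.1).2‖ / (‖L q.1‖ + ‖L q.2‖) with hκ0
    have hne : Nonempty (Fin d × Fin d) := ⟨(⟨0, by omega⟩, ⟨0, by omega⟩)⟩
    obtain ⟨q0, hq0⟩ := Finite.exists_min κ0
    refine ⟨κ0 q0, ?_, ?_⟩
    · simp only [hκ0]
      split_ifs with hq
      · exact one_pos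
      · exact div_pos (norm_pos_iff.mpr (hL _ _ hq))
          (add_pos (norm_pos_iff.mpr (hL0 _)) (norm_pos_iff.mpr (hL0 _)))
    · intro i j hij p
      have h1 := hq0 (i, j)
      have hpos : 0 < ‖L i‖ + ‖L j‖ := add_pos (norm_pos_iff.mpr (hL0 _)) (norm_pos_iff.mpr (hL0 _))
      have h2 : κ0 (i, j) = ‖(L i).1 * (L j).2 - (L j).1 * (L i).2‖ / (‖L i‖ + ‖L j‖) := by
        simp [hκ0, hij]
      have h3 := det_mul_norm_le (L i) (L j) p
      calc κ0 q0 * ‖p‖ ≤ κ0 (i, j) * ‖p‖ := by gcongr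
        _ = ‖(L i).1 * (L j).2 - (L j).1 * (L i).2‖ * ‖p‖ / (‖L i‖ + ‖L j‖) := by rw [h2]; ring
        _ ≤ _ := by rw [div_le_iff₀ hpos]; linarith
  refine ⟨L, ‖c‖ * κ ^ (d - 1), by positivity, hL0, ?_, ?_⟩
  · intro j x y hxy
    have := hF x y
    rw [show BF d a x y = _ from this, Finset.prod_eq_zero (Finset.mem_univ j) hxy, mul_zero]
  · intro p
    have hne : Nonempty (Fin d) := ⟨⟨0, by omega⟩⟩
    obtain ⟨j, hj⟩ := Finite.exists_min fun i => ‖linAt (L i) p‖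
    refine ⟨j, ?_⟩
    have hval : |BF d a p.1 p.2| = ‖c‖ * ∏ i, ‖linAt (L i) p‖ := by
      have e := hF p.1 p.2
      have e2 : ((BF d a p.1 p.2 : ℝ) : ℂ) = BF d a (p.1 : ℂ) (p.2 : ℂ) :=
        map_BF Complex.ofRealHom d a p.1 p.2
      rw [← Real.norm_eq_abs, ← Complex.norm_real, e2]
      rw [show BF d a (p.1 : ℂ) (p.2 : ℂ) = _ from e, norm_mul, norm_prod]
      rfl
    rw [hval, ← Finset.mul_prod_erase _ _ (Finset.mem_univ j)]
    have : (κ * ‖p‖) ^ (d - 1) ≤ ∏ i ∈ Finset.univ.erase j, ‖linAt (L i) p‖ := by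
      have hcard : (Finset.univ.erase j).card = d - 1 := by
        rw [Finset.card_erase_of_mem (Finset.mem_univ j), Finset.card_univ, Fintype.card_fin]
      rw [← hcard, ← Finset.prod_const]
      refine Finset.prod_le_prod (fun _ _ => by positivity) fun i hi => ?_
      have h1 := hsep i j (Finset.ne_of_mem_erase hi) p
      rwa [max_eq_left (hj i)] at h1
    calc ‖c‖ * κ ^ (d - 1) * ‖p‖ ^ (d - 1) * ‖linAt (L j) p‖
        = ‖c‖ * (‖linAt (L j) p‖ * (κ * ‖p‖) ^ (d - 1)) := by rw [mul_pow]; ring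
      _ ≤ _ := by gcongr

/-- The integral polynomial `F(X, 1)`. -/
noncomputable def formPoly (d : ℕ) (a : Fin (d + 1) → ℤ) : ℤ[X] :=
  ∑ i : Fin (d + 1), C (a i) * X ^ (i : ℕ)

theorem aeval_formPoly (z : ℂ) : aeval z (formPoly d a) = BF d a z 1 := by
  simp [formPoly, BF, map_sum]

theorem natDegree_formPoly_le : (formPoly d a).natDegree ≤ d := by
  refine natDegree_sum_le_of_forall_le _ _ fun i _ => ?_
  exact (natDegree_C_mul_X_pow_le _ _).trans (by omega)

theorem formPoly_ne_zero (hd : 2 ≤ d) (h : FormNonzeroDisc d a) : formPoly d a ≠ 0 := by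
  intro h0
  have hc : ∀ i, a i = 0 := by
    intro i
    have := congrArg (fun p => p.coeff (i : ℕ)) h0
    simp only [formPoly, finsetSum_coeff, coeff_C_mul_X_pow, coeff_zero] at this
    rw [Finset.sum_eq_single i (fun j _ hj => by
      rw [if_neg]; exact fun e => hj (Fin.ext e.symm)) (by simp)] at this
    simpa using this
  obtain ⟨x, y, hxy⟩ := BF_ne_zero_somewhere hd h
  exact hxy (by simp [BF, hc])

theorem exists_integral_generator (hd : 2 ≤ d) (h : FormNonzeroDisc d a) {ξ : ℂ}
    (hξ : BF d a ξ 1 = 0) :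
    ∃ (b : ℤ) (f : ℤ[X]), b ≠ 0 ∧ f.Monic ∧ Irreducible (f.map (algebraMap ℤ ℚ)) ∧
      f.natDegree ≤ d ∧ aeval ((b : ℂ) * ξ) f = 0 := by
  have hg0 := formPoly_ne_zero hd h
  have halg : IsAlgebraic ℤ ξ := ⟨formPoly d a, hg0, by rw [aeval_formPoly, hξ]⟩
  obtain ⟨b, hb, hintegral⟩ := halg.exists_integral_multiple
  rw [zsmul_eq_mul] at hintegral
  have e := minpoly.isIntegrallyClosed_eq_field_fractions' ℚ hintegral
  refine ⟨b, minpoly ℤ ((b : ℂ) * ξ), hb, minpoly.monic hintegral, ?_, ?_, minpoly.aeval _ _⟩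
  · rw [← e]
    exact minpoly.irreducible hintegral.tower_top
  · have e1 : (minpoly ℤ ((b : ℂ) * ξ)).natDegree = (minpoly ℚ ((b : ℂ) * ξ)).natDegree := by
      rw [e, (minpoly.monic hintegral).natDegree_map]
    have hbq : (b : ℚ) ≠ 0 := by exact_mod_cast hb
    have hbc : (b : ℂ) ≠ 0 := by exact_mod_cast hb
    set g : ℚ[X] := ((formPoly d a).map (algebraMap ℤ ℚ)).comp (C (b : ℚ)⁻¹ * X) with hg
    have hdeg : (C (b : ℚ)⁻¹ * X).natDegree = 1 := natDegree_C_mul_X _ (inv_ne_zero hbq)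
    have hmap : (formPoly d a).map (algebraMap ℤ ℚ) ≠ 0 :=
      (Polynomial.map_ne_zero_iff (RingHom.injective_int _)).mpr hg0
    have hgne : g ≠ 0 := by
      intro h0
      rcases comp_eq_zero_iff.mp h0 with h1 | ⟨_, h2⟩
      · exact hmap h1
      · rw [h2] at hdeg
        simp at hdeg
    have hgev : aeval ((b : ℂ) * ξ) g = 0 := by
      rw [hg, aeval_comp]
      simp only [map_mul, aeval_C, aeval_X]
      rw [aeval_map_algebraMap]
      have : (algebraMap ℚ ℂ) (b : ℚ)⁻¹ * ((b : ℂ) * ξ) = ξ := by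
        simp only [map_inv₀, map_intCast]
        field_simp
      rw [this, aeval_formPoly, hξ]
    have := minpoly.degree_le_of_ne_zero ℚ _ hgne hgev
    rw [e1]
    refine (natDegree_le_natDegree this).trans ?_
    rw [hg, natDegree_comp, hdeg, mul_one]
    exact natDegree_map_le.trans natDegree_formPoly_le

theorem rpow_le_one_of_norm {N e : ℝ} (hN : 1 ≤ N) (he : e ≤ 0) : N ^ e ≤ 1 :=
  Real.rpow_le_one_of_one_le_of_nonpos hN he

theorem linear_form_lower (hd : 2 ≤ d) (h : FormNonzeroDisc d a) {l : ℂ × ℂ} (hl : l ≠ 0)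
    (hroot : ∀ x y : ℂ, l.1 * x + l.2 * y = 0 → BF d a x y = 0) {κ : ℝ}
    (hκ : (d : ℝ) / 2 + 1 < κ) :
    ∃ c : ℝ, 0 < c ∧ ∃ R : ℝ, 1 ≤ R ∧ ∀ v : ℤ × ℤ, R ≤ ‖realPt v‖ → linAt l (realPt v) ≠ 0 →
      c * ‖realPt v‖ ^ (1 - κ) ≤ ‖linAt l (realPt v)‖ := by
  have hd0 : (0 : ℝ) ≤ d := Nat.cast_nonneg d
  have hκ1 : 1 - κ ≤ 0 := by linarith
  have int_ge : ∀ m : ℤ, m ≠ 0 → (1 : ℝ) ≤ ‖(m : ℂ)‖ := by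
    intro m hm
    rw [Complex.norm_intCast]
    exact_mod_cast Int.one_le_abs hm
  by_cases hl1 : l.1 = 0
  · have hl2 : l.2 ≠ 0 := fun h2 => hl (Prod.ext hl1 h2)
    refine ⟨‖l.2‖, norm_pos_iff.mpr hl2, 1, le_rfl, fun v hv hne => ?_⟩
    have e : linAt l (realPt v) = l.2 * (v.2 : ℂ) := by simp [linAt, realPt, hl1]
    rw [e] at hne ⊢
    have h2 : v.2 ≠ 0 := fun h0 => hne (by simp [h0])
    rw [norm_mul]
    gcongr
    exact (rpow_le_one_of_norm hv hκ1).trans (int_ge _ h2)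
  set ξ : ℂ := -l.2 / l.1 with hξ
  have hξ0 : BF d a ξ 1 = 0 := hroot _ _ (by rw [hξ]; field_simp; ring)
  obtain ⟨b, f, hb, hf, hirr, hdeg, hθ⟩ := exists_integral_generator hd h hξ0
  set θ : ℂ := (b : ℂ) * ξ with hθdef
  have hbc : (b : ℂ) ≠ 0 := by exact_mod_cast hb
  have hb1 : 1 ≤ ‖(b : ℂ)‖ := int_ge b hb
  have hL : ∀ v : ℤ × ℤ, linAt l (realPt v) = l.1 / b * (b * v.1 - θ * v.2) := by
    intro v
    simp only [linAt, realPt, hθdef, hξ, Complex.ofReal_intCast]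
    field_simp
    ring
  have hcpos : 0 < ‖l.1 / (b : ℂ)‖ := norm_pos_iff.mpr (div_ne_zero hl1 hbc)
  by_cases hn : f.natDegree ≤ 1
  · have hn1 : f.natDegree = 1 := by
      have : f.natDegree ≠ 0 := by
        intro h0
        rw [hf.natDegree_eq_zero] at h0
        rw [h0, Polynomial.map_one] at hirr
        exact hirr.not_isUnit isUnit_one
      omega
    have hfe : f = X + C (f.coeff 0) := hf.eq_X_add_C hn1
    have hθe : θ = -(f.coeff 0 : ℂ) := by
      rw [hfe] at hθ
      simp only [map_add, aeval_X, aeval_C] at hθ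
      exact eq_neg_of_add_eq_zero_left hθ
    refine ⟨‖l.1 / (b : ℂ)‖, hcpos, 1, le_rfl, fun v hv hne => ?_⟩
    rw [hL] at hne ⊢
    rw [norm_mul]
    gcongr
    refine (rpow_le_one_of_norm hv hκ1).trans ?_
    have e : (b : ℂ) * v.1 - θ * v.2 = ((b * v.1 + f.coeff 0 * v.2 : ℤ) : ℂ) := by
      rw [hθe]; push_cast; ring
    rw [e] at hne ⊢
    exact int_ge _ fun h0 => hne (by rw [h0]; simp)
  · have hκn : (f.natDegree : ℝ) / 2 + 1 < κ := by
      have : (f.natDegree : ℝ) ≤ d := by exact_mod_cast hdeg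
      linarith
    obtain ⟨Q, hQ⟩ := thue_eventually hf hirr (by omega) hθ hκn
    set Q' : ℝ := max Q 1 with hQ'
    have hQ1 : 1 ≤ Q' := le_max_right _ _
    have hξn : 0 ≤ ‖ξ‖ * Q' := by positivity
    refine ⟨‖l.1 / (b : ℂ)‖, hcpos, Q' + ‖ξ‖ * Q' + 1, by linarith, fun v hv hne => ?_⟩
    have hv1 : 1 ≤ ‖realPt v‖ := by linarith
    rcases lt_or_ge |(v.2 : ℝ)| Q' with hy | hy
    · have hx : ‖realPt v‖ = |(v.1 : ℝ)| := by
        rw [norm_realPt] at hv ⊢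
        refine max_eq_left ?_
        by_contra hlt
        rw [max_eq_right (not_le.mp hlt).le] at hv
        linarith
      have e : linAt l (realPt v) = l.1 * (v.1 - ξ * v.2) := by
        rw [hL, hθdef]; field_simp
      have h1 : 1 ≤ ‖(v.1 : ℂ) - ξ * v.2‖ := by
        have h2 := norm_sub_norm_le (v.1 : ℂ) (ξ * v.2)
        rw [norm_mul, Complex.norm_intCast, Complex.norm_intCast] at h2
        have h3 : ‖ξ‖ * |(v.2 : ℝ)| ≤ ‖ξ‖ * Q' := by gcongr
        rw [hx] at hv
        linarith
      have h4 : ‖l.1 / (b : ℂ)‖ ≤ ‖l.1‖ := by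
        rw [norm_div]
        exact div_le_self (norm_nonneg _) hb1
      rw [e, norm_mul]
      exact mul_le_mul h4 ((rpow_le_one_of_norm hv1 hκ1).trans h1)
        (by positivity) (norm_nonneg _)
    · have hy0 : (0 : ℝ) < |(v.2 : ℝ)| := by linarith
      have hv2 : v.2 ≠ 0 := by
        rintro h0
        rw [h0] at hy0
        simp at hy0
      have hyc : (v.2 : ℂ) ≠ 0 := by exact_mod_cast hv2
      have h1 := hQ (b * v.1 * v.2.sign) |v.2| (abs_pos.mpr hv2)
        (by push_cast; exact (le_max_left _ _).trans hy)
      have e1 : (((b * v.1 * v.2.sign : ℤ) : ℂ) / ((|v.2| : ℤ) : ℂ)) = b * v.1 / v.2 := by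
        have h3 : ((|v.2| : ℤ) : ℂ) = v.2.sign * v.2 := by
          rw [← Int.sign_mul_self_eq_abs]; push_cast; ring
        have h4 : (v.2.sign : ℂ) ≠ 0 := by
          exact_mod_cast fun h0 => hv2 (Int.sign_eq_zero_iff_zero.mp h0)
        rw [h3]
        push_cast
        field_simp
      rw [e1] at h1
      rw [hL, norm_mul]
      gcongr
      have e2 : (b : ℂ) * v.1 - θ * v.2 = v.2 * (b * v.1 / v.2 - θ) := by field_simp
      rw [e2, norm_mul, Complex.norm_intCast]
      calc ‖realPt v‖ ^ (1 - κ) ≤ |(v.2 : ℝ)| ^ (1 - κ) :=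
            Real.rpow_le_rpow_of_nonpos hy0 (by rw [norm_realPt]; exact le_max_right _ _) hκ1
        _ = |(v.2 : ℝ)| * |(v.2 : ℝ)| ^ (-κ) := by
            rw [sub_eq_add_neg, Real.rpow_add hy0, Real.rpow_one]
        _ ≤ _ := by
            have h5 : (((|v.2| : ℤ) : ℝ)) = |(v.2 : ℝ)| := by push_cast; rfl
            rw [h5] at h1
            gcongr

theorem form_lower (hd : d = 3 ∨ d = 4) (h : FormNonzeroDisc d a) :
    ∃ τ : ℝ, 0 < τ ∧ ∃ R : ℝ, 1 ≤ R ∧ ∀ v : ℤ × ℤ, R ≤ ‖realPt v‖ → BF d a v.1 v.2 ≠ 0 →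
      ‖realPt v‖ ^ τ ≤ |(BF d a v.1 v.2 : ℝ)| := by
  have hd2 : 2 ≤ d := by omega
  obtain ⟨L, C, hC, hL0, hroot, hmin⟩ := exists_linear_minorant hd2 h
  set κ : ℝ := d - 1 / 4 with hκ
  have hκd : (d : ℝ) / 2 + 1 < κ := by
    rcases hd with rfl | rfl <;> norm_num [hκ]
  choose c hc R hR1 hR using fun j => linear_form_lower hd2 h (hL0 j) (hroot j) hκd
  have hne : Nonempty (Fin d) := ⟨⟨0, by omega⟩⟩
  obtain ⟨j0, hj0⟩ := Finite.exists_min c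
  obtain ⟨j1, hj1⟩ := Finite.exists_max R
  have hT : Tendsto (fun x : ℝ => x ^ ((1 : ℝ) / 8)) atTop atTop :=
    tendsto_rpow_atTop (by norm_num)
  obtain ⟨X, hX⟩ := (hT.eventually_ge_atTop (1 / (C * c j0))).exists_forall_of_atTop
  refine ⟨1 / 8, by norm_num, max (R j1) X, (hR1 j1).trans (le_max_left _ _), fun v hv hF => ?_⟩
  have hvR : R j1 ≤ ‖realPt v‖ := (le_max_left _ _).trans hv
  have hv1 : 1 ≤ ‖realPt v‖ := (hR1 j1).trans hvR
  have hv0 : 0 < ‖realPt v‖ := by linarith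
  obtain ⟨j, hj⟩ := hmin (realPt v)
  have hCc : 0 < C * c j0 := mul_pos hC (hc j0)
  have e : BF d a (realPt v).1 (realPt v).2 = ((BF d a v.1 v.2 : ℤ) : ℝ) :=
    (BF_intCast d a v.1 v.2).symm
  have hlin : linAt (L j) (realPt v) ≠ 0 := by
    intro h0
    have h1 := hroot j v.1 v.2 (by simpa [linAt, realPt] using h0)
    rw [← BF_intCast] at h1
    exact hF (by exact_mod_cast h1)
  have h2 := hR j v ((hj1 j).trans hvR) hlin
  have h3 := hX _ ((le_max_right _ _).trans hv)
  rw [div_le_iff₀ hCc] at h3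
  have e4 : ‖realPt v‖ ^ (d - 1) * ‖realPt v‖ ^ (1 - κ) =
      ‖realPt v‖ ^ ((1 : ℝ) / 8) * ‖realPt v‖ ^ ((1 : ℝ) / 8) := by
    rw [← Real.rpow_natCast, ← Real.rpow_add hv0, ← Real.rpow_add hv0]
    congr 1
    rw [Nat.cast_sub (by omega), hκ]
    push_cast
    ring
  rw [← BF_intCast] at *
  rw [e] at hj
  calc ‖realPt v‖ ^ ((1 : ℝ) / 8) = ‖realPt v‖ ^ ((1 : ℝ) / 8) * 1 := by ring
    _ ≤ ‖realPt v‖ ^ ((1 : ℝ) / 8) * (‖realPt v‖ ^ ((1 : ℝ) / 8) * (C * c j0)) := by gcongr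
    _ = C * ‖realPt v‖ ^ (d - 1) * (c j0 * ‖realPt v‖ ^ (1 - κ)) := by
        linear_combination (-(C * c j0)) * e4
    _ ≤ C * ‖realPt v‖ ^ (d - 1) * (c j * ‖realPt v‖ ^ (1 - κ)) := by
        gcongr
        exact hj0 j
    _ ≤ C * ‖realPt v‖ ^ (d - 1) * ‖linAt (L j) (realPt v)‖ := by gcongr
    _ ≤ _ := hj

end Roots

section Counting

variable {d : ℕ} {a : Fin (d + 1) → ℤ}

theorem norm_mul_abs_det_le (l : ℂ × ℂ) (p q : ℝ × ℝ) {ε B : ℝ} (hp : ‖linAt l p‖ ≤ ε)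
    (hq : ‖linAt l q‖ ≤ ε) (hpB : ‖p‖ ≤ B) (hqB : ‖q‖ ≤ B) :
    ‖l‖ * |p.1 * q.2 - q.1 * p.2| ≤ 2 * B * ε := by
  have key : ∀ (s : ℂ) (x y : ℝ), |x| ≤ B → |y| ≤ B →
      s * ((p.1 * q.2 - q.1 * p.2 : ℝ) : ℂ) = linAt l p * x - linAt l q * y →
      ‖s‖ * |p.1 * q.2 - q.1 * p.2| ≤ 2 * B * ε := by
    intro s x y hx hy e
    have hε : 0 ≤ ε := (norm_nonneg _).trans hp
    calc ‖s‖ * |p.1 * q.2 - q.1 * p.2| = ‖linAt l p * x - linAt l q * y‖ := by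
          rw [← e, norm_mul, Complex.norm_real, Real.norm_eq_abs]
      _ ≤ ‖linAt l p‖ * |x| + ‖linAt l q‖ * |y| := by
          refine (norm_sub_le _ _).trans ?_
          rw [norm_mul, norm_mul, Complex.norm_real, Complex.norm_real, Real.norm_eq_abs,
            Real.norm_eq_abs]
      _ ≤ ε * B + ε * B := by gcongr
      _ = _ := by ring
  have e : ‖l‖ = max ‖l.1‖ ‖l.2‖ := rfl
  have hp1 : |p.1| ≤ B := (norm_fst_le p).trans hpB
  have hp2 : |p.2| ≤ B := (norm_snd_le p).trans hpB
  have hq1 : |q.1| ≤ B := (norm_fst_le q).trans hqB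
  have hq2 : |q.2| ≤ B := (norm_snd_le q).trans hqB
  rw [e]
  rcases max_choice ‖l.1‖ ‖l.2‖ with h | h
  · rw [h]
    refine key l.1 q.2 p.2 hq2 hp2 ?_
    unfold linAt; push_cast; ring
  · rw [h]
    refine key l.2 (-q.1) (-p.1) (by rwa [abs_neg]) (by rwa [abs_neg]) ?_
    unfold linAt; push_cast; ring

theorem eq_zero_of_small_of_parallel {w z : ℤ × ℤ} {g : ℕ} (hg : 0 < g)
    (hw : Int.gcd w.1 w.2 = g) (hz1 : (g : ℤ) ∣ z.1) (hz2 : (g : ℤ) ∣ z.2)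
    (hdet : w.1 * z.2 = z.1 * w.2) (hlt : ‖realPt z‖ < ‖realPt w‖) : z = 0 := by
  obtain ⟨w1, w2, hco, e1, e2⟩ : ∃ w1 w2 : ℤ, IsCoprime w1 w2 ∧ w.1 = w1 * g ∧ w.2 = w2 * g := by
    have hpos : 0 < Int.gcd w.1 w.2 := by omega
    obtain ⟨m, n, h1, h2, h3⟩ := Int.exists_gcd_one hpos
    exact ⟨m, n, Int.isCoprime_iff_gcd_eq_one.mpr h1, by rw [← hw]; exact h2, by rw [← hw]; exact h3⟩
  obtain ⟨z1, hz1⟩ := hz1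
  obtain ⟨z2, hz2⟩ := hz2
  have hg0 : (g : ℤ) ≠ 0 := by exact_mod_cast hg.ne'
  have hdet' : w1 * z2 = z1 * w2 := by
    rw [e1, e2, hz1, hz2] at hdet
    have : (g : ℤ) * g * (w1 * z2) = g * g * (z1 * w2) := by linear_combination hdet
    exact mul_left_cancel₀ (mul_ne_zero hg0 hg0) this
  obtain ⟨u, t, hut⟩ := hco
  set k : ℤ := u * z1 + t * z2 with hk
  have hk1 : z1 = k * w1 := by rw [hk]; linear_combination (-z1) * hut - t * hdet'
  have hk2 : z2 = k * w2 := by rw [hk]; linear_combination (-z2) * hut + u * hdet'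
  have hzk1 : z.1 = k * w.1 := by rw [hz1, e1, hk1]; ring
  have hzk2 : z.2 = k * w.2 := by rw [hz2, e2, hk2]; ring
  by_contra hne
  have hk0 : k ≠ 0 := by
    rintro h0
    exact hne (Prod.ext (by simp [hzk1, h0]) (by simp [hzk2, h0]))
  have hsm : realPt z = (k : ℝ) • realPt w := by
    simp [realPt, hzk1, hzk2]
  rw [hsm, norm_smul, Real.norm_eq_abs] at hlt
  have : (1 : ℝ) ≤ |(k : ℝ)| := by exact_mod_cast Int.one_le_abs hk0
  nlinarith [norm_nonneg (realPt w)]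

theorem card_strip_gcd_le {l : ℂ × ℂ} (hl : l ≠ 0) {R X ε : ℝ} (hR : 1 ≤ R) (hX : 1 ≤ X)
    (hε : 0 ≤ ε) {g : ℕ} (hg : 0 < g) (T : Finset (ℤ × ℤ))
    (hT : ∀ v ∈ T, R < ‖realPt v‖ ∧ ‖realPt v‖ ≤ R * X ∧ ‖linAt l (realPt v)‖ ≤ ε ∧
      Int.gcd v.1 v.2 = g) :
    (T.card : ℝ) ≤ 16 * X ^ 2 * (2 * (2 * (R * X) * ε / ‖l‖) * ((g : ℝ) ^ 2)⁻¹ + 1) := by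
  have hR0 : 0 < R := by linarith
  have hlpos : 0 < ‖l‖ := norm_pos_iff.mpr hl
  have hgR : (0 : ℝ) < g := by exact_mod_cast hg
  rcases T.eq_empty_or_nonempty with rfl | ⟨w, hw⟩
  · simp only [Finset.card_empty, Nat.cast_zero]
    positivity
  obtain ⟨hw1, hw2, hw3, hw4⟩ := hT w hw
  set M : ℝ := 2 * (R * X) * ε / ‖l‖ * ((g : ℝ) ^ 2)⁻¹ with hM
  have hM0 : 0 ≤ M := by positivity
  have hdvd : ∀ v ∈ T, (g : ℤ) ∣ v.1 ∧ (g : ℤ) ∣ v.2 := by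
    intro v hv
    rw [← (hT v hv).2.2.2]
    exact ⟨Int.gcd_dvd_left .., Int.gcd_dvd_right ..⟩
  have hdd : ∀ v ∈ T, (g : ℤ) ^ 2 ∣ w.1 * v.2 - v.1 * w.2 := by
    intro v hv
    rw [sq]
    exact dvd_sub (mul_dvd_mul (hdvd w hw).1 (hdvd v hv).2) (mul_dvd_mul (hdvd v hv).1 (hdvd w hw).2)
  choose! D hD using hdd
  set φ : ℤ × ℤ → ℤ × ℤ × ℤ := fun v => (D v, ⌊(v.1 : ℝ) / R⌋, ⌊(v.2 : ℝ) / R⌋) with hφ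
  set I : Finset ℤ := Finset.Icc ⌊-X⌋ ⌊X⌋ with hI
  have hmaps : ∀ v ∈ T, φ v ∈ Finset.Icc (-⌊M⌋) ⌊M⌋ ×ˢ (I ×ˢ I) := by
    intro v hv
    obtain ⟨_, hv2, hv3, _⟩ := hT v hv
    have hco : ∀ x : ℤ, |(x : ℝ)| ≤ ‖realPt v‖ → ⌊(x : ℝ) / R⌋ ∈ I := by
      intro x hx
      have h1 : |(x : ℝ) / R| ≤ X := by
        rw [abs_div, abs_of_pos hR0, div_le_iff₀ hR0]
        linarith
      rw [hI, Finset.mem_Icc]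
      exact ⟨Int.floor_le_floor (abs_le.mp h1).1, Int.floor_le_floor (abs_le.mp h1).2⟩
    have h1 := norm_mul_abs_det_le l (realPt w) (realPt v) hw3 hv3 hw2 hv2
    have h2 : |(D v : ℝ)| ≤ M := by
      have e : (realPt w).1 * (realPt v).2 - (realPt v).1 * (realPt w).2 = (g : ℝ) ^ 2 * D v := by
        have := hD v hv
        simp only [realPt]
        exact_mod_cast this
      rw [e, abs_mul, abs_of_pos (by positivity)] at h1
      rw [hM, ← div_eq_mul_inv, le_div_iff₀ (by positivity), le_div_iff₀ hlpos]
      linarith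
    have h3 : |D v| ≤ ⌊M⌋ := by
      rw [Int.le_floor]
      exact_mod_cast h2
    simp only [hφ, Finset.mem_product, Finset.mem_Icc]
    exact ⟨abs_le.mp h3, hco _ (le_max_left _ _), hco _ (le_max_right _ _)⟩
  have hinj : Set.InjOn φ T := by
    intro u hu v hv huv
    simp only [hφ, Prod.mk.injEq] at huv
    obtain ⟨h1, h2, h3⟩ := huv
    have hsub : ∀ x y : ℤ, ⌊(x : ℝ) / R⌋ = ⌊(y : ℝ) / R⌋ → |((x - y : ℤ) : ℝ)| < R := by
      intro x y hxy
      have := Int.abs_sub_lt_one_of_floor_eq_floor hxy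
      rw [← sub_div, abs_div, abs_of_pos hR0, div_lt_one hR0] at this
      push_cast
      exact this
    have : u - v = 0 := by
      refine eq_zero_of_small_of_parallel hg hw4 (dvd_sub (hdvd u hu).1 (hdvd v hv).1)
        (dvd_sub (hdvd u hu).2 (hdvd v hv).2) ?_ (lt_trans ?_ hw1)
      · have e1 := hD u hu
        have e2 := hD v hv
        rw [h1] at e1
        simp only [Prod.fst_sub, Prod.snd_sub]
        linear_combination e1 - e2
      · rw [norm_realPt]
        exact max_lt (hsub _ _ h2) (hsub _ _ h3)
    exact sub_eq_zero.mp this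
  have hcard := Finset.card_le_card_of_injOn φ hmaps hinj
  rw [Finset.card_product, Finset.card_product] at hcard
  have hIc : (I.card : ℝ) ≤ 4 * X := by
    rw [hI, Int.card_Icc]
    have h1 := Int.floor_le X
    have h2 := Int.lt_floor_add_one (-X)
    have h3 : ⌊-X⌋ ≤ ⌊X⌋ := Int.floor_le_floor (by linarith)
    have h4 : (((⌊X⌋ + 1 - ⌊-X⌋).toNat : ℤ) : ℝ) = ((⌊X⌋ + 1 - ⌊-X⌋ : ℤ) : ℝ) := by
      rw [Int.toNat_of_nonneg (by omega)]
    rw [Int.cast_natCast] at h4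
    rw [h4]
    push_cast
    linarith
  have hMc : ((Finset.Icc (-⌊M⌋) ⌊M⌋).card : ℝ) ≤ 2 * M + 1 := by
    rw [Int.card_Icc]
    have h1 := Int.floor_le M
    have h3 : 0 ≤ ⌊M⌋ := Int.floor_nonneg.mpr hM0
    have h4 : (((⌊M⌋ + 1 - -⌊M⌋).toNat : ℤ) : ℝ) = ((⌊M⌋ + 1 - -⌊M⌋ : ℤ) : ℝ) := by
      rw [Int.toNat_of_nonneg (by omega)]
    rw [Int.cast_natCast] at h4
    rw [h4]
    push_cast
    linarith
  calc (T.card : ℝ) ≤ (Finset.Icc (-⌊M⌋) ⌊M⌋).card * (I.card * I.card) := by exact_mod_cast hcard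
    _ ≤ (2 * M + 1) * ((4 * X) * (4 * X)) := by gcongr
    _ = _ := by rw [hM]; ring

theorem card_strip_le {l : ℂ × ℂ} (hl : l ≠ 0) {R X ε H : ℝ} (hR : 1 ≤ R) (hX : 1 ≤ X)
    (hε : 0 ≤ ε) (hH : 0 ≤ H) (T : Finset (ℤ × ℤ))
    (hT : ∀ v ∈ T, R < ‖realPt v‖ ∧ ‖realPt v‖ ≤ R * X ∧ ‖linAt l (realPt v)‖ ≤ ε ∧
      (Int.gcd v.1 v.2 : ℝ) ≤ H) :
    (T.card : ℝ) ≤ 16 * X ^ 2 * (8 * (R * X) * ε / ‖l‖ + H) := by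
  classical
  set M : ℝ := 2 * (2 * (R * X) * ε / ‖l‖) with hM
  have hM0 : 0 ≤ M := by positivity
  have hmaps : ∀ v ∈ T, Int.gcd v.1 v.2 ∈ Finset.Ioo 0 (⌊H⌋₊ + 1) := by
    intro v hv
    obtain ⟨h1, _, _, h4⟩ := hT v hv
    rw [Finset.mem_Ioo, Nat.lt_succ_iff]
    refine ⟨Nat.pos_of_ne_zero fun h0 => ?_, Nat.le_floor h4⟩
    rw [Int.gcd_eq_zero_iff] at h0
    rw [norm_realPt, h0.1, h0.2] at h1
    simp at h1
    linarith
  rw [Finset.card_eq_sum_card_fiberwise hmaps]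
  push_cast
  calc ∑ g ∈ Finset.Ioo 0 (⌊H⌋₊ + 1), ((T.filter fun v => Int.gcd v.1 v.2 = g).card : ℝ)
      ≤ ∑ g ∈ Finset.Ioo 0 (⌊H⌋₊ + 1), 16 * X ^ 2 * (M * ((g : ℝ) ^ 2)⁻¹ + 1) := by
        refine Finset.sum_le_sum fun g hg => ?_
        refine card_strip_gcd_le hl hR hX hε (Finset.mem_Ioo.mp hg).1 _ fun v hv => ?_
        rw [Finset.mem_filter] at hv
        obtain ⟨h1, h2, h3, _⟩ := hT v hv.1
        exact ⟨h1, h2, h3, hv.2⟩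
    _ = 16 * X ^ 2 * (M * ∑ g ∈ Finset.Ioo 0 (⌊H⌋₊ + 1), ((g : ℝ) ^ 2)⁻¹ + ⌊H⌋₊) := by
        rw [← Finset.mul_sum, Finset.sum_add_distrib, ← Finset.mul_sum, Finset.sum_const,
          Nat.card_Ioo]
        simp
    _ ≤ 16 * X ^ 2 * (M * 2 + H) := by
        have h1 := sum_Ioo_inv_sq_le (α := ℝ) 0 (⌊H⌋₊ + 1)
        have h2 := Nat.floor_le hH
        norm_num at h1
        gcongr
    _ = _ := by rw [hM]; ring

theorem gcd_pow_le_form (hd : d ≠ 0) {v : ℤ × ℤ} {Z : ℝ} (hF : BF d a v.1 v.2 ≠ 0)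
    (hZ : |(BF d a (v.1 : ℝ) v.2)| ≤ Z) : (Int.gcd v.1 v.2 : ℝ) ≤ Z ^ ((1 : ℝ) / d) := by
  set g := Int.gcd v.1 v.2 with hg
  obtain ⟨x, hx⟩ : (g : ℤ) ∣ v.1 := Int.gcd_dvd_left ..
  obtain ⟨y, hy⟩ : (g : ℤ) ∣ v.2 := Int.gcd_dvd_right ..
  have h1 : ((g : ℤ)) ^ d ∣ BF d a v.1 v.2 := ⟨BF d a x y, by rw [hx, hy, BF_mul]⟩
  have h2 : ((g : ℤ)) ^ d ≤ |BF d a v.1 v.2| :=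
    Int.le_of_dvd (abs_pos.mpr hF) ((dvd_abs _ _).mpr h1)
  have h3 : (g : ℝ) ^ d ≤ Z := by
    refine le_trans ?_ hZ
    rw [← BF_intCast]
    exact_mod_cast h2
  rw [one_div]
  calc (g : ℝ) = ((g : ℝ) ^ d) ^ ((d : ℝ)⁻¹) := (Real.pow_rpow_inv_natCast (by positivity) hd).symm
    _ ≤ _ := by gcongr

theorem card_shell_le (hd : 2 ≤ d) (h : FormNonzeroDisc d a) :
    ∃ K : ℝ, 0 < K ∧ ∀ (Z R X : ℝ), 1 ≤ Z → 1 ≤ R → 1 ≤ X → ∀ T : Finset (ℤ × ℤ),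
      (∀ v ∈ T, R < ‖realPt v‖ ∧ ‖realPt v‖ ≤ R * X ∧ BF d a v.1 v.2 ≠ 0 ∧
        |BF d a (v.1 : ℝ) v.2| ≤ Z) →
      (T.card : ℝ) ≤ K * X ^ 3 * (Z / R ^ (d - 2) + Z ^ ((1 : ℝ) / d)) := by
  classical
  obtain ⟨L, C, hC, hL0, hroot, hmin⟩ := exists_linear_minorant hd h
  have hLpos : ∀ j, 0 < ‖L j‖ := fun j => norm_pos_iff.mpr (hL0 j)
  have hsum : 0 ≤ ∑ j, 16 * (8 / (C * ‖L j‖) + 1) :=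
    Finset.sum_nonneg fun j _ => by have := hLpos j; positivity
  refine ⟨∑ j, 16 * (8 / (C * ‖L j‖) + 1) + 1, by linarith, fun Z R X hZ hR hX T hT => ?_⟩
  have hR0 : 0 < R := by linarith
  have hZ0 : 0 < Z := by linarith
  choose J hJ using hmin
  have hmaps : ∀ v ∈ T, J (realPt v) ∈ Finset.univ := fun v _ => Finset.mem_univ _
  set E : ℝ := Z / R ^ (d - 2) + Z ^ ((1 : ℝ) / d) with hE
  have hE0 : 0 < E := by positivity
  calc (T.card : ℝ) = ∑ j, ((T.filter fun v => J (realPt v) = j).card : ℝ) := by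
        rw [Finset.card_eq_sum_card_fiberwise hmaps]
        push_cast
        rfl
    _ ≤ ∑ j, 16 * (8 / (C * ‖L j‖) + 1) * (X ^ 3 * E) := by
        refine Finset.sum_le_sum fun j _ => ?_
        have hlj := hLpos j
        have h1 := card_strip_le (hL0 j) hR hX (ε := Z / (C * R ^ (d - 1))) (by positivity)
          (H := Z ^ ((1 : ℝ) / d)) (by positivity) (T.filter fun v => J (realPt v) = j) (by
            intro v hv
            rw [Finset.mem_filter] at hv
            obtain ⟨h1, h2, h3, h4⟩ := hT v hv.1
            refine ⟨h1, h2, ?_, gcd_pow_le_form (by omega) h3 h4⟩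
            have h5 := hJ (realPt v)
            rw [hv.2] at h5
            rw [le_div_iff₀ (by positivity)]
            calc ‖linAt (L j) (realPt v)‖ * (C * R ^ (d - 1))
                = C * R ^ (d - 1) * ‖linAt (L j) (realPt v)‖ := by ring
              _ ≤ C * ‖realPt v‖ ^ (d - 1) * ‖linAt (L j) (realPt v)‖ := by gcongr
              _ ≤ Z := h5.trans h4)
        refine h1.trans ?_
        have e1 : R ^ (d - 1) = R * R ^ (d - 2) := by
          rw [← pow_succ']; congr 1; omega
        have e2 : 8 * (R * X) * (Z / (C * R ^ (d - 1))) / ‖L j‖ =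
            X * (8 / (C * ‖L j‖) * (Z / R ^ (d - 2))) := by
          rw [e1]; field_simp
        rw [e2]
        have h2 : Z / R ^ (d - 2) ≤ E := le_add_of_nonneg_right (by positivity)
        have h3 : Z ^ ((1 : ℝ) / d) ≤ E := le_add_of_nonneg_left (by positivity)
        calc 16 * X ^ 2 * (X * (8 / (C * ‖L j‖) * (Z / R ^ (d - 2))) + Z ^ ((1 : ℝ) / d))
            ≤ 16 * X ^ 2 * (X * (8 / (C * ‖L j‖) * E) + X * E) := by
              gcongr
              exact h3.trans (le_mul_of_one_le_left hE0.le hX)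
          _ = _ := by ring
    _ = (∑ j, 16 * (8 / (C * ‖L j‖) + 1)) * X ^ 3 * E := by
        rw [← Finset.sum_mul]; ring
    _ ≤ _ := by gcongr; linarith

theorem card_iterated_shell_le {K Z R X : ℝ} (hZ : 1 ≤ Z) (hR : 1 ≤ R) (hX : 1 ≤ X) (hK : 0 < K)
    (hshell : ∀ (R' : ℝ), 1 ≤ R' → ∀ T : Finset (ℤ × ℤ),
      (∀ v ∈ T, R' < ‖realPt v‖ ∧ ‖realPt v‖ ≤ R' * X ∧ BF d a v.1 v.2 ≠ 0 ∧
        |BF d a (v.1 : ℝ) v.2| ≤ Z) →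
      (T.card : ℝ) ≤ K * X ^ 3 * (Z / R' ^ (d - 2) + Z ^ ((1 : ℝ) / d))) (m : ℕ) :
    ∀ T : Finset (ℤ × ℤ), (∀ v ∈ T, R < ‖realPt v‖ ∧ ‖realPt v‖ ≤ R * X ^ m ∧
      BF d a v.1 v.2 ≠ 0 ∧ |BF d a (v.1 : ℝ) v.2| ≤ Z) →
      (T.card : ℝ) ≤ m * (K * X ^ 3 * (Z / R ^ (d - 2) + Z ^ ((1 : ℝ) / d))) := by
  classical
  induction m with
  | zero =>
    intro T hT
    have : T = ∅ := Finset.eq_empty_of_forall_notMem fun v hv => by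
      obtain ⟨h1, h2, _⟩ := hT v hv
      rw [pow_zero, mul_one] at h2
      linarith
    simp [this]
  | succ m ih =>
    intro T hT
    have hXm : 1 ≤ X ^ m := one_le_pow₀ hX
    have h1 := ih (T.filter fun v => ‖realPt v‖ ≤ R * X ^ m) (by
      intro v hv
      rw [Finset.mem_filter] at hv
      obtain ⟨h1, _, h3⟩ := hT v hv.1
      exact ⟨h1, hv.2, h3⟩)
    have hR' : R ≤ R * X ^ m := le_mul_of_one_le_right (by linarith) hXm
    have h2 := hshell (R * X ^ m) (hR.trans hR') (T.filter fun v => ¬ ‖realPt v‖ ≤ R * X ^ m) (by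
      intro v hv
      rw [Finset.mem_filter] at hv
      obtain ⟨_, h2, h3⟩ := hT v hv.1
      exact ⟨not_le.mp hv.2, by rw [mul_assoc, ← pow_succ]; exact h2, h3⟩)
    have h3 : K * X ^ 3 * (Z / (R * X ^ m) ^ (d - 2) + Z ^ ((1 : ℝ) / d)) ≤
        K * X ^ 3 * (Z / R ^ (d - 2) + Z ^ ((1 : ℝ) / d)) := by
      gcongr
    have h4 := Finset.card_filter_add_card_filter_not (s := T) (fun v => ‖realPt v‖ ≤ R * X ^ m)
    have h5 : (T.card : ℝ) = (T.filter fun v => ‖realPt v‖ ≤ R * X ^ m).card +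
        (T.filter fun v => ¬ ‖realPt v‖ ≤ R * X ^ m).card := by exact_mod_cast h4.symm
    push_cast
    linarith

theorem card_far_le (hd : d = 3 ∨ d = 4) (h : FormNonzeroDisc d a) {η : ℝ} (hη : 0 < η)
    (hηd : η ≤ 1 / d) :
    ∃ K : ℝ, 0 < K ∧ ∃ Z0 : ℝ, 1 ≤ Z0 ∧ ∀ Z R : ℝ, Z0 ≤ Z → Z ^ (1 / (d : ℝ) + η) ≤ R →
      ∀ T : Finset (ℤ × ℤ), (∀ v ∈ T, R < ‖realPt v‖ ∧ BF d a v.1 v.2 ≠ 0 ∧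
        |BF d a (v.1 : ℝ) v.2| ≤ Z) → (T.card : ℝ) ≤ K * Z ^ (2 / (d : ℝ) - η / 2) := by
  have hd2 : 2 ≤ d := by omega
  have hdR : (0 : ℝ) < d := by exact_mod_cast (by omega : 0 < d)
  obtain ⟨K, hK, hshell⟩ := card_shell_le hd2 h
  obtain ⟨τ, hτ, R0, hR0, hlow⟩ := form_lower hd h
  set m : ℕ := ⌈6 / (τ * η)⌉₊ with hm
  have hT : Tendsto (fun x : ℝ => x ^ (1 / (d : ℝ) + η)) atTop atTop :=
    tendsto_rpow_atTop (by positivity)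
  obtain ⟨Z1, hZ1⟩ := (hT.eventually_ge_atTop R0).exists_forall_of_atTop
  refine ⟨2 * m * K + 1, by positivity, max Z1 1, le_max_right _ _, fun Z R hZ hR T hTv => ?_⟩
  have hZ1' : 1 ≤ Z := (le_max_right _ _).trans hZ
  have hZpos : 0 < Z := by linarith
  have hRR : R0 ≤ R := (hZ1 Z ((le_max_left _ _).trans hZ)).trans hR
  have hR1 : 1 ≤ R := hR0.trans hRR
  set X : ℝ := Z ^ (η / 6) with hX
  have hX1 : 1 ≤ X := Real.one_le_rpow hZ1' (by positivity)
  have h1 := card_iterated_shell_le hZ1' hR1 hX1 hK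
    (fun R' hR' T hT => hshell Z R' X hZ1' hR' hX1 T hT) m T (by
      intro v hv
      obtain ⟨h1, h2, h3⟩ := hTv v hv
      refine ⟨h1, ?_, h2, h3⟩
      have h4 := (hlow v (by linarith) h2).trans h3
      have hv0 : 0 ≤ ‖realPt v‖ := norm_nonneg _
      calc ‖realPt v‖ = (‖realPt v‖ ^ τ) ^ τ⁻¹ := by
            rw [← Real.rpow_mul hv0, mul_inv_cancel₀ hτ.ne', Real.rpow_one]
        _ ≤ Z ^ τ⁻¹ := by gcongr
        _ ≤ Z ^ (η / 6 * m) := by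
            gcongr
            · have := Nat.le_ceil (6 / (τ * η))
              rw [← hm, div_le_iff₀ (by positivity)] at this
              rw [inv_eq_one_div, div_le_iff₀ hτ]
              linarith
        _ = X ^ m := by rw [hX, Real.rpow_mul hZpos.le, Real.rpow_natCast]
        _ ≤ R * X ^ m := le_mul_of_one_le_left (by positivity) hR1)
  refine h1.trans ?_
  have hX3 : X ^ 3 = Z ^ (η / 2) := by
    rw [hX, ← Real.rpow_natCast, ← Real.rpow_mul hZpos.le]
    congr 1; push_cast; ring
  have e1 : Z / R ^ (d - 2) ≤ Z ^ (2 / (d : ℝ) - η) := by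
    rw [div_le_iff₀ (by positivity)]
    have hZR : (Z ^ (1 / (d : ℝ) + η)) ^ (d - 2) ≤ R ^ (d - 2) := by gcongr
    calc Z = Z ^ (1 : ℝ) := (Real.rpow_one Z).symm
      _ ≤ Z ^ (2 / (d : ℝ) - η + (1 / (d : ℝ) + η) * ((d - 2 : ℕ) : ℝ)) := by
          gcongr
          · rcases hd with rfl | rfl
            · norm_num
            · norm_num; linarith
      _ = Z ^ (2 / (d : ℝ) - η) * (Z ^ (1 / (d : ℝ) + η)) ^ (d - 2) := by
          rw [Real.rpow_add hZpos, Real.rpow_mul hZpos.le, Real.rpow_natCast]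
      _ ≤ _ := by gcongr
  have e2 : Z ^ ((1 : ℝ) / d) ≤ Z ^ (2 / (d : ℝ) - η) := by
    gcongr
    · have : 2 / (d : ℝ) = 1 / d + 1 / d := by ring
      linarith
  have e3 : Z ^ (η / 2) * Z ^ (2 / (d : ℝ) - η) = Z ^ (2 / (d : ℝ) - η / 2) := by
    rw [← Real.rpow_add hZpos]; congr 1; ring
  rw [hX3]
  calc (m : ℝ) * (K * Z ^ (η / 2) * (Z / R ^ (d - 2) + Z ^ ((1 : ℝ) / d)))
      ≤ m * (K * Z ^ (η / 2) * (Z ^ (2 / (d : ℝ) - η) + Z ^ (2 / (d : ℝ) - η))) := by gcongr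
    _ = 2 * m * K * (Z ^ (η / 2) * Z ^ (2 / (d : ℝ) - η)) := by ring
    _ = 2 * m * K * Z ^ (2 / (d : ℝ) - η / 2) := by rw [e3]
    _ ≤ _ := by
        gcongr
        linarith

end Counting

section Area

open MeasureTheory
open scoped Pointwise

variable {d : ℕ} {a : Fin (d + 1) → ℤ}

theorem continuous_linAt (l : ℂ × ℂ) : Continuous fun p : ℝ × ℝ => linAt l p := by
  unfold linAt
  fun_prop

theorem volume_affine_strip_le {s : ℂ} (hs : s ≠ 0) (t : ℂ) {ε : ℝ} :
    volume {x : ℝ | ‖s * x + t‖ ≤ ε} ≤ ENNReal.ofReal (2 * ε / ‖s‖) := by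
  have hs0 : 0 < ‖s‖ := norm_pos_iff.mpr hs
  refine (Real.volume_le_diam _).trans (Metric.ediam_le fun x hx y hy => ?_)
  rw [edist_dist]
  refine ENNReal.ofReal_le_ofReal ?_
  rw [le_div_iff₀ hs0, Real.dist_eq]
  simp only [Set.mem_ofPred_eq] at hx hy
  calc |x - y| * ‖s‖ = ‖(s * x + t) - (s * y + t)‖ := by
        rw [show (s * x + t) - (s * y + t) = s * ((x - y : ℝ) : ℂ) by push_cast; ring, norm_mul,
          Complex.norm_real, Real.norm_eq_abs, mul_comm]
    _ ≤ ε + ε := (norm_sub_le _ _).trans (add_le_add hx hy)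
    _ = 2 * ε := by ring

theorem lintegral_le_of_supported {f : ℝ → ENNReal} {B c : ℝ} (hc : 0 ≤ c)
    (h1 : ∀ x, f x ≤ ENNReal.ofReal c) (h0 : ∀ x, B < |x| → f x = 0) :
    ∫⁻ x, f x ≤ ENNReal.ofReal (c * (2 * B)) := by
  calc ∫⁻ x, f x ≤ ∫⁻ x, (Set.Icc (-B) B).indicator (fun _ => ENNReal.ofReal c) x := by
        refine lintegral_mono fun x => ?_
        by_cases hx : x ∈ Set.Icc (-B) B
        · rw [Set.indicator_of_mem hx]
          exact h1 x
        · rw [h0 x]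
          · exact zero_le
          · by_contra hlt
            exact hx (abs_le.mp (not_lt.mp hlt))
    _ = _ := by
        rw [lintegral_indicator_const measurableSet_Icc, Real.volume_Icc, ← ENNReal.ofReal_mul hc]
        congr 2; ring

theorem volume_strip_le {l : ℂ × ℂ} (hl : l ≠ 0) {B ε : ℝ} (hε : 0 ≤ ε) :
    volume {p : ℝ × ℝ | ‖p‖ ≤ B ∧ ‖linAt l p‖ ≤ ε} ≤ ENNReal.ofReal (4 * B * ε / ‖l‖) := by
  have hl0 : 0 < ‖l‖ := norm_pos_iff.mpr hl
  have hmeas : MeasurableSet {p : ℝ × ℝ | ‖p‖ ≤ B ∧ ‖linAt l p‖ ≤ ε} :=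
    ((isClosed_le continuous_norm continuous_const).inter
      (isClosed_le (continuous_linAt l).norm continuous_const)).measurableSet
  have e : ‖l‖ = max ‖l.1‖ ‖l.2‖ := rfl
  have e2 : 4 * B * ε / ‖l‖ = 2 * ε / ‖l‖ * (2 * B) := by ring
  rw [Measure.volume_eq_prod, e2]
  rcases max_choice ‖l.1‖ ‖l.2‖ with h | h
  · rw [Measure.prod_apply_symm hmeas]
    rw [e, h] at hl0 ⊢
    refine lintegral_le_of_supported (by positivity) (fun y => ?_) fun y hy => ?_
    · refine (measure_mono ?_).trans (volume_affine_strip_le (norm_pos_iff.mp hl0) (l.2 * y))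
      rintro x ⟨_, hx⟩
      exact hx
    · have : (fun x : ℝ => (x, y)) ⁻¹' {p : ℝ × ℝ | ‖p‖ ≤ B ∧ ‖linAt l p‖ ≤ ε} = ∅ := by
        refine Set.eq_empty_of_forall_notMem fun x hx => ?_
        exact absurd ((norm_snd_le (x, y)).trans hx.1) (not_le.mpr hy)
      rw [this, measure_empty]
  · rw [Measure.prod_apply hmeas]
    rw [e, h] at hl0 ⊢
    refine lintegral_le_of_supported (by positivity) (fun x => ?_) fun x hx => ?_
    · refine (measure_mono ?_).trans (volume_affine_strip_le (norm_pos_iff.mp hl0) (l.1 * x))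
      rintro y ⟨_, hy⟩
      simp only [linAt] at hy
      rwa [add_comm] at hy
    · have : Prod.mk x ⁻¹' {p : ℝ × ℝ | ‖p‖ ≤ B ∧ ‖linAt l p‖ ≤ ε} = ∅ := by
        refine Set.eq_empty_of_forall_notMem fun y hy => ?_
        exact absurd ((norm_fst_le (x, y)).trans hy.1) (not_le.mpr hx)
      rw [this, measure_empty]

theorem volume_shell_le (hd : 3 ≤ d) (h : FormNonzeroDisc d a) :
    ∃ K : ℝ, 0 < K ∧ ∀ R : ℝ, 1 ≤ R →
      volume {p : ℝ × ℝ | R < ‖p‖ ∧ ‖p‖ ≤ 2 * R ∧ |BF d a p.1 p.2| ≤ 1} ≤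
        ENNReal.ofReal (K / R) := by
  obtain ⟨L, C, hC, hL0, _, hmin⟩ := exists_linear_minorant (by omega) h
  have hLpos : ∀ j, 0 < ‖L j‖ := fun j => norm_pos_iff.mpr (hL0 j)
  have hsum : 0 ≤ ∑ j, 8 / (C * ‖L j‖) :=
    Finset.sum_nonneg fun j _ => by have := hLpos j; positivity
  refine ⟨∑ j, 8 / (C * ‖L j‖) + 1, by linarith, fun R hR => ?_⟩
  have hR0 : 0 < R := by linarith
  have hsub : {p : ℝ × ℝ | R < ‖p‖ ∧ ‖p‖ ≤ 2 * R ∧ |BF d a p.1 p.2| ≤ 1} ⊆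
      ⋃ j ∈ (Finset.univ : Finset (Fin d)),
        {p : ℝ × ℝ | ‖p‖ ≤ 2 * R ∧ ‖linAt (L j) p‖ ≤ 1 / (C * R ^ (d - 1))} := by
    rintro p ⟨h1, h2, h3⟩
    obtain ⟨j, hj⟩ := hmin p
    simp only [Finset.mem_univ, Set.iUnion_true, Set.mem_iUnion]
    refine ⟨j, h2, ?_⟩
    rw [le_div_iff₀ (by positivity)]
    calc ‖linAt (L j) p‖ * (C * R ^ (d - 1)) = C * R ^ (d - 1) * ‖linAt (L j) p‖ := by ring
      _ ≤ C * ‖p‖ ^ (d - 1) * ‖linAt (L j) p‖ := by gcongr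
      _ ≤ 1 := hj.trans h3
  calc volume _ ≤ _ := measure_mono hsub
    _ ≤ ∑ j, _ := measure_biUnion_finset_le _ _
    _ ≤ ∑ j, ENNReal.ofReal (8 / (C * ‖L j‖) * (1 / R)) := by
        refine Finset.sum_le_sum fun j _ => (volume_strip_le (hL0 j) (by positivity)).trans ?_
        refine ENNReal.ofReal_le_ofReal ?_
        have hlj := hLpos j
        have hR2 : R * R ≤ R ^ (d - 1) := by
          rw [← sq]; exact pow_le_pow_right₀ hR (by omega)
        calc 4 * (2 * R) * (1 / (C * R ^ (d - 1))) / ‖L j‖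
            = 8 / (C * ‖L j‖) * (R / R ^ (d - 1)) := by field_simp; ring
          _ ≤ 8 / (C * ‖L j‖) * (1 / R) := by
              gcongr 8 / (C * ‖L j‖) * ?_
              rw [div_le_div_iff₀ (by positivity) hR0]
              linarith
    _ = ENNReal.ofReal (∑ j, 8 / (C * ‖L j‖) * (1 / R)) :=
        (ENNReal.ofReal_sum_of_nonneg fun j _ => by have := hLpos j; positivity).symm
    _ ≤ _ := by
        refine ENNReal.ofReal_le_ofReal ?_
        rw [← Finset.sum_mul, mul_one_div]
        gcongr
        linarith

theorem volume_tail_le (hd : 3 ≤ d) (h : FormNonzeroDisc d a) :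
    ∃ K : ℝ, 0 < K ∧ ∀ R : ℝ, 1 ≤ R →
      volume {p : ℝ × ℝ | |BF d a p.1 p.2| ≤ 1 ∧ R < ‖p‖} ≤ ENNReal.ofReal (K / R) := by
  obtain ⟨K, hK, hsh⟩ := volume_shell_le hd h
  refine ⟨2 * K, by positivity, fun R hR => ?_⟩
  have hR0 : 0 < R := by linarith
  have hsub : {p : ℝ × ℝ | |BF d a p.1 p.2| ≤ 1 ∧ R < ‖p‖} ⊆ ⋃ k : ℕ,
      {p : ℝ × ℝ | R * 2 ^ k < ‖p‖ ∧ ‖p‖ ≤ 2 * (R * 2 ^ k) ∧ |BF d a p.1 p.2| ≤ 1} := by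
    rintro p ⟨h1, h2⟩
    have hex : ∃ k : ℕ, ‖p‖ ≤ R * 2 ^ k := by
      obtain ⟨k, hk⟩ := pow_unbounded_of_one_lt ‖p‖ (one_lt_two)
      exact ⟨k, hk.le.trans (le_mul_of_one_le_left (by positivity) hR)⟩
    classical
    have hs := Nat.find_spec hex
    have hmin := fun m => Nat.find_min hex (m := m)
    set k := Nat.find hex
    rcases Nat.eq_zero_or_pos k with h0 | hpos
    · rw [h0] at hs
      linarith
    · rw [Set.mem_iUnion]
      refine ⟨k - 1, not_le.mp (hmin (k - 1) (by omega)), ?_, h1⟩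
      refine hs.trans (le_of_eq ?_)
      obtain ⟨m, hm⟩ : ∃ m, k = m + 1 := ⟨k - 1, by omega⟩
      rw [hm, Nat.add_sub_cancel, pow_succ]
      ring
  calc volume _ ≤ _ := measure_mono hsub
    _ ≤ ∑' k : ℕ, _ := measure_iUnion_le _
    _ ≤ ∑' k : ℕ, ENNReal.ofReal (K / R * (1 / 2) ^ k) := by
        refine ENNReal.tsum_le_tsum fun k => ?_
        refine (hsh _ (hR.trans (le_mul_of_one_le_right hR0.le (one_le_pow₀ one_le_two)))).trans ?_
        refine ENNReal.ofReal_le_ofReal (le_of_eq ?_)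
        rw [one_div, inv_pow]
        field_simp
    _ = ENNReal.ofReal (∑' k : ℕ, K / R * (1 / 2) ^ k) :=
        (ENNReal.ofReal_tsum_of_nonneg (fun k => by positivity)
          (summable_geometric_two.mul_left _)).symm
    _ = _ := by
        rw [tsum_mul_left, tsum_geometric_two]
        congr 1; ring

theorem volume_form_region_lt_top (hd : 3 ≤ d) (h : FormNonzeroDisc d a) :
    volume {p : ℝ × ℝ | |BF d a p.1 p.2| ≤ 1} < ⊤ := by
  obtain ⟨K, hK, ht⟩ := volume_tail_le hd h
  have hsub : {p : ℝ × ℝ | |BF d a p.1 p.2| ≤ 1} ⊆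
      Metric.closedBall 0 1 ∪ {p : ℝ × ℝ | |BF d a p.1 p.2| ≤ 1 ∧ 1 < ‖p‖} := by
    intro p hp
    rcases le_or_gt ‖p‖ 1 with h1 | h1
    · exact Or.inl (by simpa using h1)
    · exact Or.inr ⟨hp, h1⟩
  refine (measure_mono hsub).trans_lt ((measure_union_le _ _).trans_lt ?_)
  exact ENNReal.add_lt_top.mpr ⟨measure_closedBall_lt_top,
    (ht 1 le_rfl).trans_lt ENNReal.ofReal_lt_top⟩

theorem volume_scaled {t Z R : ℝ} (ht : 0 < t) (hZ : Z = t ^ d) :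
    volume {p : ℝ × ℝ | |BF d a p.1 p.2| ≤ Z ∧ t * R < ‖p‖} =
      ENNReal.ofReal (t ^ 2) * volume {p : ℝ × ℝ | |BF d a p.1 p.2| ≤ 1 ∧ R < ‖p‖} := by
  have e : {p : ℝ × ℝ | |BF d a p.1 p.2| ≤ Z ∧ t * R < ‖p‖} =
      t • {p : ℝ × ℝ | |BF d a p.1 p.2| ≤ 1 ∧ R < ‖p‖} := by
    ext p
    rw [Set.mem_smul_set_iff_inv_smul_mem₀ ht.ne']
    simp only [Set.mem_ofPred_eq, Prod.smul_fst, Prod.smul_snd, smul_eq_mul]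
    rw [BF_mul, abs_mul, abs_of_pos (show (0 : ℝ) < t⁻¹ ^ d by positivity), norm_smul, norm_inv, Real.norm_eq_abs,
      abs_of_pos ht, inv_pow, inv_mul_le_iff₀ (by positivity), lt_inv_mul_iff₀ ht, mul_one, hZ]
  rw [e, Measure.addHaar_smul, Module.finrank_prod, Module.finrank_self, abs_of_pos (by positivity)]

theorem volume_region (hd : d ≠ 0) {Z : ℝ} (hZ : 0 < Z) :
    (volume {p : ℝ × ℝ | |BF d a p.1 p.2| ≤ Z}).toReal = AF d a * Z ^ ((2 : ℝ) / d) := by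
  have h1 := volume_scaled (a := a) (t := Z ^ ((d : ℝ)⁻¹)) (Z := Z) (R := -1) (by positivity)
    (Real.rpow_inv_natCast_pow hZ.le hd).symm
  have e : ∀ W s : ℝ, s < 0 → {p : ℝ × ℝ | |BF d a p.1 p.2| ≤ W ∧ s < ‖p‖} =
      {p : ℝ × ℝ | |BF d a p.1 p.2| ≤ W} := by
    intro W s hs
    ext p
    simp only [Set.mem_ofPred_eq, and_iff_left_iff_imp]
    exact fun _ => hs.trans_le (norm_nonneg p)
  rw [e _ _ (by have : 0 < Z ^ ((d : ℝ)⁻¹) := by positivity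
                linarith), e _ _ (by norm_num)] at h1
  rw [h1, ENNReal.toReal_mul, ENNReal.toReal_ofReal (by positivity), mul_comm,
    ← Real.rpow_natCast, ← Real.rpow_mul hZ.le]
  congr 2
  push_cast
  ring

theorem exists_lipschitz_bound (d : ℕ) (a : Fin (d + 1) → ℤ) :
    ∃ C : ℝ, 0 < C ∧ ∀ (B δ : ℝ), 0 ≤ δ → ∀ p q : ℝ × ℝ, ‖p‖ ≤ B → ‖q‖ ≤ B →
      ‖p - q‖ ≤ δ → |BF d a p.1 p.2 - BF d a q.1 q.2| ≤ C * δ * B ^ (d - 1) := by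
  refine ⟨(∑ i, |(a i : ℝ)|) * d + 1,
    by have : 0 ≤ ∑ i, |(a i : ℝ)| := Finset.sum_nonneg fun i _ => abs_nonneg _
       positivity, fun B δ hδ p q hp hq hpq => ?_⟩
  have hB : 0 ≤ B := (norm_nonneg p).trans hp
  have hpow : ∀ (n : ℕ) (x y : ℝ), |x| ≤ B → |y| ≤ B → |x - y| ≤ δ →
      |x ^ n - y ^ n| ≤ δ * n * B ^ (n - 1) := by
    intro n x y hx hy hxy
    refine (abs_pow_sub_pow_le x y n).trans ?_
    gcongr
    exact max_le hx hy
  have hp1 : |p.1| ≤ B := (norm_fst_le p).trans hp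
  have hp2 : |p.2| ≤ B := (norm_snd_le p).trans hp
  have hq1 : |q.1| ≤ B := (norm_fst_le q).trans hq
  have hq2 : |q.2| ≤ B := (norm_snd_le q).trans hq
  have h1 : |p.1 - q.1| ≤ δ := (norm_fst_le (p - q)).trans hpq
  have h2 : |p.2 - q.2| ≤ δ := (norm_snd_le (p - q)).trans hpq
  have hmon : ∀ n m : ℕ, n + m = d →
      |p.1 ^ n * p.2 ^ m - q.1 ^ n * q.2 ^ m| ≤ d * δ * B ^ (d - 1) := by
    intro n m hnm
    have e : p.1 ^ n * p.2 ^ m - q.1 ^ n * q.2 ^ m =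
        (p.1 ^ n - q.1 ^ n) * p.2 ^ m + q.1 ^ n * (p.2 ^ m - q.2 ^ m) := by ring
    have hn : (n : ℝ) * B ^ (n - 1) * B ^ m = n * B ^ (d - 1) := by
      rcases Nat.eq_zero_or_pos n with h0 | h0
      · simp [h0]
      · rw [mul_assoc, ← pow_add]; congr 2; omega
    have hm : (m : ℝ) * (B ^ n * B ^ (m - 1)) = m * B ^ (d - 1) := by
      rcases Nat.eq_zero_or_pos m with h0 | h0
      · simp [h0]
      · rw [← pow_add]; congr 2; omega
    calc |p.1 ^ n * p.2 ^ m - q.1 ^ n * q.2 ^ m|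
        ≤ |p.1 ^ n - q.1 ^ n| * |p.2| ^ m + |q.1| ^ n * |p.2 ^ m - q.2 ^ m| := by
          rw [e]
          refine (abs_add_le _ _).trans ?_
          rw [abs_mul, abs_mul, abs_pow, abs_pow]
      _ ≤ (δ * n * B ^ (n - 1)) * B ^ m + B ^ n * (δ * m * B ^ (m - 1)) := by
          gcongr
          · exact hpow n _ _ hp1 hq1 h1
          · exact hpow m _ _ hp2 hq2 h2
      _ = δ * (n * B ^ (n - 1) * B ^ m) + δ * (m * (B ^ n * B ^ (m - 1))) := by ring
      _ = δ * (n * B ^ (d - 1)) + δ * (m * B ^ (d - 1)) := by rw [hn, hm]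
      _ = d * δ * B ^ (d - 1) := by rw [← hnm]; push_cast; ring
  calc |BF d a p.1 p.2 - BF d a q.1 q.2|
      = |∑ i : Fin (d + 1), (a i : ℝ) *
          (p.1 ^ (i : ℕ) * p.2 ^ (d - (i : ℕ)) - q.1 ^ (i : ℕ) * q.2 ^ (d - (i : ℕ)))| := by
        unfold BF
        rw [← Finset.sum_sub_distrib]
        congr 1
        exact Finset.sum_congr rfl fun i _ => by ring
    _ ≤ ∑ i : Fin (d + 1), |(a i : ℝ)| * (d * δ * B ^ (d - 1)) := by
        refine (Finset.abs_sum_le_sum_abs _ _).trans (Finset.sum_le_sum fun i _ => ?_)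
        rw [abs_mul]
        gcongr
        exact hmon _ _ (by omega)
    _ = (∑ i, |(a i : ℝ)|) * d * δ * B ^ (d - 1) := by rw [← Finset.sum_mul]; ring
    _ ≤ _ := by gcongr; linarith

/-- The half-open square of side `N` with lower left corner `v`. -/
def cell (N : ℕ) (v : ℤ × ℤ) : Set (ℝ × ℝ) :=
  Set.Ico (v.1 : ℝ) (v.1 + N) ×ˢ Set.Ico (v.2 : ℝ) (v.2 + N)

theorem measurableSet_cell (N : ℕ) (v : ℤ × ℤ) : MeasurableSet (cell N v) :=
  measurableSet_Ico.prod measurableSet_Ico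

theorem volume_cell (N : ℕ) (v : ℤ × ℤ) : volume (cell N v) = ENNReal.ofReal ((N : ℝ) ^ 2) := by
  rw [cell, Measure.volume_eq_prod, Measure.prod_prod, Real.volume_Ico, Real.volume_Ico,
    ← ENNReal.ofReal_mul (by simp)]
  congr 1; ring

theorem norm_sub_le_of_mem_cell {N : ℕ} {v : ℤ × ℤ} {p : ℝ × ℝ} (hp : p ∈ cell N v) :
    ‖p - realPt v‖ ≤ N := by
  obtain ⟨⟨h1, h2⟩, h3, h4⟩ := hp
  refine max_le ?_ ?_
  · rw [Real.norm_eq_abs, abs_le]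
    constructor <;> simp only [realPt, Prod.fst_sub] <;> linarith
  · rw [Real.norm_eq_abs, abs_le]
    constructor <;> simp only [realPt, Prod.snd_sub] <;> linarith

theorem eq_of_dvd_of_cell {N : ℕ} {x y : ℤ} {t : ℝ} (hdvd : (N : ℤ) ∣ x - y)
    (hx : t ∈ Set.Ico (x : ℝ) (x + N)) (hy : t ∈ Set.Ico (y : ℝ) (y + N)) : x = y := by
  have h1 : x < y + N := by
    have : (x : ℝ) < y + N := hx.1.trans_lt hy.2
    exact_mod_cast this
  have h2 : y < x + N := by
    have : (y : ℝ) < x + N := hy.1.trans_lt hx.2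
    exact_mod_cast this
  have := Int.eq_zero_of_abs_lt_dvd hdvd (by rw [abs_lt]; constructor <;> omega)
  omega

theorem card_mul_sq_le_volume {N : ℕ} {b : ℤ × ℤ} {D : Set (ℝ × ℝ)} (hD : volume D < ⊤)
    (T : Finset (ℤ × ℤ)) (hT : ∀ v ∈ T, (N : ℤ) ∣ v.1 - b.1 ∧ (N : ℤ) ∣ v.2 - b.2)
    (hsub : ∀ v ∈ T, cell N v ⊆ D) : (T.card : ℝ) * N ^ 2 ≤ (volume D).toReal := by
  have hdisj : (T : Set (ℤ × ℤ)).PairwiseDisjoint (cell N) := by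
    intro u hu v hv huv
    refine Set.disjoint_left.mpr fun p hp hq => huv ?_
    have h1 := hT u hu
    have h2 := hT v hv
    refine Prod.ext (eq_of_dvd_of_cell ?_ hp.1 hq.1) (eq_of_dvd_of_cell ?_ hp.2 hq.2)
    · simpa using dvd_sub h1.1 h2.1
    · simpa using dvd_sub h1.2 h2.2
  have h1 := measure_biUnion_finset (μ := volume) hdisj fun v _ => measurableSet_cell N v
  have h2 : volume (⋃ v ∈ T, cell N v) ≤ volume D :=
    measure_mono (Set.iUnion₂_subset fun v hv => hsub v hv)
  rw [h1, Finset.sum_congr rfl fun v _ => volume_cell N v, Finset.sum_const] at h2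
  have h3 := ENNReal.toReal_mono hD.ne h2
  rw [nsmul_eq_mul, ENNReal.toReal_mul, ENNReal.toReal_natCast,
    ENNReal.toReal_ofReal (by positivity)] at h3
  exact h3

theorem volume_le_card_mul_sq {N : ℕ} {D : Set (ℝ × ℝ)} (T : Finset (ℤ × ℤ))
    (hsub : D ⊆ ⋃ v ∈ T, cell N v) : (volume D).toReal ≤ (T.card : ℝ) * N ^ 2 := by
  have h1 := (measure_mono hsub).trans (measure_biUnion_finset_le (μ := volume) T (cell N))
  rw [Finset.sum_congr rfl fun v _ => volume_cell N v, Finset.sum_const, nsmul_eq_mul] at h1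
  have h3 := ENNReal.toReal_mono (ENNReal.mul_ne_top (by simp) ENNReal.ofReal_ne_top) h1
  rw [ENNReal.toReal_mul, ENNReal.toReal_natCast, ENNReal.toReal_ofReal (by positivity)] at h3
  exact h3

theorem exists_mem_cell {N : ℕ} (hN : 0 < N) (b : ℤ × ℤ) (p : ℝ × ℝ) :
    ∃ v : ℤ × ℤ, p ∈ cell N v ∧ (N : ℤ) ∣ v.1 - b.1 ∧ (N : ℤ) ∣ v.2 - b.2 := by
  have hN0 : (0 : ℝ) < N := by exact_mod_cast hN
  have key : ∀ (b : ℤ) (t : ℝ), ∃ x : ℤ, t ∈ Set.Ico (x : ℝ) (x + N) ∧ (N : ℤ) ∣ x - b := by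
    intro b t
    refine ⟨b + N * ⌊(t - b) / N⌋, ?_, by simp⟩
    have h1 := Int.floor_le ((t - b) / N)
    have h2 := Int.lt_floor_add_one ((t - b) / N)
    rw [le_div_iff₀ hN0] at h1
    rw [div_lt_iff₀ hN0] at h2
    push_cast
    constructor <;> linarith
  obtain ⟨x, hx, hx'⟩ := key b.1 p.1
  obtain ⟨y, hy, hy'⟩ := key b.2 p.2
  exact ⟨(x, y), ⟨hx, hy⟩, hx', hy'⟩

theorem AF_nonneg (d : ℕ) (a : Fin (d + 1) → ℤ) : 0 ≤ AF d a := ENNReal.toReal_nonneg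

theorem volume_region_lt_top (hd : 3 ≤ d) (h : FormNonzeroDisc d a) {Z : ℝ} (hZ : 0 < Z) :
    volume {p : ℝ × ℝ | |BF d a p.1 p.2| ≤ Z} < ⊤ := by
  have ht : 0 < Z ^ ((d : ℝ)⁻¹) := by positivity
  have h1 := volume_scaled (a := a) (t := Z ^ ((d : ℝ)⁻¹)) (Z := Z) (R := -1) ht
    (Real.rpow_inv_natCast_pow hZ.le (by omega)).symm
  have hle : volume {p : ℝ × ℝ | |BF d a p.1 p.2| ≤ Z} ≤
      volume {p : ℝ × ℝ | |BF d a p.1 p.2| ≤ Z ∧ Z ^ ((d : ℝ)⁻¹) * -1 < ‖p‖} :=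
    measure_mono fun p hp => ⟨hp, by linarith [norm_nonneg p]⟩
  refine hle.trans_lt (h1 ▸ ENNReal.mul_lt_top ENNReal.ofReal_lt_top ?_)
  exact (measure_mono fun p hp => hp.1).trans_lt (volume_form_region_lt_top hd h)

theorem volume_region_tail_le (hd : 3 ≤ d) (h : FormNonzeroDisc d a) :
    ∃ K : ℝ, 0 < K ∧ ∀ Z R : ℝ, 0 < Z → 1 ≤ R →
      (volume {p : ℝ × ℝ | |BF d a p.1 p.2| ≤ Z ∧ Z ^ (1 / (d : ℝ)) * R < ‖p‖}).toReal ≤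
        K * Z ^ (2 / (d : ℝ)) / R := by
  obtain ⟨K, hK, ht⟩ := volume_tail_le hd h
  refine ⟨K, hK, fun Z R hZ hR => ?_⟩
  have ht0 : 0 < Z ^ (1 / (d : ℝ)) := by positivity
  have hZd : Z = (Z ^ (1 / (d : ℝ))) ^ d := by
    rw [one_div]
    exact (Real.rpow_inv_natCast_pow hZ.le (by omega)).symm
  rw [volume_scaled ht0 hZd, ENNReal.toReal_mul, ENNReal.toReal_ofReal (by positivity),
    ← Real.rpow_natCast, ← Real.rpow_mul hZ.le]
  have h1 := ENNReal.toReal_mono ENNReal.ofReal_ne_top (ht R hR)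
  rw [ENNReal.toReal_ofReal (by positivity)] at h1
  have e : 1 / (d : ℝ) * (2 : ℕ) = 2 / d := by push_cast; ring
  rw [e]
  calc Z ^ (2 / (d : ℝ)) * _ ≤ Z ^ (2 / (d : ℝ)) * (K / R) := by gcongr
    _ = _ := by ring

theorem rpow_mul_one_add_le {Z t p : ℝ} (hZ : 0 < Z) (ht : 0 ≤ t) (hp : p ≤ 1) :
    (Z * (1 + t)) ^ p ≤ Z ^ p * (1 + t) := by
  rw [Real.mul_rpow hZ.le (by linarith)]
  gcongr
  calc (1 + t) ^ p ≤ (1 + t) ^ (1 : ℝ) := Real.rpow_le_rpow_of_exponent_le (by linarith) hp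
    _ = _ := Real.rpow_one _

theorem le_rpow_mul_one_sub {Z t p : ℝ} (hZ : 0 < Z) (ht : 0 ≤ t) (ht1 : t < 1) (hp : p ≤ 1) :
    Z ^ p * (1 - t) ≤ (Z * (1 - t)) ^ p := by
  rw [Real.mul_rpow hZ.le (by linarith)]
  gcongr
  calc 1 - t = (1 - t) ^ (1 : ℝ) := (Real.rpow_one _).symm
    _ ≤ (1 - t) ^ p := Real.rpow_le_rpow_of_exponent_ge (by linarith) (by linarith) hp

theorem card_residue_class_asymptotic (hd : 3 ≤ d) (h : FormNonzeroDisc d a) {N : ℕ} (hN : 0 < N)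
    {η : ℝ} (hη : 0 < η) (hηd : η * d ≤ 1 / d) :
    ∃ K : ℝ, 0 < K ∧ ∃ Z0 : ℝ, 1 ≤ Z0 ∧ ∀ Z : ℝ, Z0 ≤ Z → ∀ b : ℤ × ℤ, ∀ T : Finset (ℤ × ℤ),
      (∀ v, v ∈ T ↔ ‖realPt v‖ ≤ Z ^ (1 / (d : ℝ) + η) ∧ |BF d a (v.1 : ℝ) v.2| ≤ Z ∧
        (N : ℤ) ∣ v.1 - b.1 ∧ (N : ℤ) ∣ v.2 - b.2) →
      |(T.card : ℝ) * N ^ 2 - AF d a * Z ^ (2 / (d : ℝ))| ≤ K * Z ^ (2 / (d : ℝ) - η) := by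
  have hd0 : d ≠ 0 := by omega
  have hdR : (3 : ℝ) ≤ d := by exact_mod_cast hd
  have hNR : (1 : ℝ) ≤ N := by exact_mod_cast hN
  have hp : (2 : ℝ) / d ≤ 1 := by rw [div_le_one (by linarith)]; linarith
  obtain ⟨C, hC, hlip⟩ := exists_lipschitz_bound d a
  obtain ⟨K, hK, htail⟩ := volume_region_tail_le hd h
  have hA := AF_nonneg d a
  set C' : ℝ := C * N * 2 ^ (d - 1) with hC'
  have hC'0 : 0 < C' := by positivity
  have hT1 : Tendsto (fun x : ℝ => x ^ (1 / (d : ℝ) + η)) atTop atTop :=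
    tendsto_rpow_atTop (by positivity)
  have hT2 : Tendsto (fun x : ℝ => x ^ η) atTop atTop := tendsto_rpow_atTop hη
  obtain ⟨Z1, hZ1⟩ := (hT1.eventually_ge_atTop (2 * N)).exists_forall_of_atTop
  obtain ⟨Z2, hZ2⟩ := (hT2.eventually_ge_atTop (2 * C' + 2)).exists_forall_of_atTop
  refine ⟨AF d a * C' + 2 * K, by positivity, max (max Z1 Z2) 1, le_max_right _ _,
    fun Z hZ b T hT => ?_⟩
  have hZ1' : 1 ≤ Z := (le_max_right _ _).trans hZ
  have hZ0 : 0 < Z := by linarith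
  have hY := hZ1 Z (((le_max_left _ _).trans (le_max_left _ _)).trans hZ)
  have hX := hZ2 Z (((le_max_right _ _).trans (le_max_left _ _)).trans hZ)
  set Y : ℝ := Z ^ (1 / (d : ℝ) + η) with hYdef
  set X : ℝ := Z ^ η with hXdef
  have hX0 : 0 < X := by positivity
  have hYX : Y = Z ^ (1 / (d : ℝ)) * X := Real.rpow_add hZ0 _ _
  have hZX : Z ^ (2 / (d : ℝ)) / X = Z ^ (2 / (d : ℝ) - η) := (Real.rpow_sub hZ0 _ _).symm
  set t : ℝ := C' / X with htdef
  have ht0 : 0 ≤ t := by positivity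
  have ht1 : t ≤ 1 / 2 := by
    rw [htdef, div_le_iff₀ hX0]; linarith
  have hYpow : Y ^ (d - 1) ≤ Z / X := by
    rw [le_div_iff₀ hX0, hYdef, hXdef, ← Real.rpow_natCast, ← Real.rpow_mul hZ0.le,
      ← Real.rpow_add hZ0]
    calc Z ^ ((1 / (d : ℝ) + η) * ((d - 1 : ℕ) : ℝ) + η) ≤ Z ^ (1 : ℝ) := by
          refine Real.rpow_le_rpow_of_exponent_le hZ1' ?_
          rw [Nat.cast_sub (by omega)]
          push_cast
          have e : (1 / (d : ℝ) + η) * (d - 1) + η = 1 + η * d - 1 / d := by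
            field_simp; ring
          linarith
      _ = Z := Real.rpow_one Z
  have herr : ∀ p q : ℝ × ℝ, ‖p‖ ≤ 2 * Y → ‖q‖ ≤ 2 * Y → ‖p - q‖ ≤ N →
      |BF d a p.1 p.2| ≤ |BF d a q.1 q.2| + Z * t := by
    intro p q hp hq hpq
    have h1 := hlip (2 * Y) N (by positivity) p q hp hq hpq
    have h2 : C * N * (2 * Y) ^ (d - 1) ≤ Z * t := by
      calc C * N * (2 * Y) ^ (d - 1) = C' * Y ^ (d - 1) := by rw [mul_pow, hC']; ring
        _ ≤ C' * (Z / X) := by gcongr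
        _ = Z * t := by rw [htdef]; ring
    have h3 := abs_sub_abs_le_abs_sub (BF d a p.1 p.2) (BF d a q.1 q.2)
    linarith
  have hupper : (T.card : ℝ) * N ^ 2 ≤ AF d a * (Z ^ (2 / (d : ℝ)) * (1 + t)) := by
    have hpos : 0 < Z * (1 + t) := by positivity
    calc (T.card : ℝ) * N ^ 2
        ≤ (volume {p : ℝ × ℝ | |BF d a p.1 p.2| ≤ Z * (1 + t)}).toReal := by
          refine card_mul_sq_le_volume (volume_region_lt_top hd h hpos) T
            (fun v hv => ((hT v).mp hv).2.2) fun v hv p hp => ?_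
          obtain ⟨h1, h2, _⟩ := (hT v).mp hv
          have h3 := norm_sub_le_of_mem_cell hp
          have h4 := norm_sub_norm_le p (realPt v)
          have h5 := herr p (realPt v) (by linarith) (by linarith) h3
          have h6 : |BF d a (realPt v).1 (realPt v).2| ≤ Z := h2
          simp only [Set.mem_ofPred_eq]
          linarith
      _ = AF d a * (Z * (1 + t)) ^ (2 / (d : ℝ)) := volume_region hd0 hpos
      _ ≤ _ := by
          gcongr
          exact rpow_mul_one_add_le hZ0 ht0 hp
  have hlower : AF d a * (Z ^ (2 / (d : ℝ)) * (1 - t)) ≤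
      (T.card : ℝ) * N ^ 2 + 2 * K * Z ^ (2 / (d : ℝ) - η) := by
    have hpos : 0 < Z * (1 - t) := mul_pos hZ0 (by linarith)
    set D : Set (ℝ × ℝ) := {p | |BF d a p.1 p.2| ≤ Z * (1 - t) ∧ ‖p‖ ≤ Y / 2} with hD
    set E : Set (ℝ × ℝ) := {p | |BF d a p.1 p.2| ≤ Z ∧ Z ^ (1 / (d : ℝ)) * (X / 2) < ‖p‖} with hE
    have hDT : D ⊆ ⋃ v ∈ T, cell N v := by
      rintro p ⟨hp1, hp2⟩
      obtain ⟨v, hv, hvb⟩ := exists_mem_cell hN b p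
      refine Set.mem_iUnion₂.mpr ⟨v, (hT v).mpr ⟨?_, ?_, hvb⟩, hv⟩
      all_goals
        have h3 := norm_sub_le_of_mem_cell hv
        have h4 := norm_sub_norm_le (realPt v) p
        rw [norm_sub_rev] at h4
      · linarith
      · rw [norm_sub_rev] at h3
        have h5 := herr (realPt v) p (by linarith [norm_sub_rev p (realPt v)])
          (by linarith [norm_nonneg p]) h3
        have h6 : |BF d a (v.1 : ℝ) v.2| ≤ |BF d a p.1 p.2| + Z * t := h5
        linarith
    have hE_top : volume E < ⊤ :=
      (measure_mono fun p hp => hp.1).trans_lt (volume_region_lt_top hd h hZ0)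
    have hD_top : volume D < ⊤ :=
      (measure_mono fun p hp => hp.1).trans_lt (volume_region_lt_top hd h hpos)
    have hsub : {p : ℝ × ℝ | |BF d a p.1 p.2| ≤ Z * (1 - t)} ⊆ D ∪ E := by
      intro p hp
      simp only [Set.mem_ofPred_eq] at hp
      rcases le_or_gt ‖p‖ (Y / 2) with h1 | h1
      · exact Or.inl ⟨hp, h1⟩
      · refine Or.inr ⟨hp.trans ?_, ?_⟩
        · exact mul_le_of_le_one_right hZ0.le (by linarith)
        · rw [hYX] at h1
          linarith
    have h1 := ENNReal.toReal_mono (ENNReal.add_lt_top.mpr ⟨hD_top, hE_top⟩).ne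
      ((measure_mono hsub).trans (measure_union_le _ _))
    rw [ENNReal.toReal_add hD_top.ne hE_top.ne, volume_region hd0 hpos] at h1
    have h2 := volume_le_card_mul_sq T hDT
    have h3 := htail Z (X / 2) hZ0 (by linarith)
    have h4 : K * Z ^ (2 / (d : ℝ)) / (X / 2) = 2 * K * Z ^ (2 / (d : ℝ) - η) := by
      rw [← hZX]; field_simp
    have h5 : AF d a * (Z ^ (2 / (d : ℝ)) * (1 - t)) ≤ AF d a * (Z * (1 - t)) ^ (2 / (d : ℝ)) := by
      gcongr
      exact le_rpow_mul_one_sub hZ0 ht0 (by linarith) hp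
    rw [h4] at h3
    linarith
  have e : AF d a * (Z ^ (2 / (d : ℝ)) * t) = AF d a * C' * Z ^ (2 / (d : ℝ) - η) := by
    rw [← hZX, htdef]; ring
  have hpos2 : 0 < Z ^ (2 / (d : ℝ) - η) := by positivity
  have hKp : 0 ≤ 2 * K * Z ^ (2 / (d : ℝ) - η) := by positivity
  rw [abs_le]
  constructor
  · linarith
  · linarith

end Area

section Final

variable {d : ℕ} {a : Fin (d + 1) → ℤ}

theorem card_Icc_floor_le {B : ℝ} (hB : 0 ≤ B) :
    ((Finset.Icc (-⌊B⌋) ⌊B⌋).card : ℝ) ≤ 2 * B + 1 := by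
  rw [Int.card_Icc]
  have h1 := Int.floor_le B
  have h3 : 0 ≤ ⌊B⌋ := Int.floor_nonneg.mpr hB
  have h4 : (((⌊B⌋ + 1 - -⌊B⌋).toNat : ℤ) : ℝ) = ((⌊B⌋ + 1 - -⌊B⌋ : ℤ) : ℝ) := by
    rw [Int.toNat_of_nonneg (by omega)]
  rw [Int.cast_natCast] at h4
  rw [h4]
  push_cast
  linarith

theorem mem_Icc_floor {B : ℝ} {x : ℤ} : x ∈ Finset.Icc (-⌊B⌋) ⌊B⌋ ↔ |(x : ℝ)| ≤ B := by
  rw [Finset.mem_Icc, ← abs_le, Int.le_floor]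
  push_cast
  rfl

/-- The integral points of sup norm at most `B`. -/
noncomputable def ptBox (B : ℝ) : Finset (ℤ × ℤ) :=
  Finset.Icc (-⌊B⌋) ⌊B⌋ ×ˢ Finset.Icc (-⌊B⌋) ⌊B⌋

theorem mem_ptBox {B : ℝ} {v : ℤ × ℤ} : v ∈ ptBox B ↔ ‖realPt v‖ ≤ B := by
  rw [ptBox, Finset.mem_product, mem_Icc_floor, mem_Icc_floor, norm_realPt, max_le_iff]

theorem card_line_le {l : ℂ × ℂ} (hl : l ≠ 0) {B : ℝ} (hB : 0 ≤ B) (T : Finset (ℤ × ℤ))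
    (hT : ∀ v ∈ T, ‖realPt v‖ ≤ B ∧ linAt l (realPt v) = 0) : (T.card : ℝ) ≤ 2 * B + 1 := by
  refine le_trans ?_ (card_Icc_floor_le hB)
  rw [Nat.cast_le]
  by_cases h1 : l.1 = 0
  · have h2 : l.2 ≠ 0 := fun h2 => hl (Prod.ext h1 h2)
    refine Finset.card_le_card_of_injOn Prod.fst
      (fun v hv => mem_Icc_floor.mpr ((le_max_left _ _).trans (hT v hv).1)) fun u hu v hv huv => ?_
    have hu2 := (hT u hu).2
    have hv2 := (hT v hv).2
    simp only [linAt, realPt, h1, zero_mul, zero_add, mul_eq_zero, h2, false_or] at hu2 hv2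
    refine Prod.ext huv ?_
    norm_cast at hu2 hv2
    rw [hu2, hv2]
  · refine Finset.card_le_card_of_injOn Prod.snd
      (fun v hv => mem_Icc_floor.mpr ((le_max_right _ _).trans (hT v hv).1)) fun u hu v hv huv => ?_
    have hu2 := (hT u hu).2
    have hv2 := (hT v hv).2
    simp only [linAt, realPt] at hu2 hv2 huv
    rw [huv] at hu2
    have h3 : l.1 * ((u.1 : ℂ) - v.1) = 0 := by
      push_cast at hu2 hv2
      linear_combination hu2 - hv2
    have h4 := (mul_eq_zero.mp h3).resolve_left h1
    refine Prod.ext ?_ huv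
    exact_mod_cast sub_eq_zero.mp h4

theorem card_zeros_le (hd : 2 ≤ d) (h : FormNonzeroDisc d a) {B : ℝ} (hB : 0 ≤ B)
    (T : Finset (ℤ × ℤ)) (hT : ∀ v ∈ T, ‖realPt v‖ ≤ B ∧ BF d a v.1 v.2 = 0) :
    (T.card : ℝ) ≤ d * (2 * B + 1) := by
  classical
  obtain ⟨L, C, hC, hL0, _, hmin⟩ := exists_linear_minorant hd h
  choose J hJ using hmin
  rw [Finset.card_eq_sum_card_fiberwise (f := fun v => J (realPt v)) (t := Finset.univ)
    fun v _ => Finset.mem_univ _]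
  push_cast
  calc ∑ j, ((T.filter fun v => J (realPt v) = j).card : ℝ) ≤ ∑ _j : Fin d, (2 * B + 1) := by
        refine Finset.sum_le_sum fun j _ => card_line_le (hL0 j) hB _ fun v hv => ?_
        rw [Finset.mem_filter] at hv
        obtain ⟨h1, h2⟩ := hT v hv.1
        refine ⟨h1, ?_⟩
        have h3 := hJ (realPt v)
        have h4 : BF d a (realPt v).1 (realPt v).2 = 0 := by
          rw [show BF d a (realPt v).1 (realPt v).2 = ((BF d a v.1 v.2 : ℤ) : ℝ) from
            (BF_intCast d a v.1 v.2).symm, h2, Int.cast_zero]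
        rw [hv.2, h4, abs_zero] at h3
        by_contra hne
        have hv0 : 0 < ‖realPt v‖ := by
          rw [norm_pos_iff]
          intro h0
          exact hne (by rw [h0]; simp [linAt])
        have := norm_pos_iff.mpr hne
        have : 0 < C * ‖realPt v‖ ^ (d - 1) * ‖linAt (L j) (realPt v)‖ := by positivity
        linarith
    _ = _ := by rw [Finset.sum_const, Finset.card_univ, Fintype.card_fin, nsmul_eq_mul]

theorem abs_card_image_sub_sum_le {α β : Type*} [DecidableEq α] [DecidableEq β] (S E : Finset α)
    (f : α → β) (τ : α → ℕ) (hτ : ∀ v, 1 ≤ τ v)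
    (hfib : ∀ v ∈ S, v ∉ E → (S.filter fun w => f w = f v).card = τ v) :
    |((S.image f).card : ℝ) - ∑ v ∈ S, (1 : ℝ) / τ v| ≤ E.card := by
  set r : α → ℝ := fun v => ((S.filter fun w => f w = f v).card : ℝ) with hr
  have hr1 : ∀ v ∈ S, 1 ≤ r v := by
    intro v hv
    have : 0 < (S.filter fun w => f w = f v).card :=
      Finset.card_pos.mpr ⟨v, Finset.mem_filter.mpr ⟨hv, rfl⟩⟩
    simp only [hr]
    exact_mod_cast this
  have e : ((S.image f).card : ℝ) = ∑ v ∈ S, 1 / r v := by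
    rw [← Finset.sum_fiberwise_of_maps_to (t := S.image f) (g := f)
      fun v hv => Finset.mem_image_of_mem f hv]
    rw [Finset.card_eq_sum_ones]
    push_cast
    refine Finset.sum_congr rfl fun b hb => ?_
    obtain ⟨u, hu, rfl⟩ := Finset.mem_image.mp hb
    rw [Finset.sum_congr rfl (g := fun _ => 1 / r u) fun v hv => by
      rw [Finset.mem_filter] at hv
      simp only [hr, hv.2], Finset.sum_const, nsmul_eq_mul]
    have := hr1 u hu
    have h0 : r u ≠ 0 := by linarith
    exact (mul_one_div_cancel h0).symm
  rw [e, ← Finset.sum_sub_distrib]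
  have hzero : ∀ v ∈ S, v ∉ E → |1 / r v - (1 : ℝ) / τ v| = 0 := by
    intro v hv hE
    simp only [hr, hfib v hv hE, sub_self, abs_zero]
  calc |∑ v ∈ S, (1 / r v - (1 : ℝ) / τ v)| ≤ ∑ v ∈ S, |1 / r v - (1 : ℝ) / τ v| :=
        Finset.abs_sum_le_sum_abs _ _
    _ ≤ ∑ v ∈ S, if v ∈ E then (1 : ℝ) else 0 := by
        refine Finset.sum_le_sum fun v hv => ?_
        split_ifs with hE
        · have h1 := hr1 v hv
          have h2 : (1 : ℝ) ≤ τ v := by exact_mod_cast hτ v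
          have h3 : 1 / r v ≤ 1 := by rw [div_le_one (by linarith)]; exact h1
          have h4 : (1 : ℝ) / τ v ≤ 1 := by rw [div_le_one (by linarith)]; exact h2
          have h5 : 0 ≤ 1 / r v := by positivity
          have h6 : 0 ≤ (1 : ℝ) / τ v := by positivity
          rw [abs_le]
          constructor <;> linarith
        · exact (hzero v hv hE).le
    _ = ((S.filter fun v => v ∈ E).card : ℝ) := by
        rw [Finset.sum_ite, Finset.sum_const_zero, add_zero, Finset.sum_const, nsmul_eq_mul, mul_one]
    _ ≤ _ := by
        rw [Nat.cast_le]
        exact Finset.card_le_card fun v hv => (Finset.mem_filter.mp hv).2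

/-- `w` is the image of the integral point `v` under the rational matrix `M`. -/
def IntImg (M : Matrix (Fin 2) (Fin 2) ℚ) (v w : ℤ × ℤ) : Prop :=
  (w.1 : ℚ) = M 0 0 * v.1 + M 0 1 * v.2 ∧ (w.2 : ℚ) = M 1 0 * v.1 + M 1 1 * v.2

theorem IntImg.unique {M : Matrix (Fin 2) (Fin 2) ℚ} {v w w' : ℤ × ℤ} (h : IntImg M v w)
    (h' : IntImg M v w') : w = w' := by
  have h1 := h.1.trans h'.1.symm
  have h2 := h.2.trans h'.2.symm
  exact Prod.ext (by exact_mod_cast h1) (by exact_mod_cast h2)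

theorem IntImg.BF_eq {M : Matrix (Fin 2) (Fin 2) ℚ} {v w : ℤ × ℤ} (h : IntImg M v w)
    (hM : M ∈ autForm d a) : BF d a w.1 w.2 = BF d a v.1 v.2 := by
  have h1 := hM v.1 v.2
  rw [← h.1, ← h.2, ← BF_intCast, ← BF_intCast] at h1
  exact_mod_cast h1

theorem exists_norm_le_of_intImg (G : Finset (Matrix (Fin 2) (Fin 2) ℚ)) :
    ∃ K : ℝ, 0 < K ∧ ∀ M ∈ G, ∀ v w : ℤ × ℤ, IntImg M v w → ‖realPt w‖ ≤ K * ‖realPt v‖ := by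
  set s : Matrix (Fin 2) (Fin 2) ℚ → ℝ := fun M => ∑ i, ∑ j, |(M i j : ℝ)| with hs
  have hs0 : ∀ M, 0 ≤ s M := fun M => Finset.sum_nonneg fun i _ =>
    Finset.sum_nonneg fun j _ => abs_nonneg _
  refine ⟨∑ M ∈ G, s M + 1, by have := Finset.sum_nonneg fun M (_ : M ∈ G) => hs0 M; linarith,
    fun M hM v w h => ?_⟩
  have hle : s M ≤ ∑ M ∈ G, s M := Finset.single_le_sum (fun M _ => hs0 M) hM
  have hn := norm_nonneg (realPt v)
  refine le_trans ?_ (mul_le_mul_of_nonneg_right (hle.trans (by linarith)) hn)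
  have e1 : (w.1 : ℝ) = M 0 0 * v.1 + M 0 1 * v.2 := by exact_mod_cast congrArg (Rat.cast (K := ℝ)) h.1
  have e2 : (w.2 : ℝ) = M 1 0 * v.1 + M 1 1 * v.2 := by exact_mod_cast congrArg (Rat.cast (K := ℝ)) h.2
  have hv1 : |(v.1 : ℝ)| ≤ ‖realPt v‖ := by rw [norm_realPt]; exact le_max_left _ _
  have hv2 : |(v.2 : ℝ)| ≤ ‖realPt v‖ := by rw [norm_realPt]; exact le_max_right _ _
  have key : ∀ p q : ℝ, |p * v.1 + q * v.2| ≤ (|p| + |q|) * ‖realPt v‖ := fun p q => by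
    refine (abs_add_le _ _).trans ?_
    rw [abs_mul, abs_mul, add_mul]
    gcongr
  have hsM : s M = (|(M 0 0 : ℝ)| + |(M 0 1 : ℝ)|) + (|(M 1 0 : ℝ)| + |(M 1 1 : ℝ)|) := by
    simp [hs, Fin.sum_univ_two]
  rw [norm_realPt w, hsM, max_le_iff, e1, e2]
  refine ⟨(key _ _).trans (mul_le_mul_of_nonneg_right ?_ hn),
    (key _ _).trans (mul_le_mul_of_nonneg_right ?_ hn)⟩
  · exact le_add_of_nonneg_right (by positivity)
  · exact le_add_of_nonneg_left (by positivity)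

theorem exists_common_denominator (G : Finset (Matrix (Fin 2) (Fin 2) ℚ)) :
    ∃ N : ℕ, 0 < N ∧ ∀ M ∈ G, ∀ i j, ∃ k : ℤ, (N : ℚ) * M i j = k := by
  refine ⟨∏ M ∈ G, ∏ i, ∏ j, (M i j).den, Finset.prod_pos fun M _ => Finset.prod_pos fun i _ =>
    Finset.prod_pos fun j _ => (M i j).den_pos, fun M hM i j => ?_⟩
  have h1 : (M i j).den ∣ ∏ M ∈ G, ∏ i, ∏ j, (M i j).den :=
    ((Finset.dvd_prod_of_mem (fun j => (M i j).den) (Finset.mem_univ j)).trans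
      (Finset.dvd_prod_of_mem (fun i => ∏ j, (M i j).den) (Finset.mem_univ i))).trans
      (Finset.dvd_prod_of_mem (fun M : Matrix (Fin 2) (Fin 2) ℚ => ∏ i, ∏ j, (M i j).den) hM)
  obtain ⟨c, hc⟩ := h1
  refine ⟨c * (M i j).num, ?_⟩
  rw [hc]
  push_cast
  rw [mul_comm ((M i j).den : ℚ), mul_assoc, Rat.den_mul_eq_num]

open Classical in
/-- The number of matrices in `G` mapping `v` to an integral point. -/
noncomputable def tau (G : Finset (Matrix (Fin 2) (Fin 2) ℚ)) (v : ℤ × ℤ) : ℕ :=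
  (G.filter fun M => ∃ w, IntImg M v w).card

theorem one_le_tau {G : Finset (Matrix (Fin 2) (Fin 2) ℚ)} (hG : 1 ∈ G) (v : ℤ × ℤ) :
    1 ≤ tau G v := by
  classical
  exact Finset.card_pos.mpr ⟨1, Finset.mem_filter.mpr ⟨hG, v, by simp [IntImg]⟩⟩

theorem tau_congr {G : Finset (Matrix (Fin 2) (Fin 2) ℚ)} {N : ℕ}
    (hN : ∀ M ∈ G, ∀ i j, ∃ k : ℤ, (N : ℚ) * M i j = k) {u v : ℤ × ℤ}
    (h1 : (N : ℤ) ∣ v.1 - u.1) (h2 : (N : ℤ) ∣ v.2 - u.2) : tau G u = tau G v := by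
  classical
  have key : ∀ u v : ℤ × ℤ, (N : ℤ) ∣ v.1 - u.1 → (N : ℤ) ∣ v.2 - u.2 → ∀ M ∈ G,
      (∃ w, IntImg M u w) → ∃ w, IntImg M v w := by
    rintro u v ⟨p, hp⟩ ⟨q, hq⟩ M hM ⟨w, hw1, hw2⟩
    choose k hk using hN M hM
    have e1 : (v.1 : ℚ) = u.1 + N * p := by
      have : v.1 = u.1 + N * p := by linarith
      exact_mod_cast this
    have e2 : (v.2 : ℚ) = u.2 + N * q := by
      have : v.2 = u.2 + N * q := by linarith
      exact_mod_cast this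
    refine ⟨(w.1 + k 0 0 * p + k 0 1 * q, w.2 + k 1 0 * p + k 1 1 * q), ?_, ?_⟩
    · push_cast
      rw [e1, e2, hw1, ← hk, ← hk]
      ring
    · push_cast
      rw [e1, e2, hw2, ← hk, ← hk]
      ring
  refine congrArg Finset.card (Finset.filter_congr fun M hM => ⟨key u v h1 h2 M hM, key v u ?_ ?_ M hM⟩)
  · rw [← neg_sub]; exact (dvd_neg).mpr h1
  · rw [← neg_sub]; exact (dvd_neg).mpr h2

theorem card_coincidence_le (G : Finset (Matrix (Fin 2) (Fin 2) ℚ)) {B : ℝ} (hB : 0 ≤ B)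
    (T : Finset (ℤ × ℤ)) (hT : ∀ v ∈ T, ‖realPt v‖ ≤ B ∧
      ∃ M ∈ G, ∃ M' ∈ G, M ≠ M' ∧ ∃ w, IntImg M v w ∧ IntImg M' v w) :
    (T.card : ℝ) ≤ G.card ^ 2 * (2 * B + 1) := by
  classical
  set Q : Matrix (Fin 2) (Fin 2) ℚ × Matrix (Fin 2) (Fin 2) ℚ → Finset (ℤ × ℤ) := fun p =>
    T.filter fun v => p.1 ≠ p.2 ∧ ∃ w, IntImg p.1 v w ∧ IntImg p.2 v w with hQ
  have hsub : T ⊆ (G ×ˢ G).biUnion Q := by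
    intro v hv
    obtain ⟨_, M, hM, M', hM', hne, hw⟩ := hT v hv
    exact Finset.mem_biUnion.mpr ⟨(M, M'), Finset.mem_product.mpr ⟨hM, hM'⟩,
      Finset.mem_filter.mpr ⟨hv, hne, hw⟩⟩
  have hline : ∀ p, ((Q p).card : ℝ) ≤ 2 * B + 1 := by
    rintro ⟨M, M'⟩
    by_cases hne : M = M'
    · have : Q (M, M') = ∅ := Finset.filter_eq_empty_iff.mpr fun v _ hv => hv.1 hne
      rw [this, Finset.card_empty, Nat.cast_zero]
      linarith
    obtain ⟨i, j, hij⟩ : ∃ i j, M i j ≠ M' i j := by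
      by_contra! hall
      exact hne (Matrix.ext hall)
    refine card_line_le (l := (((M i 0 - M' i 0 : ℚ) : ℂ), ((M i 1 - M' i 1 : ℚ) : ℂ))) ?_ hB _
      fun v hv => ?_
    · intro h0
      rw [Prod.mk_eq_zero, Rat.cast_eq_zero, Rat.cast_eq_zero, sub_eq_zero, sub_eq_zero] at h0
      fin_cases j
      · exact hij h0.1
      · exact hij h0.2
    · obtain ⟨hvT, -, w, hw, hw'⟩ := Finset.mem_filter.mp hv
      refine ⟨(hT v hvT).1, ?_⟩
      have e : (M i 0 - M' i 0) * (v.1 : ℚ) + (M i 1 - M' i 1) * v.2 = 0 := by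
        fin_cases i
        · have := hw.1.symm.trans hw'.1
          simp only [Fin.zero_eta]
          linear_combination this
        · have := hw.2.symm.trans hw'.2
          simp only [Fin.mk_one]
          linear_combination this
      have e' := congrArg (Rat.cast (K := ℂ)) e
      simp only [linAt, realPt]
      push_cast at e' ⊢
      exact e'
  calc (T.card : ℝ) ≤ (((G ×ˢ G).biUnion Q).card : ℝ) := by
        exact_mod_cast Finset.card_le_card hsub
    _ ≤ ∑ p ∈ G ×ˢ G, ((Q p).card : ℝ) := by exact_mod_cast Finset.card_biUnion_le
    _ ≤ ∑ _p ∈ G ×ˢ G, (2 * B + 1) := Finset.sum_le_sum fun p _ => hline p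
    _ = _ := by
        rw [Finset.sum_const, Finset.card_product, nsmul_eq_mul, Nat.cast_mul, sq]

open Classical in
/-- The integral points of norm at most `Y` at which the form takes a non-zero value of absolute
value at most `Z`. -/
noncomputable def formPts (d : ℕ) (a : Fin (d + 1) → ℤ) (Y Z : ℝ) : Finset (ℤ × ℤ) :=
  (ptBox Y).filter fun v => BF d a v.1 v.2 ≠ 0 ∧ |BF d a (v.1 : ℝ) v.2| ≤ Z

theorem mem_formPts {Y Z : ℝ} {v : ℤ × ℤ} : v ∈ formPts d a Y Z ↔
    ‖realPt v‖ ≤ Y ∧ BF d a v.1 v.2 ≠ 0 ∧ |BF d a (v.1 : ℝ) v.2| ≤ Z := by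
  rw [formPts, Finset.mem_filter, mem_ptBox]

theorem mem_formPts_of_BF_eq {Y Z : ℝ} {v w : ℤ × ℤ} (hv : v ∈ formPts d a Y Z)
    (h : BF d a w.1 w.2 = BF d a v.1 v.2) : w ∈ formPts d a Y Z ↔ ‖realPt w‖ ≤ Y := by
  have h' : BF d a (w.1 : ℝ) w.2 = BF d a (v.1 : ℝ) v.2 := by rw [← BF_intCast, h, BF_intCast]
  rw [mem_formPts] at hv ⊢
  rw [h, h']
  exact and_iff_left hv.2

theorem card_fiber_eq_tau {G : Finset (Matrix (Fin 2) (Fin 2) ℚ)} (hG : ∀ M ∈ G, M ∈ autForm d a)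
    {Y Z : ℝ} {v : ℤ × ℤ}
    (h1 : ¬ ∃ M ∈ G, ∃ M' ∈ G, M ≠ M' ∧ ∃ w, IntImg M v w ∧ IntImg M' v w)
    (h2 : ¬ ∃ w ∈ formPts d a Y Z, BF d a w.1 w.2 = BF d a v.1 v.2 ∧ ¬ ∃ M ∈ G, IntImg M v w)
    (h3 : ¬ ∃ M ∈ G, ∃ w, w ∉ formPts d a Y Z ∧ IntImg M v w) :
    ((formPts d a Y Z).filter fun w => BF d a w.1 w.2 = BF d a v.1 v.2).card = tau G v := by
  classical
  push Not at h1 h2 h3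
  refine (Finset.card_bij (fun M hM => (Finset.mem_filter.mp hM).2.choose) ?_ ?_ ?_).symm
  · intro M hM
    have hw := (Finset.mem_filter.mp hM).2.choose_spec
    have hMG := (Finset.mem_filter.mp hM).1
    refine Finset.mem_filter.mpr ⟨?_, hw.BF_eq (hG M hMG)⟩
    by_contra hn
    exact h3 M hMG _ hn hw
  · intro M hM M' hM' heq
    have hw := (Finset.mem_filter.mp hM).2.choose_spec
    have hw' := (Finset.mem_filter.mp hM').2.choose_spec
    by_contra hne
    refine h1 M (Finset.mem_filter.mp hM).1 M' (Finset.mem_filter.mp hM').1 hne _ hw ?_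
    rw [heq]
    exact hw'
  · intro w hw
    rw [Finset.mem_filter] at hw
    obtain ⟨M, hM, hMw⟩ := h2 w hw.1 hw.2
    have hmem : M ∈ G.filter fun M => ∃ w, IntImg M v w := Finset.mem_filter.mpr ⟨hM, w, hMw⟩
    exact ⟨M, hmem, (Finset.mem_filter.mp hmem).2.choose_spec.unique hMw⟩

theorem card_unmatched_le (hd : d = 3 ∨ d = 4) (h : FormNonzeroDisc d a)
    {G : Finset (Matrix (Fin 2) (Fin 2) ℚ)} (hG : ∀ M, M ∈ G ↔ M ∈ autForm d a) :
    ∃ K : ℝ, 0 < K ∧ ∀ Y Z : ℝ, 1 ≤ Y → ∀ T : Finset (ℤ × ℤ), (∀ v ∈ T, v ∈ formPts d a Y Z ∧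
      ∃ w ∈ formPts d a Y Z, BF d a w.1 w.2 = BF d a v.1 v.2 ∧ ¬ ∃ M ∈ G, IntImg M v w) →
      (T.card : ℝ) ≤ K * Y ^ (79 / 40 : ℝ) := by
  classical
  obtain ⟨K, hK, hcard⟩ := card_goodPt_le hd h
  refine ⟨K, hK, fun Y Z hY T hT => ?_⟩
  choose! w hw using fun v hv => (hT v hv).2
  set f : ℤ × ℤ → Fin 4 → ℤ := fun v => ![v.1, v.2, (w v).1, (w v).2] with hf
  have hinj : Set.InjOn f T := fun u _ v _ huv =>
    Prod.ext (by simpa [hf] using congrFun huv 0) (by simpa [hf] using congrFun huv 1)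
  rw [← Finset.card_image_of_injOn hinj]
  refine hcard Y hY _ ?_ ?_
  · intro P hP
    obtain ⟨v, hv, rfl⟩ := Finset.mem_image.mp hP
    obtain ⟨-, h2, h3⟩ := hw v hv
    refine ⟨h2.symm, (mem_formPts.mp (hT v hv).1).2.1, ?_⟩
    rintro ⟨M, hM, h4⟩
    exact h3 ⟨M, (hG M).mpr hM, h4⟩
  · intro P hP j
    obtain ⟨v, hv, rfl⟩ := Finset.mem_image.mp hP
    have h1 := (mem_formPts.mp (hT v hv).1).1
    have h2 := (mem_formPts.mp (hw v hv).1).1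
    rw [norm_realPt, max_le_iff] at h1 h2
    fin_cases j
    · exact h1.1
    · exact h1.2
    · exact h2.1
    · exact h2.2

theorem abs_card_image_formPts_sub_le (hd : d = 3 ∨ d = 4) (h : FormNonzeroDisc d a)
    {G : Finset (Matrix (Fin 2) (Fin 2) ℚ)} (hG : ∀ M, M ∈ G ↔ M ∈ autForm d a) :
    ∃ K : ℝ, 0 < K ∧ ∃ Z0 : ℝ, 1 ≤ Z0 ∧ ∀ Z : ℝ, Z0 ≤ Z →
      |((((formPts d a (Z ^ (1 / (d : ℝ) + 1 / 1000)) Z).image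
          fun v => BF d a v.1 v.2).card : ℕ) : ℝ) -
        ∑ v ∈ formPts d a (Z ^ (1 / (d : ℝ) + 1 / 1000)) Z, (1 : ℝ) / tau G v| ≤
      K * Z ^ (2 / (d : ℝ) - 1 / 4000) := by
  classical
  obtain ⟨K0, hK0, hnorm⟩ := exists_norm_le_of_intImg G
  obtain ⟨K2, hK2, hun⟩ := card_unmatched_le hd h hG
  have hdR : (3 : ℝ) ≤ d := by rcases hd with rfl | rfl <;> norm_num
  have hd0 : (0 : ℝ) < d := by linarith
  obtain ⟨K3, hK3, Z3, hZ3, hfar⟩ := card_far_le hd h (η := 1 / 2000) (by norm_num)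
    (by rcases hd with rfl | rfl <;> norm_num)
  obtain ⟨Z1, hZ1⟩ := ((tendsto_rpow_atTop (y := (1 / 2000 : ℝ))
    (by norm_num)).eventually_ge_atTop K0).exists_forall_of_atTop
  refine ⟨G.card ^ 2 * 3 + K2 + K3, by positivity, max Z1 Z3, le_max_of_le_right hZ3,
    fun Z hZ => ?_⟩
  have hZ1' := hZ1 Z ((le_max_left _ _).trans hZ)
  have hZ3' : Z3 ≤ Z := (le_max_right _ _).trans hZ
  have hZone : 1 ≤ Z := hZ3.trans hZ3'
  have hZpos : 0 < Z := by linarith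
  set Y := Z ^ (1 / (d : ℝ) + 1 / 1000) with hY
  have hYone : 1 ≤ Y := Real.one_le_rpow hZone (by positivity)
  set S := formPts d a Y Z with hS
  set E1 := S.filter fun v => ∃ M ∈ G, ∃ M' ∈ G, M ≠ M' ∧ ∃ w, IntImg M v w ∧ IntImg M' v w with hE1
  set E2 := S.filter fun v => ∃ w ∈ S, BF d a w.1 w.2 = BF d a v.1 v.2 ∧ ¬ ∃ M ∈ G, IntImg M v w
    with hE2
  set E3 := S.filter fun v => ∃ M ∈ G, ∃ w, w ∉ S ∧ IntImg M v w with hE3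
  have c1 : (E1.card : ℝ) ≤ G.card ^ 2 * 3 * Z ^ (2 / (d : ℝ) - 1 / 4000) := by
    refine (card_coincidence_le G (B := Y) (by linarith) _ fun v hv => ?_).trans ?_
    · rw [hE1, Finset.mem_filter] at hv
      exact ⟨(mem_formPts.mp hv.1).1, hv.2⟩
    · have hle : Y ≤ Z ^ (2 / (d : ℝ) - 1 / 4000) :=
        Real.rpow_le_rpow_of_exponent_le hZone (by rcases hd with rfl | rfl <;> norm_num)
      rw [mul_assoc]
      gcongr
      linarith
  have c2 : (E2.card : ℝ) ≤ K2 * Z ^ (2 / (d : ℝ) - 1 / 4000) := by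
    refine (hun Y Z hYone _ fun v hv => Finset.mem_filter.mp hv).trans ?_
    rw [hY, ← Real.rpow_mul hZpos.le]
    gcongr
    rcases hd with rfl | rfl <;> norm_num
  have c3 : (E3.card : ℝ) ≤ K3 * Z ^ (2 / (d : ℝ) - 1 / 4000) := by
    have hR : Z ^ (1 / (d : ℝ) + 1 / 2000) ≤ Y / K0 := by
      have e : Y = Z ^ (1 / (d : ℝ) + 1 / 2000) * Z ^ (1 / 2000 : ℝ) := by
        rw [hY, ← Real.rpow_add hZpos]
        congr 1
        ring
      rw [le_div_iff₀ hK0, e]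
      gcongr
    refine (hfar Z (Y / K0) hZ3' hR E3 fun v hv => ?_).trans ?_
    · obtain ⟨hvS, M, hM, w, hwS, hMw⟩ := Finset.mem_filter.mp hv
      refine ⟨?_, (mem_formPts.mp hvS).2⟩
      rw [hS, mem_formPts_of_BF_eq hvS (hMw.BF_eq ((hG M).mp hM)), not_le] at hwS
      rw [div_lt_iff₀ hK0, mul_comm]
      exact hwS.trans_le (hnorm M hM v w hMw)
    · exact mul_le_mul_of_nonneg_left
        (Real.rpow_le_rpow_of_exponent_le hZone (by linarith)) hK3.le
  have hone : (1 : Matrix (Fin 2) (Fin 2) ℚ) ∈ G := (hG 1).mpr fun x y => by simp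
  refine (abs_card_image_sub_sum_le S (E1 ∪ E2 ∪ E3) (fun v => BF d a v.1 v.2) (tau G)
    (one_le_tau hone) fun v hv hE => ?_).trans ?_
  · simp only [Finset.mem_union, not_or, hE1, hE2, hE3, Finset.mem_filter, hv, true_and] at hE
    exact card_fiber_eq_tau (fun M hM => (hG M).mp hM) hE.1.1 hE.1.2 hE.2
  · have hu : ((E1 ∪ E2 ∪ E3).card : ℝ) ≤ E1.card + E2.card + E3.card := by
      exact_mod_cast (Finset.card_union_le _ _).trans
        (Nat.add_le_add_right (Finset.card_union_le _ _) _)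
    linarith

theorem intForm_represented_iff {n : ℤ} :
    (∃ x y : ℤ, intForm d a x y = n) ↔ ∃ v : ℤ × ℤ, BF d a v.1 v.2 = n := by
  constructor
  · rintro ⟨x, y, hxy⟩
    exact ⟨(x, y), by rw [← hxy, intForm_eq_BF]⟩
  · rintro ⟨v, hv⟩
    exact ⟨v.1, v.2, by rw [← hv, intForm_eq_BF]⟩

theorem abs_RF_sub_card_image_le (hd : d = 3 ∨ d = 4) (h : FormNonzeroDisc d a) :
    ∃ K : ℝ, 0 < K ∧ ∃ Z0 : ℝ, 1 ≤ Z0 ∧ ∀ Z : ℝ, Z0 ≤ Z →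
      |(RF d a Z : ℝ) - (((formPts d a (Z ^ (1 / (d : ℝ) + 1 / 1000)) Z).image
          fun v => BF d a v.1 v.2).card : ℕ)| ≤ K * Z ^ (2 / (d : ℝ) - 1 / 4000) := by
  classical
  obtain ⟨K3, hK3, Z3, hZ3, hfar⟩ := card_far_le hd h (η := 1 / 1000) (by norm_num)
    (by rcases hd with rfl | rfl <;> norm_num)
  refine ⟨1 + K3, by positivity, Z3, hZ3, fun Z hZ => ?_⟩
  have hZone : 1 ≤ Z := hZ3.trans hZ
  set Y := Z ^ (1 / (d : ℝ) + 1 / 1000) with hY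
  set I := (formPts d a Y Z).image fun v => BF d a v.1 v.2 with hI
  set A : Finset ℤ := (Finset.Icc (-⌊Z⌋) ⌊Z⌋).filter fun n => ∃ v : ℤ × ℤ, BF d a v.1 v.2 = n with hA
  have hRF : RF d a Z = A.card := by
    rw [RF, ← Set.ncard_coe_finset]
    congr 1
    ext n
    simp only [hA, Finset.coe_filter, mem_Icc_floor, Set.mem_ofPred_eq, intForm_represented_iff]
  have hIA : I ⊆ A := by
    intro n hn
    obtain ⟨v, hv, rfl⟩ := Finset.mem_image.mp hn
    refine Finset.mem_filter.mpr ⟨mem_Icc_floor.mpr ?_, v, rfl⟩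
    rw [BF_intCast]
    exact (mem_formPts.mp hv).2.2
  set D := (A \ I).erase 0 with hD
  have hDc : (D.card : ℝ) ≤ K3 * Z ^ (2 / (d : ℝ) - 1 / 4000) := by
    have hrep : ∀ n ∈ D, ∃ v : ℤ × ℤ, BF d a v.1 v.2 = n := fun n hn =>
      (Finset.mem_filter.mp (Finset.mem_sdiff.mp (Finset.mem_of_mem_erase hn)).1).2
    choose! r hr using hrep
    have hinj : Set.InjOn r D := fun m hm n hn hmn => by rw [← hr m hm, ← hr n hn, hmn]
    rw [← Finset.card_image_of_injOn hinj]
    refine (hfar Z Y hZ le_rfl _ fun v hv => ?_).trans ?_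
    · obtain ⟨n, hn, rfl⟩ := Finset.mem_image.mp hv
      obtain ⟨hn0, hnd⟩ := Finset.mem_erase.mp hn
      obtain ⟨hnA, hnI⟩ := Finset.mem_sdiff.mp hnd
      have h1 : BF d a (r n).1 (r n).2 ≠ 0 := by rw [hr n hn]; exact hn0
      have h2 : |BF d a ((r n).1 : ℝ) (r n).2| ≤ Z := by
        rw [← BF_intCast, hr n hn]
        exact mem_Icc_floor.mp (Finset.mem_filter.mp hnA).1
      refine ⟨?_, h1, h2⟩
      by_contra hle
      exact hnI (Finset.mem_image.mpr ⟨r n, mem_formPts.mpr ⟨not_lt.mp hle, h1, h2⟩, hr n hn⟩)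
    · exact mul_le_mul_of_nonneg_left
        (Real.rpow_le_rpow_of_exponent_le hZone (by linarith)) hK3.le
  have h1 : A.card ≤ I.card + D.card + 1 := by
    have := Finset.card_sdiff_add_card_eq_card hIA
    have h0 : (A \ I).card - 1 ≤ D.card := Finset.pred_card_le_card_erase
    omega
  have h2 := Finset.card_le_card hIA
  have h1' : (A.card : ℝ) ≤ I.card + D.card + 1 := by exact_mod_cast h1
  have h2' : (I.card : ℝ) ≤ A.card := by exact_mod_cast h2
  have h3 : (1 : ℝ) ≤ Z ^ (2 / (d : ℝ) - 1 / 4000) :=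
    Real.one_le_rpow hZone (by rcases hd with rfl | rfl <;> norm_num)
  rw [hRF, abs_of_nonneg (by linarith)]
  linarith

theorem abs_sum_inv_tau_sub_le (hd : d = 3 ∨ d = 4) (h : FormNonzeroDisc d a)
    {G : Finset (Matrix (Fin 2) (Fin 2) ℚ)} (hone : 1 ∈ G) {N : ℕ} (hN : 0 < N)
    (hGN : ∀ M ∈ G, ∀ i j, ∃ k : ℤ, (N : ℚ) * M i j = k) :
    ∃ K : ℝ, 0 < K ∧ ∃ Z0 : ℝ, 1 ≤ Z0 ∧ ∀ Z : ℝ, Z0 ≤ Z →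
      |∑ v ∈ formPts d a (Z ^ (1 / (d : ℝ) + 1 / 1000)) Z, (1 : ℝ) / tau G v -
        (∑ b ∈ Finset.range N ×ˢ Finset.range N, (1 : ℝ) / tau G (b.1, b.2)) / N ^ 2 *
          (AF d a * Z ^ (2 / (d : ℝ)))| ≤ K * Z ^ (2 / (d : ℝ) - 1 / 4000) := by
  classical
  have hd3 : 3 ≤ d := by omega
  obtain ⟨K, hK, Z0, hZ0, hres⟩ := card_residue_class_asymptotic hd3 h hN (η := 1 / 1000)
    (by norm_num) (by rcases hd with rfl | rfl <;> norm_num)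
  have hNR : (1 : ℝ) ≤ N := by exact_mod_cast hN
  refine ⟨N ^ 2 * (K + 3 * d), by positivity, Z0, hZ0, fun Z hZ => ?_⟩
  have hZone : 1 ≤ Z := hZ0.trans hZ
  set Y := Z ^ (1 / (d : ℝ) + 1 / 1000) with hY
  have hYone : 1 ≤ Y := Real.one_le_rpow hZone (by positivity)
  set X := AF d a * Z ^ (2 / (d : ℝ)) with hX
  set e := Z ^ (2 / (d : ℝ) - 1 / 4000) with he
  have he0 : 0 < e := by positivity
  set S := formPts d a Y Z with hS
  set q : ℤ × ℤ → ℕ × ℕ := fun v => ((v.1 % N).toNat, (v.2 % N).toNat) with hq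
  have hNZ : (0 : ℤ) < N := by exact_mod_cast hN
  have hq1 : ∀ x : ℤ, ((x % N).toNat : ℤ) = x % N := fun x =>
    Int.toNat_of_nonneg (Int.emod_nonneg _ hNZ.ne')
  have hqmem : ∀ v ∈ S, q v ∈ Finset.range N ×ˢ Finset.range N := by
    intro v _
    rw [Finset.mem_product, Finset.mem_range, Finset.mem_range]
    have := hq1 v.1
    have := hq1 v.2
    have := Int.emod_lt_of_pos v.1 hNZ
    have := Int.emod_lt_of_pos v.2 hNZ
    simp only [hq]
    omega
  have hqiff : ∀ v : ℤ × ℤ, ∀ b ∈ Finset.range N ×ˢ Finset.range N,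
      q v = b ↔ (N : ℤ) ∣ v.1 - b.1 ∧ (N : ℤ) ∣ v.2 - b.2 := by
    intro v b hb
    rw [Finset.mem_product, Finset.mem_range, Finset.mem_range] at hb
    have key : ∀ (x : ℤ) (c : ℕ), c < N → ((x % N).toNat = c ↔ (N : ℤ) ∣ x - c) := by
      intro x c hc
      rw [← Int.emod_emod_of_dvd x dvd_rfl, ← Int.natCast_inj, Int.emod_emod_of_dvd _ dvd_rfl, hq1,
        ← Int.emod_eq_emod_iff_emod_sub_eq_zero.trans Int.dvd_iff_emod_eq_zero.symm,
        Int.emod_eq_of_lt (b := (N : ℤ)) (Int.natCast_nonneg c) (by exact_mod_cast hc)]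
    rw [← key v.1 b.1 hb.1, ← key v.2 b.2 hb.2, Prod.ext_iff]
  have hclass : ∀ b ∈ Finset.range N ×ˢ Finset.range N,
      |((S.filter fun v => q v = b).card : ℝ) - X / N ^ 2| ≤ (K + 3 * d) * e := by
    intro b hb
    set T := (ptBox Y).filter fun v => |BF d a (v.1 : ℝ) v.2| ≤ Z ∧ q v = b with hT
    have h1 := hres Z hZ (b.1, b.2) T fun v => by
      rw [hT, Finset.mem_filter, mem_ptBox, hqiff v b hb]
    set T0 := T.filter fun v => BF d a v.1 v.2 = 0 with hT0
    have h2 : (S.filter fun v => q v = b) = T.filter fun v => ¬ BF d a v.1 v.2 = 0 := by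
      ext v
      simp only [hS, hT, Finset.mem_filter, mem_formPts, mem_ptBox]
      tauto
    have h3 := Finset.card_filter_add_card_filter_not (s := T) fun v => BF d a v.1 v.2 = 0
    rw [← h2] at h3
    have h3' : (T0.card : ℝ) + (S.filter fun v => q v = b).card = T.card := by exact_mod_cast h3
    have h4 := card_zeros_le (by omega) h (B := Y) (by linarith) T0 fun v hv => by
      rw [hT0, Finset.mem_filter, hT, Finset.mem_filter, mem_ptBox] at hv
      exact ⟨hv.1.1, hv.2⟩
    have hYe : Y ≤ e :=
      Real.rpow_le_rpow_of_exponent_le hZone (by rcases hd with rfl | rfl <;> norm_num)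
    have h5 : (T0.card : ℝ) ≤ 3 * d * e := by
      refine h4.trans ?_
      rw [mul_comm (3 : ℝ), mul_assoc]
      gcongr
      linarith
    have h6 : |(T.card : ℝ) - X / N ^ 2| ≤ K * e := by
      have hN2 : (1 : ℝ) ≤ N ^ 2 := one_le_pow₀ hNR
      have e1 : (T.card : ℝ) * N ^ 2 - X = (T.card - X / N ^ 2) * N ^ 2 := by
        field_simp
      rw [e1, abs_mul, abs_of_pos (by positivity : (0 : ℝ) < N ^ 2)] at h1
      refine (le_mul_of_one_le_right (abs_nonneg _) hN2).trans (h1.trans ?_)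
      exact mul_le_mul_of_nonneg_left
        (Real.rpow_le_rpow_of_exponent_le hZone (by linarith)) hK.le
    have h7 : (0 : ℝ) ≤ T0.card := Nat.cast_nonneg _
    rw [abs_le] at h6 ⊢
    constructor <;> linarith
  rw [← Finset.sum_fiberwise_of_maps_to hqmem, Finset.sum_div, Finset.sum_mul,
    ← Finset.sum_sub_distrib]
  refine (Finset.abs_sum_le_sum_abs _ _).trans ?_
  refine (Finset.sum_le_sum (g := fun _ => (K + 3 * d) * e) fun b hb => ?_).trans ?_
  · have ht : ∀ v ∈ S.filter fun v => q v = b, (1 : ℝ) / tau G v = 1 / tau G (b.1, b.2) := by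
      intro v hv
      have := (hqiff v b hb).mp (Finset.mem_filter.mp hv).2
      rw [tau_congr hGN (u := ((b.1 : ℤ), (b.2 : ℤ))) this.1 this.2]
    rw [Finset.sum_congr rfl ht, Finset.sum_const, nsmul_eq_mul]
    have h1 : (1 : ℝ) ≤ tau G (b.1, b.2) := by exact_mod_cast one_le_tau hone _
    have e1 : ((S.filter fun v => q v = b).card : ℝ) * (1 / tau G (b.1, b.2)) -
        1 / tau G (b.1, b.2) / N ^ 2 * X =
        1 / tau G (b.1, b.2) * ((S.filter fun v => q v = b).card - X / N ^ 2) := by ring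
    rw [e1, abs_mul, abs_of_pos (by positivity)]
    refine (mul_le_of_le_one_left (abs_nonneg _) ?_).trans (hclass b hb)
    rw [div_le_one (by linarith)]
    exact h1
  · rw [Finset.sum_const, Finset.card_product, Finset.card_range, nsmul_eq_mul]
    push_cast
    exact le_of_eq (by ring)

/-- The asymptotic formula with the explicit exponent `2 / d - 1 / 4000`. -/
theorem exists_abs_RF_sub_le (hd : d = 3 ∨ d = 4) (h : FormNonzeroDisc d a) :
    ∃ W : ℚ, 0 < W ∧ ∃ K : ℝ, 0 < K ∧ ∃ Z0 : ℝ, 1 ≤ Z0 ∧ ∀ Z : ℝ, Z0 ≤ Z →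
      |(RF d a Z : ℝ) - W * AF d a * Z ^ (2 / (d : ℝ))| ≤ K * Z ^ (2 / (d : ℝ) - 1 / 4000) := by
  set G := (autForm_finite (by omega) h).toFinset with hGdef
  have hG : ∀ M, M ∈ G ↔ M ∈ autForm d a := fun M => Set.Finite.mem_toFinset _
  have hone : (1 : Matrix (Fin 2) (Fin 2) ℚ) ∈ G := (hG 1).mpr fun x y => by simp
  obtain ⟨N, hN, hGN⟩ := exists_common_denominator G
  obtain ⟨K1, hK1, Z1, hZ1, h1⟩ := abs_RF_sub_card_image_le hd h
  obtain ⟨K2, hK2, Z2, hZ2, h2⟩ := abs_card_image_formPts_sub_le hd h hG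
  obtain ⟨K3, hK3, Z3, hZ3, h3⟩ := abs_sum_inv_tau_sub_le hd h hone hN hGN
  refine ⟨(∑ b ∈ Finset.range N ×ˢ Finset.range N, (1 : ℚ) / tau G (b.1, b.2)) / N ^ 2, ?_,
    K1 + K2 + K3, by positivity, max (max Z1 Z2) Z3, le_max_of_le_right hZ3, fun Z hZ => ?_⟩
  · have hNQ : (0 : ℚ) < N := by exact_mod_cast hN
    refine div_pos (Finset.sum_pos (fun b _ => ?_) ⟨(0, 0), by simp [hN]⟩) (by positivity)
    have : (0 : ℚ) < tau G (b.1, b.2) := by exact_mod_cast one_le_tau hone _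
    positivity
  · have g1 := h1 Z ((le_max_left _ _).trans ((le_max_left _ _).trans hZ))
    have g2 := h2 Z ((le_max_right _ _).trans ((le_max_left _ _).trans hZ))
    have g3 := h3 Z ((le_max_right _ _).trans hZ)
    push_cast
    rw [mul_assoc]
    rw [abs_le] at g1 g2 g3 ⊢
    constructor <;> linarith [g1.1, g1.2, g2.1, g2.2, g3.1, g3.2]

end Final

/-- For a binary form `F` of degree `d ∈ {3,4}` with integer coefficients and non-zero
discriminant, there are `0 < β_d < 2/d` (depending only on `d`) and a positive rational
`W_F` such that for every `ε > 0`,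
`R_F(Z) = W_F·A_F·Z^(2/d) + O_{F,ε}(Z^(β_d + ε))` as `Z → ∞`. -/
theorem count_represented_integers (d : ℕ) (hd : d = 3 ∨ d = 4) :
    ∃ β : ℝ, 0 < β ∧ β < 2 / (d : ℝ) ∧
      ∀ a : Fin (d + 1) → ℤ, FormNonzeroDisc d a →
        ∃ W : ℚ, 0 < W ∧ ∀ ε : ℝ, 0 < ε →
          (fun Z : ℝ => (RF d a Z : ℝ) - (W : ℝ) * AF d a * Z ^ ((2 : ℝ) / (d : ℝ)))
            =O[atTop] (fun Z : ℝ => Z ^ (β + ε)) := by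
  have hdR : (d : ℝ) = 3 ∨ (d : ℝ) = 4 := by rcases hd with rfl | rfl <;> norm_num
  refine ⟨2 / (d : ℝ) - 1 / 4000, by rcases hdR with e | e <;> rw [e] <;> norm_num, by linarith,
    fun a h => ?_⟩
  obtain ⟨W, hW, K, hK, Z0, hZ0, hmain⟩ := exists_abs_RF_sub_le hd h
  refine ⟨W, hW, fun ε hε => IsBigO.of_bound K ?_⟩
  filter_upwards [eventually_ge_atTop Z0] with Z hZ
  have hZ1 : 1 ≤ Z := hZ0.trans hZ
  rw [Real.norm_eq_abs, Real.norm_eq_abs, abs_of_nonneg (Real.rpow_nonneg (by linarith) _)]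
  refine (hmain Z hZ).trans (mul_le_mul_of_nonneg_left ?_ hK.le)
  exact Real.rpow_le_rpow_of_exponent_le hZ1 (by linarith)
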